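/- Let m be a fixed odd positive integer. For an odd prime p let a_p(λ) := -∑_{x∈F_p} φ(x(x-1)(x-λ)). Then, as p tends to infinity through the primes, p^{-(m/2+1)} · ∑_{λ∈F_p, λ≠0,1} a_p(λ)^{m} converges to 0 (here p^{-(m/2+1)} is the real number p raised to the power -(m+2)/2). -/

import Mathlib

open Finset Filter

/-- Trace of Frobenius of the Legendre curve with parameter `l`. -/
noncomputable def legA (p : ℕ) [Fact p.Prime] (l : ZMod p) : ℤ :=
  -∑ x : ZMod p, quadraticChar (ZMod p) (x * (x - 1) * (x - l))

/-- The Hasse polynomial `∑ (N choose i)² Xⁱ`. -/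
noncomputable def hassePoly (R : Type*) [CommRing R] (N : ℕ) : Polynomial R :=
  ∑ i ∈ range (N + 1), Polynomial.C (((N.choose i : ℕ) : R) ^ 2) * Polynomial.X ^ i

section CharSum
variable {p : ℕ} [Fact p.Prime]

lemma legA_one_sub (l : ZMod p) :
    legA p (1 - l) = quadraticChar (ZMod p) (-1) * legA p l := by
  unfold legA
  rw [mul_neg, mul_sum, ← Equiv.sum_comp (Equiv.subLeft (1 : ZMod p))]
  congr 1
  refine sum_congr rfl fun x _ => ?_
  rw [← map_mul]
  congr 1
  simp only [Equiv.subLeft_apply]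
  ring

lemma legA_inv {l : ZMod p} (hl : l ≠ 0) :
    legA p l⁻¹ = quadraticChar (ZMod p) l * legA p l := by
  unfold legA
  rw [mul_neg, mul_sum, ← Equiv.sum_comp (Equiv.mulRight₀ l⁻¹ (inv_ne_zero hl))]
  congr 1
  refine sum_congr rfl fun x _ => ?_
  have h1 : quadraticChar (ZMod p) ((l⁻¹) ^ 2) = 1 := by
    rw [quadraticChar_sq_one' (inv_ne_zero hl)]
  have h2 : quadraticChar (ZMod p) ((l⁻¹ ^ 2) ^ 2) = 1 := by
    rw [quadraticChar_sq_one' (pow_ne_zero 2 (inv_ne_zero hl))]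
  calc quadraticChar (ZMod p) (x * l⁻¹ * (x * l⁻¹ - 1) * (x * l⁻¹ - l⁻¹))
      = quadraticChar (ZMod p) ((l⁻¹ ^ 2) ^ 2 * (l * (x * (x - 1) * (x - l)))) := by
        congr 1
        field_simp
    _ = _ := by rw [map_mul, h2, one_mul, map_mul]

lemma sum_quadraticChar_mul_shift (hp : p ≠ 2) {c : ZMod p} (hc : c ≠ 0) :
    ∑ u : ZMod p, quadraticChar (ZMod p) (u * (u + c)) = -1 := by
  have hr : ringChar (ZMod p) ≠ 2 := by rwa [ZMod.ringChar_zmod_n]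
  have h0 : ∑ v : ZMod p, quadraticChar (ZMod p) (1 + c * v) = 0 := by
    rw [← quadraticChar_sum_zero hr]
    exact Equiv.sum_comp ((Equiv.mulLeft₀ c hc).trans (Equiv.addLeft 1))
      (fun a => quadraticChar (ZMod p) a)
  rw [← add_sum_erase univ _ (mem_univ (0 : ZMod p))] at h0
  rw [← add_sum_erase univ _ (mem_univ (0 : ZMod p))]
  simp only [mul_zero, add_zero, map_one, zero_mul, MulChar.map_zero, zero_add] at h0 ⊢
  have : ∑ u ∈ univ.erase (0 : ZMod p), quadraticChar (ZMod p) (u * (u + c)) =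
      ∑ v ∈ univ.erase (0 : ZMod p), quadraticChar (ZMod p) (1 + c * v) := by
    refine sum_bij' (fun u _ => u⁻¹) (fun u _ => u⁻¹) (by simp) (by simp) (by simp) (by simp) ?_
    intro u hu
    have hu0 : u ≠ 0 := by simpa using hu
    have h1 : quadraticChar (ZMod p) (u ^ 2) = 1 := quadraticChar_sq_one' hu0
    rw [← one_mul (quadraticChar (ZMod p) (1 + c * u⁻¹)), ← h1, ← map_mul]
    congr 1
    field_simp
  rw [this]
  linarith

lemma sum_legA_sq_le (hp : p ≠ 2) : ∑ l : ZMod p, legA p l ^ 2 ≤ (p : ℤ) ^ 2 := by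
  set χ := quadraticChar (ZMod p)
  have key : ∀ x y : ZMod p, ∑ l : ZMod p, χ ((x - l) * (y - l)) =
      (if x = y then (p : ℤ) else 0) - 1 := by
    intro x y
    rw [← Equiv.sum_comp (Equiv.subLeft x)]
    simp only [Equiv.subLeft_apply]
    split_ifs with h
    · subst h
      rw [← add_sum_erase univ _ (mem_univ (0 : ZMod p))]
      simp only [sub_sub_cancel, mul_zero, MulChar.map_zero, zero_add]
      rw [sum_congr rfl (g := fun _ => (1 : ℤ))]
      · simp [ZMod.card, Nat.cast_sub (Fact.out : p.Prime).one_le]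
      · intro u hu
        rw [← sq]
        exact quadraticChar_sq_one' (by simpa using hu)
    · rw [zero_sub, ← sum_quadraticChar_mul_shift hp (sub_ne_zero.mpr (Ne.symm h))]
      refine sum_congr rfl fun u _ => ?_
      congr 1
      ring
  have e1 : ∀ l : ZMod p, legA p l ^ 2 =
      ∑ x : ZMod p, ∑ y : ZMod p, χ (x * (x - 1)) * χ (y * (y - 1)) * χ ((x - l) * (y - l)) := by
    intro l
    unfold legA
    rw [neg_sq, sq, sum_mul_sum]
    refine sum_congr rfl fun x _ => sum_congr rfl fun y _ => ?_
    change χ _ * χ _ = _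
    rw [← map_mul, ← map_mul, ← map_mul]
    congr 1
    ring
  rw [sum_congr rfl fun l _ => e1 l, sum_comm]
  have e2 : ∀ x : ZMod p, ∑ l : ZMod p, ∑ y : ZMod p,
      χ (x * (x - 1)) * χ (y * (y - 1)) * χ ((x - l) * (y - l)) =
      p * (χ (x * (x - 1))) ^ 2 - χ (x * (x - 1)) * ∑ y : ZMod p, χ (y * (y - 1)) := by
    intro x
    rw [sum_comm]
    simp_rw [← mul_sum, key, mul_sub, mul_one, mul_ite, mul_zero]
    rw [sum_sub_distrib, sum_ite_eq, mul_sum]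
    simp only [mem_univ, if_true]
    ring
  rw [sum_congr rfl fun x _ => e2 x, sum_sub_distrib, ← mul_sum, ← sum_mul]
  have e3 : ∑ x : ZMod p, (χ (x * (x - 1))) ^ 2 ≤ p := by
    calc ∑ x : ZMod p, (χ (x * (x - 1))) ^ 2 ≤ ∑ x : ZMod p, (1 : ℤ) := by
          refine sum_le_sum fun x _ => ?_
          rcases quadraticChar_isQuadratic (ZMod p) (x * (x - 1)) with h | h | h <;>
            simp [χ, h]
      _ = p := by simp [ZMod.card]
  nlinarith [sq_nonneg (∑ x : ZMod p, χ (x * (x - 1)))]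

/-- For `p ≡ 1 mod 4` every trace satisfies `2 a² ≤ p²`. -/
lemma two_mul_legA_sq_le (hp4 : p % 4 = 1) (l : ZMod p) : 2 * legA p l ^ 2 ≤ (p : ℤ) ^ 2 := by
  have hp2 : p ≠ 2 := by rintro rfl; omega
  have hp3 : p ≠ 3 := by rintro rfl; omega
  have h2 : (2 : ZMod p) ≠ 0 := by
    intro h
    have : ((2 : ℕ) : ZMod p) = 0 := by exact_mod_cast h
    rw [ZMod.natCast_eq_zero_iff] at this
    exact hp2 ((Nat.prime_dvd_prime_iff_eq Fact.out Nat.prime_two).1 this)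
  have h3 : (3 : ZMod p) ≠ 0 := by
    intro h
    have : ((3 : ℕ) : ZMod p) = 0 := by exact_mod_cast h
    rw [ZMod.natCast_eq_zero_iff] at this
    exact hp3 ((Nat.prime_dvd_prime_iff_eq Fact.out Nat.prime_three).1 this)
  have hr : ringChar (ZMod p) ≠ 2 := by rwa [ZMod.ringChar_zmod_n]
  have pair : ∀ l' : ZMod p, l' ≠ l → legA p l' ^ 2 = legA p l ^ 2 →
      2 * legA p l ^ 2 ≤ (p : ℤ) ^ 2 := by
    intro l' hne heq
    refine le_trans ?_ (sum_legA_sq_le hp2)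
    rw [two_mul]
    nth_rw 1 [← heq]
    rw [← sum_pair (f := fun l => legA p l ^ 2) hne]
    exact sum_le_sum_of_subset_of_nonneg (subset_univ _) fun _ _ _ => sq_nonneg _
  by_cases h : 1 - l = l
  · have hl0 : l ≠ 0 := by
      rintro rfl
      simp at h
    refine pair l⁻¹ ?_ ?_
    · intro h'
      have h1 : l * l = 1 := by nth_rw 1 [← h']; exact inv_mul_cancel₀ hl0
      have h2l : 2 * l = 1 := by linear_combination -h
      exact h3 (by linear_combination (2 * l + 1) * h2l - 4 * h1)
    · rw [legA_inv hl0, mul_pow, quadraticChar_sq_one hl0, one_mul]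
  · refine pair (1 - l) h ?_
    rw [legA_one_sub, mul_pow, quadraticChar_sq_one (neg_ne_zero.mpr one_ne_zero), one_mul]

lemma sum_zmod_pow {e : ℕ} (he : 0 < e) (he2 : e < 2 * (p - 1)) :
    ∑ x : ZMod p, x ^ e = if e = p - 1 then -1 else 0 := by
  have h := FiniteField.sum_pow_units (ZMod p) e
  rw [ZMod.card] at h
  have h1 : ∑ x : ZMod p, x ^ e = ∑ x : (ZMod p)ˣ, (x : ZMod p) ^ e := by
    rw [← add_sum_erase univ _ (mem_univ (0 : ZMod p)), zero_pow he.ne', zero_add]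
    symm
    refine sum_bij (fun u _ => (u : ZMod p)) (by simp) (fun _ _ _ _ h => Units.ext h) ?_
      (fun _ _ => rfl)
    intro b hb
    exact ⟨Units.mk0 b (by simpa using hb), mem_univ _, rfl⟩
  rw [h1, h]
  by_cases hc : e = p - 1
  · simp [hc]
  · rw [if_neg, if_neg hc]
    rintro ⟨k, hk⟩
    rcases k with _ | _ | k
    · omega
    · omega
    · nlinarith [Nat.zero_le ((p - 1) * k)]

lemma legA_cast (hp4 : p % 4 = 1) (l : ZMod p) :
    ((legA p l : ℤ) : ZMod p) = (hassePoly (ZMod p) ((p - 1) / 2)).eval l := by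
  have hp2 : p ≠ 2 := by rintro rfl; omega
  have hr : ringChar (ZMod p) ≠ 2 := by rwa [ZMod.ringChar_zmod_n]
  obtain ⟨n, hn⟩ : ∃ n, p = 4 * n + 1 := ⟨p / 4, by omega⟩
  have hpp := (Fact.out : p.Prime).two_le
  set N := (p - 1) / 2 with hN
  have hNe : N = 2 * n := by omega
  have hp1 : p - 1 = 2 * N := by omega
  have hp2' : p / 2 = N := by omega
  unfold legA hassePoly
  push_cast
  simp_rw [quadraticChar_eq_pow_of_char_ne_two' hr, ZMod.card, hp2']
  have ex : ∀ x : ZMod p, (x * (x - 1) * (x - l)) ^ N =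
      ∑ i ∈ range (N + 1), ∑ j ∈ range (N + 1),
        ((N.choose i : ZMod p) * (-1) ^ (N - i) * ((N.choose j : ZMod p) * (-l) ^ j)) *
          x ^ (N + i + (N - j)) := by
    intro x
    rw [mul_pow, mul_pow, sub_eq_add_neg x 1, sub_eq_add_neg x l, add_pow, add_comm x (-l), add_pow,
      mul_assoc, sum_mul_sum, mul_sum]
    refine sum_congr rfl fun i _ => ?_
    rw [mul_sum]
    refine sum_congr rfl fun j _ => ?_
    ring
  rw [sum_congr rfl fun x _ => ex x, sum_comm]
  simp only [Polynomial.eval_finsetSum, Polynomial.eval_mul, Polynomial.eval_C,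
    Polynomial.eval_pow, Polynomial.eval_X]
  rw [← sum_neg_distrib]
  refine sum_congr rfl fun i hi => ?_
  rw [sum_comm]
  simp_rw [← mul_sum]
  have hi' : i ≤ N := by simpa [Nat.lt_succ_iff] using hi
  rw [sum_congr rfl (g := fun j => if j = i then -((N.choose i : ZMod p) * (-1) ^ (N - i) *
    ((N.choose j : ZMod p) * (-l) ^ j)) else 0)]
  · rw [sum_ite_eq' (range (N + 1)) i, if_pos hi, neg_neg]
    have : (-1 : ZMod p) ^ (N - i) * (-l) ^ i = l ^ i := by
      rw [neg_pow l, ← mul_assoc, ← pow_add, Nat.sub_add_cancel hi', hNe, pow_mul]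
      simp
    linear_combination ((N.choose i : ZMod p)) ^ 2 * this
  · intro j hj
    have hj' : j ≤ N := by simpa [Nat.lt_succ_iff] using hj
    rw [sum_zmod_pow (by omega) (by omega)]
    by_cases hji : j = i
    · subst hji
      rw [if_pos (by omega), if_pos rfl, mul_neg_one]
    · rw [if_neg (by omega), if_neg hji, mul_zero]

end CharSum

section HasseLanden

lemma centralBinom_cast_zmod {p N : ℕ} [Fact p.Prime] (hp : p = 2 * N + 1) {i : ℕ} (hi : i ≤ N) :
    ((2 * i).choose i : ZMod p) * (-1) ^ i = 4 ^ i * (N.choose i : ZMod p) := by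
  induction i with
  | zero => simp
  | succ i ih =>
    have ih := ih (by omega)
    have h1 : ((i : ZMod p) + 1) ≠ 0 := by
      intro h
      have : ((i + 1 : ℕ) : ZMod p) = 0 := by exact_mod_cast h
      rw [ZMod.natCast_eq_zero_iff] at this
      have := Nat.le_of_dvd (by omega) this
      omega
    have hp0 : (2 * (N : ZMod p) + 1) = 0 := by
      have : ((2 * N + 1 : ℕ) : ZMod p) = 0 := by rw [← hp]; simp
      exact_mod_cast this
    have h2 : ((i : ZMod p) + 1) * ((2 * (i + 1)).choose (i + 1) : ZMod p) =
        2 * (2 * i + 1) * ((2 * i).choose i : ZMod p) := by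
      have := Nat.succ_mul_centralBinom_succ i
      simp only [Nat.centralBinom] at this
      have h := congrArg (Nat.cast (R := ZMod p)) this
      push_cast at h
      exact h
    have h3 : (N.choose (i + 1) : ZMod p) * (i + 1) = (N.choose i : ZMod p) * (N - i) := by
      have := Nat.choose_succ_right_eq N i
      have h := congrArg (Nat.cast (R := ZMod p)) this
      push_cast [Nat.cast_sub (show i ≤ N by omega)] at h
      exact h
    apply mul_left_cancel₀ h1
    rw [pow_succ, pow_succ]
    linear_combination (-(-1) ^ i) * h2 - 2 * (2 * i + 1) * ih - 4 * 4 ^ i * h3 -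
      2 * 4 ^ i * (N.choose i : ZMod p) * hp0

open Polynomial in
lemma coeff_mul_pow_landen {R : Type*} [CommRing R] (k : R) (N : ℕ) :
    ∑ i ∈ range (N + 1), (N.choose i : R) ^ 2 * (k ^ 2) ^ i =
      ∑ i ∈ range (N + 1), (N.choose i : R) * (1 + k) ^ (2 * (N - i)) * k ^ i *
        ((-1) ^ i * ((2 * i).choose i : R)) := by
  have e : ((1 + C k * X) * (X + C k) : R[X]) ^ N =
      (C k * (X + C (-1)) ^ 2 + C ((1 + k) ^ 2) * X) ^ N := by
    congr 1
    simp only [map_pow, map_add, map_one, map_neg]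
    ring
  have h := congrArg (fun P => Polynomial.coeff P N) e
  have l1 : (((1 + C k * X) * (X + C k) : R[X]) ^ N).coeff N =
      ∑ i ∈ range (N + 1), (N.choose i : R) ^ 2 * (k ^ 2) ^ i := by
    rw [mul_pow, add_comm (1 : R[X]), add_pow, sum_mul, finsetSum_coeff]
    refine sum_congr rfl fun i hi => ?_
    have hi' : i ≤ N := by simpa [Nat.lt_succ_iff] using hi
    have : ((C k * X) ^ i * 1 ^ (N - i) * (N.choose i : R[X]) * (X + C k) ^ N : R[X]) =
        C (k ^ i * (N.choose i : R)) * ((X + C k) ^ N * X ^ i) := by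
      simp only [map_mul, map_pow, map_natCast]
      ring
    rw [this, coeff_C_mul, coeff_mul_X_pow', if_pos hi', coeff_X_add_C_pow, Nat.sub_sub_self hi',
      Nat.choose_symm hi']
    ring
  have l2 : ((C k * (X + C (-1)) ^ 2 + C ((1 + k) ^ 2) * X : R[X]) ^ N).coeff N =
      ∑ i ∈ range (N + 1), (N.choose i : R) * (1 + k) ^ (2 * (N - i)) * k ^ i *
        ((-1) ^ i * ((2 * i).choose i : R)) := by
    rw [add_pow, finsetSum_coeff]
    refine sum_congr rfl fun i hi => ?_
    have hi' : i ≤ N := by simpa [Nat.lt_succ_iff] using hi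
    have : ((C k * (X + C (-1)) ^ 2) ^ i * (C ((1 + k) ^ 2) * X) ^ (N - i) * (N.choose i : R[X])) =
        C (k ^ i * ((1 + k) ^ 2) ^ (N - i) * (N.choose i : R)) *
          ((X + C (-1)) ^ (2 * i) * X ^ (N - i)) := by
      simp only [map_mul, map_pow, map_natCast, mul_pow, ← pow_mul]
      ring
    rw [this, coeff_C_mul, coeff_mul_X_pow', if_pos (by omega), coeff_X_add_C_pow,
      Nat.sub_sub_self hi']
    rw [show 2 * i - i = i by omega, ← pow_mul]
    ring
  rw [l1, l2] at h
  exact h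

/-- Landen's transformation for the Hasse polynomial. -/
lemma hassePoly_landen {p N : ℕ} [Fact p.Prime] (hp : p = 2 * N + 1) {R : Type*} [CommRing R]
    [Algebra (ZMod p) R] (k l : R) (hl : l * (1 + k) ^ 2 = 4 * k) :
    (1 + k) ^ (p - 1) * Polynomial.aeval l (hassePoly (ZMod p) N) =
      Polynomial.aeval (k ^ 2) (hassePoly (ZMod p) N) := by
  unfold hassePoly
  simp only [map_sum, map_mul, map_pow, Polynomial.aeval_X, map_natCast]
  rw [coeff_mul_pow_landen, mul_sum]
  refine sum_congr rfl fun i hi => ?_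
  have hi' : i ≤ N := by simpa [Nat.lt_succ_iff] using hi
  have h := congrArg (algebraMap (ZMod p) R) (centralBinom_cast_zmod hp hi')
  simp only [map_mul, map_pow, map_natCast, map_neg, map_one, map_ofNat] at h
  have e1 : (1 + k) ^ (p - 1) = (1 + k) ^ (2 * (N - i)) * ((1 + k) ^ 2) ^ i := by
    rw [← pow_mul, ← pow_add]
    congr 1
    omega
  have e2 : l ^ i * ((1 + k) ^ 2) ^ i = 4 ^ i * k ^ i := by rw [← mul_pow, hl, mul_pow]
  rw [e1]
  linear_combination (1 + k) ^ (2 * (N - i)) * (N.choose i : R) ^ 2 * e2 -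
    (N.choose i : R) * (1 + k) ^ (2 * (N - i)) * k ^ i * h

end HasseLanden

section Theta
open Complex

/-- The pairs `(u + v, u - v)` and `(u + v + 1, u - v)` exhaust `ℤ × ℤ`. -/
noncomputable def sumDiffEquiv : (ℤ × ℤ) ⊕ (ℤ × ℤ) ≃ ℤ × ℤ :=
  Equiv.ofBijective
    (Sum.elim (fun x => (x.1 + x.2, x.1 - x.2)) (fun x => (x.1 + x.2 + 1, x.1 - x.2))) <| by
    constructor
    · rintro (⟨a, b⟩ | ⟨a, b⟩) (⟨c, d⟩ | ⟨c, d⟩) h <;>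
        simp only [Sum.elim_inl, Sum.elim_inr, Prod.mk.injEq, Sum.inl.injEq, Sum.inr.injEq,
          reduceCtorEq] at h ⊢ <;> omega
    · rintro ⟨m, n⟩
      rcases Int.even_or_odd (m + n) with ⟨k, hk⟩ | ⟨k, hk⟩
      · exact ⟨Sum.inl (k, m - k), by simp only [Sum.elim_inl, Prod.mk.injEq]; omega⟩
      · exact ⟨Sum.inr (k, m - k - 1), by simp only [Sum.elim_inr, Prod.mk.injEq]; omega⟩

lemma sumDiffEquiv_inl (x : ℤ × ℤ) : sumDiffEquiv (Sum.inl x) = (x.1 + x.2, x.1 - x.2) := rfl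

lemma sumDiffEquiv_inr (x : ℤ × ℤ) : sumDiffEquiv (Sum.inr x) = (x.1 + x.2 + 1, x.1 - x.2) := rfl

lemma HasSum.mul_prod {ι κ : Type*} {f : ι → ℂ} {g : κ → ℂ} {a b : ℂ} (hf : HasSum f a)
    (hg : HasSum g b) : HasSum (fun x : ι × κ => f x.1 * g x.2) (a * b) :=
  hf.mul hg (summable_mul_of_summable_norm hf.summable.norm hg.summable.norm)

lemma hasSum_jacobiTheta₂_mul (z w : ℂ) {τ : ℂ} (hτ : 0 < τ.im) :
    HasSum (fun x : ℤ × ℤ => jacobiTheta₂_term x.1 z τ * jacobiTheta₂_term x.2 w τ)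
      (jacobiTheta₂ z τ * jacobiTheta₂ w τ) :=
  HasSum.mul_prod (f := (jacobiTheta₂_term · z τ)) (g := (jacobiTheta₂_term · w τ))
    (hasSum_jacobiTheta₂_term z hτ) (hasSum_jacobiTheta₂_term w hτ)

/-- Duplication formula for products of Jacobi theta functions. -/
lemma jacobiTheta₂_mul (z w : ℂ) {τ : ℂ} (hτ : 0 < τ.im) :
    jacobiTheta₂ z τ * jacobiTheta₂ w τ =
      jacobiTheta₂ (z + w) (2 * τ) * jacobiTheta₂ (z - w) (2 * τ) +
      cexp (2 * Real.pi * I * z + Real.pi * I * τ) *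
        (jacobiTheta₂ (z + w + τ) (2 * τ) * jacobiTheta₂ (z - w + τ) (2 * τ)) := by
  have hτ2 : 0 < (2 * τ).im := by simpa using hτ
  have h1 := hasSum_jacobiTheta₂_mul z w hτ
  rw [← sumDiffEquiv.hasSum_iff] at h1
  refine h1.unique (HasSum.sum ?_ ?_)
  · convert hasSum_jacobiTheta₂_mul (z + w) (z - w) hτ2 using 2 with x
    simp only [Function.comp, sumDiffEquiv_inl,
      jacobiTheta₂_term, ← Complex.exp_add]
    congr 1
    push_cast
    ring
  · refine ((hasSum_jacobiTheta₂_mul (z + w + τ) (z - w + τ) hτ2).mul_left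
      (cexp (2 * Real.pi * I * z + Real.pi * I * τ))).congr_fun fun x => ?_
    simp only [Function.comp, sumDiffEquiv_inr, jacobiTheta₂_term, ← Complex.exp_add]
    congr 1
    push_cast
    ring

/-- The Jacobi theta constant `θ₃`. -/
noncomputable def th3 (τ : ℂ) : ℂ := jacobiTheta₂ 0 τ
/-- The Jacobi theta constant `θ₄`. -/
noncomputable def th4 (τ : ℂ) : ℂ := jacobiTheta₂ (1 / 2) τ
/-- The Jacobi theta constant `θ₂`. -/
noncomputable def th2 (τ : ℂ) : ℂ := cexp (Real.pi * I * τ / 4) * jacobiTheta₂ (τ / 2) τ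

lemma th2_two_mul_sq (τ : ℂ) :
    th2 (2 * τ) ^ 2 = cexp (Real.pi * I * τ) * jacobiTheta₂ τ (2 * τ) ^ 2 := by
  rw [th2, mul_pow, ← Complex.exp_nat_mul, show 2 * τ / 2 = τ by ring]
  congr 2
  push_cast
  ring

lemma th3_sq {τ : ℂ} (hτ : 0 < τ.im) : th3 τ ^ 2 = th3 (2 * τ) ^ 2 + th2 (2 * τ) ^ 2 := by
  rw [th2_two_mul_sq, sq, th3, jacobiTheta₂_mul 0 0 hτ]
  simp only [add_zero, sub_zero, zero_add, mul_zero, th3]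
  ring

lemma th4_sq {τ : ℂ} (hτ : 0 < τ.im) : th4 τ ^ 2 = th3 (2 * τ) ^ 2 - th2 (2 * τ) ^ 2 := by
  have e1 : jacobiTheta₂ 1 (2 * τ) = jacobiTheta₂ 0 (2 * τ) := by
    simpa using jacobiTheta₂_add_left 0 (2 * τ)
  have e2 : jacobiTheta₂ (1 + τ) (2 * τ) = jacobiTheta₂ τ (2 * τ) := by
    rw [add_comm, jacobiTheta₂_add_left]
  rw [th2_two_mul_sq, sq, th4, jacobiTheta₂_mul _ _ hτ, show (1 / 2 + 1 / 2 : ℂ) = 1 by norm_num,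
    sub_self, e1, e2, zero_add, th3,
    show 2 * (Real.pi : ℂ) * I * (1 / 2) + Real.pi * I * τ = Real.pi * I + Real.pi * I * τ by ring,
    Complex.exp_add, Complex.exp_pi_mul_I]
  ring

lemma jacobiTheta₂_half_add (τ : ℂ) : jacobiTheta₂ (1 / 2 + τ) (2 * τ) = 0 := by
  have h1 : jacobiTheta₂ (1 / 2 + τ) (2 * τ) = jacobiTheta₂ (1 / 2 - τ) (2 * τ) := by
    rw [← jacobiTheta₂_neg_left, ← jacobiTheta₂_add_left]
    congr 1
    ring
  have h2 := jacobiTheta₂_add_left' (1 / 2 - τ) (2 * τ)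
  rw [show (1 / 2 - τ + 2 * τ) = 1 / 2 + τ by ring, show -(Real.pi : ℂ) * I *
    (2 * τ + 2 * (1 / 2 - τ)) = -(Real.pi * I) by ring, Complex.exp_neg, Complex.exp_pi_mul_I,
    h1] at h2
  rw [h1]
  have : (2 : ℂ) * jacobiTheta₂ (1 / 2 - τ) (2 * τ) = 0 := by
    linear_combination (norm := (norm_num; ring)) h2
  simpa using this

lemma th3_mul_th4 {τ : ℂ} (hτ : 0 < τ.im) : th3 τ * th4 τ = th4 (2 * τ) ^ 2 := by
  rw [th3, th4, jacobiTheta₂_mul _ _ hτ]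
  simp only [zero_add, zero_sub, jacobiTheta₂_half_add, zero_mul, mul_zero, add_zero,
    jacobiTheta₂_neg_left, th4]
  ring

lemma th2_sq {τ : ℂ} (hτ : 0 < τ.im) : th2 τ ^ 2 = 2 * th2 (2 * τ) * th3 (2 * τ) := by
  have h2 : jacobiTheta₂ (2 * τ) (2 * τ) =
      cexp (-Real.pi * I * (2 * τ)) * jacobiTheta₂ 0 (2 * τ) := by
    simpa using jacobiTheta₂_add_left' 0 (2 * τ)
  have h3 : cexp (2 * Real.pi * I * (τ / 2) + Real.pi * I * τ) * cexp (-Real.pi * I * (2 * τ)) = 1 := by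
    rw [← Complex.exp_add, ← Complex.exp_zero]
    congr 1
    ring
  have h4 : cexp (Real.pi * I * τ / 4) ^ 2 = cexp (Real.pi * I * (2 * τ) / 4) := by
    rw [← Complex.exp_nat_mul]
    congr 1
    push_cast
    ring
  have h1 : jacobiTheta₂ (τ / 2) τ ^ 2 = 2 * jacobiTheta₂ τ (2 * τ) * jacobiTheta₂ 0 (2 * τ) := by
    rw [sq, jacobiTheta₂_mul _ _ hτ, sub_self, add_halves, zero_add, ← two_mul, h2]
    linear_combination jacobiTheta₂ 0 (2 * τ) * jacobiTheta₂ τ (2 * τ) * h3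
  rw [th2, th2, th3, mul_pow, h1, h4, show 2 * τ / 2 = τ by ring]
  ring

lemma th3_pow_four {τ : ℂ} (hτ : 0 < τ.im) : th3 τ ^ 4 = th2 τ ^ 4 + th4 τ ^ 4 := by
  have h1 := th3_sq hτ
  have h2 := th4_sq hτ
  have h3 := th2_sq hτ
  calc th3 τ ^ 4 = (th3 τ ^ 2) ^ 2 := by ring
    _ = (th2 τ ^ 2) ^ 2 + (th4 τ ^ 2) ^ 2 := by rw [h1, h2, h3]; ring
    _ = _ := by ring

lemma th3_add_one (τ : ℂ) : th3 (τ + 1) = th4 τ := by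
  refine tsum_congr fun n => ?_
  simp only [jacobiTheta₂_term]
  rw [Complex.exp_eq_exp_iff_exists_int]
  rcases Int.even_or_odd n with ⟨k, hk⟩ | ⟨k, hk⟩
  · exact ⟨2 * k ^ 2 - k, by subst hk; push_cast; ring⟩
  · exact ⟨2 * k ^ 2 + k, by subst hk; push_cast; ring⟩

lemma th4_add_one (τ : ℂ) : th4 (τ + 1) = th3 τ := by
  rw [← th3_add_one, add_assoc, one_add_one_eq_two, th3, th3, jacobiTheta₂_add_right]

lemma th2_add_one_sq (τ : ℂ) : th2 (τ + 1) ^ 2 = I * th2 τ ^ 2 := by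
  have h : jacobiTheta₂ ((τ + 1) / 2) (τ + 1) = jacobiTheta₂ (τ / 2) τ := by
    refine tsum_congr fun n => ?_
    simp only [jacobiTheta₂_term]
    rw [Complex.exp_eq_exp_iff_exists_int]
    rcases Int.even_or_odd n with ⟨k, hk⟩ | ⟨k, hk⟩
    · exact ⟨2 * k ^ 2 + k, by subst hk; push_cast; ring⟩
    · exact ⟨2 * k ^ 2 + 3 * k + 1, by subst hk; push_cast; ring⟩
  have h' : cexp (Real.pi * I * (τ + 1) / 4) ^ 2 = I * cexp (Real.pi * I * τ / 4) ^ 2 := by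
    have hI : I = cexp (Real.pi / 2 * I) := Complex.exp_pi_div_two_mul_I.symm
    refine Eq.trans ?_ (congrArg (· * cexp (Real.pi * I * τ / 4) ^ 2) hI.symm)
    rw [← Complex.exp_nat_mul, ← Complex.exp_nat_mul, ← Complex.exp_add]
    congr 1
    push_cast
    ring
  rw [th2, th2, h, mul_pow, mul_pow, h', mul_assoc]

lemma neg_I_mul_cpow_half_sq {τ : ℂ} : ((-I * τ) ^ (1 / 2 : ℂ)) ^ 2 = -I * τ := by
  rw [← Complex.cpow_nat_mul]
  norm_num

lemma neg_I_mul_ne_zero {τ : ℂ} (hτ : 0 < τ.im) : -I * τ ≠ 0 := by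
  refine mul_ne_zero (neg_ne_zero.mpr I_ne_zero) ?_
  rintro rfl
  simp at hτ

lemma th3_S_sq {τ : ℂ} (hτ : 0 < τ.im) : th3 (-1 / τ) ^ 2 = -I * τ * th3 τ ^ 2 := by
  have hτ0 : τ ≠ 0 := by rintro rfl; simp at hτ
  have h := jacobiTheta₂_functional_equation 0 τ
  simp only [zero_div, ne_eq, OfNat.ofNat_ne_zero, not_false_eq_true, zero_pow, mul_zero,
    Complex.exp_zero, mul_one] at h
  rw [th3, th3, h, mul_pow, div_pow, neg_I_mul_cpow_half_sq, one_pow]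
  field_simp [neg_I_mul_ne_zero hτ]

lemma th4_S_sq {τ : ℂ} (hτ : 0 < τ.im) : th4 (-1 / τ) ^ 2 = -I * τ * th2 τ ^ 2 := by
  have hτ0 : τ ≠ 0 := by rintro rfl; simp at hτ
  have h := jacobiTheta₂_functional_equation (τ / 2) τ
  rw [show τ / 2 / τ = 1 / 2 by field_simp] at h
  have e : cexp (Real.pi * I * τ / 4) * cexp (-Real.pi * I * (τ / 2) ^ 2 / τ) = 1 := by
    rw [← Complex.exp_add, ← Complex.exp_zero]
    congr 1
    field_simp
    ring
  have h2 : th2 τ = 1 / (-I * τ) ^ (1 / 2 : ℂ) * th4 (-1 / τ) := by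
    rw [th2, h, th4]
    linear_combination 1 / (-I * τ) ^ (1 / 2 : ℂ) * jacobiTheta₂ (1 / 2) (-1 / τ) * e
  rw [h2, mul_pow, div_pow, neg_I_mul_cpow_half_sq, one_pow]
  field_simp [neg_I_mul_ne_zero hτ]

lemma im_neg_one_div_pos {τ : ℂ} (hτ : 0 < τ.im) : 0 < (-1 / τ).im := by
  rw [neg_div, neg_im, one_div, inv_im, neg_div, neg_neg]
  exact div_pos hτ (normSq_pos.mpr (by rintro rfl; simp at hτ))

lemma th2_S_sq {τ : ℂ} (hτ : 0 < τ.im) : th2 (-1 / τ) ^ 2 = -I * τ * th4 τ ^ 2 := by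
  have hτ0 : τ ≠ 0 := by rintro rfl; simp at hτ
  have h := th4_S_sq (im_neg_one_div_pos hτ)
  rw [show -1 / (-1 / τ) = τ by field_simp] at h
  rw [h]
  field_simp
  rw [I_sq]
  ring

end Theta

section QSeries
open Complex PowerSeries

/-- The local parameter `exp(π i τ / h)` at the cusp `i∞`. -/
noncomputable def nome (h : ℕ) (τ : ℂ) : ℂ := cexp (Real.pi * I * τ / h)

/-- `F` is given on the upper half-plane by the power series `s` in `exp(π i τ / h)`. -/
def HasQ (h : ℕ) (F : ℂ → ℂ) (s : PowerSeries ℂ) : Prop :=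
  ∀ τ : ℂ, 0 < τ.im → HasSum (fun n => s.coeff n * nome h τ ^ n) (F τ)

lemma nome_ne_zero (h : ℕ) (τ : ℂ) : nome h τ ≠ 0 := Complex.exp_ne_zero _

lemma norm_nome (h : ℕ) (τ : ℂ) : ‖nome h τ‖ = Real.exp (-Real.pi * τ.im / h) := by
  rw [nome, Complex.norm_exp]
  congr 1
  rw [Complex.div_natCast_re]
  simp

lemma norm_nome_lt_one {h : ℕ} (hh : 0 < h) {τ : ℂ} (hτ : 0 < τ.im) : ‖nome h τ‖ < 1 := by
  rw [norm_nome, Real.exp_lt_one_iff]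
  have : 0 < Real.pi * τ.im / h := by positivity
  rw [neg_mul, neg_div]
  linarith

lemma exists_nome_eq {h : ℕ} (hh : 0 < h) {z : ℂ} (hz : z ≠ 0) (hz1 : ‖z‖ < 1) :
    ∃ τ : ℂ, 0 < τ.im ∧ nome h τ = z := by
  have hpi : (Real.pi : ℂ) ≠ 0 := by exact_mod_cast Real.pi_ne_zero
  have hh' : (h : ℂ) ≠ 0 := by exact_mod_cast hh.ne'
  have key : nome h (h * Complex.log z / (Real.pi * I)) = z := by
    rw [nome]
    rw [show (Real.pi : ℂ) * I * (h * Complex.log z / (Real.pi * I)) / h = Complex.log z by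
      field_simp]
    exact Complex.exp_log hz
  refine ⟨_, ?_, key⟩
  by_contra hneg
  have h1 := norm_nome h (h * Complex.log z / (Real.pi * I))
  rw [key] at h1
  have : (0 : ℝ) ≤ -Real.pi * (h * Complex.log z / (Real.pi * I)).im / h := by
    apply div_nonneg _ (Nat.cast_nonneg _)
    nlinarith [Real.pi_pos]
  have := Real.one_le_exp this
  linarith

lemma HasQ.const (h : ℕ) (c : ℂ) : HasQ h (fun _ => c) (C c) := by
  intro τ _
  convert hasSum_single (f := fun n => (C c).coeff n * nome h τ ^ n) 0 ?_ using 1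
  · simp
  · intro n hn
    simp [PowerSeries.coeff_C, hn]

lemma HasQ.add {h : ℕ} {F G : ℂ → ℂ} {s t : PowerSeries ℂ} (hF : HasQ h F s) (hG : HasQ h G t) :
    HasQ h (fun τ => F τ + G τ) (s + t) := by
  intro τ hτ
  simpa [add_mul] using (hF τ hτ).add (hG τ hτ)

lemma HasQ.mul {h : ℕ} {F G : ℂ → ℂ} {s t : PowerSeries ℂ} (hF : HasQ h F s) (hG : HasQ h G t) :
    HasQ h (fun τ => F τ * G τ) (s * t) := by
  intro τ hτ
  have h1 := hF τ hτ
  have h2 := hG τ hτ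
  have h3 := summable_norm_sum_mul_antidiagonal_of_summable_norm h1.summable.norm
    h2.summable.norm
  have h4 := tsum_mul_tsum_eq_tsum_sum_antidiagonal_of_summable_norm h1.summable.norm
    h2.summable.norm
  rw [h1.tsum_eq, h2.tsum_eq] at h4
  simp only [h4]
  refine h3.of_norm.hasSum.congr_fun fun n => ?_
  rw [PowerSeries.coeff_mul, Finset.sum_mul]
  refine Finset.sum_congr rfl fun x hx => ?_
  rw [← Finset.HasAntidiagonal.mem_antidiagonal.mp hx, pow_add]
  ring

lemma HasQ.neg {h : ℕ} {F : ℂ → ℂ} {s : PowerSeries ℂ} (hF : HasQ h F s) :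
    HasQ h (fun τ => -F τ) (-s) := by
  intro τ hτ
  simpa using (hF τ hτ).neg

lemma HasQ.sub {h : ℕ} {F G : ℂ → ℂ} {s t : PowerSeries ℂ} (hF : HasQ h F s) (hG : HasQ h G t) :
    HasQ h (fun τ => F τ - G τ) (s - t) := by
  simpa [sub_eq_add_neg] using hF.add hG.neg

lemma HasQ.pow {h : ℕ} {F : ℂ → ℂ} {s : PowerSeries ℂ} (hF : HasQ h F s) (n : ℕ) :
    HasQ h (fun τ => F τ ^ n) (s ^ n) := by
  induction n with
  | zero => simpa using HasQ.const h 1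
  | succ n ih => simpa [pow_succ] using ih.mul hF

lemma HasQ.prod {h : ℕ} {ι : Type*} (u : Finset ι) {F : ι → ℂ → ℂ} {s : ι → PowerSeries ℂ}
    (hF : ∀ i ∈ u, HasQ h (F i) (s i)) :
    HasQ h (fun τ => ∏ i ∈ u, F i τ) (∏ i ∈ u, s i) := by
  classical
  induction u using Finset.induction_on with
  | empty => simpa using HasQ.const h 1
  | insert a u ha ih =>
    simp only [Finset.prod_insert ha]
    exact (hF a (by simp)).mul (ih fun i hi => hF i (by simp [hi]))

lemma HasQ.aeval {h : ℕ} {F : ℂ → ℂ} {s : PowerSeries ℂ} (hF : HasQ h F s)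
    (P : Polynomial ℂ) : HasQ h (fun τ => P.eval (F τ)) (Polynomial.aeval s P) := by
  induction P using Polynomial.induction_on' with
  | add p q hp hq => simpa using hp.add hq
  | monomial n a =>
    have := (HasQ.const h a).mul (hF.pow n)
    simpa [Polynomial.aeval_monomial] using this

lemma HasQ.congr {h : ℕ} {F G : ℂ → ℂ} {s : PowerSeries ℂ} (hF : HasQ h F s)
    (hFG : ∀ τ : ℂ, 0 < τ.im → G τ = F τ) : HasQ h G s := fun τ hτ => by
  rw [hFG τ hτ]
  exact hF τ hτ

/-- Substitution `nome ↦ c * nome ^ m`. -/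
lemma HasQ.comp {h h' m : ℕ} (hm : m ≠ 0) {c : ℂ} {φ : ℂ → ℂ} {F : ℂ → ℂ} {s : PowerSeries ℂ}
    (hF : HasQ h F s) (hφ : ∀ τ : ℂ, 0 < τ.im → 0 < (φ τ).im)
    (hφ' : ∀ τ : ℂ, nome h (φ τ) = c * nome h' τ ^ m) :
    HasQ h' (fun τ => F (φ τ)) (PowerSeries.expand m hm (rescale c s)) := by
  intro τ hτ
  have h1 := hF (φ τ) (hφ τ hτ)
  have hinj : Function.Injective (fun n : ℕ => m * n) :=
    fun a b hab => Nat.eq_of_mul_eq_mul_left (Nat.pos_of_ne_zero hm) hab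
  rw [← hinj.hasSum_iff]
  · refine h1.congr_fun fun n => ?_
    simp only [Function.comp, PowerSeries.coeff_expand_mul, coeff_rescale, hφ', mul_pow, pow_mul]
    ring
  · intro n hn
    rw [PowerSeries.coeff_expand_of_not_dvd, zero_mul]
    rintro ⟨k, rfl⟩
    exact hn ⟨k, rfl⟩

/-- The analytic function on the unit disc attached to a `q`-series. -/
lemma HasQ.exists_disc {h : ℕ} (hh : 0 < h) {F : ℂ → ℂ} {s : PowerSeries ℂ} (hF : HasQ h F s) :
    ∃ g : ℂ → ℂ, HasFPowerSeriesOnBall g (FormalMultilinearSeries.ofScalars ℂ (s.coeff ·)) 0 1 ∧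
      g 0 = s.coeff 0 ∧ ∀ τ : ℂ, 0 < τ.im → F τ = g (nome h τ) := by
  have hs : ∀ z : ℂ, ‖z‖ < 1 → Summable fun n => s.coeff n * z ^ n := by
    intro z hz
    rcases eq_or_ne z 0 with rfl | hz0
    · refine summable_of_ne_finset_zero (s := {0}) fun n hn => ?_
      simp at hn
      simp [hn]
    · obtain ⟨τ, hτ, rfl⟩ := exists_nome_eq hh hz0 hz
      exact (hF τ hτ).summable
  refine ⟨fun z => ∑' n, s.coeff n * z ^ n, ⟨?_, one_pos, ?_⟩, ?_, fun τ hτ => (hF τ hτ).tsum_eq.symm⟩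
  · refine ENNReal.le_of_forall_nnreal_lt fun r hr => ?_
    have hr1 : (r : ℝ) < 1 := by exact_mod_cast hr
    refine FormalMultilinearSeries.le_radius_of_summable _ ?_
    have := (hs (r : ℂ) (by simpa using hr1)).norm
    refine this.congr fun n => ?_
    rw [FormalMultilinearSeries.ofScalars_norm]
    simp
  · intro y hy
    have hy1 : ‖y‖ < 1 := by
      rw [Metric.mem_eball, edist_zero_right, ← ofReal_norm, ← ENNReal.ofReal_one] at hy
      exact (ENNReal.ofReal_lt_ofReal_iff one_pos).mp hy
    simp only [zero_add]
    refine (hs y hy1).hasSum.congr_fun fun n => ?_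
    simp [mul_comm]
  · simp only
    rw [tsum_eq_single 0 (fun n hn => by simp [hn])]
    simp

lemma HasQ.unique {h : ℕ} (hh : 0 < h) {F : ℂ → ℂ} {s t : PowerSeries ℂ} (hs : HasQ h F s)
    (ht : HasQ h F t) : s = t := by
  obtain ⟨g, hg, -, hFg⟩ := hs.exists_disc hh
  obtain ⟨k, hk, -, hFk⟩ := ht.exists_disc hh
  have hfr : ∃ᶠ z in nhdsWithin (0 : ℂ) {0}ᶜ, g z = k z := by
    refine Eventually.frequently ?_
    have : Metric.ball (0 : ℂ) 1 ∈ nhdsWithin (0 : ℂ) {0}ᶜ :=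
      mem_nhdsWithin_of_mem_nhds (Metric.ball_mem_nhds _ one_pos)
    filter_upwards [this, self_mem_nhdsWithin] with z hz hz0
    obtain ⟨τ, hτ, rfl⟩ := exists_nome_eq hh hz0 (by simpa using hz)
    rw [← hFg τ hτ, ← hFk τ hτ]
  have hev := (hg.analyticAt.frequently_eq_iff_eventually_eq hk.analyticAt).mp hfr
  have := (hg.hasFPowerSeriesAt.congr hev).eq_formalMultilinearSeries hk.hasFPowerSeriesAt
  have h2 := FormalMultilinearSeries.ofScalars_series_injective (𝕜 := ℂ) ℂ this
  ext n
  exact congrFun h2 n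

lemma HasQ.inv {h : ℕ} (hh : 0 < h) {F : ℂ → ℂ} {s : PowerSeries ℂ} (hF : HasQ h F s)
    (hF0 : ∀ τ : ℂ, 0 < τ.im → F τ ≠ 0) (hs : s.coeff 0 ≠ 0) :
    HasQ h (fun τ => (F τ)⁻¹) s⁻¹ := by
  obtain ⟨g, hg, hg0, hFg⟩ := hF.exists_disc hh
  have hne : ∀ z ∈ Metric.ball (0 : ℂ) 1, g z ≠ 0 := by
    intro z hz
    rcases eq_or_ne z 0 with rfl | hz0
    · rwa [hg0]
    · obtain ⟨τ, hτ, rfl⟩ := exists_nome_eq hh hz0 (by simpa using hz)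
      rw [← hFg τ hτ]
      exact hF0 τ hτ
  have hd : DifferentiableOn ℂ (fun z => (g z)⁻¹) (Metric.ball 0 1) := by
    refine DifferentiableOn.inv ?_ hne
    have := hg.differentiableOn
    rwa [← ENNReal.ofReal_one, Metric.eball_ofReal] at this
  have ht : ∀ z ∈ Metric.ball (0 : ℂ) 1, HasSum (fun n => ((n.factorial : ℂ)⁻¹ *
      iteratedDeriv n (fun z => (g z)⁻¹) 0) * z ^ n) (g z)⁻¹ := by
    intro z hz
    have := Complex.hasSum_taylorSeries_on_ball (r := 1) hd (by simpa using hz)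
    refine this.congr_fun fun n => ?_
    simp only [sub_zero, smul_eq_mul]
    ring
  have hQ : HasQ h (fun τ => (F τ)⁻¹) (PowerSeries.mk fun n => (n.factorial : ℂ)⁻¹ *
      iteratedDeriv n (fun z => (g z)⁻¹) 0) := by
    intro τ hτ
    simp only [coeff_mk, hFg τ hτ]
    exact ht _ (by simpa using norm_nome_lt_one hh hτ)
  have h1 : s * (PowerSeries.mk fun n => (n.factorial : ℂ)⁻¹ *
      iteratedDeriv n (fun z => (g z)⁻¹) 0) = 1 := by
    refine ((hF.mul hQ).congr (G := fun _ => 1) fun τ hτ => ?_).unique hh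
      (by simpa using HasQ.const h 1)
    exact (mul_inv_cancel₀ (hF0 τ hτ)).symm
  have h2 : s⁻¹ = PowerSeries.mk fun n => (n.factorial : ℂ)⁻¹ *
      iteratedDeriv n (fun z => (g z)⁻¹) 0 := by
    have hc : constantCoeff s ≠ 0 := by simpa using hs
    rw [eq_comm, PowerSeries.eq_inv_iff_mul_eq_one hc, mul_comm, h1]
  rwa [h2]

lemma HasQ.bounded {h : ℕ} {F : ℂ → ℂ} {s : PowerSeries ℂ} (hF : HasQ h F s) :
    ∃ B : ℝ, ∀ τ : ℂ, 1 ≤ τ.im → ‖F τ‖ ≤ B := by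
  have h1 := (hF I (by simp)).summable.norm
  refine ⟨∑' n, ‖s.coeff n * nome h I ^ n‖, fun τ hτ => ?_⟩
  have hτ0 : 0 < τ.im := by linarith
  have h2 := (hF τ hτ0)
  have hle : ∀ n, ‖s.coeff n * nome h τ ^ n‖ ≤ ‖s.coeff n * nome h I ^ n‖ := by
    intro n
    rw [norm_mul, norm_mul, norm_pow, norm_pow, norm_nome, norm_nome]
    refine mul_le_mul_of_nonneg_left (pow_le_pow_left₀ (Real.exp_nonneg _)
      (Real.exp_le_exp.mpr (div_le_div_of_nonneg_right ?_ (Nat.cast_nonneg _))) n) (norm_nonneg _)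
    rw [I_im]
    nlinarith [Real.pi_pos]
  rw [← h2.tsum_eq]
  exact (norm_tsum_le_tsum_norm h2.summable.norm).trans (h2.summable.norm.tsum_le_tsum hle h1)

lemma nome_differentiable (h : ℕ) : Differentiable ℂ (nome h) := by
  unfold nome
  fun_prop

lemma HasQ.differentiableAt {h : ℕ} (hh : 0 < h) {F : ℂ → ℂ} {s : PowerSeries ℂ}
    (hF : HasQ h F s) {τ : ℂ} (hτ : 0 < τ.im) : DifferentiableAt ℂ F τ := by
  obtain ⟨g, hg, -, hFg⟩ := hF.exists_disc hh
  have hd := hg.differentiableOn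
  rw [← ENNReal.ofReal_one, Metric.eball_ofReal] at hd
  have h1 : DifferentiableAt ℂ g (nome h τ) :=
    hd.differentiableAt (Metric.isOpen_ball.mem_nhds (by simpa using norm_nome_lt_one hh hτ))
  refine (h1.comp τ (nome_differentiable h τ)).congr_of_eventuallyEq ?_
  filter_upwards [(isOpen_lt continuous_const Complex.continuous_im).mem_nhds hτ] with w hw
  exact hFg w hw

lemma HasQ.tendsto {h : ℕ} (hh : 0 < h) {F : ℂ → ℂ} {s : PowerSeries ℂ} (hF : HasQ h F s) :
    Tendsto F (comap Complex.im atTop) (nhds (s.coeff 0)) := by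
  obtain ⟨g, hg, hg0, hFg⟩ := hF.exists_disc hh
  have h1 : Tendsto (nome h) (comap Complex.im atTop) (nhds 0) := by
    rw [tendsto_zero_iff_norm_tendsto_zero]
    simp only [norm_nome]
    refine Real.tendsto_exp_atBot.comp ?_
    have : Tendsto (fun x : ℝ => -Real.pi * x / h) atTop atBot := by
      have hc : -Real.pi / h < 0 := div_neg_of_neg_of_pos (by simp [Real.pi_pos]) (by exact_mod_cast hh)
      refine (tendsto_id.const_mul_atTop_of_neg hc).congr fun x => ?_
      simp only [id]
      ring
    exact this.comp tendsto_comap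
  rw [← hg0]
  refine (hg.analyticAt.continuousAt.tendsto.comp h1).congr' ?_
  have : ∀ᶠ τ : ℂ in comap Complex.im atTop, 0 < τ.im := tendsto_comap.eventually (eventually_gt_atTop 0)
  filter_upwards [this] with τ hτ
  exact (hFg τ hτ).symm

end QSeries

section ThetaSeries
open Complex PowerSeries

/-- The generating series of the fibres of `f`. -/
noncomputable def fibreSeries (f : ℤ → ℕ) : PowerSeries ℤ :=
  PowerSeries.mk fun k => ({n : ℤ | f n = k}.ncard : ℤ)

lemma hasQ_fibreSeries (f : ℤ → ℕ) (hf : ∀ k, {n : ℤ | f n = k}.Finite) (F : ℂ → ℂ)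
    (hF : ∀ τ : ℂ, 0 < τ.im → HasSum (fun n : ℤ => nome 1 τ ^ f n) (F τ)) :
    HasQ 1 F ((fibreSeries f).map (Int.castRingHom ℂ)) := by
  intro τ hτ
  have h1 := (Equiv.sigmaFiberEquiv f).hasSum_iff.mpr (hF τ hτ)
  refine h1.sigma fun k => ?_
  have : Fintype {n : ℤ // f n = k} := (hf k).fintype
  have h2 := hasSum_fintype fun n : {n : ℤ // f n = k} => nome 1 τ ^ f n
  refine HasSum.congr_fun (f := fun n : {n : ℤ // f n = k} => nome 1 τ ^ f n) ?_ fun _ => rfl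
  convert h2 using 1
  rw [Finset.sum_congr rfl (g := fun _ => nome 1 τ ^ k) fun n _ => by rw [n.2]]
  simp only [fibreSeries, coeff_map, coeff_mk, Finset.sum_const, Finset.card_univ, nsmul_eq_mul]
  congr 1
  simp only [eq_intCast, Int.cast_natCast, Nat.cast_inj]
  rw [← Nat.card_coe_set_eq]
  exact Nat.card_eq_fintype_card (α := {n : ℤ // f n = k})

/-- The series `∑ q^{n²}`. -/
noncomputable def thetaZ : PowerSeries ℤ := fibreSeries fun n => n.natAbs ^ 2

/-- The series `∑ q^{n(n+1)}`. -/
noncomputable def psiZ : PowerSeries ℤ := fibreSeries fun n => (n * (n + 1)).toNat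

/-- `θ₂` without its leading power of `q`. -/
noncomputable def psi (τ : ℂ) : ℂ := jacobiTheta₂ (τ / 2) τ

lemma nome_one (τ : ℂ) : nome 1 τ = cexp (Real.pi * I * τ) := by simp [nome]

lemma hasQ_th3 : HasQ 1 th3 (thetaZ.map (Int.castRingHom ℂ)) := by
  refine hasQ_fibreSeries _ (fun k => ?_) _ fun τ hτ => ?_
  · refine (Set.finite_Icc (-(k : ℤ)) k).subset fun n hn => ?_
    have : n.natAbs ^ 2 = k := hn
    have : n.natAbs ≤ k := by nlinarith [Nat.zero_le n.natAbs]
    rw [Set.mem_Icc]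
    omega
  · refine (hasSum_jacobiTheta₂_term 0 hτ).congr_fun fun n => ?_
    rw [jacobiTheta₂_term, nome_one, ← Complex.exp_nat_mul]
    congr 1
    have : ((n.natAbs ^ 2 : ℕ) : ℂ) = (n : ℂ) ^ 2 := by
      have : ((n.natAbs ^ 2 : ℕ) : ℤ) = n ^ 2 := by simp
      have := congrArg (Int.cast : ℤ → ℂ) this
      rwa [Int.cast_natCast, Int.cast_pow] at this
    rw [this]
    ring

lemma hasQ_psi : HasQ 1 psi (psiZ.map (Int.castRingHom ℂ)) := by
  have hnn : ∀ n : ℤ, 0 ≤ n * (n + 1) := fun n => by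
    rcases le_or_gt 0 n with h | h <;> nlinarith
  refine hasQ_fibreSeries _ (fun k => ?_) _ fun τ hτ => ?_
  · refine (Set.finite_Icc (-(k : ℤ) - 1) k).subset fun n hn => ?_
    have h1 : (n * (n + 1)).toNat = k := hn
    have h2 : n * (n + 1) = k := by rw [← h1, Int.toNat_of_nonneg (hnn n)]
    rw [Set.mem_Icc]
    constructor
    · rcases le_or_gt 0 n with h | h
      · have : (0 : ℤ) ≤ k := by positivity
        linarith
      · nlinarith
    · nlinarith
  · refine (hasSum_jacobiTheta₂_term (τ / 2) hτ).congr_fun fun n => ?_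
    rw [jacobiTheta₂_term, nome_one, ← Complex.exp_nat_mul]
    congr 1
    have : (((n * (n + 1)).toNat : ℕ) : ℂ) = (n : ℂ) * (n + 1) := by
      exact_mod_cast congrArg (Int.cast : ℤ → ℂ) (Int.toNat_of_nonneg (hnn n))
    rw [this]
    ring

lemma coeff_zero_thetaZ : thetaZ.coeff 0 = 1 := by
  have : {n : ℤ | n.natAbs ^ 2 = 0} = {0} := by ext; simp
  rw [thetaZ, fibreSeries, coeff_mk, this]
  simp

lemma coeff_zero_psiZ : psiZ.coeff 0 = 2 := by
  have : {n : ℤ | (n * (n + 1)).toNat = 0} = {0, -1} := by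
    ext n
    simp only [Int.toNat_eq_zero, Set.mem_ofPred_eq, Set.mem_insert_iff, Set.mem_singleton_iff]
    constructor
    · intro h
      rcases lt_trichotomy n (-1) with h1 | h1 | h1
      · nlinarith
      · exact Or.inr h1
      · left
        by_contra h0
        nlinarith [show 0 < n by omega]
    · rintro (rfl | rfl) <;> norm_num
  rw [psiZ, fibreSeries, coeff_mk, this, Set.ncard_pair (by norm_num)]
  rfl

lemma th2_pow_four (τ : ℂ) : th2 τ ^ 4 = nome 1 τ * psi τ ^ 4 := by
  rw [th2, nome_one, mul_pow, ← Complex.exp_nat_mul, psi]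
  congr 2
  push_cast
  ring

lemma hasQ_th4 : HasQ 1 th4 (rescale (-1) (thetaZ.map (Int.castRingHom ℂ))) := by
  have := hasQ_th3.comp (h' := 1) (m := 1) (c := -1) one_ne_zero (φ := fun τ => τ + 1)
    (fun τ hτ => by simpa using hτ) (fun τ => by
      rw [nome_one, nome_one, mul_add, mul_one, Complex.exp_add, Complex.exp_pi_mul_I]
      ring)
  rw [PowerSeries.expand_one] at this
  exact this.congr fun τ _ => (th3_add_one τ).symm

lemma th4_ne_zero {τ : ℂ} (hτ : 0 < τ.im) : th4 τ ≠ 0 := by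
  intro h0
  have him : ∀ n : ℕ, ((2 ^ n : ℕ) * τ).im = 2 ^ n * τ.im := fun n => by
    rw [← Complex.ofReal_natCast, Complex.im_ofReal_mul]
    push_cast
    rfl
  have h1 : ∀ n : ℕ, th4 ((2 ^ n : ℕ) * τ) = 0 := by
    intro n
    induction n with
    | zero => simpa using h0
    | succ n ih =>
      have := th3_mul_th4 (τ := (2 ^ n : ℕ) * τ) (by rw [him]; positivity)
      rw [ih, mul_zero] at this
      rw [pow_succ, mul_comm, Nat.cast_mul, mul_comm, mul_comm ((2 ^ n : ℕ) : ℂ), mul_assoc]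
      exact (pow_eq_zero_iff two_ne_zero).mp this.symm
  have h2 : Tendsto (fun n : ℕ => ((2 ^ n : ℕ) * τ)) atTop (comap Complex.im atTop) := by
    rw [tendsto_comap_iff]
    refine Tendsto.congr (fun n => (him n).symm) ?_
    exact (tendsto_pow_atTop_atTop_of_one_lt one_lt_two).atTop_mul_const hτ
  have h3 := (hasQ_th4.tendsto one_pos).comp h2
  have h4 : Tendsto (fun n : ℕ => th4 ((2 ^ n : ℕ) * τ)) atTop (nhds 0) := by
    simp only [h1, tendsto_const_nhds]
  have h5 := tendsto_nhds_unique h3 h4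
  rw [coeff_rescale, coeff_map, coeff_zero_thetaZ] at h5
  simp at h5

lemma th3_ne_zero {τ : ℂ} (hτ : 0 < τ.im) : th3 τ ≠ 0 := by
  rw [← th4_add_one]
  exact th4_ne_zero (by simpa using hτ)

lemma th2_ne_zero {τ : ℂ} (hτ : 0 < τ.im) : th2 τ ≠ 0 := by
  intro h
  have h1 := th4_S_sq hτ
  rw [h] at h1
  exact th4_ne_zero (im_neg_one_div_pos hτ) (by simpa using h1)

lemma psi_ne_zero {τ : ℂ} (hτ : 0 < τ.im) : psi τ ≠ 0 := fun h =>
  th2_ne_zero hτ (by rw [th2, ← psi, h, mul_zero])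

/-- The modular function `λ`. -/
noncomputable def lam (τ : ℂ) : ℂ := th2 τ ^ 4 / th3 τ ^ 4

/-- The weight one form `θ₃²`. -/
noncomputable def thA (τ : ℂ) : ℂ := th3 τ ^ 2

/-- The square root `k(2τ)` of `λ(2τ)`. -/
noncomputable def kap (τ : ℂ) : ℂ := th2 (2 * τ) ^ 2 / th3 (2 * τ) ^ 2

lemma thA_ne_zero {τ : ℂ} (hτ : 0 < τ.im) : thA τ ≠ 0 := pow_ne_zero _ (th3_ne_zero hτ)

lemma lam_ne_zero {τ : ℂ} (hτ : 0 < τ.im) : lam τ ≠ 0 :=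
  div_ne_zero (pow_ne_zero _ (th2_ne_zero hτ)) (pow_ne_zero _ (th3_ne_zero hτ))

lemma one_sub_lam {τ : ℂ} (hτ : 0 < τ.im) : 1 - lam τ = th4 τ ^ 4 / th3 τ ^ 4 := by
  have := th3_ne_zero hτ
  rw [lam]
  field_simp
  rw [th3_pow_four hτ]
  ring

lemma lam_ne_one {τ : ℂ} (hτ : 0 < τ.im) : lam τ ≠ 1 := by
  have h : 1 - lam τ ≠ 0 := by
    rw [one_sub_lam hτ]
    exact div_ne_zero (pow_ne_zero _ (th4_ne_zero hτ)) (pow_ne_zero _ (th3_ne_zero hτ))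
  exact fun h1 => h (by rw [h1, sub_self])

lemma im_two_mul_pos {τ : ℂ} (hτ : 0 < τ.im) : 0 < (2 * τ).im := by simpa using hτ

lemma lam_mul_one_add_kap_sq {τ : ℂ} (hτ : 0 < τ.im) :
    lam τ * (1 + kap τ) ^ 2 = 4 * kap τ := by
  have h2 := th3_ne_zero (im_two_mul_pos hτ)
  have h3 : (th3 (2 * τ) ^ 2 + th2 (2 * τ) ^ 2) ≠ 0 := by
    rw [← th3_sq hτ]
    exact thA_ne_zero hτ
  have h4 : lam τ = (2 * th2 (2 * τ) * th3 (2 * τ)) ^ 2 /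
      (th3 (2 * τ) ^ 2 + th2 (2 * τ) ^ 2) ^ 2 := by
    rw [← th3_sq hτ, ← th2_sq hτ, lam]
    ring
  rw [h4, kap]
  field_simp
  ring

lemma kap_sq (τ : ℂ) : kap τ ^ 2 = lam (2 * τ) := by
  rw [kap, lam]
  ring

lemma thA_eq {τ : ℂ} (hτ : 0 < τ.im) : thA τ = (1 + kap τ) * thA (2 * τ) := by
  have h2 := th3_ne_zero (im_two_mul_pos hτ)
  rw [thA, th3_sq hτ, kap, thA]
  field_simp

/-- The series of `θ₃⁻¹`. -/
noncomputable def thetaInvZ : PowerSeries ℤ := thetaZ.invOfUnit 1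

lemma thetaZ_mul_inv : thetaZ * thetaInvZ = 1 :=
  PowerSeries.mul_invOfUnit _ _ (by simpa using coeff_zero_thetaZ)

/-- The integral `q`-expansion of `λ`. -/
noncomputable def lamZ : PowerSeries ℤ := X * (psiZ ^ 4 * thetaInvZ ^ 4)

/-- The integral `q`-expansion of `kap`. -/
noncomputable def kapZ : PowerSeries ℤ := X * PowerSeries.expand 2 two_ne_zero (psiZ ^ 2 * thetaInvZ ^ 2)

lemma hasQ_th3_inv : HasQ 1 (fun τ => (th3 τ)⁻¹) (thetaInvZ.map (Int.castRingHom ℂ)) := by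
  have h := hasQ_th3.inv one_pos (fun τ hτ => th3_ne_zero hτ)
    (by rw [coeff_map, coeff_zero_thetaZ]; simp)
  convert h using 1
  rw [PowerSeries.eq_inv_iff_mul_eq_one, ← map_mul, mul_comm, thetaZ_mul_inv, map_one]
  rw [← coeff_zero_eq_constantCoeff_apply, coeff_map, coeff_zero_thetaZ]
  simp

lemma hasQ_nome : HasQ 1 (nome 1) X := by
  intro τ _
  convert hasSum_single (f := fun n => (X : PowerSeries ℂ).coeff n * nome 1 τ ^ n) 1 ?_ using 1
  · simp
  · intro n hn
    simp [PowerSeries.coeff_X, hn]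

lemma hasQ_lam : HasQ 1 lam (lamZ.map (Int.castRingHom ℂ)) := by
  have := hasQ_nome.mul ((hasQ_psi.pow 4).mul (hasQ_th3_inv.pow 4))
  simp only [lamZ, map_mul, map_pow, map_X]
  refine this.congr fun τ _ => ?_
  rw [lam, th2_pow_four]
  ring

lemma HasQ.two_mul {F : ℂ → ℂ} {s : PowerSeries ℂ} (h : HasQ 1 F s) :
    HasQ 1 (fun τ => F (2 * τ)) (PowerSeries.expand 2 two_ne_zero s) := by
  have := h.comp (h' := 1) (m := 2) (c := 1) two_ne_zero (φ := fun τ => 2 * τ)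
    (fun τ hτ => im_two_mul_pos hτ) (fun τ => by
      rw [nome_one, nome_one, one_mul, ← Complex.exp_nat_mul]
      congr 1
      push_cast
      ring)
  simpa using this

lemma hasQ_kap : HasQ 1 kap (kapZ.map (Int.castRingHom ℂ)) := by
  have := hasQ_nome.mul ((hasQ_psi.pow 2).mul (hasQ_th3_inv.pow 2)).two_mul
  simp only [kapZ, map_mul, map_pow, map_X, ← PowerSeries.map_expand] at this ⊢
  refine this.congr fun τ _ => ?_
  rw [kap, th2_two_mul_sq, nome_one, psi, show 2 * τ / 2 = τ by ring]
  ring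

lemma hasQ_thA : HasQ 1 thA ((thetaZ ^ 2).map (Int.castRingHom ℂ)) := by
  rw [map_pow]
  exact hasQ_th3.pow 2

lemma map_intCast_injective :
    Function.Injective (PowerSeries.map (Int.castRingHom ℂ)) :=
  PowerSeries.map_injective _ Int.cast_injective

lemma lamZ_mul_one_add_kapZ_sq : lamZ * (1 + kapZ) ^ 2 = 4 * kapZ := by
  apply map_intCast_injective
  have h1 := hasQ_lam.mul (((HasQ.const 1 1).add hasQ_kap).pow 2)
  have h2 := (HasQ.const 1 4).mul hasQ_kap
  have h3 := h1.unique one_pos (h2.congr fun τ hτ => lam_mul_one_add_kap_sq hτ)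
  simp only [map_mul, map_pow, map_add, map_one, map_ofNat] at h3 ⊢
  exact h3

lemma kapZ_sq : kapZ ^ 2 = PowerSeries.expand 2 two_ne_zero lamZ := by
  apply map_intCast_injective
  have h3 := (hasQ_kap.pow 2).unique one_pos (hasQ_lam.two_mul.congr fun τ _ => kap_sq τ)
  simp only [map_pow, PowerSeries.map_expand] at h3 ⊢
  exact h3

lemma thetaZ_sq_eq : thetaZ ^ 2 = (1 + kapZ) * PowerSeries.expand 2 two_ne_zero (thetaZ ^ 2) := by
  apply map_intCast_injective
  have h3 := hasQ_thA.unique one_pos ((((HasQ.const 1 1).add hasQ_kap).mul hasQ_thA.two_mul).congr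
    fun τ hτ => thA_eq hτ)
  simp only [map_mul, map_add, map_one, PowerSeries.map_expand] at h3 ⊢
  exact h3

lemma coeff_zero_lamZ : lamZ.coeff 0 = 0 := by simp [lamZ]

lemma coeff_one_lamZ : lamZ.coeff 1 = 16 := by
  have h : constantCoeff thetaInvZ = 1 := by
    simp [thetaInvZ]
  have h2 : constantCoeff psiZ = 2 := by simpa using coeff_zero_psiZ
  rw [lamZ, show (1 : ℕ) = 0 + 1 from rfl, PowerSeries.coeff_succ_X_mul]
  simp [h, h2]

end ThetaSeries

section Moebius
open Complex

/-- The automorphy factor `cτ + d` of an integral matrix. -/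
noncomputable def jden (M : Matrix (Fin 2) (Fin 2) ℤ) (τ : ℂ) : ℂ := M 1 0 * τ + M 1 1

/-- The Möbius action of an integral matrix. -/
noncomputable def mob (M : Matrix (Fin 2) (Fin 2) ℤ) (τ : ℂ) : ℂ := (M 0 0 * τ + M 0 1) / jden M τ

lemma jden_ne_zero {M : Matrix (Fin 2) (Fin 2) ℤ} (hM : M.det ≠ 0) {τ : ℂ} (hτ : 0 < τ.im) :
    jden M τ ≠ 0 := by
  intro h
  have h1 := congrArg Complex.im h
  have h2 := congrArg Complex.re h
  simp only [jden, add_im, mul_im, intCast_re, intCast_im, zero_mul, add_zero, zero_im,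
    add_re, mul_re, sub_zero, zero_re] at h1 h2
  have h3 : (M 1 0 : ℝ) = 0 := by
    rcases mul_eq_zero.mp h1 with h | h
    · exact h
    · exact absurd h hτ.ne'
  rw [h3, zero_mul, zero_add] at h2
  apply hM
  rw [Matrix.det_fin_two, show M 1 0 = 0 by exact_mod_cast h3, show M 1 1 = 0 by exact_mod_cast h2]
  simp

lemma mob_im (M : Matrix (Fin 2) (Fin 2) ℤ) (τ : ℂ) :
    (mob M τ).im = M.det * τ.im / normSq (jden M τ) := by
  rw [mob, Complex.div_im, Matrix.det_fin_two]
  simp only [jden, add_im, mul_im, intCast_re, intCast_im, zero_mul, add_zero,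
    add_re, mul_re, sub_zero]
  push_cast
  ring

lemma mob_im_pos {M : Matrix (Fin 2) (Fin 2) ℤ} (hM : 0 < M.det) {τ : ℂ} (hτ : 0 < τ.im) :
    0 < (mob M τ).im := by
  rw [mob_im]
  have : 0 < normSq (jden M τ) := normSq_pos.mpr (jden_ne_zero hM.ne' hτ)
  have : (0 : ℝ) < M.det := by exact_mod_cast hM
  positivity

lemma jden_mul (M : Matrix (Fin 2) (Fin 2) ℤ) {N : Matrix (Fin 2) (Fin 2) ℤ} (hN : N.det ≠ 0)
    {τ : ℂ} (hτ : 0 < τ.im) : jden (M * N) τ = jden M (mob N τ) * jden N τ := by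
  have := jden_ne_zero hN hτ
  rw [jden, jden, mob]
  field_simp
  simp only [jden, Matrix.mul_apply, Fin.sum_univ_two]
  push_cast
  ring

lemma mob_mul {M N : Matrix (Fin 2) (Fin 2) ℤ} (hM : 0 < M.det) (hN : 0 < N.det)
    {τ : ℂ} (hτ : 0 < τ.im) : mob (M * N) τ = mob M (mob N τ) := by
  have h1 := jden_ne_zero hN.ne' hτ
  have h2 := jden_ne_zero hM.ne' (mob_im_pos hN hτ)
  rw [mob, jden_mul M hN.ne' hτ]
  rw [show mob M (mob N τ) = (M 0 0 * mob N τ + M 0 1) / jden M (mob N τ) from rfl,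
    div_eq_div_iff (mul_ne_zero h2 h1) h2]
  have h3 : (M 0 0 : ℂ) * mob N τ + M 0 1 =
      (((M * N) 0 0 : ℤ) * τ + ((M * N) 0 1 : ℤ)) / jden N τ := by
    rw [mob, eq_div_iff h1, add_mul, mul_assoc, div_mul_cancel₀ _ h1]
    simp only [jden, Matrix.mul_apply, Fin.sum_univ_two]
    push_cast
    ring
  rw [h3]
  field_simp

lemma mob_neg (M : Matrix (Fin 2) (Fin 2) ℤ) (τ : ℂ) : mob (-M) τ = mob M τ := by
  rw [mob, mob, show jden (-M) τ = -jden M τ by simp [jden]; ring, ← neg_div_neg_eq]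
  simp only [Matrix.neg_apply]
  push_cast
  congr 1 <;> ring

lemma jden_neg (M : Matrix (Fin 2) (Fin 2) ℤ) (τ : ℂ) : jden (-M) τ = -jden M τ := by
  simp [jden]
  ring

lemma mob_one (τ : ℂ) : mob 1 τ = τ := by simp [mob, jden]

lemma jden_one (τ : ℂ) : jden 1 τ = 1 := by simp [jden]

/-! ### The level of `λ` and `θ₃²` -/

lemma thA_S {τ : ℂ} (hτ : 0 < τ.im) : thA (-1 / τ) = -I * τ * thA τ := th3_S_sq hτ

lemma lam_S {τ : ℂ} (hτ : 0 < τ.im) : lam (-1 / τ) = 1 - lam τ := by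
  have hτ0 : τ ≠ 0 := by rintro rfl; simp at hτ
  have h : lam (-1 / τ) = (th2 (-1 / τ) ^ 2) ^ 2 / (th3 (-1 / τ) ^ 2) ^ 2 := by rw [lam]; ring
  have h3 := th3_ne_zero hτ
  rw [h, th2_S_sq hτ, th3_S_sq hτ, one_sub_lam hτ]
  field_simp

lemma thA_T (τ : ℂ) : thA (τ + 1) = th4 τ ^ 2 := by rw [thA, th3_add_one]

lemma lam_T {τ : ℂ} (hτ : 0 < τ.im) : lam (τ + 1) = lam τ / (lam τ - 1) := by
  have h3 := th3_ne_zero hτ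
  have h4 := th4_ne_zero hτ
  have h : lam (τ + 1) = (th2 (τ + 1) ^ 2) ^ 2 / th3 (τ + 1) ^ 4 := by rw [lam]; ring
  rw [h, th2_add_one_sq, th3_add_one, show lam τ - 1 = -(th4 τ ^ 4 / th3 τ ^ 4) by
    rw [← one_sub_lam hτ]; ring, lam, mul_pow, I_sq]
  field_simp

lemma thA_add_two (τ : ℂ) : thA (τ + 2) = thA τ := by
  rw [thA, show τ + 2 = τ + 1 + 1 by ring, th3_add_one, th4_add_one, thA]

lemma lam_add_two (τ : ℂ) : lam (τ + 2) = lam τ := by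
  have h : ∀ τ, lam τ = (th2 τ ^ 2) ^ 2 / th3 τ ^ 4 := fun τ => by rw [lam]; ring
  rw [h, h, show τ + 2 = τ + 1 + 1 by ring, th3_add_one, th4_add_one, th2_add_one_sq,
    th2_add_one_sq, mul_pow, mul_pow, I_sq]
  ring

/-- `γ` fixes `λ` and acts on `θ₃²` by the automorphy factor of weight one. -/
def FixesTheta (γ : Matrix (Fin 2) (Fin 2) ℤ) : Prop :=
  ∀ τ : ℂ, 0 < τ.im → thA (mob γ τ) = jden γ τ * thA τ ∧ lam (mob γ τ) = lam τ

lemma FixesTheta.mul {γ δ : Matrix (Fin 2) (Fin 2) ℤ} (hγ : FixesTheta γ) (hδ : FixesTheta δ)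
    (h1 : γ.det = 1) (h2 : δ.det = 1) : FixesTheta (γ * δ) := by
  intro τ hτ
  have hd : 0 < δ.det := by omega
  have hm := mob_im_pos hd hτ
  rw [mob_mul (by omega) hd hτ, jden_mul γ hd.ne' hτ]
  refine ⟨?_, by rw [(hγ _ hm).2, (hδ _ hτ).2]⟩
  rw [(hγ _ hm).1, (hδ _ hτ).1]
  ring

lemma FixesTheta.of_mul_eq_one {γ δ : Matrix (Fin 2) (Fin 2) ℤ} (hγ : FixesTheta γ)
    (h1 : γ.det = 1) (h2 : δ.det = 1) (h : γ * δ = 1) : FixesTheta δ := by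
  intro τ hτ
  have hd : 0 < δ.det := by omega
  have hm := mob_im_pos hd hτ
  have e1 : mob γ (mob δ τ) = τ := by rw [← mob_mul (by omega) hd hτ, h, mob_one]
  have e2 := jden_mul γ hd.ne' hτ
  rw [h, jden_one] at e2
  have h3 := hγ _ hm
  rw [e1] at h3
  refine ⟨?_, h3.2.symm⟩
  rw [h3.1]
  linear_combination thA (mob δ τ) * e2

lemma fixesTheta_T : FixesTheta !![1, 2; 0, 1] := by
  intro τ _
  simp [mob, jden, thA_add_two, lam_add_two]

lemma fixesTheta_V : FixesTheta !![1, 0; 2, 1] := by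
  intro τ hτ
  have hτ0 : τ ≠ 0 := by rintro rfl; simp at hτ
  have hV : (2 : ℂ) * τ + 1 ≠ 0 := by
    have := jden_ne_zero (M := !![1, 0; 2, 1]) (by simp) hτ
    simpa [jden] using this
  have hw : 0 < (-1 / τ - 2).im := by simpa using im_neg_one_div_pos hτ
  have hw0 : -1 / τ - 2 ≠ 0 := by
    intro h
    rw [h] at hw
    simp at hw
  have e : mob !![1, 0; 2, 1] τ = -1 / (-1 / τ - 2) := by
    rw [eq_div_iff hw0]
    simp only [mob, jden, Matrix.of_apply, Matrix.cons_val', Matrix.cons_val_zero,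
      Matrix.cons_val_one, Matrix.cons_val_fin_one]
    push_cast
    rw [div_mul_eq_mul_div, div_eq_iff hV]
    field_simp
    ring
  have e2 : -1 / τ = (-1 / τ - 2) + 2 := by ring
  have a1 : thA (-1 / τ - 2) = thA (-1 / τ) := by rw [e2, thA_add_two, ← e2]
  have a2 : lam (-1 / τ - 2) = lam (-1 / τ) := by rw [e2, lam_add_two, ← e2]
  rw [e, thA_S hw, lam_S hw, a1, a2, thA_S hτ, lam_S hτ]
  refine ⟨?_, by ring⟩
  simp only [jden, Matrix.of_apply, Matrix.cons_val', Matrix.cons_val_zero,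
      Matrix.cons_val_one, Matrix.cons_val_fin_one]
  push_cast
  field_simp
  ring_nf
  rw [I_sq]
  ring

/-- The congruence conditions `b ≡ c ≡ 0 (mod 2)`, `d ≡ 1 (mod 4)`. -/
def ThetaLevel (γ : Matrix (Fin 2) (Fin 2) ℤ) : Prop := 2 ∣ γ 0 1 ∧ 2 ∣ γ 1 0 ∧ 4 ∣ γ 1 1 - 1

theorem fixesTheta_of_thetaLevel {γ : Matrix (Fin 2) (Fin 2) ℤ} (h1 : γ.det = 1)
    (hγ : ThetaLevel γ) : FixesTheta γ := by
  obtain ⟨n, hn⟩ : ∃ n, (γ 1 0).natAbs + (γ 1 1).natAbs ≤ n := ⟨_, le_rfl⟩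
  induction n generalizing γ with
  | zero =>
    obtain ⟨-, -, h⟩ := hγ
    omega
  | succ n ih =>
    have hT : FixesTheta !![1, -2; 0, 1] :=
      fixesTheta_T.of_mul_eq_one (by simp) (by simp) (by ext i j; fin_cases i <;> fin_cases j <;> simp)
    have hV : FixesTheta !![1, 0; -2, 1] :=
      fixesTheta_V.of_mul_eq_one (by simp) (by simp) (by ext i j; fin_cases i <;> fin_cases j <;> simp)
    have step : ∀ δ ε : Matrix (Fin 2) (Fin 2) ℤ, δ.det = 1 → ε.det = 1 → δ * ε = 1 →
        FixesTheta ε → ThetaLevel (γ * δ) →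
        ((γ * δ) 1 0).natAbs + ((γ * δ) 1 1).natAbs ≤ n → FixesTheta γ := by
      intro δ ε hδ hε hδε hfix hl hle
      have := (ih (by rw [Matrix.det_mul, h1, hδ, one_mul]) hl hle).mul hfix
        (by rw [Matrix.det_mul, h1, hδ, one_mul]) hε
      rwa [mul_assoc, hδε, mul_one] at this
    obtain ⟨hb, hc, hd⟩ := hγ
    have hTT : (!![1, 2; 0, 1] * !![1, -2; 0, 1] : Matrix (Fin 2) (Fin 2) ℤ) = 1 := by
      ext i j; fin_cases i <;> fin_cases j <;> simp
    have hTT' : (!![1, -2; 0, 1] * !![1, 2; 0, 1] : Matrix (Fin 2) (Fin 2) ℤ) = 1 := by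
      ext i j; fin_cases i <;> fin_cases j <;> simp
    have hVV : (!![1, 0; 2, 1] * !![1, 0; -2, 1] : Matrix (Fin 2) (Fin 2) ℤ) = 1 := by
      ext i j; fin_cases i <;> fin_cases j <;> simp
    have hVV' : (!![1, 0; -2, 1] * !![1, 0; 2, 1] : Matrix (Fin 2) (Fin 2) ℤ) = 1 := by
      ext i j; fin_cases i <;> fin_cases j <;> simp
    rcases eq_or_ne (γ 1 0) 0 with h0 | h0
    · rw [Matrix.det_fin_two, h0, mul_zero, sub_zero] at h1
      have hd1 : γ 1 1 = 1 := by
        rcases Int.isUnit_iff.mp (IsUnit.of_mul_eq_one _ (by rwa [mul_comm] at h1)) with h | h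
        · exact h
        · omega
      rw [hd1, mul_one] at h1
      intro τ _
      obtain ⟨k, hk⟩ := hb
      have hper : ∀ k : ℤ, thA (τ + 2 * k) = thA τ ∧ lam (τ + 2 * k) = lam τ := by
        intro k
        induction k using Int.induction_on with
        | zero => simp
        | succ i hi =>
          rw [← hi.1, ← hi.2, ← thA_add_two (τ + 2 * (i : ℤ)), ← lam_add_two (τ + 2 * (i : ℤ))]
          push_cast
          constructor <;> congr 1 <;> ring
        | pred i hi =>
          rw [← hi.1, ← hi.2, ← thA_add_two (τ + 2 * ((-i - 1 : ℤ) : ℂ)),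
            ← lam_add_two (τ + 2 * ((-i - 1 : ℤ) : ℂ))]
          push_cast
          constructor <;> congr 1 <;> ring
      have e : mob γ τ = τ + 2 * k := by simp [mob, jden, h0, hd1, h1, hk]
      rw [e]
      simpa [jden, h0, hd1] using hper k
    · by_cases hcd : (γ 1 0).natAbs < (γ 1 1).natAbs
      · by_cases hs : 0 < γ 1 0 ↔ 0 < γ 1 1
        · refine step !![1, -2; 0, 1] !![1, 2; 0, 1] (by simp) (by simp) hTT' fixesTheta_T ?_ ?_ <;>
          simp only [ThetaLevel, Matrix.mul_apply, Fin.sum_univ_two, Matrix.of_apply,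
            Matrix.cons_val', Matrix.cons_val_zero, Matrix.cons_val_one, Matrix.cons_val_fin_one] <;>
          omega
        · refine step !![1, 2; 0, 1] !![1, -2; 0, 1] (by simp) (by simp) hTT hT ?_ ?_ <;>
          simp only [ThetaLevel, Matrix.mul_apply, Fin.sum_univ_two, Matrix.of_apply,
            Matrix.cons_val', Matrix.cons_val_zero, Matrix.cons_val_one, Matrix.cons_val_fin_one] <;>
          omega
      · by_cases hs : 0 < γ 1 0 ↔ 0 < γ 1 1
        · refine step !![1, 0; -2, 1] !![1, 0; 2, 1] (by simp) (by simp) hVV' fixesTheta_V ?_ ?_ <;>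
          simp only [ThetaLevel, Matrix.mul_apply, Fin.sum_univ_two, Matrix.of_apply,
            Matrix.cons_val', Matrix.cons_val_zero, Matrix.cons_val_one, Matrix.cons_val_fin_one] <;>
          omega
        · refine step !![1, 0; 2, 1] !![1, 0; -2, 1] (by simp) (by simp) hVV hV ?_ ?_ <;>
          simp only [ThetaLevel, Matrix.mul_apply, Fin.sum_univ_two, Matrix.of_apply,
            Matrix.cons_val', Matrix.cons_val_zero, Matrix.cons_val_one, Matrix.cons_val_fin_one] <;>
          omega

/-- Matrices congruent to the identity modulo `2`, up to the sign. -/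
def LevelTwo (γ : Matrix (Fin 2) (Fin 2) ℤ) : Prop := 2 ∣ γ 0 1 ∧ 2 ∣ γ 1 0

lemma thetaLevel_or_neg {γ : Matrix (Fin 2) (Fin 2) ℤ} (h1 : γ.det % 2 = 1) (hγ : LevelTwo γ) :
    ThetaLevel γ ∨ ThetaLevel (-γ) := by
  obtain ⟨hb, hc⟩ := hγ
  rw [Matrix.det_fin_two] at h1
  have hd : γ 1 1 % 2 = 1 := by
    rcases Int.emod_two_eq_zero_or_one (γ 1 1) with h | h
    · exfalso
      obtain ⟨k, hk⟩ := Int.dvd_of_emod_eq_zero h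
      obtain ⟨l, hl⟩ := hc
      rw [hk, hl, show γ 0 0 * (2 * k) - γ 0 1 * (2 * l) = 2 * (γ 0 0 * k - γ 0 1 * l) by ring] at h1
      omega
    · exact h
  have : γ 1 1 % 4 = 1 ∨ γ 1 1 % 4 = 3 := by omega
  rcases this with h | h
  · left
    exact ⟨hb, hc, by omega⟩
  · right
    simp only [ThetaLevel, Matrix.neg_apply]
    omega

lemma lam_mob {γ : Matrix (Fin 2) (Fin 2) ℤ} (h1 : γ.det = 1) (hγ : LevelTwo γ) {τ : ℂ}
    (hτ : 0 < τ.im) : lam (mob γ τ) = lam τ := by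
  rcases thetaLevel_or_neg (by omega) hγ with h | h
  · exact (fixesTheta_of_thetaLevel h1 h τ hτ).2
  · rw [← mob_neg]
    exact (fixesTheta_of_thetaLevel (by rw [Matrix.det_neg]; simpa using h1) h τ hτ).2

lemma norm_thA_mob {γ : Matrix (Fin 2) (Fin 2) ℤ} (h1 : γ.det = 1) (hγ : LevelTwo γ) {τ : ℂ}
    (hτ : 0 < τ.im) : ‖thA (mob γ τ)‖ = ‖jden γ τ‖ * ‖thA τ‖ := by
  rcases thetaLevel_or_neg (by omega) hγ with h | h
  · rw [(fixesTheta_of_thetaLevel h1 h τ hτ).1, norm_mul]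
  · rw [← mob_neg, (fixesTheta_of_thetaLevel (by rw [Matrix.det_neg]; simpa using h1) h τ hτ).1,
      norm_mul, jden_neg, norm_neg]

end Moebius

section PolyTheorem
open Complex UpperHalfPlane ModularGroup Matrix.SpecialLinearGroup
open scoped MatrixGroups Manifold ModularForm

/-- Bounded near `i∞`. -/
def BddInfty (F : ℂ → ℂ) : Prop := ∃ B Y : ℝ, ∀ τ : ℂ, 0 < τ.im → Y ≤ τ.im → ‖F τ‖ ≤ B

/-- Invariant under the principal congruence subgroup of level two. -/
def GammaTwoInvariant (F : ℂ → ℂ) : Prop :=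
  ∀ γ : Matrix (Fin 2) (Fin 2) ℤ, γ.det = 1 → LevelTwo γ → ∀ τ : ℂ, 0 < τ.im → F (mob γ τ) = F τ

lemma mob_S (τ : ℂ) : mob !![0, -1; 1, 0] τ = -1 / τ := by simp [mob, jden]

lemma mob_TS {τ : ℂ} (hτ : 0 < τ.im) : mob !![1, -1; 1, 0] τ = -1 / τ + 1 := by
  have hτ0 : τ ≠ 0 := by rintro rfl; simp at hτ
  simp [mob, jden]
  field_simp
  ring

lemma mob_T_zpow (k : ℤ) (τ : ℂ) : mob !![1, k; 0, 1] τ = τ + k := by simp [mob, jden]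

/-- Representatives of the cosets of the level two subgroup modulo translations. -/
lemma exists_levelTwo_mul {g : Matrix (Fin 2) (Fin 2) ℤ} (hg : g.det = 1) :
    ∃ γ h : Matrix (Fin 2) (Fin 2) ℤ, ∃ k : ℤ, γ.det = 1 ∧ LevelTwo γ ∧
      (h = 1 ∨ h = !![0, -1; 1, 0] ∨ h = !![1, -1; 1, 0]) ∧ (k = 0 ∨ k = 1) ∧
      g = γ * (h * !![1, k; 0, 1]) := by
  have key : ∀ h : Matrix (Fin 2) (Fin 2) ℤ, h.det = 1 → ∀ k : ℤ,
      LevelTwo (g * (h * !![1, k; 0, 1]).adjugate) →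
      ∃ γ : Matrix (Fin 2) (Fin 2) ℤ, γ.det = 1 ∧ LevelTwo γ ∧ g = γ * (h * !![1, k; 0, 1]) := by
    intro h hh k hl
    have hd : (h * !![1, k; 0, 1]).det = 1 := by
      rw [Matrix.det_mul, hh, Matrix.det_fin_two]
      simp
    refine ⟨_, ?_, hl, ?_⟩
    · rw [Matrix.det_mul, Matrix.det_adjugate, hg, hd]
      simp
    · rw [mul_assoc, Matrix.adjugate_mul, hd, one_smul, mul_one]
  suffices H : ∃ h : Matrix (Fin 2) (Fin 2) ℤ, ∃ k : ℤ,
      (h = 1 ∨ h = !![0, -1; 1, 0] ∨ h = !![1, -1; 1, 0]) ∧ (k = 0 ∨ k = 1) ∧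
      LevelTwo (g * (h * !![1, k; 0, 1]).adjugate) by
    obtain ⟨h, k, h1, h2, h3⟩ := H
    have hd : h.det = 1 := by
      rcases h1 with rfl | rfl | rfl <;> simp [Matrix.det_fin_two]
    obtain ⟨γ, a, b, c⟩ := key h hd k h3
    exact ⟨γ, h, k, a, b, h1, h2, c⟩
  rw [Matrix.det_fin_two] at hg
  have hp : (g 0 0 * g 1 1 - g 0 1 * g 1 0) % 2 = 1 := by rw [hg]; rfl
  rcases Int.emod_two_eq_zero_or_one (g 0 0) with h00 | h00 <;>
  rcases Int.emod_two_eq_zero_or_one (g 0 1) with h01 | h01 <;>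
  rcases Int.emod_two_eq_zero_or_one (g 1 0) with h10 | h10 <;>
  rcases Int.emod_two_eq_zero_or_one (g 1 1) with h11 | h11 <;>
  (try (exfalso; rw [Int.sub_emod, Int.mul_emod, Int.mul_emod (g 0 1), h00, h01, h10, h11] at hp
        revert hp; decide)) <;>
  [refine ⟨!![0, -1; 1, 0], 0, by simp, by simp, ?_⟩;
   refine ⟨!![0, -1; 1, 0], 1, by simp, by simp, ?_⟩;
   refine ⟨1, 0, by simp, by simp, ?_⟩;
   refine ⟨!![1, -1; 1, 0], 1, by simp, by simp, ?_⟩;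
   refine ⟨1, 1, by simp, by simp, ?_⟩;
   refine ⟨!![1, -1; 1, 0], 0, by simp, by simp, ?_⟩] <;>
  simp [LevelTwo, Matrix.adjugate_fin_two, Matrix.mul_apply, Fin.sum_univ_two] <;> omega

lemma GammaTwoInvariant.bddInfty_mob {F : ℂ → ℂ} (hF : GammaTwoInvariant F) (h1 : BddInfty F)
    (h2 : BddInfty fun τ => F (-1 / τ)) (h3 : BddInfty fun τ => F (-1 / τ + 1))
    {g : Matrix (Fin 2) (Fin 2) ℤ} (hg : g.det = 1) : BddInfty fun τ => F (mob g τ) := by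
  obtain ⟨γ, h, k, hγ1, hγ2, hh, hk, rfl⟩ := exists_levelTwo_mul hg
  have hhd : h.det = 1 := by
    rcases hh with rfl | rfl | rfl <;> simp [Matrix.det_fin_two]
  have hkd : (!![1, k; 0, 1] : Matrix (Fin 2) (Fin 2) ℤ).det = 1 := by simp [Matrix.det_fin_two]
  have e : ∀ τ : ℂ, 0 < τ.im → F (mob (γ * (h * !![1, k; 0, 1])) τ) = F (mob h (τ + k)) := by
    intro τ hτ
    have hd : 0 < (h * !![1, k; 0, 1]).det := by rw [Matrix.det_mul, hhd, hkd]; norm_num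
    rw [mob_mul (by omega) hd hτ, hF γ hγ1 hγ2 _ (mob_im_pos hd hτ),
      mob_mul (by omega) (by omega) hτ, mob_T_zpow]
  suffices H : BddInfty fun τ => F (mob h τ) by
    obtain ⟨B, Y, H⟩ := H
    refine ⟨B, Y, fun τ hτ hY => ?_⟩
    dsimp only
    rw [e τ hτ]
    exact H _ (by simpa using hτ) (by simpa using hY)
  rcases hh with rfl | rfl | rfl
  · simpa only [mob_one] using h1
  · simpa only [mob_S] using h2
  · obtain ⟨B, Y, H⟩ := h3
    refine ⟨B, Y, fun τ hτ hY => ?_⟩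
    dsimp only
    rw [mob_TS hτ]
    exact H τ hτ hY

lemma coe_smul_eq_mob (g : SL(2, ℤ)) (τ : ℍ) : ((g • τ : ℍ) : ℂ) = mob g.1 τ := by
  rw [UpperHalfPlane.specialLinearGroup_apply]
  simp [mob, jden]

/-- A `Γ(2)`-invariant function, holomorphic and bounded at every cusp, is constant. -/
lemma GammaTwoInvariant.eq_const {F : ℂ → ℂ} (hF : GammaTwoInvariant F)
    (hd : ∀ τ : ℂ, 0 < τ.im → DifferentiableAt ℂ F τ) (h1 : BddInfty F)
    (h2 : BddInfty fun τ => F (-1 / τ)) (h3 : BddInfty fun τ => F (-1 / τ + 1)) :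
    ∃ c, ∀ τ : ℂ, 0 < τ.im → F τ = c := by
  let 𝒢 : Subgroup (GL (Fin 2) ℝ) := (CongruenceSubgroup.Gamma 2).map (mapGL ℝ)
  let f : ModularForm 𝒢 0 :=
    { toFun := fun τ => F τ
      slash_action_eq' := by
        rintro _ ⟨γ, hγ, rfl⟩
        have hγ' := CongruenceSubgroup.Gamma_mem.mp hγ
        have hl : LevelTwo γ.1 :=
          ⟨(ZMod.intCast_zmod_eq_zero_iff_dvd _ 2).mp hγ'.2.1,
            (ZMod.intCast_zmod_eq_zero_iff_dvd _ 2).mp hγ'.2.2.1⟩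
        change ((fun τ : ℍ => F τ) ∣[(0 : ℤ)] γ) = (fun τ : ℍ => F τ)
        ext τ
        rw [ModularForm.SL_slash_apply, coe_smul_eq_mob, hF γ.1 γ.2 hl τ τ.2]
        simp
      holo' := by
        rw [UpperHalfPlane.mdifferentiable_iff]
        intro τ hτ
        refine ((hd τ hτ).congr_of_eventuallyEq ?_).differentiableWithinAt
        filter_upwards [(isOpen_lt continuous_const Complex.continuous_im).mem_nhds hτ] with z hz
        simp [UpperHalfPlane.ofComplex_apply_of_im_pos hz]
      bdd_at_cusps' := by
        intro c hc
        have hc' := (Subgroup.IsArithmetic.isCusp_iff_isCusp_SL2Z 𝒢).mp hc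
        rw [OnePoint.isBoundedAt_iff_forall_SL2Z hc']
        intro γ _
        rw [UpperHalfPlane.isBoundedAtImInfty_iff]
        obtain ⟨B, Y, H⟩ := hF.bddInfty_mob h1 h2 h3 γ.2
        refine ⟨B, Y, fun τ hτ => ?_⟩
        rw [ModularForm.SL_slash_apply, coe_smul_eq_mob]
        simpa using H τ τ.2 hτ }
  obtain ⟨c, hc⟩ := ModularForm.eq_const_of_weight_zero f
  exact ⟨c, fun τ hτ => congrFun hc ⟨τ, hτ⟩⟩

lemma BddInfty.add {F G : ℂ → ℂ} (hF : BddInfty F) (hG : BddInfty G) :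
    BddInfty fun τ => F τ + G τ := by
  obtain ⟨B, Y, hF⟩ := hF
  obtain ⟨C, Z, hG⟩ := hG
  exact ⟨B + C, max Y Z, fun τ hτ h => (norm_add_le _ _).trans
    (add_le_add (hF τ hτ (le_of_max_le_left h)) (hG τ hτ (le_of_max_le_right h)))⟩

lemma BddInfty.mul {F G : ℂ → ℂ} (hF : BddInfty F) (hG : BddInfty G) :
    BddInfty fun τ => F τ * G τ := by
  obtain ⟨B, Y, hF⟩ := hF
  obtain ⟨C, Z, hG⟩ := hG
  refine ⟨|B| * |C|, max Y Z, fun τ hτ h => ?_⟩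
  rw [norm_mul]
  exact mul_le_mul ((hF τ hτ (le_of_max_le_left h)).trans (le_abs_self _))
    ((hG τ hτ (le_of_max_le_right h)).trans (le_abs_self _)) (norm_nonneg _) (abs_nonneg _)

lemma BddInfty.congr {F G : ℂ → ℂ} (hF : BddInfty F) (h : ∀ τ : ℂ, 0 < τ.im → G τ = F τ) :
    BddInfty G := by
  obtain ⟨B, Y, hF⟩ := hF
  exact ⟨B, Y, fun τ hτ hY => by rw [h τ hτ]; exact hF τ hτ hY⟩

lemma BddInfty.const (c : ℂ) : BddInfty fun _ => c := ⟨‖c‖, 0, fun _ _ _ => le_rfl⟩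

lemma BddInfty.neg {F : ℂ → ℂ} (hF : BddInfty F) : BddInfty fun τ => -F τ :=
  ((BddInfty.const (-1)).mul hF).congr fun τ _ => by ring

lemma BddInfty.sub {F G : ℂ → ℂ} (hF : BddInfty F) (hG : BddInfty G) :
    BddInfty fun τ => F τ - G τ :=
  (hF.add hG.neg).congr fun τ _ => by ring

lemma BddInfty.pow {F : ℂ → ℂ} (hF : BddInfty F) (n : ℕ) : BddInfty fun τ => F τ ^ n := by
  induction n with
  | zero => exact (BddInfty.const 1).congr fun τ _ => by simp
  | succ n ih => exact (ih.mul hF).congr fun τ _ => pow_succ _ _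

lemma BddInfty.prod {ι : Type*} (s : Finset ι) {F : ι → ℂ → ℂ} (hF : ∀ i ∈ s, BddInfty (F i)) :
    BddInfty fun τ => ∏ i ∈ s, F i τ := by
  classical
  induction s using Finset.induction_on with
  | empty => exact (BddInfty.const 1).congr fun τ _ => by simp
  | insert a s ha ih =>
    exact ((hF a (mem_insert_self _ _)).mul
      (ih fun i hi => hF i (mem_insert_of_mem hi))).congr fun τ _ => prod_insert ha

lemma HasQ.bddInfty {h : ℕ} {F : ℂ → ℂ} {s : PowerSeries ℂ} (hF : HasQ h F s) : BddInfty F := by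
  obtain ⟨B, hB⟩ := hF.bounded
  exact ⟨B, 1, fun τ _ hτ => hB τ hτ⟩

/-- The inverse of `λ` has a simple pole at `i∞`. -/
lemma bddInfty_nome_div_lam : BddInfty fun τ => nome 1 τ / lam τ := by
  have hp : HasQ 1 psi _ := hasQ_psi
  have hpi : HasQ 1 psi⁻¹ _ := hp.inv one_pos (fun τ hτ => psi_ne_zero hτ) (by
    rw [PowerSeries.coeff_map, coeff_zero_psiZ]; norm_num)
  refine ((hasQ_th3.pow 4).mul (hpi.pow 4)).bddInfty.congr fun τ hτ => ?_
  have h1 := psi_ne_zero hτ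
  have h2 := nome_ne_zero 1 τ
  have h3 := th3_ne_zero hτ
  rw [lam, th2_pow_four τ]
  simp only [Pi.inv_apply]
  field_simp

lemma bddInfty_lam : BddInfty lam := hasQ_lam.bddInfty

lemma lam_TS {τ : ℂ} (hτ : 0 < τ.im) : lam (-1 / τ + 1) = 1 - 1 / lam τ := by
  have h := lam_ne_zero hτ
  rw [lam_T (im_neg_one_div_pos hτ), lam_S hτ]
  rw [show 1 - lam τ - 1 = -lam τ by ring]
  field_simp
  ring

lemma lam_differentiableAt {τ : ℂ} (hτ : 0 < τ.im) : DifferentiableAt ℂ lam τ :=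
  hasQ_lam.differentiableAt one_pos hτ

lemma GammaTwoInvariant.TS_add_two {F : ℂ → ℂ} (hF : GammaTwoInvariant F) {τ : ℂ}
    (hτ : 0 < τ.im) : F (-1 / (τ + 2) + 1) = F (-1 / τ + 1) := by
  have h2 : 0 < (τ + 2).im := by simpa using hτ
  have hw : 0 < (-1 / τ + 1).im := by simpa using im_neg_one_div_pos hτ
  rw [← hF !![-1, 2; -2, 3] (by simp [Matrix.det_fin_two]) (by simp [LevelTwo]) _ hw,
    ← mob_TS hτ, ← mob_TS h2, ← mob_mul (by simp [Matrix.det_fin_two])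
      (by simp [Matrix.det_fin_two]) hτ, show τ + 2 = mob !![1, 2; 0, 1] τ by
      rw [mob_T_zpow]; simp, ← mob_mul (by simp [Matrix.det_fin_two])
      (by simp [Matrix.det_fin_two]) hτ]
  congr 2
  ext i j
  fin_cases i <;> fin_cases j <;> simp

/-- Leading behaviour of a bounded `2`-periodic function. -/
lemma exists_limit_of_periodic {G : ℂ → ℂ} (hp : ∀ τ : ℂ, 0 < τ.im → G (τ + 2) = G τ)
    (hd : ∀ τ : ℂ, 0 < τ.im → DifferentiableAt ℂ G τ) (hb : BddInfty G) :
    ∃ c : ℂ, BddInfty fun τ => (G τ - c) / nome 1 τ := by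
  classical
  let G' : ℂ → ℂ := fun τ => if 0 < τ.im then G τ else 0
  have hG' : ∀ τ : ℂ, 0 < τ.im → G' τ = G τ := fun τ hτ => if_pos hτ
  have hper : Function.Periodic G' (2 : ℝ) := by
    intro τ
    by_cases hτ : 0 < τ.im
    · have h2 : 0 < (τ + 2).im := by simpa using hτ
      push_cast
      rw [hG' _ h2, hG' _ hτ, hp τ hτ]
    · have h2 : ¬ 0 < (τ + (2 : ℝ)).im := by simpa using hτ
      simp only [G', if_neg hτ, if_neg h2]
  have hI : ∀ Y : ℝ, ∀ᶠ τ in comap Complex.im atTop, Y ≤ τ.im := fun Y =>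
    (eventually_ge_atTop Y).comap _
  have hI0 : ∀ᶠ τ in comap Complex.im atTop, 0 < τ.im := (eventually_gt_atTop 0).comap _
  have hol : ∀ᶠ τ in comap Complex.im atTop, DifferentiableAt ℂ G' τ := by
    filter_upwards [hI0] with τ hτ
    refine (hd τ hτ).congr_of_eventuallyEq ?_
    filter_upwards [(isOpen_lt continuous_const Complex.continuous_im).mem_nhds hτ] with z hz
    exact hG' z hz
  obtain ⟨B, Y, hB⟩ := hb
  have hbd : BoundedAtFilter (comap Complex.im atTop) G' := by
    refine Asymptotics.IsBigO.of_bound B ?_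
    filter_upwards [hI0, hI Y] with τ h1 h2
    simpa [hG' τ h1] using hB τ h1 h2
  have := Function.Periodic.exp_decay_sub_of_bounded_at_inf two_pos hper hol hbd
  obtain ⟨C, hC⟩ := this.bound
  rw [Filter.eventually_comap] at hC
  obtain ⟨Z, hZ⟩ := eventually_atTop.mp hC
  refine ⟨Function.Periodic.cuspFunction 2 G' 0, C, Z, fun τ hτ hYτ => ?_⟩
  have h := hZ _ hYτ τ rfl
  rw [hG' τ hτ] at h
  rw [norm_div, div_le_iff₀ (by simp [nome_ne_zero]), norm_nome]
  rw [Real.norm_eq_abs, Real.abs_exp] at h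
  refine h.trans (le_of_eq ?_)
  congr 2
  push_cast
  ring

/-- A `Γ(2)`-invariant function which is holomorphic, bounded at two of the cusps and of bounded
growth at the third, is a polynomial in `λ`. -/
theorem GammaTwoInvariant.exists_polynomial (K : ℕ) {F : ℂ → ℂ} (hF : GammaTwoInvariant F)
    (hd : ∀ τ : ℂ, 0 < τ.im → DifferentiableAt ℂ F τ) (h1 : BddInfty F)
    (h2 : BddInfty fun τ => F (-1 / τ))
    (h3 : BddInfty fun τ => F (-1 / τ + 1) * lam τ ^ K) :
    ∃ P : Polynomial ℂ, P.natDegree ≤ K ∧ ∀ τ : ℂ, 0 < τ.im → F τ = P.eval (lam τ) := by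
  induction K generalizing F with
  | zero =>
    obtain ⟨c, hc⟩ := hF.eq_const hd h1 h2 (h3.congr fun τ _ => by simp)
    exact ⟨Polynomial.C c, by simp, fun τ hτ => by rw [hc τ hτ, Polynomial.eval_C]⟩
  | succ K ih =>
    have hTS : ∀ τ : ℂ, 0 < τ.im → 0 < (-1 / τ + 1).im := fun τ hτ => by
      simpa using im_neg_one_div_pos hτ
    have hne : ∀ τ : ℂ, 0 < τ.im → τ ≠ 0 := fun τ hτ => by rintro rfl; simp at hτ
    obtain ⟨c, hc⟩ := exists_limit_of_periodic (G := fun τ => F (-1 / τ + 1) * lam τ ^ (K + 1))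
      (fun τ hτ => by rw [hF.TS_add_two hτ, lam_add_two])
      (fun τ hτ => by
        refine DifferentiableAt.mul ?_ ((lam_differentiableAt hτ).pow _)
        refine DifferentiableAt.comp (f := fun τ : ℂ => -1 / τ + 1) τ (hd _ (hTS τ hτ)) ?_
        exact ((differentiableAt_const _).div differentiableAt_id (hne τ hτ)).add_const _) h3
    let Q : Polynomial ℂ := Polynomial.C c * (1 - Polynomial.X) ^ (K + 1)
    have hQ : ∀ x, Q.eval x = c * (1 - x) ^ (K + 1) := fun x => by simp [Q]
    have hQd : Q.natDegree ≤ K + 1 := by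
      refine (Polynomial.natDegree_C_mul_le _ _).trans (Polynomial.natDegree_pow_le_of_le _ ?_ |>.trans
        (by rw [mul_one]))
      compute_degree
    obtain ⟨P, hP, hPe⟩ := ih (F := fun τ => F τ - c * (1 - lam τ) ^ (K + 1))
      (fun γ hγ hl τ hτ => by dsimp only; rw [hF γ hγ hl τ hτ, lam_mob hγ hl hτ])
      (fun τ hτ => (hd τ hτ).sub
        ((((differentiableAt_const _).sub (lam_differentiableAt hτ)).pow _).const_mul _))
      (h1.sub ((BddInfty.const c).mul (((BddInfty.const 1).sub bddInfty_lam).pow _)))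
      ((h2.sub ((BddInfty.const c).mul (bddInfty_lam.pow (K + 1)))).congr fun τ hτ => by
        rw [lam_S hτ, sub_sub_cancel])
      ((hc.mul bddInfty_nome_div_lam).congr fun τ hτ => by
        have h1 := lam_ne_zero hτ
        have h2 := nome_ne_zero 1 τ
        have h3 : (1 / lam τ) ^ (K + 1) * lam τ ^ (K + 1) = 1 := by
          rw [← mul_pow, one_div_mul_cancel h1, one_pow]
        rw [lam_TS hτ, sub_sub_cancel, div_mul_div_cancel₀ h2, eq_div_iff h1]
        linear_combination -c * h3)
    refine ⟨P + Q, (Polynomial.natDegree_add_le _ _).trans (max_le (by omega) hQd),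
      fun τ hτ => ?_⟩
    rw [Polynomial.eval_add, ← hPe τ hτ, hQ]
    ring

end PolyTheorem

section Lattice
open Complex PeriodPair
open scoped PeriodPair

/-- Lattices with the same invariants have the same `℘` function near the origin. -/
lemma PeriodPair.weierstrassPExcept_eventuallyEq {L M : PeriodPair} (h2 : L.g₂ = M.g₂)
    (h3 : L.g₃ = M.g₃) : ∀ᶠ z in nhds (0 : ℂ), L.weierstrassPExcept 0 z = M.weierstrassPExcept 0 z := by
  set f := L.weierstrassPExcept 0 with hf
  set g := M.weierstrassPExcept 0 with hg
  set f' := L.derivWeierstrassPExcept 0 with hf'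
  set g' := M.derivWeierstrassPExcept 0 with hg'
  have af : AnalyticAt ℂ f 0 := L.analyticAt_weierstrassPExcept 0
  have ag : AnalyticAt ℂ g 0 := M.analyticAt_weierstrassPExcept 0
  have af' : AnalyticAt ℂ f' 0 := L.analyticAt_derivWeierstrassPExcept 0
  have ag' : AnalyticAt ℂ g' 0 := M.analyticAt_derivWeierstrassPExcept 0
  have hL : ∀ᶠ z in nhds (0 : ℂ), z ∈ ((L.lattice : Set ℂ) \ {0})ᶜ :=
    L.compl_lattice_sdiff_singleton_mem_nhds 0
  have hM : ∀ᶠ z in nhds (0 : ℂ), z ∈ ((M.lattice : Set ℂ) \ {0})ᶜ :=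
    M.compl_lattice_sdiff_singleton_mem_nhds 0
  have key : ∀ᶠ z in nhdsWithin (0 : ℂ) {0}ᶜ,
      z * (deriv f z - deriv g z) * (z ^ 3 * (f' z + g' z) - 4) =
      (f z - g z) * (4 * ((1 + z ^ 2 * f z) ^ 2 + (1 + z ^ 2 * f z) * (1 + z ^ 2 * g z) +
        (1 + z ^ 2 * g z) ^ 2) - L.g₂ * z ^ 4) := by
    filter_upwards [nhdsWithin_le_nhds hL, nhdsWithin_le_nhds hM, self_mem_nhdsWithin] with z hzL hzM hz
    have hz0 : z ≠ 0 := hz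
    have hz1 : z ∉ L.lattice := fun h => hzL ⟨h, hz0⟩
    have hz2 : z ∉ M.lattice := fun h => hzM ⟨h, hz0⟩
    have e1 := L.derivWeierstrassP_sq z hz1
    have e2 := M.derivWeierstrassP_sq z hz2
    have d1 := L.eqOn_deriv_weierstrassPExcept_derivWeierstrassPExcept 0 hzL
    have d2 := M.eqOn_deriv_weierstrassPExcept_derivWeierstrassPExcept 0 hzM
    have a1 := L.weierstrassPExcept_add 0 z
    have a2 := M.weierstrassPExcept_add 0 z
    have b1 := L.derivWeierstrassPExcept_sub 0 z
    have b2 := M.derivWeierstrassPExcept_sub 0 z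
    simp only [ZeroMemClass.coe_zero, sub_zero] at a1 a2 b1 b2
    rw [d1, d2]
    rw [← a1, ← b1] at e1
    rw [← a2, ← b2, ← h2, ← h3] at e2
    simp only [← hf, ← hg, ← hf', ← hg'] at e1 e2 ⊢
    field_simp at e1 e2
    have hz6 : z ^ 2 ≠ 0 := pow_ne_zero _ hz0
    apply mul_left_cancel₀ hz6
    linear_combination e1 - e2
  by_contra hne
  have ah : AnalyticAt ℂ (fun z => f z - g z) 0 := af.sub ag
  have hnz : ¬ ∀ᶠ z in nhds (0 : ℂ), f z - g z = 0 := fun h => hne (h.mono fun z hz => sub_eq_zero.mp hz)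
  obtain ⟨n, k, ak, hk0, hk⟩ := ah.exists_eventuallyEq_pow_smul_nonzero_iff.mpr hnz
  simp only [sub_zero, smul_eq_mul] at hk
  have hder : ∀ᶠ z in nhdsWithin (0 : ℂ) {0}ᶜ,
      (n * k z + z * deriv k z) * (z ^ 3 * (f' z + g' z) - 4) =
      k z * (4 * ((1 + z ^ 2 * f z) ^ 2 + (1 + z ^ 2 * f z) * (1 + z ^ 2 * g z) +
        (1 + z ^ 2 * g z) ^ 2) - L.g₂ * z ^ 4) := by
    filter_upwards [key, nhdsWithin_le_nhds hk, nhdsWithin_le_nhds (eventually_eventually_nhds.mpr hk),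
      nhdsWithin_le_nhds ak.eventually_analyticAt, nhdsWithin_le_nhds af.eventually_analyticAt,
      nhdsWithin_le_nhds ag.eventually_analyticAt, self_mem_nhdsWithin] with z h1 h2 h3 h4 h5 h6 hz
    have hz0 : z ≠ 0 := hz
    have e : deriv f z - deriv g z = n * z ^ (n - 1) * k z + z ^ n * deriv k z := by
      rw [← deriv_fun_sub h5.differentiableAt h6.differentiableAt, Filter.EventuallyEq.deriv_eq h3,
        deriv_fun_mul (by fun_prop) h4.differentiableAt]
      simp
    have e' : z * (deriv f z - deriv g z) = z ^ n * (n * k z + z * deriv k z) := by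
      rw [e]
      rcases n with _ | n
      · simp
      · simp only [Nat.add_sub_cancel]
        ring
    rw [e', h2] at h1
    apply mul_left_cancel₀ (pow_ne_zero n hz0)
    linear_combination h1
  have ck := ak.continuousAt
  have ck' := ak.deriv.continuousAt
  have cf := af.continuousAt
  have cg := ag.continuousAt
  have cf' := af'.continuousAt
  have cg' := ag'.continuousAt
  have c1 : ContinuousAt (fun z => (n * k z + z * deriv k z) * (z ^ 3 * (f' z + g' z) - 4)) 0 := by
    fun_prop
  have c2 : ContinuousAt (fun z => k z * (4 * ((1 + z ^ 2 * f z) ^ 2 +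
      (1 + z ^ 2 * f z) * (1 + z ^ 2 * g z) + (1 + z ^ 2 * g z) ^ 2) - L.g₂ * z ^ 4)) 0 := by
    fun_prop
  have lim := tendsto_nhds_unique_of_eventuallyEq (c1.tendsto.mono_left nhdsWithin_le_nhds)
    (c2.tendsto.mono_left nhdsWithin_le_nhds) hder
  simp only [zero_mul, add_zero, ne_eq, OfNat.ofNat_ne_zero, not_false_eq_true, zero_pow, zero_sub,
    mul_zero, sub_zero] at lim
  have h4 : k 0 * (4 * n + 12) = 0 := by linear_combination -lim
  rcases mul_eq_zero.mp h4 with h | h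
  · exact hk0 h
  · have : ((4 * n + 12 : ℕ) : ℂ) = 0 := by push_cast; exact h
    exact absurd (Nat.cast_eq_zero.mp this) (by omega)

lemma PeriodPair.countable_lattice (L : PeriodPair) : (L.lattice : Set ℂ).Countable := by
  have : Countable L.lattice := L.latticeEquivProd.toEquiv.countable_iff.mpr inferInstance
  exact Set.to_countable _

/-- The lattice is determined by its invariants. -/
lemma PeriodPair.lattice_le_of_g_eq {L M : PeriodPair} (h2 : L.g₂ = M.g₂) (h3 : L.g₃ = M.g₃) :
    L.lattice ≤ M.lattice := by
  have hev := PeriodPair.weierstrassPExcept_eventuallyEq h2 h3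
  have hconn : IsPreconnected (((L.lattice : Set ℂ) ∪ M.lattice)ᶜ) :=
    ((L.countable_lattice.union M.countable_lattice).isConnected_compl_of_one_lt_rank
      (by rw [Complex.rank_real_complex]; norm_num)).isPreconnected
  have aL : AnalyticOnNhd ℂ L.weierstrassP (((L.lattice : Set ℂ) ∪ M.lattice)ᶜ) :=
    L.analyticOnNhd_weierstrassP.mono (Set.compl_subset_compl.mpr Set.subset_union_left)
  have aM : AnalyticOnNhd ℂ M.weierstrassP (((L.lattice : Set ℂ) ∪ M.lattice)ᶜ) :=
    M.analyticOnNhd_weierstrassP.mono (Set.compl_subset_compl.mpr Set.subset_union_right)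
  have hpunct : ∀ x : ℂ, ∀ᶠ z in nhdsWithin x {x}ᶜ, z ∈ (((L.lattice : Set ℂ) ∪ M.lattice)ᶜ) := by
    intro x
    filter_upwards [nhdsWithin_le_nhds (L.compl_lattice_sdiff_singleton_mem_nhds x),
      nhdsWithin_le_nhds (M.compl_lattice_sdiff_singleton_mem_nhds x), self_mem_nhdsWithin]
      with z h1 h2 h3
    rintro (h | h)
    · exact h1 ⟨h, h3⟩
    · exact h2 ⟨h, h3⟩
  have hev' : ∀ᶠ z in nhdsWithin (0 : ℂ) {0}ᶜ, L.weierstrassP z = M.weierstrassP z := by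
    filter_upwards [nhdsWithin_le_nhds hev] with z hz
    have a1 := L.weierstrassPExcept_add 0 z
    have a2 := M.weierstrassPExcept_add 0 z
    simp only [ZeroMemClass.coe_zero] at a1 a2
    rw [← a1, ← a2, hz]
  obtain ⟨z₀, ⟨hz₀, hz₁⟩⟩ := ((eventually_eventually_nhdsWithin.mpr hev').and
    ((hpunct 0).and self_mem_nhdsWithin)).exists
  have hev₀ : L.weierstrassP =ᶠ[nhds z₀] M.weierstrassP := by
    have : nhdsWithin z₀ {0}ᶜ = nhds z₀ := IsOpen.nhdsWithin_eq isOpen_compl_singleton hz₁.2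
    rw [this] at hz₀
    exact hz₀
  have heq := aL.eqOn_of_preconnected_of_eventuallyEq aM hconn hz₁.1 hev₀
  intro l hl
  by_contra hlM
  have e : L.weierstrassP =ᶠ[nhdsWithin l {l}ᶜ] M.weierstrassP := by
    filter_upwards [hpunct l] with z hz using heq hz
  have o1 := L.order_weierstrassP l hl
  rw [meromorphicOrderAt_congr e] at o1
  have := (M.analyticOnNhd_weierstrassP l hlM).meromorphicOrderAt_nonneg
  rw [o1] at this
  exact absurd this (by decide)

end Lattice

section Uniformization
open Complex hiding I
open UpperHalfPlane hiding I
open Complex (I)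
open ModularGroup Matrix.SpecialLinearGroup
open scoped MatrixGroups Manifold ModularForm

lemma im_TS_pos {τ : ℂ} (hτ : 0 < τ.im) : 0 < (-1 / τ + 1).im := by
  simpa using im_neg_one_div_pos hτ

lemma thA_TS {τ : ℂ} (hτ : 0 < τ.im) : thA (-1 / τ + 1) = -I * τ * th2 τ ^ 2 := by
  rw [thA_T, th4_S_sq hτ]

lemma modularForm_mob {k : ℕ} (f : ModularForm 𝒮ℒ k) {g : Matrix (Fin 2) (Fin 2) ℤ}
    (hg : g.det = 1) {τ : ℂ} (hτ : 0 < τ.im) :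
    f (ofComplex (mob g τ)) = jden g τ ^ k * f (ofComplex τ) := by
  obtain ⟨γ, rfl⟩ : ∃ γ : SL(2, ℤ), γ.1 = g := ⟨⟨g, hg⟩, rfl⟩
  have h : f (γ • (⟨τ, hτ⟩ : ℍ)) = _ :=
    SlashInvariantForm.slash_action_eqn'' f (γ := mapGL ℝ γ) (MonoidHom.mem_range.mpr ⟨γ, rfl⟩)
      ⟨τ, hτ⟩
  have e : ofComplex (mob γ.1 τ) = γ • (⟨τ, hτ⟩ : ℍ) := by
    rw [← UpperHalfPlane.ofComplex_apply (γ • (⟨τ, hτ⟩ : ℍ)), coe_smul_eq_mob]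
  rw [e, h, UpperHalfPlane.ofComplex_apply_of_im_pos hτ]
  simp [UpperHalfPlane.denom, jden]

lemma modularForm_bddInfty {k : ℕ} (f : ModularForm 𝒮ℒ k) : BddInfty fun τ => f (ofComplex τ) := by
  have := ModularFormClass.bdd_at_infty f
  rw [UpperHalfPlane.isBoundedAtImInfty_iff] at this
  obtain ⟨B, Y, h⟩ := this
  refine ⟨B, Y, fun τ hτ hY => ?_⟩
  dsimp only
  rw [UpperHalfPlane.ofComplex_apply_of_im_pos hτ]
  exact h ⟨τ, hτ⟩ hY

/-- Level one modular forms of even weight are polynomials in `λ` times powers of theta. -/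
lemma modularForm_eq_polynomial {K : ℕ} (f : ModularForm 𝒮ℒ ((2 * K : ℕ) : ℤ)) :
    ∃ P : Polynomial ℂ, ∀ τ : ℂ, 0 < τ.im →
      f (ofComplex τ) = thA τ ^ (2 * K) * P.eval (lam τ) := by
  have h3i : BddInfty fun τ => (th3 τ)⁻¹ := hasQ_th3_inv.bddInfty
  have hA : ∀ τ : ℂ, 0 < τ.im → thA τ ≠ 0 := fun τ hτ => thA_ne_zero hτ
  have hI : (I : ℂ) ≠ 0 := I_ne_zero
  suffices H : ∃ P : Polynomial ℂ, P.natDegree ≤ K ∧ ∀ τ : ℂ, 0 < τ.im →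
      f (ofComplex τ) / thA τ ^ (2 * K) = P.eval (lam τ) by
    obtain ⟨P, -, hP⟩ := H
    refine ⟨P, fun τ hτ => ?_⟩
    have := hA τ hτ
    rw [← hP τ hτ]
    field_simp
  refine GammaTwoInvariant.exists_polynomial K
    (F := fun τ => f (ofComplex τ) / thA τ ^ (2 * K)) ?_ ?_ ?_ ?_ ?_
  · intro γ h1 hl τ hτ
    have := hA τ hτ
    have hj := jden_ne_zero (M := γ) (by omega) hτ
    have e : thA (mob γ τ) ^ (2 * K) = jden γ τ ^ (2 * K) * thA τ ^ (2 * K) := by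
      rcases thetaLevel_or_neg (by omega) hl with h | h
      · rw [(fixesTheta_of_thetaLevel h1 h τ hτ).1, mul_pow]
      · rw [← mob_neg, (fixesTheta_of_thetaLevel (by rw [Matrix.det_neg]; simpa using h1) h τ hτ).1,
          mul_pow, jden_neg, (even_two_mul K).neg_pow]
    dsimp only
    rw [modularForm_mob f h1 hτ, e]
    field_simp
  · intro τ hτ
    refine DifferentiableAt.div ?_ ((hasQ_thA.differentiableAt one_pos hτ).pow _)
      (pow_ne_zero _ (hA τ hτ))
    exact ((UpperHalfPlane.mdifferentiable_iff.mp (ModularFormClass.holo f)) τ hτ).differentiableAt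
      ((isOpen_lt continuous_const Complex.continuous_im).mem_nhds hτ)
  · refine ((modularForm_bddInfty f).mul (h3i.pow (4 * K))).congr fun τ hτ => ?_
    rw [thA, div_eq_mul_inv, inv_pow, ← pow_mul, show 2 * (2 * K) = 4 * K by ring]
  · refine ((BddInfty.const (((-I) ^ (2 * K))⁻¹)).mul
      ((modularForm_bddInfty f).mul (h3i.pow (4 * K)))).congr fun τ hτ => ?_
    have hτ0 : τ ≠ 0 := by rintro rfl; simp at hτ
    have := hA τ hτ
    have h3 := th3_ne_zero hτ
    rw [← mob_S, modularForm_mob f (by simp [Matrix.det_fin_two]) hτ, mob_S, thA_S hτ]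
    have : jden !![0, -1; 1, 0] τ = τ := by simp [jden]
    rw [this, mul_pow, mul_pow, thA, ← pow_mul, show 2 * (2 * K) = 4 * K by ring, inv_pow]
    field_simp
  · refine ((BddInfty.const (((-I) ^ (2 * K))⁻¹)).mul
      ((modularForm_bddInfty f).mul (h3i.pow (4 * K)))).congr fun τ hτ => ?_
    have hτ0 : τ ≠ 0 := by rintro rfl; simp at hτ
    have h2 := th2_ne_zero hτ
    have h3 := th3_ne_zero hτ
    rw [← mob_TS hτ, modularForm_mob f (by simp [Matrix.det_fin_two]) hτ, mob_TS hτ, thA_TS hτ]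
    have : jden !![1, -1; 1, 0] τ = τ := by simp [jden]
    rw [this, mul_pow, mul_pow, lam, div_pow, ← pow_mul, ← pow_mul, ← pow_mul,
      show 2 * (2 * K) = 4 * K by ring, inv_pow]
    field_simp

lemma linearIndependent_pair {A τ : ℂ} (hA : A ≠ 0) (hτ : 0 < τ.im) :
    LinearIndependent ℝ ![A * τ, A] := by
  rw [LinearIndependent.pair_iff]
  intro s t h
  have h1 : (s : ℂ) * τ + t = 0 := by
    have : A * (s * τ + t) = 0 := by rw [← h]; simp; ring
    exact (mul_eq_zero.mp this).resolve_left hA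
  have h2 := congrArg Complex.im h1
  have h3 := congrArg Complex.re h1
  simp at h2 h3
  have hs : s = 0 := h2.resolve_right hτ.ne'
  subst hs
  simpa using h3

/-- The lattice of periods normalised by `θ₃²`. -/
noncomputable def thetaPair {τ : ℂ} (hτ : 0 < τ.im) : PeriodPair where
  ω₁ := thA τ * τ
  ω₂ := thA τ
  indep := linearIndependent_pair (thA_ne_zero hτ) hτ

lemma thetaPair_G {k : ℕ} (hk : 3 ≤ k) {τ : ℂ} (hτ : 0 < τ.im) :
    (thetaPair hτ).G k = (thA τ ^ k)⁻¹ * (riemannZeta k * 2 * ModularForm.E hk (ofComplex τ)) := by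
  have h := tsum_eisSummand_eq_riemannZeta_mul_eisensteinSeries hk ⟨τ, hτ⟩
  have hE : ModularForm.E hk (ofComplex τ) =
      (1 / 2 : ℂ) * eisensteinSeries (N := 1) 0 k ⟨τ, hτ⟩ := by
    rw [UpperHalfPlane.ofComplex_apply_of_im_pos hτ]
    rfl
  rw [hE, show riemannZeta k * 2 * (1 / 2 * eisensteinSeries (N := 1) 0 k ⟨τ, hτ⟩)
    = riemannZeta k * eisensteinSeries (N := 1) 0 k ⟨τ, hτ⟩ by ring, ← h,
    PeriodPair.G, ← (thetaPair hτ).latticeEquivProd.symm.toEquiv.tsum_eq,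
    ← (finTwoArrowEquiv ℤ).symm.tsum_eq, ← tsum_mul_left]
  refine tsum_congr fun x => ?_
  rw [LinearEquiv.coe_toEquiv, PeriodPair.latticeEquiv_symm_apply]
  simp only [thetaPair, EisensteinSeries.eisSummand, finTwoArrowEquiv_symm_apply, zpow_neg,
    zpow_natCast]
  rw [← mul_inv, ← mul_pow]
  simp
  ring_nf

lemma exists_mob_of_lam_eq {τ σ : ℂ} (hτ : 0 < τ.im) (hσ : 0 < σ.im) (h : lam τ = lam σ) :
    ∃ g : Matrix (Fin 2) (Fin 2) ℤ, g.det = 1 ∧ τ = mob g σ ∧ thA τ = jden g σ * thA σ := by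
  have hG : ∀ K : ℕ, ∀ hK : 3 ≤ 2 * K, (thetaPair hτ).G (2 * K) = (thetaPair hσ).G (2 * K) := by
    intro K hK
    obtain ⟨P, hP⟩ := modularForm_eq_polynomial (ModularForm.E hK)
    have h1 := thA_ne_zero hτ
    have h2 := thA_ne_zero hσ
    rw [thetaPair_G hK, thetaPair_G hK, hP τ hτ, hP σ hσ, h]
    field_simp
  have h4 := hG 2 (by norm_num)
  have h6 := hG 3 (by norm_num)
  norm_num at h4 h6
  have hg2 : (thetaPair hτ).g₂ = (thetaPair hσ).g₂ := by rw [PeriodPair.g₂, PeriodPair.g₂, h4]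
  have hg3 : (thetaPair hτ).g₃ = (thetaPair hσ).g₃ := by rw [PeriodPair.g₃, PeriodPair.g₃, h6]
  have hle := PeriodPair.lattice_le_of_g_eq hg2 hg3
  have hge := PeriodPair.lattice_le_of_g_eq hg2.symm hg3.symm
  obtain ⟨a, b, hab⟩ := PeriodPair.mem_lattice.mp (hle (PeriodPair.ω₁_mem_lattice _))
  obtain ⟨c, d, hcd⟩ := PeriodPair.mem_lattice.mp (hle (PeriodPair.ω₂_mem_lattice _))
  obtain ⟨a', b', hab'⟩ := PeriodPair.mem_lattice.mp (hge (PeriodPair.ω₁_mem_lattice _))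
  obtain ⟨c', d', hcd'⟩ := PeriodPair.mem_lattice.mp (hge (PeriodPair.ω₂_mem_lattice _))
  simp only [thetaPair] at hab hcd hab' hcd'
  have hA := thA_ne_zero hτ
  have hB := thA_ne_zero hσ
  have hli := LinearIndependent.pair_iff.mp (linearIndependent_pair hB hσ)
  have e1 := hli (a' * a + b' * c - 1 : ℝ) (a' * b + b' * d : ℝ) (by
    simp
    linear_combination hab' + a' * hab + b' * hcd)
  have e2 := hli (c' * a + d' * c : ℝ) (c' * b + d' * d - 1 : ℝ) (by
    simp
    linear_combination hcd' + c' * hab + d' * hcd)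
  have f1 : a' * a + b' * c = 1 := by exact_mod_cast sub_eq_zero.mp e1.1
  have f2 : a' * b + b' * d = 0 := by exact_mod_cast e1.2
  have f3 : c' * a + d' * c = 0 := by exact_mod_cast e2.1
  have f4 : c' * b + d' * d = 1 := by exact_mod_cast sub_eq_zero.mp e2.2
  have hdet : (a' * d' - b' * c') * (a * d - b * c) = 1 := by
    calc (a' * d' - b' * c') * (a * d - b * c) = (a' * a + b' * c) * (c' * b + d' * d) -
        (a' * b + b' * d) * (c' * a + d' * c) := by ring
      _ = 1 := by rw [f1, f2, f3, f4]; norm_num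
  have hj : thA τ = (c * σ + d) * thA σ := by linear_combination -hcd
  have hj0 : (c * σ + d) ≠ 0 := by
    intro h0
    rw [h0, zero_mul] at hj
    exact hA hj
  have hm : τ = mob !![a, b; c, d] σ := by
    have : mob !![a, b; c, d] σ = (a * σ + b) / (c * σ + d) := by simp [mob, jden]
    rw [this, eq_div_iff hj0]
    refine mul_left_cancel₀ hB ?_
    linear_combination -hab - τ * hj
  refine ⟨!![a, b; c, d], ?_, hm, by rw [hj]; simp [jden]⟩
  have him := mob_im !![a, b; c, d] σ
  rw [← hm] at him
  have hpos : (0 : ℤ) < (!![a, b; c, d] : Matrix (Fin 2) (Fin 2) ℤ).det := by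
    by_contra hn
    push Not at hn
    have : τ.im ≤ 0 := by
      rw [him]
      refine div_nonpos_of_nonpos_of_nonneg (mul_nonpos_of_nonpos_of_nonneg ?_ hσ.le)
        (normSq_nonneg _)
      exact_mod_cast hn
    linarith
  rw [Matrix.det_fin_two] at hpos ⊢
  simp at hpos ⊢
  rcases Int.isUnit_iff.mp (IsUnit.of_mul_eq_one_right _ hdet) with h | h <;> linarith

end Uniformization

section LambdaBijection
open Complex

/-- `λ` separates the orbits of the theta subgroup. -/
theorem exists_thetaLevel_of_lam_eq {τ σ : ℂ} (hτ : 0 < τ.im) (hσ : 0 < σ.im)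
    (h : lam τ = lam σ) :
    ∃ γ : Matrix (Fin 2) (Fin 2) ℤ, γ.det = 1 ∧ ThetaLevel γ ∧ τ = mob γ σ := by
  obtain ⟨g, hg, hgσ, hA⟩ := exists_mob_of_lam_eq hτ hσ h
  obtain ⟨γ, s, k, hγ1, hγ2, hs, hk, rfl⟩ := exists_levelTwo_mul hg
  have hsd : s.det = 1 := by
    rcases hs with rfl | rfl | rfl <;> simp [Matrix.det_fin_two]
  have hkd : (!![1, k; 0, 1] : Matrix (Fin 2) (Fin 2) ℤ).det = 1 := by simp [Matrix.det_fin_two]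
  have hd : 0 < (s * !![1, k; 0, 1]).det := by rw [Matrix.det_mul, hsd, hkd]; norm_num
  set w := mob (s * !![1, k; 0, 1]) σ with hw
  have hwp : 0 < w.im := mob_im_pos hd hσ
  have hσk : 0 < (σ + k).im := by simpa using hσ
  have hw' : w = mob s (σ + k) := by
    rw [hw, mob_mul (by omega) (by omega) hσ, mob_T_zpow]
  have hj' : jden (s * !![1, k; 0, 1]) σ = jden s (σ + k) := by
    rw [jden_mul s (by omega) hσ, mob_T_zpow]
    simp [jden]
  have hτw : τ = mob γ w := by rw [hgσ, mob_mul (by omega) hd hσ]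
  have hlw : lam w = lam σ := by rw [← h, hτw, lam_mob hγ1 hγ2 hwp]
  have hjγ : jden γ w ≠ 0 := jden_ne_zero (by omega) hwp
  have hA2 : thA w ^ 2 = jden s (σ + k) ^ 2 * thA σ ^ 2 := by
    have e1 : thA τ ^ 2 = jden γ w ^ 2 * thA w ^ 2 := by
      rw [hτw]
      rcases thetaLevel_or_neg (by omega) hγ2 with h | h
      · rw [(fixesTheta_of_thetaLevel hγ1 h w hwp).1, mul_pow]
      · rw [← mob_neg, (fixesTheta_of_thetaLevel (by rw [Matrix.det_neg]; simpa using hγ1) h w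
          hwp).1, mul_pow, jden_neg, neg_sq]
    rw [hA, jden_mul γ hd.ne' hσ, ← hw, hj'] at e1
    refine mul_left_cancel₀ (pow_ne_zero 2 hjγ) ?_
    rw [← e1]
    ring
  have h2 := th2_ne_zero hσ
  have h3 := th3_ne_zero hσ
  have h4 := th4_ne_zero hσ
  have hl1 := lam_ne_one hσ
  have hl0 := lam_ne_zero hσ
  have h1l := one_sub_lam hσ
  have hσ0 : σ ≠ 0 := by rintro rfl; simp at hσ
  have hσ1 : σ + 1 ≠ 0 := by
    intro h0
    have := congrArg im h0
    simp at this
    exact hσ.ne' this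
  have hσ1p : 0 < (σ + 1).im := by simpa using hσ
  have h3p : th3 σ ^ 4 ≠ 0 := pow_ne_zero _ h3
  have hlam : lam σ = th2 σ ^ 4 / th3 σ ^ 4 := rfl
  have hsj : jden 1 (σ + k) = 1 := jden_one _
  have hSj : ∀ z, jden !![0, -1; 1, 0] z = z := fun z => by simp [jden]
  have hTSj : ∀ z, jden !![1, -1; 1, 0] z = z := fun z => by simp [jden]
  rcases hs with rfl | rfl | rfl <;> rcases hk with rfl | rfl
  · have hwσ : w = σ := by rw [hw', mob_one]; simp
    rw [hwσ] at hτw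
    rcases thetaLevel_or_neg (by omega) hγ2 with h | h
    · exact ⟨γ, hγ1, h, hτw⟩
    · exact ⟨-γ, by rw [Matrix.det_neg]; simpa using hγ1, h, by rw [mob_neg, hτw]⟩
  · exfalso
    rw [hw', mob_one, jden_one, Int.cast_one, thA_T, thA] at hA2
    have : 1 - lam σ = 1 := by
      rw [h1l, div_eq_one_iff_eq h3p]; linear_combination hA2
    exact hl0 (by linear_combination -this)
  · exfalso
    rw [hw', mob_S, hSj, Int.cast_zero, add_zero, thA_S hσ, mul_pow, mul_pow, neg_sq, I_sq, thA]
      at hA2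
    have : σ ^ 2 * (th3 σ ^ 2) ^ 2 ≠ 0 := by positivity
    exact this (by linear_combination -1 / 2 * hA2)
  · exfalso
    rw [hw', mob_S, hSj, Int.cast_one, thA_S hσ1p, thA_T, mul_pow, mul_pow, neg_sq, I_sq, thA]
      at hA2
    have e : th4 σ ^ 4 = - th3 σ ^ 4 := by
      refine mul_left_cancel₀ (pow_ne_zero 2 hσ1) ?_
      linear_combination -hA2
    have e2 : lam σ = 2 := by
      rw [e, neg_div, div_self h3p] at h1l
      linear_combination -h1l
    rw [hw', mob_S, Int.cast_one, lam_S hσ1p, lam_T hσ, e2] at hlw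
    norm_num at hlw
  · exfalso
    rw [hw', Int.cast_zero, add_zero, mob_TS hσ, hTSj, thA_TS hσ, mul_pow, mul_pow, neg_sq, I_sq,
      thA] at hA2
    have e2 : lam σ = -1 := by
      rw [hlam, div_eq_iff h3p]
      refine mul_left_cancel₀ (pow_ne_zero 2 hσ0) ?_
      linear_combination -hA2
    rw [hw', Int.cast_zero, add_zero, mob_TS hσ, lam_TS hσ, e2] at hlw
    norm_num at hlw
  · exfalso
    rw [hw', Int.cast_one, mob_TS hσ1p, hTSj, thA_TS hσ1p, th2_add_one_sq, thA] at hA2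
    refine hl1 ?_
    rw [hlam, div_eq_one_iff_eq h3p]
    refine mul_left_cancel₀ (pow_ne_zero 2 hσ1) ?_
    have hI4 : (I : ℂ) ^ 4 = 1 := I_pow_four
    linear_combination hA2 - (σ + 1) ^ 2 * th2 σ ^ 4 * hI4

lemma bddInfty_of_tendsto {F : ℂ → ℂ} {c : ℂ}
    (h : Tendsto F (comap im atTop) (nhds c)) : BddInfty F := by
  have h1 : ∀ᶠ τ in comap im atTop, ‖F τ‖ ≤ ‖c‖ + 1 :=
    (h.norm.eventually (eventually_le_nhds (by linarith)))
  rw [Filter.eventually_comap] at h1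
  obtain ⟨Y, hY⟩ := eventually_atTop.mp h1
  exact ⟨_, Y, fun τ _ hτ => hY _ hτ τ rfl⟩

lemma tendsto_lam : Tendsto lam (comap im atTop) (nhds 0) := by
  have := hasQ_lam.tendsto one_pos
  rwa [PowerSeries.coeff_map, coeff_zero_lamZ, map_zero] at this

instance neBot_comap_im : (comap im (atTop : Filter ℝ)).NeBot :=
  atTop_neBot.comap_of_surj fun x => ⟨x * I, by simp⟩

lemma not_lam_const (c : ℂ) : ¬ ∀ τ : ℂ, 0 < τ.im → lam τ = c := by
  intro h
  have h0 : ∀ᶠ τ in comap im atTop, lam τ = c := by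
    filter_upwards [(eventually_gt_atTop 0).comap im] with τ hτ using h τ hτ
  have := tendsto_nhds_unique_of_eventuallyEq tendsto_lam tendsto_const_nhds h0
  exact lam_ne_zero (τ := I) (by simp) (by rw [h I (by simp), this])

/-- `λ` takes every value except `0` and `1`. -/
theorem exists_lam_eq {c : ℂ} (h0 : c ≠ 0) (h1 : c ≠ 1) : ∃ τ : ℂ, 0 < τ.im ∧ lam τ = c := by
  by_contra! hc
  have hc' : ∀ τ : ℂ, 0 < τ.im → lam τ - c ≠ 0 := fun τ hτ => sub_ne_zero.mpr (hc τ hτ)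
  obtain ⟨k, hk⟩ := GammaTwoInvariant.eq_const (F := fun τ => (lam τ - c)⁻¹)
    (fun γ hγ hl τ hτ => by dsimp only; rw [lam_mob hγ hl hτ])
    (fun τ hτ => ((lam_differentiableAt hτ).sub_const c).inv (hc' τ hτ))
    (bddInfty_of_tendsto ((tendsto_lam.sub_const c).inv₀ (by simpa using h0)))
    ((bddInfty_of_tendsto (((tendsto_lam.const_sub 1).sub_const c).inv₀
      (by simpa using sub_ne_zero.mpr h1.symm))).congr fun τ hτ => by rw [lam_S hτ])
    ((bddInfty_of_tendsto (tendsto_lam.mul (((tendsto_lam.mul_const (1 - c)).sub_const 1).inv₀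
      (by simp)))).congr fun τ hτ => by
        have := lam_ne_zero hτ
        have h2 := hc' _ (im_TS_pos hτ)
        rw [lam_TS hτ] at h2 ⊢
        rw [inv_eq_iff_eq_inv, mul_inv, inv_inv]
        field_simp
        ring)
  refine not_lam_const (k⁻¹ + c) fun τ hτ => ?_
  rw [← hk τ hτ, inv_inv, sub_add_cancel]

end LambdaBijection

section LambdaDeriv
open Complex

lemma BddInfty.deriv {F : ℂ → ℂ} (hF : BddInfty F)
    (hd : ∀ τ : ℂ, 0 < τ.im → DifferentiableAt ℂ F τ) : BddInfty (deriv F) := by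
  obtain ⟨B, Y, h⟩ := hF
  refine ⟨B, max Y 0 + 2, fun τ hτ hY => ?_⟩
  have hz : ∀ z : ℂ, ‖z - τ‖ ≤ 1 → 0 < z.im ∧ Y ≤ z.im := by
    intro z hz
    have h1 := (abs_im_le_norm (z - τ)).trans hz
    rw [sub_im, abs_le] at h1
    have h2 := le_max_left Y 0
    have h3 := le_max_right Y 0
    constructor <;> linarith
  have := norm_deriv_le_of_forall_mem_sphere_norm_le (f := F) (c := τ) (R := 1) (C := B) one_pos ?_ ?_
  · simpa using this
  · refine DifferentiableOn.diffContOnCl_ball (U := {z | 0 < z.im}) ?_ ?_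
    · exact fun z hz => (hd z hz).differentiableWithinAt
    · intro z hz'
      exact (hz z (by simpa [dist_eq_norm] using hz')).1
  · intro z hz'
    have := hz z (by rw [mem_sphere_iff_norm] at hz'; exact hz'.le)
    exact h z this.1 this.2

lemma hasDerivAt_mob {γ : Matrix (Fin 2) (Fin 2) ℤ} (h : γ.det ≠ 0) {τ : ℂ} (hτ : 0 < τ.im) :
    HasDerivAt (mob γ) (γ.det / jden γ τ ^ 2) τ := by
  have hj := jden_ne_zero h hτ
  have h1 : HasDerivAt (fun τ : ℂ => γ 0 0 * τ + γ 0 1) (γ 0 0 : ℂ) τ := by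
    simpa using ((hasDerivAt_id τ).const_mul (γ 0 0 : ℂ)).add_const (γ 0 1 : ℂ)
  have h2 : HasDerivAt (fun τ : ℂ => γ 1 0 * τ + γ 1 1) (γ 1 0 : ℂ) τ := by
    simpa using ((hasDerivAt_id τ).const_mul (γ 1 0 : ℂ)).add_const (γ 1 1 : ℂ)
  refine (h1.div h2 hj).congr_deriv ?_
  rw [Matrix.det_fin_two]
  push_cast
  congr 1
  ring

lemma deriv_congr_upper {F G : ℂ → ℂ} (h : ∀ τ : ℂ, 0 < τ.im → F τ = G τ) {τ : ℂ}
    (hτ : 0 < τ.im) : deriv F τ = deriv G τ := by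
  refine EventuallyEq.deriv_eq ?_
  filter_upwards [(isOpen_lt continuous_const Complex.continuous_im).mem_nhds hτ] with z hz
    using h z hz

lemma deriv_lam_mob {γ : Matrix (Fin 2) (Fin 2) ℤ} (h : 0 < γ.det) {τ : ℂ} (hτ : 0 < τ.im) :
    deriv (fun τ => lam (mob γ τ)) τ = deriv lam (mob γ τ) * (γ.det / jden γ τ ^ 2) :=
  (HasDerivAt.comp τ (lam_differentiableAt (mob_im_pos h hτ)).hasDerivAt
    (hasDerivAt_mob h.ne' hτ)).deriv

/-- The logarithmic derivative of `λ`, normalised by theta functions to weight zero. -/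
noncomputable def lamW (τ : ℂ) : ℂ := deriv lam τ / (lam τ * (1 - lam τ) * thA τ ^ 2)

lemma differentiableAt_deriv_lam {τ : ℂ} (hτ : 0 < τ.im) : DifferentiableAt ℂ (deriv lam) τ := by
  have hU : IsOpen {z : ℂ | 0 < z.im} := isOpen_lt continuous_const Complex.continuous_im
  have : DifferentiableOn ℂ lam {z : ℂ | 0 < z.im} := fun z hz =>
    (lam_differentiableAt hz).differentiableWithinAt
  exact (this.deriv hU).differentiableAt (hU.mem_nhds hτ)

lemma bddInfty_lamW : BddInfty lamW := by
  let u : ℂ → ℂ := fun τ => psi τ ^ 4 * (th3 τ)⁻¹ ^ 4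
  have hu : HasQ 1 u _ := (hasQ_psi.pow 4).mul (hasQ_th3_inv.pow 4)
  have hlu : ∀ τ : ℂ, 0 < τ.im → lam τ = nome 1 τ * u τ := by
    intro τ hτ
    have h3 := th3_ne_zero hτ
    rw [lam, th2_pow_four τ]
    simp only [u, inv_pow]
    field_simp
  have hud : ∀ τ : ℂ, 0 < τ.im → DifferentiableAt ℂ u τ := fun τ hτ =>
    hu.differentiableAt one_pos hτ
  have hn : ∀ τ : ℂ, HasDerivAt (nome 1) (Real.pi * I * nome 1 τ) τ := by
    intro τ
    have e : nome 1 = fun τ => cexp (Real.pi * I * τ) := funext nome_one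
    rw [e]
    have := ((hasDerivAt_id τ).const_mul (Real.pi * I)).cexp
    simpa [mul_comm] using this
  have hd : ∀ τ : ℂ, 0 < τ.im → deriv lam τ = Real.pi * I * lam τ + nome 1 τ * deriv u τ := by
    intro τ hτ
    rw [deriv_congr_upper hlu hτ, ((hn τ).fun_mul (hud τ hτ).hasDerivAt).deriv, hlu τ hτ]
    ring
  have h1 : BddInfty fun τ => (1 - lam τ)⁻¹ :=
    bddInfty_of_tendsto ((tendsto_lam.const_sub 1).inv₀ (by simp))
  refine (((BddInfty.const (Real.pi * I)).add (bddInfty_nome_div_lam.mul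
    (hu.bddInfty.deriv hud))).mul (h1.mul (hasQ_th3_inv.bddInfty.pow 4))).congr fun τ hτ => ?_
  have h3 := th3_ne_zero hτ
  have hl := lam_ne_zero hτ
  have hl1 : 1 - lam τ ≠ 0 := sub_ne_zero.mpr (lam_ne_one hτ).symm
  rw [lamW, hd τ hτ, thA]
  simp only [inv_pow]
  field_simp

lemma lamW_S {τ : ℂ} (hτ : 0 < τ.im) : lamW (-1 / τ) = lamW τ := by
  have hτ0 : τ ≠ 0 := by rintro rfl; simp at hτ
  have h := deriv_lam_mob (γ := !![0, -1; 1, 0]) (by simp [Matrix.det_fin_two]) hτ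
  have h' := deriv_congr_upper (F := fun τ => lam (mob !![0, -1; 1, 0] τ))
    (G := fun τ => 1 - lam τ) (fun τ hτ => by rw [mob_S, lam_S hτ]) hτ
  rw [h, deriv_const_sub, mob_S] at h'
  simp [Matrix.det_fin_two, jden] at h'
  have h3 := thA_ne_zero hτ
  have hl := lam_ne_zero hτ
  have hl1 : 1 - lam τ ≠ 0 := sub_ne_zero.mpr (lam_ne_one hτ).symm
  have e : deriv lam (-1 / τ) = -τ ^ 2 * deriv lam τ := by
    rw [← div_eq_mul_inv, div_eq_iff (pow_ne_zero 2 hτ0)] at h'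
    linear_combination h'
  rw [lamW, lamW, e, lam_S hτ, thA_S hτ, mul_pow, mul_pow, neg_sq, I_sq]
  rw [show 1 - (1 - lam τ) = lam τ by ring]
  field_simp

lemma lamW_TS {τ : ℂ} (hτ : 0 < τ.im) : lamW (-1 / τ + 1) = lamW τ := by
  have hτ0 : τ ≠ 0 := by rintro rfl; simp at hτ
  have hl := lam_ne_zero hτ
  have h := deriv_lam_mob (γ := !![1, -1; 1, 0]) (by simp [Matrix.det_fin_two]) hτ
  have h' := deriv_congr_upper (F := fun τ => lam (mob !![1, -1; 1, 0] τ))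
    (G := fun τ => 1 - (lam τ)⁻¹) (fun τ hτ => by rw [mob_TS hτ, lam_TS hτ, one_div]) hτ
  have hi := ((lam_differentiableAt hτ).hasDerivAt.inv hl).deriv
  rw [h, deriv_const_sub, mob_TS hτ] at h'
  have hi' : deriv (fun τ => (lam τ)⁻¹) τ = -deriv lam τ / lam τ ^ 2 := hi
  rw [hi'] at h'
  simp [Matrix.det_fin_two, jden] at h'
  have h3 := th3_ne_zero hτ
  have h2 := th2_ne_zero hτ
  have hl1 : lam τ - 1 ≠ 0 := sub_ne_zero.mpr (lam_ne_one hτ)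
  have hl1' : 1 - lam τ ≠ 0 := sub_ne_zero.mpr (lam_ne_one hτ).symm
  have e : deriv lam (-1 / τ + 1) = τ ^ 2 * deriv lam τ / lam τ ^ 2 := by
    field_simp at h' ⊢
    linear_combination h'
  have e2 : th2 τ ^ 4 = lam τ * th3 τ ^ 4 := by rw [lam]; field_simp
  have e3 : (th2 τ ^ 2) ^ 2 = lam τ * th3 τ ^ 4 := by rw [← e2]; ring
  rw [lamW, lamW, e, lam_TS hτ, thA_TS hτ, mul_pow, mul_pow, neg_sq, I_sq, e3, thA,
    show 1 - (1 - 1 / lam τ) = 1 / lam τ by ring, show 1 - 1 / lam τ = (lam τ - 1) / lam τ by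
      field_simp, show 1 - lam τ = -(lam τ - 1) by ring]
  field_simp

/-- `λ` is a local biholomorphism. -/
theorem deriv_lam_ne_zero {τ : ℂ} (hτ : 0 < τ.im) : deriv lam τ ≠ 0 := by
  have hI : GammaTwoInvariant lamW := by
    intro γ h1 hl τ hτ
    have h := deriv_lam_mob (γ := γ) (by omega) hτ
    rw [deriv_congr_upper (fun τ hτ => lam_mob h1 hl hτ) hτ, h1, Int.cast_one] at h
    have hj := jden_ne_zero (M := γ) (by omega) hτ
    have hA := thA_ne_zero hτ
    have hA2 : thA (mob γ τ) ^ 2 = jden γ τ ^ 2 * thA τ ^ 2 := by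
      rcases thetaLevel_or_neg (by omega) hl with h | h
      · rw [(fixesTheta_of_thetaLevel h1 h τ hτ).1, mul_pow]
      · rw [← mob_neg, (fixesTheta_of_thetaLevel (by rw [Matrix.det_neg]; simpa using h1) h τ
          hτ).1, mul_pow, jden_neg, neg_sq]
    have h0 := lam_ne_zero hτ
    have hl1 : 1 - lam τ ≠ 0 := sub_ne_zero.mpr (lam_ne_one hτ).symm
    rw [lamW, lamW, lam_mob h1 hl hτ, hA2, h]
    field_simp
  have hne : ∀ τ : ℂ, 0 < τ.im → lam τ * (1 - lam τ) * thA τ ^ 2 ≠ 0 := fun τ hτ =>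
    mul_ne_zero (mul_ne_zero (lam_ne_zero hτ) (sub_ne_zero.mpr (lam_ne_one hτ).symm))
      (pow_ne_zero 2 (thA_ne_zero hτ))
  obtain ⟨c, hc⟩ := hI.eq_const
    (fun τ hτ => (differentiableAt_deriv_lam hτ).div
      (((lam_differentiableAt hτ).mul ((lam_differentiableAt hτ).const_sub 1)).mul
        ((hasQ_thA.differentiableAt one_pos hτ).pow 2)) (hne τ hτ)) bddInfty_lamW
    (bddInfty_lamW.congr fun τ hτ => lamW_S hτ) (bddInfty_lamW.congr fun τ hτ => lamW_TS hτ)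
  intro h0
  have hc0 : c = 0 := by rw [← hc τ hτ, lamW, h0, zero_div]
  have hd : ∀ z : ℂ, 0 < z.im → deriv lam z = 0 := by
    intro z hz
    have := hc z hz
    rw [lamW, hc0, div_eq_zero_iff] at this
    exact this.resolve_right (hne z hz)
  have hU : IsOpen {z : ℂ | 0 < z.im} := isOpen_lt continuous_const Complex.continuous_im
  have hconv : Convex ℝ {z : ℂ | 0 < z.im} := convex_halfSpace_im_gt 0
  refine not_lam_const (lam I) fun z hz => ?_
  exact hU.is_const_of_deriv_eq_zero hconv.isPreconnected
    (fun z hz => (lam_differentiableAt hz).differentiableWithinAt) (fun z hz => hd z hz) hz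
    (by simp)

end LambdaDeriv

section HeckeCosets

/-- Representatives of the integral matrices of determinant `p` modulo the level two group. -/
def heckeRep (p : ℕ) : Option (Fin p) → Matrix (Fin 2) (Fin 2) ℤ
  | none => !![(p : ℤ), 0; 0, 1]
  | some j => !![1, 2 * (j : ℤ); 0, (p : ℤ)]

lemma det_heckeRep (p : ℕ) (i : Option (Fin p)) : (heckeRep p i).det = p := by
  cases i <;> simp [heckeRep, Matrix.det_fin_two]

lemma eq_of_heckeRep_eq_mul {p : ℕ} [hp : Fact p.Prime] (hp2 : p ≠ 2) {i j : Option (Fin p)}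
    {g : Matrix (Fin 2) (Fin 2) ℤ} (h : heckeRep p i = g * heckeRep p j) : i = j := by
  have hp1 : (1 : ℤ) < p := by exact_mod_cast hp.out.one_lt
  have h00 := congrFun (congrFun h 0) 0
  have h01 := congrFun (congrFun h 0) 1
  have h10 := congrFun (congrFun h 1) 0
  have h11 := congrFun (congrFun h 1) 1
  cases i with
  | none =>
    cases j with
    | none => rfl
    | some j =>
      simp [heckeRep, Matrix.mul_apply, Fin.sum_univ_two] at h00 h01 h10 h11
      rw [← h10] at h11
      have hd : (p : ℤ) ∣ 1 := ⟨g 1 1, by linear_combination h11⟩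
      have := Int.le_of_dvd one_pos hd
      omega
  | some i =>
    cases j with
    | none =>
      simp [heckeRep, Matrix.mul_apply, Fin.sum_univ_two] at h00 h01 h10 h11
      have hd : (p : ℤ) ∣ 1 := ⟨g 0 0, by linarith⟩
      have := Int.le_of_dvd one_pos hd
      omega
    | some j =>
      simp [heckeRep, Matrix.mul_apply, Fin.sum_univ_two] at h00 h01 h10 h11
      rw [← h00] at h01
      have hd : (p : ℤ) ∣ 2 * ((i : ℤ) - j) := ⟨g 0 1, by linarith⟩
      have hp' : Prime (p : ℤ) := Nat.prime_iff_prime_int.mp hp.out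
      have h2 : (p : ℤ) ∣ (i : ℤ) - j := by
        refine (hp'.dvd_or_dvd hd).resolve_left fun h2 => hp2 ?_
        have h2' : p ∣ 2 := by exact_mod_cast h2
        exact (Nat.prime_dvd_prime_iff_eq hp.out Nat.prime_two).mp h2'
      have hi := i.2
      have hj := j.2
      obtain ⟨k, hk⟩ := h2
      have : k = 0 := by
        by_contra hk0
        rcases lt_or_gt_of_ne hk0 with h | h
        · nlinarith
        · nlinarith
      rw [this] at hk
      congr 1
      ext
      omega

lemma exists_heckeRep {p : ℕ} [hp : Fact p.Prime] (hp2 : p ≠ 2) {M : Matrix (Fin 2) (Fin 2) ℤ}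
    (hM : M.det = p) (hl : LevelTwo M) :
    ∃ i, ∃ γ : Matrix (Fin 2) (Fin 2) ℤ, γ.det = 1 ∧ LevelTwo γ ∧ M = γ * heckeRep p i := by
  have hp' : Prime (p : ℤ) := Nat.prime_iff_prime_int.mp hp.out
  have hp0 : (p : ℤ) ≠ 0 := hp'.ne_zero
  have hpodd : (p : ℤ) % 2 = 1 := by
    have := hp.out.eq_two_or_odd
    omega
  suffices H : ∃ i, ∃ γ : Matrix (Fin 2) (Fin 2) ℤ, LevelTwo γ ∧ M = γ * heckeRep p i by
    obtain ⟨i, γ, h1, h2⟩ := H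
    refine ⟨i, γ, ?_, h1, h2⟩
    rw [h2, Matrix.det_mul, det_heckeRep] at hM
    exact mul_right_cancel₀ hp0 (by rw [hM, one_mul])
  have hdet := hM
  rw [Matrix.det_fin_two] at hdet
  obtain ⟨hb, hc⟩ := hl
  have half : ∀ x q : ℤ, 2 ∣ x → x = p * q → 2 ∣ q := by
    intro x q hx hq
    have : (2 : ℤ) ∣ p * q := hq ▸ hx
    rcases Int.prime_two.dvd_or_dvd this with h | h
    · omega
    · exact h
  by_cases hac : (p : ℤ) ∣ M 0 0 ∧ (p : ℤ) ∣ M 1 0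
  · obtain ⟨⟨x, hx⟩, ⟨y, hy⟩⟩ := hac
    refine ⟨none, !![x, M 0 1; y, M 1 1], ⟨by simpa using hb, ?_⟩, ?_⟩
    · simpa using half _ _ hc hy
    · ext i j
      fin_cases i <;> fin_cases j <;> simp [heckeRep, Matrix.mul_apply, Fin.sum_univ_two, hx, hy,
        mul_comm]
  · have hj : ∃ j : Fin p, (p : ℤ) ∣ M 0 1 - 2 * j * M 0 0 ∧ (p : ℤ) ∣ M 1 1 - 2 * j * M 1 0 := by
      have h20 : (2 : ZMod p) ≠ 0 := by
        intro h
        have : ((2 : ℕ) : ZMod p) = 0 := by exact_mod_cast h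
        rw [ZMod.natCast_eq_zero_iff] at this
        exact hp2 ((Nat.prime_dvd_prime_iff_eq hp.out Nat.prime_two).mp this)
      have hz : ((M 0 0 : ℤ) : ZMod p) * (M 1 1 : ℤ) = (M 0 1 : ℤ) * (M 1 0 : ℤ) := by
        have := congrArg (Int.cast : ℤ → ZMod p) hdet
        push_cast at this
        rw [CharP.cast_eq_zero] at this
        exact sub_eq_zero.mp this
      have key : ∀ s : ZMod p, (M 0 1 : ZMod p) = 2 * s * (M 0 0 : ℤ) →
          (M 1 1 : ZMod p) = 2 * s * (M 1 0 : ℤ) →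
          ∃ j : Fin p, (p : ℤ) ∣ M 0 1 - 2 * j * M 0 0 ∧ (p : ℤ) ∣ M 1 1 - 2 * j * M 1 0 := by
        intro s h1 h2
        refine ⟨⟨s.val, ZMod.val_lt s⟩, ?_, ?_⟩ <;>
        · rw [← ZMod.intCast_zmod_eq_zero_iff_dvd]
          push_cast
          rw [ZMod.natCast_zmod_val]
          first
          | rw [h1, sub_self]
          | rw [h2, sub_self]
      by_cases ha : ((M 0 0 : ℤ) : ZMod p) = 0
      · have hc0 : ((M 1 0 : ℤ) : ZMod p) ≠ 0 := by
          intro h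
          exact hac ⟨(ZMod.intCast_zmod_eq_zero_iff_dvd _ p).mp ha,
            (ZMod.intCast_zmod_eq_zero_iff_dvd _ p).mp h⟩
        refine key ((M 1 1 : ℤ) / (2 * (M 1 0 : ℤ))) ?_ ?_
        · rw [ha, zero_mul] at hz
          rw [ha, mul_zero]
          exact (mul_eq_zero.mp hz.symm).resolve_right hc0
        · field_simp
      · refine key ((M 0 1 : ℤ) / (2 * (M 0 0 : ℤ))) ?_ ?_
        · field_simp
        · field_simp
          linear_combination hz
    obtain ⟨j, ⟨x, hx⟩, ⟨y, hy⟩⟩ := hj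
    refine ⟨some j, !![M 0 0, x; M 1 0, y], ⟨?_, by simpa using hc⟩, ?_⟩
    · have : (2 : ℤ) ∣ M 0 1 - 2 * j * M 0 0 := (Dvd.dvd.sub hb ⟨j * M 0 0, by ring⟩)
      simpa using half _ _ this hx
    · ext i j
      fin_cases i <;> fin_cases j <;> simp [heckeRep, Matrix.mul_apply, Fin.sum_univ_two] <;>
        linarith

lemma levelTwo_conj_heckeRep {p : ℕ} (hp : p % 2 = 1) (N : Matrix (Fin 2) (Fin 2) ℤ)
    (i : Option (Fin p)) : LevelTwo (N.adjugate * heckeRep p i * N) := by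
  obtain ⟨q, hq⟩ : ∃ q : ℤ, (p : ℤ) = 2 * q + 1 := ⟨p / 2, by omega⟩
  cases i with
  | none =>
    constructor
    · exact ⟨q * N 0 1 * N 1 1, by
        simp [heckeRep, Matrix.adjugate_fin_two, Matrix.mul_apply, Fin.sum_univ_two, hq]; ring⟩
    · exact ⟨-q * N 1 0 * N 0 0, by
        simp [heckeRep, Matrix.adjugate_fin_two, Matrix.mul_apply, Fin.sum_univ_two, hq]; ring⟩
  | some j =>
    constructor
    · exact ⟨(N 1 1 * j - q * N 0 1) * N 1 1, by
        simp [heckeRep, Matrix.adjugate_fin_two, Matrix.mul_apply, Fin.sum_univ_two, hq]; ring⟩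
    · exact ⟨(-N 1 0 * j + q * N 0 0) * N 1 0, by
        simp [heckeRep, Matrix.adjugate_fin_two, Matrix.mul_apply, Fin.sum_univ_two, hq]; ring⟩

/-- Right multiplication permutes the Hecke cosets. -/
theorem exists_heckePerm {p : ℕ} [hp : Fact p.Prime] (hp2 : p ≠ 2) {N : Matrix (Fin 2) (Fin 2) ℤ}
    (hN : N.det = 1) : ∃ σ : Equiv.Perm (Option (Fin p)), ∀ i, ∃ γ : Matrix (Fin 2) (Fin 2) ℤ,
      γ.det = 1 ∧ LevelTwo γ ∧ heckeRep p i * N = N * γ * heckeRep p (σ i) := by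
  have hpodd : p % 2 = 1 := hp.out.eq_two_or_odd.resolve_left hp2
  have hNa : N * N.adjugate = 1 := by rw [Matrix.mul_adjugate, hN, one_smul]
  have hNa' : N.adjugate * N = 1 := by rw [Matrix.adjugate_mul, hN, one_smul]
  have H : ∀ i, ∃ k, ∃ γ : Matrix (Fin 2) (Fin 2) ℤ, γ.det = 1 ∧ LevelTwo γ ∧
      heckeRep p i * N = N * γ * heckeRep p k := by
    intro i
    have hd : (N.adjugate * heckeRep p i * N).det = p := by
      rw [Matrix.det_mul, Matrix.det_mul, Matrix.det_adjugate, hN, det_heckeRep]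
      simp
    obtain ⟨k, γ, h1, h2, h3⟩ := exists_heckeRep hp2 hd (levelTwo_conj_heckeRep hpodd N i)
    refine ⟨k, γ, h1, h2, ?_⟩
    rw [mul_assoc, ← h3, mul_assoc, ← mul_assoc, hNa, one_mul]
  choose s hs using H
  have hinj : Function.Injective s := by
    intro i j hij
    obtain ⟨γ, h1, -, h3⟩ := hs i
    obtain ⟨δ, h4, -, h6⟩ := hs j
    rw [← hij] at h6
    have hδ : δ * δ.adjugate = 1 := by rw [Matrix.mul_adjugate, h4, one_smul]
    have hδ' : δ.adjugate * δ = 1 := by rw [Matrix.adjugate_mul, h4, one_smul]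
    refine eq_of_heckeRep_eq_mul hp2 (g := N * γ * δ.adjugate * N.adjugate) ?_
    have e : heckeRep p (s i) = δ.adjugate * N.adjugate * heckeRep p j * N := by
      rw [mul_assoc, h6]
      simp only [mul_assoc]
      rw [← mul_assoc N.adjugate N, hNa', one_mul, ← mul_assoc δ.adjugate, hδ', one_mul]
    calc heckeRep p i = heckeRep p i * N * N.adjugate := by rw [mul_assoc, hNa, mul_one]
      _ = _ := by
        rw [h3, e]
        simp only [mul_assoc]
        rw [hNa, mul_one]
  exact ⟨Equiv.ofBijective s (Finite.injective_iff_bijective.mp hinj), hs⟩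

end HeckeCosets

section HeckeSeries

open PowerSeries

/-- The effect of a Hecke representative on `q`-series, with `ζ` a root of unity. -/
noncomputable def heckeSeries {R : Type*} [CommRing R] (p : ℕ) [hp : Fact p.Prime] (ζ : R) :
    Option (Fin p) → R⟦X⟧ → R⟦X⟧
  | none, s => PowerSeries.expand (p ^ 2) (pow_ne_zero 2 hp.out.ne_zero) s
  | some j, s => rescale (ζ ^ (j : ℕ)) s

lemma heckeSeries_map {R S : Type*} [CommRing R] [CommRing S] (f : R →+* S) (p : ℕ)
    [hp : Fact p.Prime] (ζ : R) (i : Option (Fin p)) (s : R⟦X⟧) :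
    (heckeSeries p ζ i s).map f = heckeSeries p (f ζ) i (s.map f) := by
  cases i with
  | none => exact PowerSeries.map_expand _ _ f s
  | some j => rw [heckeSeries, heckeSeries, ← map_pow, rescale_map]

/-- The root of unity attached to the translations by even integers. -/
noncomputable def zetaP (p : ℕ) : ℂ := Complex.exp (2 * Real.pi * Complex.I / p)

lemma zetaP_pow (p : ℕ) (hp : p ≠ 0) : zetaP p ^ p = 1 := by
  have : (p : ℂ) ≠ 0 := by exact_mod_cast hp
  rw [zetaP, ← Complex.exp_nat_mul, mul_div_cancel₀ _ this, Complex.exp_two_pi_mul_I]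

lemma mob_heckeRep_none (p : ℕ) (τ : ℂ) : mob (heckeRep p none) τ = p * τ := by
  simp [mob, jden, heckeRep]

lemma mob_heckeRep_some (p : ℕ) (j : Fin p) (τ : ℂ) :
    mob (heckeRep p (some j)) τ = (τ + 2 * j) / p := by
  simp [mob, jden, heckeRep]

lemma HasQ.self_level {F : ℂ → ℂ} {s : ℂ⟦X⟧} (hF : HasQ 1 F s) {p : ℕ} (hp : p ≠ 0) :
    HasQ p F (PowerSeries.expand p hp s) := by
  have h0 : (p : ℂ) ≠ 0 := by exact_mod_cast hp
  have := hF.comp (h' := p) hp (c := 1) (φ := id) (fun τ hτ => hτ) (fun τ => by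
    rw [nome, nome, ← Complex.exp_nat_mul, one_mul]
    congr 1
    simp
    field_simp)
  simpa [rescale_one] using this

lemma HasQ.hecke {F : ℂ → ℂ} {s : ℂ⟦X⟧} (hF : HasQ 1 F s) {p : ℕ} [hp : Fact p.Prime]
    (i : Option (Fin p)) :
    HasQ p (fun τ => F (mob (heckeRep p i) τ)) (heckeSeries p (zetaP p) i s) := by
  have h0 : (p : ℂ) ≠ 0 := by exact_mod_cast hp.out.ne_zero
  have him : ∀ τ : ℂ, 0 < τ.im → 0 < (mob (heckeRep p i) τ).im := fun τ hτ =>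
    mob_im_pos (by rw [det_heckeRep]; exact_mod_cast hp.out.pos) hτ
  cases i with
  | none =>
    have := hF.comp (h' := p) (pow_ne_zero 2 hp.out.ne_zero) (c := 1) him (fun τ => by
      rw [mob_heckeRep_none, nome, nome, ← Complex.exp_nat_mul, one_mul]
      congr 1
      push_cast
      field_simp)
    simpa [rescale_one, heckeSeries] using this
  | some j =>
    have := hF.comp (h' := p) one_ne_zero (c := zetaP p ^ (j : ℕ)) him (fun τ => by
      rw [mob_heckeRep_some, nome, nome, zetaP, pow_one, ← Complex.exp_nat_mul, ← Complex.exp_add]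
      congr 1
      push_cast
      field_simp
      ring)
    simpa [heckeSeries, PowerSeries.expand_one_apply] using this

/-- A polynomial is determined by its value at a nonzero series without constant term. -/
lemma eq_zero_of_aeval_powerSeries {K : Type*} [Field K] {s : K⟦X⟧} (hs : s ≠ 0)
    (hs0 : s.constantCoeff = 0) {P : Polynomial K} (h : Polynomial.aeval s P = 0) : P = 0 := by
  by_contra hP
  obtain ⟨Q, hQ⟩ := Polynomial.exists_eq_pow_rootMultiplicity_mul_and_not_dvd P hP 0
  have h1 : Polynomial.aeval s Q ≠ 0 := by
    intro hz
    refine hQ.2 (Polynomial.dvd_iff_isRoot.mpr ?_)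
    have := congrArg (PowerSeries.constantCoeff) hz
    rw [Polynomial.aeval_def, Polynomial.hom_eval₂, hs0, map_zero] at this
    rw [Polynomial.IsRoot, Polynomial.eval]
    have e : PowerSeries.constantCoeff.comp (algebraMap K K⟦X⟧) = RingHom.id K := by
      ext x
      simp
    rwa [e] at this
  rw [hQ.1, map_mul, map_pow] at h
  simp [h1, hs] at h

/-- Integrality of a polynomial can be tested on its value at a series with leading unit. -/
lemma coeff_mem_of_aeval_powerSeries {A K : Type*} [CommRing A] [Field K] {f : A →+* K}
    (hf : Function.Injective f) {s : A⟦X⟧} {n : ℕ} (hn : 0 < n) {u : A⟦X⟧} (hs : s = X ^ n * u)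
    (hu : IsUnit u.constantCoeff) {P : Polynomial K} {t : A⟦X⟧}
    (h : Polynomial.aeval (s.map f) P = t.map f) (k : ℕ) : P.coeff k ∈ f.range := by
  induction k using Nat.strong_induction_on generalizing P t with
  | _ k ih =>
  cases k with
  | zero =>
    have := congrArg (PowerSeries.constantCoeff) h
    have h0 : PowerSeries.constantCoeff (s.map f) = 0 := by
      rw [hs]; simp [hn.ne']
    rw [Polynomial.aeval_def, Polynomial.hom_eval₂, h0, Polynomial.eval₂_at_zero] at this
    have e : PowerSeries.constantCoeff.comp (algebraMap K K⟦X⟧) (P.coeff 0) = P.coeff 0 := by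
      simp
    have e' : PowerSeries.constantCoeff (t.map f) = f t.constantCoeff := by
      rw [← PowerSeries.coeff_zero_eq_constantCoeff_apply, PowerSeries.coeff_map,
        PowerSeries.coeff_zero_eq_constantCoeff_apply]
    rw [← e, this, e']
    exact ⟨_, rfl⟩
  | succ k =>
    obtain ⟨a, ha⟩ : P.coeff 0 ∈ f.range := ih 0 (Nat.succ_pos k) h
    obtain ⟨v, hv⟩ : ∃ v : A⟦X⟧, u * v = 1 := by
      have := PowerSeries.isUnit_iff_constantCoeff.mpr hu
      exact this.exists_right_inv
    have h1 : Polynomial.aeval (s.map f) P = s.map f *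
        Polynomial.aeval (s.map f) P.divX + (PowerSeries.C a).map f := by
      conv_lhs => rw [← Polynomial.divX_mul_X_add P]
      simp only [map_add, map_mul, Polynomial.aeval_X, Polynomial.aeval_C]
      rw [mul_comm, PowerSeries.map_C, ha]
      rfl
    have h2 : ∃ w : A⟦X⟧, t - PowerSeries.C a = X ^ n * w := by
      rw [← dvd_def, PowerSeries.X_pow_dvd_iff]
      intro m hm
      apply hf
      have h3 : (t - PowerSeries.C a).map f = X ^ n * (u.map f *
          Polynomial.aeval (s.map f) P.divX) := by
        rw [map_sub, ← h, h1, add_sub_cancel_right, hs]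
        simp [mul_assoc]
      have := congrArg (PowerSeries.coeff m) h3
      rw [PowerSeries.coeff_X_pow_mul', if_neg (by omega), PowerSeries.coeff_map] at this
      simpa using this
    obtain ⟨w, hw⟩ := h2
    have h4 : Polynomial.aeval (s.map f) P.divX = (v * w).map f := by
      have h5 : (X : K⟦X⟧) ^ n ≠ 0 := pow_ne_zero _ PowerSeries.X_ne_zero
      have h6 : X ^ n * (u.map f * Polynomial.aeval (s.map f) P.divX) =
          X ^ n * w.map f := by
        have := congrArg (PowerSeries.map f) hw
        rw [map_sub, ← h, h1, add_sub_cancel_right] at this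
        rw [← mul_assoc]
        rw [show X ^ n * u.map f = s.map f by rw [hs]; simp, this]
        simp
      have h7 := mul_left_cancel₀ h5 h6
      rw [map_mul, ← h7, ← mul_assoc, ← map_mul, mul_comm v, hv, map_one, one_mul]
    have := ih k (Nat.lt_succ_self k) h4
    rwa [Polynomial.coeff_divX] at this

end HeckeSeries

section Reduction

open PowerSeries IsLocalRing

lemma exists_valuationSubring_charP (p : ℕ) [hp : Fact p.Prime] :
    ∃ O : ValuationSubring ℂ, CharP (ResidueField O) p := by
  have hinj : Function.Injective (Int.castRingHom ℂ).rangeRestrict := by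
    rw [RingHom.injective_iff_ker_eq_bot, RingHom.ker_rangeRestrict]
    exact (RingHom.injective_iff_ker_eq_bot _).mp Int.cast_injective
  have hI : (Ideal.span {(Int.castRingHom ℂ).rangeRestrict (p : ℤ)}) ≠ ⊤ := by
    intro h
    rw [Ideal.span_singleton_eq_top] at h
    obtain ⟨⟨_, x, rfl⟩, hx⟩ := h.exists_right_inv
    have h1 : ((p : ℤ) * x : ℂ) = 1 := congrArg Subtype.val hx
    have h2 : (p : ℤ) * x = 1 := by exact_mod_cast h1
    have h3 : (p : ℤ) ∣ 1 := ⟨x, h2.symm⟩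
    have := Int.le_of_dvd one_pos h3
    have := hp.out.one_lt
    omega
  obtain ⟨O, -, hO⟩ := Ideal.image_subset_nonunits_valuationSubring _ hI
  refine ⟨O, ?_⟩
  have h1 : (p : ℂ) ∈ O.nonunits := hO ⟨_, Ideal.subset_span rfl, by simp⟩
  rw [← SetLike.mem_coe, ← O.image_maximalIdeal] at h1
  obtain ⟨x, hx, hxp⟩ := h1
  have h2 : x = (p : O) := Subtype.ext (by simpa using hxp)
  have h3 : (p : ResidueField O) = 0 := by
    rw [← map_natCast (residue O), ← h2]
    exact (residue_eq_zero_iff x).mpr hx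
  exact (CharP.charP_iff_prime_eq_zero hp.out).mpr h3

lemma map_aeval_powerSeries {R S : Type*} [CommRing R] [CommRing S] (f : R →+* S) (s : R⟦X⟧)
    (Q : Polynomial R) :
    (Polynomial.aeval s Q).map f = Polynomial.aeval (s.map f) (Q.map f) := by
  induction Q using Polynomial.induction_on' with
  | add p q hp hq => simp [hp, hq]
  | monomial n a =>
    simp only [Polynomial.aeval_monomial, map_mul, map_pow, Polynomial.map_monomial]
    congr 1
    exact PowerSeries.map_C f a

variable {p : ℕ} [hp : Fact p.Prime] (O : ValuationSubring ℂ) [CharP (ResidueField O) p]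

include hp

omit hp [CharP (ResidueField O) p] in
lemma mem_valuationSubring_of_isIntegral {x : ℂ} (hx : IsIntegral ℤ x) : x ∈ O := by
  have h : IsIntegral O x := hx.tower_top
  obtain ⟨y, hy⟩ := IsIntegrallyClosed.isIntegral_iff.mp h
  rw [← hy]
  exact y.2

omit hp in
lemma isUnit_natCast_valuationSubring {n : ℕ} (hn : ¬ p ∣ n) : IsUnit (n : O) := by
  rw [← notMem_maximalIdeal, ← residue_eq_zero_iff, map_natCast,
    CharP.cast_eq_zero_iff (ResidueField O) p]
  exact hn

lemma exists_zeta : ∃ ζ : O, (ζ : ℂ) = zetaP p ∧ residue O ζ = 1 := by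
  have h1 := zetaP_pow p hp.out.ne_zero
  have hi : IsIntegral ℤ (zetaP p) := by
    refine IsIntegral.of_pow hp.out.pos ?_
    rw [h1]
    exact isIntegral_one
  refine ⟨⟨_, mem_valuationSubring_of_isIntegral O hi⟩, rfl, ?_⟩
  set z : O := ⟨_, mem_valuationSubring_of_isIntegral O hi⟩
  have hz : z ^ p = 1 := Subtype.ext h1
  have h2 : (residue O z - 1) ^ p = 0 := by
    rw [sub_pow_char, one_pow, ← map_pow, hz, map_one, sub_self]
  exact sub_eq_zero.mp (pow_eq_zero_iff hp.out.ne_zero |>.mp h2)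

omit hp in
lemma map_subtype_intCast (s : ℤ⟦X⟧) :
    (s.map (Int.castRingHom O)).map O.subtype = s.map (Int.castRingHom ℂ) := by
  ext n
  simp

omit hp in
lemma map_residue_intCast (s : ℤ⟦X⟧) :
    (s.map (Int.castRingHom O)).map (residue O) = s.map (Int.castRingHom (ResidueField O)) := by
  ext n
  simp

omit hp in
lemma lamZ_eq_X_mul : ∃ u : ℤ⟦X⟧, lamZ = X * u ∧ u.constantCoeff = 16 := by
  refine ⟨psiZ ^ 4 * thetaInvZ ^ 4, rfl, ?_⟩
  have := coeff_one_lamZ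
  rw [lamZ, show 1 = 0 + 1 from rfl, coeff_succ_X_mul] at this
  simpa using this

lemma map_lamZ_ne_zero {K : Type*} [Field K] [CharP K p] (hp2 : p ≠ 2) :
    lamZ.map (Int.castRingHom K) ≠ 0 := by
  intro h
  have := congrArg (PowerSeries.coeff 1) h
  rw [coeff_map, coeff_one_lamZ] at this
  have h16 : ((16 : ℕ) : K) = 0 := by simpa using this
  rw [CharP.cast_eq_zero_iff K p, show 16 = 2 ^ 4 from rfl] at h16
  exact hp2 ((Nat.prime_dvd_prime_iff_eq hp.out Nat.prime_two).mp (hp.out.dvd_of_dvd_pow h16))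

/-- A polynomial in `λ` with integral `q`-expansion has integral coefficients. -/
theorem exists_integral_polynomial (hp2 : p ≠ 2) {P : Polynomial ℂ} {t : O⟦X⟧}
    (hP : HasQ p (fun τ => P.eval (lam τ)) (t.map O.subtype)) :
    ∃ Q : Polynomial O, Q.map O.subtype = P ∧
      Polynomial.aeval (PowerSeries.expand p hp.out.ne_zero
        (lamZ.map (Int.castRingHom (ResidueField O)))) (Q.map (residue O)) =
        t.map (residue O) := by
  obtain ⟨u, hu, hu16⟩ := lamZ_eq_X_mul
  set s : O⟦X⟧ := PowerSeries.expand p hp.out.ne_zero (lamZ.map (Int.castRingHom O)) with hs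
  have hsι : s.map O.subtype =
      PowerSeries.expand p hp.out.ne_zero (lamZ.map (Int.castRingHom ℂ)) := by
    rw [hs, PowerSeries.map_expand, map_subtype_intCast]
  have hsπ : s.map (residue O) =
      PowerSeries.expand p hp.out.ne_zero (lamZ.map (Int.castRingHom (ResidueField O))) := by
    rw [hs, PowerSeries.map_expand, map_residue_intCast]
  have hsu : s = X ^ p * PowerSeries.expand p hp.out.ne_zero (u.map (Int.castRingHom O)) := by
    rw [hs, hu]
    simp [PowerSeries.expand_X]
  have hunit : IsUnit (PowerSeries.expand p hp.out.ne_zero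
      (u.map (Int.castRingHom O))).constantCoeff := by
    rw [PowerSeries.constantCoeff_expand, ← coeff_zero_eq_constantCoeff_apply, coeff_map,
      coeff_zero_eq_constantCoeff_apply, hu16]
    have := isUnit_natCast_valuationSubring (p := p) O (n := 16) (by
      intro h16
      rw [show 16 = 2 ^ 4 from rfl] at h16
      exact hp2 ((Nat.prime_dvd_prime_iff_eq hp.out Nat.prime_two).mp
        (hp.out.dvd_of_dvd_pow h16)))
    simpa using this
  have h := (hasQ_lam.self_level hp.out.ne_zero).aeval P |>.unique hp.out.pos hP
  rw [← hsι] at h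
  have hinj : Function.Injective O.subtype := Subtype.val_injective
  have hc := coeff_mem_of_aeval_powerSeries hinj hp.out.pos hsu hunit h
  obtain ⟨Q, hQ⟩ := (Polynomial.mem_lifts P).mp ((Polynomial.lifts_iff_coeff_lifts P).mpr hc)
  refine ⟨Q, hQ, ?_⟩
  have h2 : Polynomial.aeval s Q = t := by
    apply PowerSeries.map_injective _ hinj
    rw [← h, ← hQ, map_aeval_powerSeries]
  rw [← hsπ, ← h2, map_aeval_powerSeries]

omit O in
/-- Frobenius on `q`-series with coefficients in the prime field. -/
lemma expand_map_intCast {K : Type*} [Field K] [CharP K p] (s : ℤ⟦X⟧) :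
    PowerSeries.expand p hp.out.ne_zero (s.map (Int.castRingHom K)) =
      s.map (Int.castRingHom K) ^ p := by
  have : ExpChar K p := ExpChar.prime hp.out
  have h := MvPowerSeries.map_frobenius_expand p hp.out.ne_zero
    (f := (s.map (Int.castRingHom K) : MvPowerSeries Unit K))
  have h2 : (PowerSeries.expand p hp.out.ne_zero (s.map (Int.castRingHom K))).map
      (frobenius K p) = s.map (Int.castRingHom K) ^ p := h
  rw [← h2, PowerSeries.map_expand]
  congr 1
  ext n
  simp

end Reduction

section HeckePoly

/-- The product of the differences between `λ` and its Hecke transforms. -/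
noncomputable def heckePsi (p : ℕ) (τ : ℂ) : ℂ :=
  ∏ i : Option (Fin p), (lam τ - lam (mob (heckeRep p i) τ))

lemma BddInfty.comp_mul_im {F φ : ℂ → ℂ} (hF : BddInfty F) {c : ℝ} (hc : 0 < c)
    (hφ : ∀ τ : ℂ, 0 < τ.im → (φ τ).im = c * τ.im) : BddInfty fun τ => F (φ τ) := by
  obtain ⟨B, Y, hB⟩ := hF
  refine ⟨B, Y / c, fun τ hτ h => hB _ ?_ ?_⟩
  · rw [hφ τ hτ]; positivity
  · rw [hφ τ hτ]
    rw [div_le_iff₀ hc] at h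
    linarith

variable {p : ℕ} [hp : Fact p.Prime]

include hp

lemma heckeRep_im_pos (i : Option (Fin p)) {τ : ℂ} (hτ : 0 < τ.im) :
    0 < (mob (heckeRep p i) τ).im :=
  mob_im_pos (by rw [det_heckeRep]; exact_mod_cast hp.out.pos) hτ

lemma BddInfty.hecke {F : ℂ → ℂ} (hF : BddInfty F) (i : Option (Fin p)) :
    BddInfty fun τ => F (mob (heckeRep p i) τ) := by
  have h0 : (0 : ℝ) < p := by exact_mod_cast hp.out.pos
  cases i with
  | none =>
    exact hF.comp_mul_im h0 fun τ _ => by rw [mob_heckeRep_none]; simp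
  | some j =>
    refine hF.comp_mul_im (inv_pos.mpr h0) fun τ _ => ?_
    rw [mob_heckeRep_some, Complex.div_natCast_im]
    simp
    field_simp

omit hp in
lemma bddInfty_lam_div_nome : BddInfty fun τ => lam τ / nome 1 τ := by
  refine ((hasQ_psi.pow 4).mul (hasQ_th3_inv.pow 4)).bddInfty.congr fun τ _ => ?_
  rw [lam, th2_pow_four]
  have := nome_ne_zero 1 τ
  field_simp

lemma lam_hecke_mob (hp2 : p ≠ 2) {N : Matrix (Fin 2) (Fin 2) ℤ} (hN : N.det = 1) {f : ℂ → ℂ}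
    (hf : ∀ z : ℂ, 0 < z.im → lam (mob N z) = f (lam z)) :
    ∃ σ : Equiv.Perm (Option (Fin p)), ∀ i, ∀ τ : ℂ, 0 < τ.im →
      lam (mob (heckeRep p i) (mob N τ)) = f (lam (mob (heckeRep p (σ i)) τ)) := by
  obtain ⟨σ, hσ⟩ := exists_heckePerm hp2 hN
  refine ⟨σ, fun i τ hτ => ?_⟩
  obtain ⟨γ, h1, h2, h3⟩ := hσ i
  have hd : ∀ k, 0 < (heckeRep p k).det := fun k => by
    rw [det_heckeRep]; exact_mod_cast hp.out.pos
  have hz := heckeRep_im_pos (σ i) hτ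
  rw [← mob_mul (hd i) (by omega) hτ, h3, mul_assoc, mob_mul (by omega)
    (by rw [Matrix.det_mul, h1, one_mul]; exact hd _) hτ, mob_mul (by omega) (hd _) hτ,
    hf _ (mob_im_pos (by omega) hz), lam_mob h1 h2 hz]

lemma heckePsi_mob (hp2 : p ≠ 2) {N : Matrix (Fin 2) (Fin 2) ℤ} (hN : N.det = 1) {f : ℂ → ℂ}
    (hf : ∀ z : ℂ, 0 < z.im → lam (mob N z) = f (lam z)) {τ : ℂ} (hτ : 0 < τ.im) :
    heckePsi p (mob N τ) =
      ∏ i : Option (Fin p), (f (lam τ) - f (lam (mob (heckeRep p i) τ))) := by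
  obtain ⟨σ, hσ⟩ := lam_hecke_mob hp2 hN hf
  rw [heckePsi, ← Equiv.prod_comp σ fun i => f (lam τ) - f (lam (mob (heckeRep p i) τ))]
  refine Finset.prod_congr rfl fun i _ => ?_
  rw [hσ i τ hτ, hf τ hτ]

lemma heckePsi_S (hp2 : p ≠ 2) {τ : ℂ} (hτ : 0 < τ.im) : heckePsi p (-1 / τ) = heckePsi p τ := by
  rw [← mob_S, heckePsi_mob hp2 (by simp [Matrix.det_fin_two]) (f := fun x => 1 - x)
    (fun z hz => by rw [mob_S, lam_S hz]) hτ, heckePsi]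
  have h : ∀ i ∈ (univ : Finset (Option (Fin p))),
      (1 - lam τ - (1 - lam (mob (heckeRep p i) τ))) =
        (-1) * (lam τ - lam (mob (heckeRep p i) τ)) := fun i _ => by ring
  rw [Finset.prod_congr rfl h, Finset.prod_mul_distrib, Finset.prod_const, Finset.card_univ]
  have hodd : p % 2 = 1 := hp.out.eq_two_or_odd.resolve_left hp2
  rw [Fintype.card_option, Fintype.card_fin, Even.neg_one_pow (by
    rw [Nat.even_iff]; omega), one_mul]

lemma differentiableAt_comp_hecke {F : ℂ → ℂ}
    (hF : ∀ τ : ℂ, 0 < τ.im → DifferentiableAt ℂ F τ) (i : Option (Fin p)) {τ : ℂ}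
    (hτ : 0 < τ.im) : DifferentiableAt ℂ (fun z => F (mob (heckeRep p i) z)) τ := by
  have h0 : (heckeRep p i).det ≠ 0 := by
    rw [det_heckeRep]; exact_mod_cast hp.out.ne_zero
  exact (hF _ (heckeRep_im_pos i hτ)).comp τ (hasDerivAt_mob h0 hτ).differentiableAt

lemma bddInfty_lam_div_lam_none :
    BddInfty fun τ => lam τ ^ p / lam (mob (heckeRep p none) τ) := by
  refine ((bddInfty_lam_div_nome).pow p |>.mul
    (bddInfty_nome_div_lam.hecke (p := p) none)).congr fun τ hτ => ?_
  have h1 : nome 1 (mob (heckeRep p none) τ) = nome 1 τ ^ p := by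
    rw [mob_heckeRep_none, nome, nome, ← Complex.exp_nat_mul]
    congr 1
    push_cast
    ring
  have h2 := nome_ne_zero 1 τ
  rw [h1, div_pow]
  field_simp

lemma bddInfty_lam_div_lam_some (j : Fin p) :
    BddInfty fun τ => lam τ / lam (mob (heckeRep p (some j)) τ) := by
  have h : BddInfty fun τ => nome 1 τ / nome 1 (mob (heckeRep p (some j)) τ) := by
    refine ⟨1, 0, fun τ hτ _ => ?_⟩
    have h1 : (1 : ℝ) ≤ p := by exact_mod_cast hp.out.one_le
    rw [norm_div, norm_nome, norm_nome, ← Real.exp_sub, Real.exp_le_one_iff, mob_heckeRep_some,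
      Complex.div_natCast_im]
    simp
    rw [← sub_nonneg]
    have h2 : τ.im / p ≤ τ.im := div_le_self hτ.le h1
    nlinarith [Real.pi_pos]
  refine (((bddInfty_lam_div_nome).mul h).mul
    (bddInfty_nome_div_lam.hecke (p := p) (some j))).congr fun τ hτ => ?_
  have h2 := nome_ne_zero 1 τ
  have h3 := nome_ne_zero 1 (mob (heckeRep p (some j)) τ)
  field_simp

theorem exists_heckePoly (hp2 : p ≠ 2) : ∃ P : Polynomial ℂ, P.natDegree ≤ 2 * p ∧
    ∀ τ : ℂ, 0 < τ.im → heckePsi p τ = P.eval (lam τ) := by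
  refine GammaTwoInvariant.exists_polynomial (2 * p) ?_ ?_ ?_ ?_ ?_
  · intro γ h1 h2 τ hτ
    rw [heckePsi_mob hp2 h1 (f := id) (fun z hz => lam_mob h1 h2 hz) hτ]
    rfl
  · intro τ hτ
    unfold heckePsi
    exact DifferentiableAt.fun_finsetProd fun i _ => (lam_differentiableAt hτ).sub
      (differentiableAt_comp_hecke (fun _ h => lam_differentiableAt h) i hτ)
  · exact BddInfty.prod _ fun i _ => bddInfty_lam.sub (bddInfty_lam.hecke i)
  · refine BddInfty.congr (BddInfty.prod univ (F := fun i τ =>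
      lam τ - lam (mob (heckeRep p i) τ)) fun i _ => bddInfty_lam.sub (bddInfty_lam.hecke i))
      fun τ hτ => ?_
    exact heckePsi_S hp2 hτ
  · have hb := (((bddInfty_lam_div_lam_none (p := p)).sub (bddInfty_lam.pow (p - 1))).mul
      (BddInfty.prod univ (F := fun (j : Fin p) τ =>
        lam τ / lam (mob (heckeRep p (some j)) τ) - 1) fun j _ =>
          (bddInfty_lam_div_lam_some j).sub (BddInfty.const 1)))
    refine hb.congr fun τ hτ => ?_
    rw [← mob_TS hτ, heckePsi_mob hp2 (by simp [Matrix.det_fin_two]) (f := fun x => 1 - 1 / x)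
      (fun z hz => by rw [mob_TS hz, lam_TS hz]) hτ, Fintype.prod_option, two_mul, pow_add,
      mul_mul_mul_comm]
    have h0 := lam_ne_zero hτ
    congr 1
    · have h1 := lam_ne_zero (heckeRep_im_pos (p := p) none hτ)
      have h2 : lam τ ^ p = lam τ ^ (p - 1) * lam τ := by
        rw [← pow_succ, Nat.sub_add_cancel hp.out.one_le]
      rw [h2]
      field_simp
      ring
    · have h2 : lam τ ^ p = ∏ _j : Fin p, lam τ := by simp
      rw [h2, ← Finset.prod_mul_distrib]
      refine Finset.prod_congr rfl fun j _ => ?_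
      have h1 := lam_ne_zero (heckeRep_im_pos (p := p) (some j) hτ)
      field_simp
      ring

end HeckePoly

section HeckeRoots

open PowerSeries IsLocalRing

lemma Polynomial.X_sq_dvd_of_aeval {K : Type*} [Field K] {n : ℕ} (hn : 0 < n) {u : K⟦X⟧}
    (hu : u.constantCoeff ≠ 0) {P : Polynomial K}
    (h : (PowerSeries.X : K⟦X⟧) ^ (2 * n) ∣ Polynomial.aeval (PowerSeries.X ^ n * u) P) :
    Polynomial.X ^ 2 ∣ P := by
  have key : ∀ Q : Polynomial K,
      (PowerSeries.X : K⟦X⟧) ^ n ∣ Polynomial.aeval (PowerSeries.X ^ n * u) Q →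
      Polynomial.X ∣ Q := by
    intro Q hQ
    rw [Polynomial.X_dvd_iff]
    rw [PowerSeries.X_pow_dvd_iff] at hQ
    have h1 := hQ 0 hn
    rw [coeff_zero_eq_constantCoeff_apply, Polynomial.aeval_def, Polynomial.hom_eval₂,
      show PowerSeries.constantCoeff (PowerSeries.X ^ n * u) = 0 by simp [hn.ne'],
      Polynomial.eval₂_at_zero] at h1
    simpa using h1
  obtain ⟨Q, rfl⟩ := key P ((pow_dvd_pow _ (by omega)).trans h)
  rw [pow_two]
  refine mul_dvd_mul_left _ (key Q ?_)
  rw [map_mul, Polynomial.aeval_X, two_mul, pow_add, mul_assoc] at h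
  have h2 := (mul_dvd_mul_iff_left (pow_ne_zero n PowerSeries.X_ne_zero)).mp h
  have hunit : IsUnit u := PowerSeries.isUnit_iff_constantCoeff.mpr (isUnit_iff_ne_zero.mpr hu)
  exact (hunit.dvd_mul_left).mp h2

variable {p : ℕ} [hp : Fact p.Prime]

include hp

lemma hasQ_heckePsi : HasQ p (heckePsi p) (∏ i : Option (Fin p),
    (PowerSeries.expand p hp.out.ne_zero (lamZ.map (Int.castRingHom ℂ)) -
      heckeSeries p (zetaP p) i (lamZ.map (Int.castRingHom ℂ)))) :=
  HasQ.prod (F := fun i τ => lam τ - lam (mob (heckeRep p i) τ)) _ fun i _ =>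
    (hasQ_lam.self_level hp.out.ne_zero).sub (hasQ_lam.hecke i)

lemma X_pow_dvd_heckePsi_series : (X : ℂ⟦X⟧) ^ (2 * p) ∣ ∏ i : Option (Fin p),
    (PowerSeries.expand p hp.out.ne_zero (lamZ.map (Int.castRingHom ℂ)) -
      heckeSeries p (zetaP p) i (lamZ.map (Int.castRingHom ℂ))) := by
  obtain ⟨u, hu, -⟩ := lamZ_eq_X_mul
  have h1 : (X : ℂ⟦X⟧) ^ p ∣
      PowerSeries.expand p hp.out.ne_zero (lamZ.map (Int.castRingHom ℂ)) := by
    rw [hu]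
    simp [PowerSeries.expand_X]
  rw [Fintype.prod_option, two_mul, pow_add]
  refine mul_dvd_mul (dvd_sub h1 ?_) ?_
  · rw [heckeSeries, hu]
    simp only [map_mul, map_X, PowerSeries.expand_X]
    exact (pow_dvd_pow _ (by nlinarith [hp.out.one_lt])).mul_right _
  · have h2 : (X : ℂ⟦X⟧) ^ p = ∏ _j : Fin p, X := by simp
    rw [h2]
    refine Finset.prod_dvd_prod_of_dvd _ _ fun j _ => dvd_sub ?_ ?_
    · exact (dvd_pow_self _ hp.out.ne_zero).trans h1
    · rw [heckeSeries, hu]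
      simp only [map_mul, map_X, rescale_X]
      exact ⟨_, by rw [mul_comm (C _), mul_assoc]⟩

variable {P : Polynomial ℂ} (hP : ∀ τ : ℂ, 0 < τ.im → heckePsi p τ = P.eval (lam τ))

include hP

lemma heckePoly_comp_one_sub (hp2 : p ≠ 2) : P.comp (1 - Polynomial.X) = P := by
  refine Polynomial.eq_of_infinite_eval_eq _ _ ?_
  refine Set.Infinite.mono (s := ({0, 1} : Set ℂ)ᶜ) ?_ ?_
  · intro c hc
    simp only [Set.mem_compl_iff, Set.mem_insert_iff, Set.mem_singleton_iff, not_or] at hc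
    obtain ⟨τ, hτ, rfl⟩ := exists_lam_eq hc.1 hc.2
    simp only [Set.mem_ofPred_eq, Polynomial.eval_comp, Polynomial.eval_sub, Polynomial.eval_one,
      Polynomial.eval_X]
    rw [← lam_S hτ, ← hP _ hτ, ← hP _ (im_neg_one_div_pos hτ), heckePsi_S hp2 hτ]
  · exact (Set.toFinite _).infinite_compl

lemma heckePoly_dvd (hp2 : p ≠ 2) :
    ∃ Q : Polynomial ℂ, P = Polynomial.X ^ 2 * (1 - Polynomial.X) ^ 2 * Q := by
  have h1 : Polynomial.X ^ 2 ∣ P := by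
    obtain ⟨u, hu, hu16⟩ := lamZ_eq_X_mul
    refine Polynomial.X_sq_dvd_of_aeval hp.out.pos (u :=
      PowerSeries.expand p hp.out.ne_zero (u.map (Int.castRingHom ℂ))) ?_ ?_
    · rw [PowerSeries.constantCoeff_expand, ← coeff_zero_eq_constantCoeff_apply, coeff_map,
        coeff_zero_eq_constantCoeff_apply, hu16]
      norm_num
    · have h := (hasQ_lam.self_level hp.out.ne_zero).aeval P |>.unique hp.out.pos
        (hasQ_heckePsi.congr fun τ hτ => (hP τ hτ).symm)
      have e : X ^ p * PowerSeries.expand p hp.out.ne_zero (u.map (Int.castRingHom ℂ)) =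
          PowerSeries.expand p hp.out.ne_zero (lamZ.map (Int.castRingHom ℂ)) := by
        rw [hu]
        simp [PowerSeries.expand_X]
      rw [e, h]
      exact X_pow_dvd_heckePsi_series
  have h2 : (1 - Polynomial.X) ^ 2 ∣ P := by
    obtain ⟨Q, hQ⟩ := h1
    rw [← heckePoly_comp_one_sub hP hp2, hQ]
    simp
  have hco : IsCoprime ((Polynomial.X : Polynomial ℂ) ^ 2) ((1 - Polynomial.X) ^ 2) :=
    IsCoprime.pow ⟨1, 1, by ring⟩
  exact hco.mul_dvd h1 h2

omit hP in
lemma prod_expand_sub_heckeSeries_one {K : Type*} [Field K] [CharP K p] :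
    ∏ i : Option (Fin p), (PowerSeries.expand p hp.out.ne_zero (lamZ.map (Int.castRingHom K)) -
      heckeSeries p (1 : K) i (lamZ.map (Int.castRingHom K))) =
    Polynomial.aeval (PowerSeries.expand p hp.out.ne_zero (lamZ.map (Int.castRingHom K)))
      (-(Polynomial.X ^ p - Polynomial.X) ^ 2 : Polynomial K) := by
  have : CharP K⟦X⟧ p := charP_of_injective_algebraMap (PowerSeries.C_injective) p
  have h : PowerSeries.expand (p ^ 2) (pow_ne_zero 2 hp.out.ne_zero)
      (lamZ.map (Int.castRingHom K)) = (lamZ.map (Int.castRingHom K) ^ p) ^ p := by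
    have e := PowerSeries.expand_mul (R := K) p hp.out.ne_zero p hp.out.ne_zero
      (lamZ.map (Int.castRingHom K))
    simp only [pow_two]
    rw [e, expand_map_intCast, map_pow, expand_map_intCast]
  rw [Fintype.prod_option]
  simp only [heckeSeries, one_pow, rescale_one, RingHom.id_apply, Finset.prod_const,
    Finset.card_univ, Fintype.card_fin]
  rw [h, expand_map_intCast, sub_pow_char]
  simp
  ring

theorem heckePoly_reduction (O : ValuationSubring ℂ) [CharP (ResidueField O) p] (hp2 : p ≠ 2) :
    ∃ Q : Polynomial O, Q.map O.subtype = P ∧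
      Q.map (residue O) = -(Polynomial.X ^ p - Polynomial.X) ^ 2 := by
  obtain ⟨ζ, hζ, hζ1⟩ := exists_zeta (p := p) O
  obtain ⟨Q, hQ, hQ2⟩ := exists_integral_polynomial (p := p) O hp2 (P := P)
    (t := ∏ i : Option (Fin p),
      (PowerSeries.expand p hp.out.ne_zero (lamZ.map (Int.castRingHom O)) -
        heckeSeries p ζ i (lamZ.map (Int.castRingHom O)))) (by
      refine HasQ.congr ?_ fun τ hτ => (hP τ hτ).symm
      convert hasQ_heckePsi (p := p) using 1
      rw [map_prod]
      refine Finset.prod_congr rfl fun i _ => ?_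
      rw [map_sub, heckeSeries_map, PowerSeries.map_expand, map_subtype_intCast,
        ← hζ]
      rfl)
  refine ⟨Q, hQ, ?_⟩
  rw [map_prod] at hQ2
  have h3 := hQ2.trans (Finset.prod_congr rfl fun i _ => by
    rw [map_sub, heckeSeries_map, PowerSeries.map_expand, map_residue_intCast, hζ1])
  rw [prod_expand_sub_heckeSeries_one, ← sub_eq_zero, ← map_sub] at h3
  refine sub_eq_zero.mp (eq_zero_of_aeval_powerSeries ?_ ?_ h3)
  · rw [expand_map_intCast]
    exact pow_ne_zero _ (map_lamZ_ne_zero hp2)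
  · rw [PowerSeries.constantCoeff_expand, ← coeff_zero_eq_constantCoeff_apply, coeff_map,
      coeff_zero_lamZ, map_zero]

omit hP in
lemma roots_X_pow_sub_X_sq {K : Type*} [Field K] [CharP K p] :
    (-(Polynomial.X ^ p - Polynomial.X) ^ 2 : Polynomial K).roots =
      2 • (univ : Finset (ZMod p)).val.map (ZMod.castHom (dvd_refl p) K) := by
  have h1 : (Polynomial.X ^ p - Polynomial.X : Polynomial (ZMod p)).roots = univ.val := by
    have := FiniteField.roots_X_pow_card_sub_X (ZMod p)
    rwa [ZMod.card] at this
  have hs : (Polynomial.X ^ p - Polynomial.X : Polynomial (ZMod p)).Splits := by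
    rw [Polynomial.splits_iff_card_roots, h1,
      FiniteField.X_pow_card_sub_X_natDegree_eq _ hp.out.one_lt]
    simp [ZMod.card]
  have h2 : (Polynomial.X ^ p - Polynomial.X : Polynomial K) =
      (Polynomial.X ^ p - Polynomial.X : Polynomial (ZMod p)).map
        (ZMod.castHom (dvd_refl p) K) := by simp
  rw [Polynomial.roots_neg, Polynomial.roots_pow, h2, hs.roots_map, h1]

end HeckeRoots

section RootMatching

open IsLocalRing

lemma exists_lift_roots {K : Type*} [Field K] [IsAlgClosed K] (O : ValuationSubring K)
    (Q : Polynomial O) (hQ : IsUnit Q.leadingCoeff) :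
    ∃ R : Multiset O, (Q.map O.subtype).roots = R.map O.subtype ∧
      (Q.map (residue O)).roots = R.map (residue O) := by
  have hinj : Function.Injective O.subtype := Subtype.val_injective
  have hQ0 : Q ≠ 0 := by
    rintro rfl
    simp at hQ
  have hmem : ∀ r ∈ (Q.map O.subtype).roots, r ∈ O := by
    intro r hr
    obtain ⟨u, hu⟩ := hQ
    have hmon : (Polynomial.C (↑u⁻¹ : O) * Q).Monic := by
      rw [Polynomial.Monic, Polynomial.leadingCoeff_mul, Polynomial.leadingCoeff_C, ← hu]
      simp
    have h_int : IsIntegral O r := by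
      refine ⟨_, hmon, ?_⟩
      have h1 := Polynomial.isRoot_of_mem_roots hr
      rw [Polynomial.IsRoot, Polynomial.eval_map] at h1
      rw [Polynomial.eval₂_mul]
      exact mul_eq_zero_of_right _ h1
    obtain ⟨y, hy⟩ := IsIntegrallyClosed.isIntegral_iff.mp h_int
    rw [← hy]
    exact y.2
  obtain ⟨R, hR⟩ : ∃ R : Multiset O, R.map O.subtype = (Q.map O.subtype).roots := by
    have := Multiset.canLift (α := K) (β := O) (c := O.subtype) (p := fun x => x ∈ O)
    exact this.prf _ hmem
  have hfac : Q = Polynomial.C Q.leadingCoeff *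
      (R.map fun r => Polynomial.X - Polynomial.C r).prod := by
    refine Polynomial.map_injective O.subtype hinj ?_
    have h1 := (IsAlgClosed.splits (Q.map O.subtype)).eq_prod_roots
    rw [← hR] at h1
    rw [h1, Polynomial.leadingCoeff_map_of_injective hinj, Polynomial.map_mul,
      Polynomial.map_multiset_prod]
    simp
  refine ⟨R, hR.symm, ?_⟩
  have h2 : Q.map (residue O) = Polynomial.C (residue O Q.leadingCoeff) *
      ((R.map (residue O)).map fun r => Polynomial.X - Polynomial.C r).prod := by
    conv_lhs => rw [hfac]
    rw [Polynomial.map_mul, Polynomial.map_multiset_prod]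
    simp
  rw [h2, Polynomial.roots_C_mul _ (hQ.map (residue O)).ne_zero,
    Polynomial.roots_multiset_prod_X_sub_C]

variable {p : ℕ} [hp : Fact p.Prime]

include hp

theorem heckePoly_roots {P : Polynomial ℂ} (hdeg : P.natDegree ≤ 2 * p)
    (hP : ∀ τ : ℂ, 0 < τ.im → heckePsi p τ = P.eval (lam τ)) (O : ValuationSubring ℂ)
    [CharP (ResidueField O) p] (hp2 : p ≠ 2) :
    ∃ R : Multiset O, P.roots = R.map O.subtype ∧
      R.map (residue O) =
        2 • (univ : Finset (ZMod p)).val.map (ZMod.castHom (dvd_refl p) (ResidueField O)) := by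
  obtain ⟨Q, hQ, hQ2⟩ := heckePoly_reduction hP O hp2
  have hinj : Function.Injective O.subtype := Subtype.val_injective
  have hdegQ : Q.natDegree ≤ 2 * p := by
    rw [← Polynomial.natDegree_map_eq_of_injective hinj, hQ]
    exact hdeg
  have hdeg2 : (Q.map (residue O)).natDegree = 2 * p := by
    rw [hQ2, Polynomial.natDegree_neg, Polynomial.natDegree_pow,
      FiniteField.X_pow_card_sub_X_natDegree_eq _ hp.out.one_lt]
  have hdeg3 : Q.natDegree = 2 * p :=
    le_antisymm hdegQ (hdeg2 ▸ Polynomial.natDegree_map_le)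
  have hu : IsUnit Q.leadingCoeff := by
    rw [← residue_ne_zero_iff_isUnit, Polynomial.leadingCoeff, ← Polynomial.coeff_map, hdeg3,
      ← hdeg2, Polynomial.coeff_natDegree, Polynomial.leadingCoeff_ne_zero]
    intro h
    rw [h, Polynomial.natDegree_zero] at hdeg2
    have := hp.out.pos
    omega
  obtain ⟨R, h1, h2⟩ := exists_lift_roots O Q hu
  refine ⟨R, by rw [← hQ, h1], ?_⟩
  rw [← h2, hQ2, roots_X_pow_sub_X_sq]

theorem sum_heckePoly_roots {P : Polynomial ℂ} (hdeg : P.natDegree ≤ 2 * p)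
    (hP : ∀ τ : ℂ, 0 < τ.im → heckePsi p τ = P.eval (lam τ)) (O : ValuationSubring ℂ)
    [CharP (ResidueField O) p] (hp2 : p ≠ 2) (g : ℂ → ℤ) (f : ZMod p → ℤ)
    (hg : ∀ r : O, (r : ℂ) ≠ 0 → (r : ℂ) ≠ 1 → P.IsRoot r → ∀ x : ZMod p,
      residue O r = ZMod.castHom (dvd_refl p) (ResidueField O) x → g r = f x) :
    ((P.roots.filter fun X => X ≠ 0 ∧ X ≠ 1).map g).sum =
      2 * ∑ x ∈ univ.filter (fun x : ZMod p => x ≠ 0 ∧ x ≠ 1), f x := by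
  classical
  obtain ⟨R, hR, hR2⟩ := heckePoly_roots hdeg hP O hp2
  obtain ⟨Q, hQ⟩ := heckePoly_dvd hP hp2
  have hinj : Function.Injective O.subtype := Subtype.val_injective
  set ι := ZMod.castHom (dvd_refl p) (ResidueField O) with hι
  have hιinj : Function.Injective ι := ι.injective
  have hP0 : P ≠ 0 := by
    rintro rfl
    rw [Polynomial.roots_zero, eq_comm, Multiset.map_eq_zero] at hR
    rw [hR] at hR2
    have := congrArg Multiset.card hR2
    simp [ZMod.card, hp.out.ne_zero] at this
  have hroots : P.roots = 2 • {0} + 2 • {1} + Q.roots := by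
    have h1 : (1 - Polynomial.X : Polynomial ℂ) = -(Polynomial.X - Polynomial.C 1) := by simp
    rw [hQ] at hP0 ⊢
    rw [Polynomial.roots_mul hP0, Polynomial.roots_mul (left_ne_zero_of_mul hP0),
      Polynomial.roots_pow, Polynomial.roots_pow, h1, Polynomial.roots_neg,
      Polynomial.roots_X_sub_C, Polynomial.roots_X]
  obtain ⟨R1, hR1⟩ : ∃ R1 : Multiset O, R1.map O.subtype = Q.roots := by
    have := Multiset.canLift (α := ℂ) (β := O) (c := O.subtype) (p := fun x => x ∈ O)
    refine this.prf _ fun x hx => ?_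
    have hx2 : x ∈ P.roots := hroots ▸ Multiset.mem_add.mpr (Or.inr hx)
    rw [hR] at hx2
    obtain ⟨y, -, rfl⟩ := Multiset.mem_map.mp hx2
    exact y.2
  have hRR : R = 2 • {0} + 2 • {1} + R1 := by
    refine Multiset.map_injective hinj ?_
    rw [← hR, hroots, Multiset.map_add, hR1, Multiset.map_add, Multiset.map_nsmul,
      Multiset.map_nsmul]
    simp
  have huniv : (univ : Finset (ZMod p)).val =
      {0} + {1} + (univ.filter (fun x : ZMod p => x ≠ 0 ∧ x ≠ 1)).val := by
    have h01 : (0 : ZMod p) ≠ 1 := zero_ne_one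
    refine (Multiset.Nodup.ext (Finset.nodup _) ?_).mpr ?_
    · rw [Multiset.nodup_add]
      refine ⟨?_, Finset.nodup _, ?_⟩
      · simp [Multiset.nodup_add, h01]
      · rw [Multiset.disjoint_left]
        simp
    · intro x
      by_cases h0 : x = 0 <;> by_cases h1 : x = 1 <;> simp [h0, h1]
  have hred : R1.map (residue O) =
      2 • ((univ.filter (fun x : ZMod p => x ≠ 0 ∧ x ≠ 1)).val.map ι) := by
    rw [hRR, huniv] at hR2
    simp only [Multiset.map_add, Multiset.map_nsmul, smul_add, Multiset.map_singleton, map_zero,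
      map_one] at hR2
    exact add_left_cancel hR2
  have hmem : ∀ r ∈ R1, ∃ x : ZMod p, x ≠ 0 ∧ x ≠ 1 ∧ residue O r = ι x := by
    intro r hr
    have h1 := Multiset.mem_map_of_mem (residue O) hr
    rw [hred] at h1
    have h2 := Multiset.mem_of_mem_nsmul h1
    obtain ⟨x, hx, h3⟩ := Multiset.mem_map.mp h2
    simp only [Finset.mem_val, Finset.mem_filter, Finset.mem_univ, true_and] at hx
    exact ⟨x, hx.1, hx.2, h3.symm⟩
  have hne : ∀ r ∈ R1, (r : ℂ) ≠ 0 ∧ (r : ℂ) ≠ 1 := by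
    intro r hr
    obtain ⟨x, h0, h1, h2⟩ := hmem r hr
    constructor
    · intro h
      have hr0 : r = 0 := Subtype.ext h
      rw [hr0, map_zero, ← map_zero ι] at h2
      exact h0 (hιinj h2).symm
    · intro h
      have hr0 : r = 1 := Subtype.ext h
      rw [hr0, map_one, ← map_one ι] at h2
      exact h1 (hιinj h2).symm
  have hfilter : P.roots.filter (fun X => X ≠ 0 ∧ X ≠ 1) = R1.map O.subtype := by
    rw [hroots, ← hR1, Multiset.filter_add, Multiset.filter_add]
    rw [Multiset.filter_eq_nil.mpr, Multiset.filter_eq_nil.mpr, zero_add, zero_add,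
      Multiset.filter_eq_self]
    · intro a ha
      obtain ⟨r, hr, rfl⟩ := Multiset.mem_map.mp ha
      exact hne r hr
    · intro a ha h
      have := Multiset.mem_of_mem_nsmul ha
      exact h.2 (by simpa using this)
    · intro a ha h
      have := Multiset.mem_of_mem_nsmul ha
      exact h.1 (by simpa using this)
  have hsum : ((R1.map (residue O)).map (Function.extend ι f 0)).sum =
      2 * ∑ x ∈ univ.filter (fun x : ZMod p => x ≠ 0 ∧ x ≠ 1), f x := by
    rw [hred, Multiset.map_nsmul, Multiset.sum_nsmul, Multiset.map_map, nsmul_eq_mul]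
    simp [Function.comp_def, hιinj.extend_apply, Finset.sum]
  rw [hfilter, ← hsum, Multiset.map_map, Multiset.map_map]
  congr 1
  refine Multiset.map_congr rfl fun r hr => ?_
  obtain ⟨x, h0, h1, h2⟩ := hmem r hr
  have hroot : P.IsRoot r := by
    refine Polynomial.isRoot_of_mem_roots ?_
    rw [hroots, ← hR1]
    exact Multiset.mem_add.mpr (Or.inr (Multiset.mem_map_of_mem O.subtype hr))
  rw [Function.comp_apply, Function.comp_apply, h2, hιinj.extend_apply]
  exact hg r (hne r hr).1 (hne r hr).2 hroot x h2

end RootMatching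

section HasseSeries

open PowerSeries

lemma PowerSeries.eq_C_of_expand_two_eq {R : Type*} [CommRing R] {s : R⟦X⟧}
    (h : PowerSeries.expand 2 two_ne_zero s = s) : s = C (s.constantCoeff) := by
  ext n
  induction n using Nat.strong_induction_on with
  | _ n ih =>
    rcases Nat.eq_zero_or_pos n with rfl | hn
    · simp
    · rw [coeff_C, if_neg hn.ne', ← h, PowerSeries.coeff_expand]
      split_ifs with h2
      · rw [ih _ (Nat.div_lt_self hn one_lt_two), coeff_C, if_neg]
        omega
      · rfl

variable {p : ℕ} [hp : Fact p.Prime]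

lemma hassePoly_lamZ_mul_aux {N : ℕ} (hN : p = 2 * N + 1) :
    Polynomial.aeval (lamZ.map (Int.castRingHom (ZMod p))) (hassePoly (ZMod p) N) *
      ((thetaZ ^ 2).map (Int.castRingHom (ZMod p))) ^ (p - 1) = 1 := by
  set ι := Int.castRingHom (ZMod p)
  set L := lamZ.map ι
  set k := kapZ.map ι
  set Θ := (thetaZ ^ 2).map ι
  have hL : L * (1 + k) ^ 2 = 4 * k := by
    have := congrArg (PowerSeries.map ι) lamZ_mul_one_add_kapZ_sq
    rwa [map_mul, map_mul, map_pow, map_add, map_one, map_ofNat] at this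
  have hk : k ^ 2 = PowerSeries.expand 2 two_ne_zero L := by
    have := congrArg (PowerSeries.map ι) kapZ_sq
    rw [PowerSeries.map_expand] at this
    simpa using this
  have hΘ : Θ = (1 + k) * PowerSeries.expand 2 two_ne_zero Θ := by
    have := congrArg (PowerSeries.map ι) thetaZ_sq_eq
    rwa [map_mul, PowerSeries.map_expand, map_add, map_one] at this
  have h1 := hassePoly_landen hN k L hL
  rw [hk, Polynomial.aeval_algHom_apply (PowerSeries.expand 2 two_ne_zero) L] at h1
  set H := Polynomial.aeval L (hassePoly (ZMod p) N) with hH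
  have h2 : PowerSeries.expand 2 two_ne_zero (H * Θ ^ (p - 1)) = H * Θ ^ (p - 1) := by
    conv_rhs => rw [hΘ]
    rw [map_mul, ← h1, map_pow, mul_pow]
    ring
  rw [PowerSeries.eq_C_of_expand_two_eq h2]
  have hL0 : constantCoeff L = 0 := by
    rw [← coeff_zero_eq_constantCoeff_apply, coeff_map, coeff_zero_lamZ, map_zero]
  have hΘ0 : constantCoeff Θ = 1 := by
    have : constantCoeff thetaZ = 1 := by
      rw [← coeff_zero_eq_constantCoeff_apply, coeff_zero_thetaZ]
    rw [← coeff_zero_eq_constantCoeff_apply, coeff_map, coeff_zero_eq_constantCoeff_apply, map_pow,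
      this]
    simp
  have hH0 : constantCoeff H = 1 := by
    rw [hH, Polynomial.aeval_def, Polynomial.hom_eval₂, hL0, Polynomial.eval₂_at_zero]
    simp [hassePoly, Polynomial.coeff_X_pow]
  rw [map_mul, map_pow, hΘ0, hH0]
  simp

lemma hassePoly_map {R S : Type*} [CommRing R] [CommRing S] (f : R →+* S) (N : ℕ) :
    (hassePoly R N).map f = hassePoly S N := by
  simp [hassePoly, Polynomial.map_sum]

/-- The Hasse polynomial at `λ` is a power of the weight one form `θ₃²` modulo `p`. -/
lemma hassePoly_lamZ_mul {N : ℕ} (hN : p = 2 * N + 1) {K : Type*} [Field K] [CharP K p] :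
    Polynomial.aeval (lamZ.map (Int.castRingHom K)) (hassePoly K N) *
      ((thetaZ ^ 2).map (Int.castRingHom K)) ^ (p - 1) = 1 := by
  have h := congrArg (PowerSeries.map (ZMod.castHom (dvd_refl p) K)) (hassePoly_lamZ_mul_aux hN)
  have hm : ∀ s : ℤ⟦X⟧, (s.map (Int.castRingHom (ZMod p))).map (ZMod.castHom (dvd_refl p) K) =
      s.map (Int.castRingHom K) := by
    intro s
    ext n
    simp
  rwa [map_mul, map_aeval_powerSeries, hassePoly_map, map_pow, hm, hm, map_one] at h

end HasseSeries

section HeckeEigen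

open PowerSeries IsLocalRing

/-- The ratio of the weight one form `θ₃²` to its Hecke transform. -/
noncomputable def heckeV (p : ℕ) (i : Option (Fin p)) (τ : ℂ) : ℂ :=
  jden (heckeRep p i) τ * thA τ / thA (mob (heckeRep p i) τ)

lemma BddInfty.of_sq {F : ℂ → ℂ} (h : BddInfty fun τ => F τ ^ 2) : BddInfty F := by
  obtain ⟨B, Y, hB⟩ := h
  refine ⟨B + 1, Y, fun τ h1 h2 => ?_⟩
  have h3 := hB τ h1 h2
  rw [norm_pow] at h3
  nlinarith [sq_nonneg (‖F τ‖ - 1), sq_nonneg (‖F τ‖), norm_nonneg (F τ)]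

lemma BddInfty.of_norm_eq {F G : ℂ → ℂ} (hF : BddInfty F)
    (h : ∀ τ : ℂ, 0 < τ.im → ‖G τ‖ = ‖F τ‖) : BddInfty G := by
  obtain ⟨B, Y, hB⟩ := hF
  exact ⟨B, Y, fun τ h1 h2 => (h τ h1).trans_le (hB τ h1 h2)⟩

variable {p : ℕ} [hp : Fact p.Prime]

include hp

omit hp in
lemma levelTwo_mul {M N : Matrix (Fin 2) (Fin 2) ℤ} (hM : LevelTwo M) (hN : LevelTwo N) :
    LevelTwo (M * N) := by
  obtain ⟨⟨a, ha⟩, ⟨b, hb⟩⟩ := hM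
  obtain ⟨⟨c, hc⟩, ⟨d, hd⟩⟩ := hN
  constructor
  · exact ⟨M 0 0 * c + a * N 1 1, by
      simp [Matrix.mul_apply, Fin.sum_univ_two, ha, hc]; ring⟩
  · exact ⟨b * N 0 0 + M 1 1 * d, by
      simp [Matrix.mul_apply, Fin.sum_univ_two, hb, hd]; ring⟩

omit hp in
lemma thetaLevel_of_mul_heckeRep (hp4 : p % 4 = 1) {M γ : Matrix (Fin 2) (Fin 2) ℤ}
    {i : Option (Fin p)} (hγ : LevelTwo γ) (hM : 4 ∣ M 1 1 - 1) (h : M = γ * heckeRep p i) :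
    ThetaLevel γ := by
  refine ⟨hγ.1, hγ.2, ?_⟩
  obtain ⟨c, hc⟩ := hγ.2
  obtain ⟨d, hd⟩ := hM
  have h11 := congrFun (congrFun h 1) 1
  have hp' : (p : ℤ) = 4 * ((p / 4 : ℕ) : ℤ) + 1 := by omega
  cases i with
  | none =>
    simp [heckeRep, Matrix.mul_apply, Fin.sum_univ_two] at h11
    exact ⟨d, by rw [← h11, hd]⟩
  | some j =>
    simp only [heckeRep, Matrix.mul_apply, Fin.sum_univ_two, Matrix.cons_val', Matrix.cons_val_zero,
      Matrix.cons_val_one, Matrix.of_apply, Matrix.cons_val_fin_one] at h11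
    rw [hp', hc] at h11
    exact ⟨d - c * j - γ 1 1 * ((p / 4 : ℕ) : ℤ), by linear_combination hd - h11⟩

lemma heckeV_comp_theta (hp4 : p % 4 = 1) {γ : Matrix (Fin 2) (Fin 2) ℤ} (h1 : γ.det = 1)
    (hγ : ThetaLevel γ) : ∃ σ : Equiv.Perm (Option (Fin p)), ∀ i, ∀ τ : ℂ, 0 < τ.im →
      heckeV p i (mob γ τ) = heckeV p (σ i) τ := by
  have hp2 : p ≠ 2 := by rintro rfl; omega
  obtain ⟨σ, hσ⟩ := exists_heckePerm hp2 h1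
  refine ⟨σ, fun i τ hτ => ?_⟩
  obtain ⟨γ', hd', hl', h3⟩ := hσ i
  have hd : ∀ k, 0 < (heckeRep p k).det := fun k => by
    rw [det_heckeRep]; exact_mod_cast hp.out.pos
  have hdd : (γ * γ').det = 1 := by rw [Matrix.det_mul, h1, hd', one_mul]
  have hth : ThetaLevel (γ * γ') := by
    refine thetaLevel_of_mul_heckeRep hp4 (levelTwo_mul ⟨hγ.1, hγ.2.1⟩ hl') ?_ h3
    obtain ⟨-, ⟨c, hc⟩, ⟨d, hd⟩⟩ := hγ
    have hd' : γ 1 1 = 4 * d + 1 := by linarith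
    have hp' : (p : ℤ) = 4 * ((p / 4 : ℕ) : ℤ) + 1 := by omega
    cases i with
    | none => simp [heckeRep, Matrix.mul_apply, Fin.sum_univ_two, hd']
    | some j =>
      refine ⟨4 * d * ((p / 4 : ℕ) : ℤ) + d + ((p / 4 : ℕ) : ℤ), ?_⟩
      simp only [heckeRep, Matrix.mul_apply, Fin.sum_univ_two, hd', Matrix.cons_val',
        Matrix.cons_val_zero, Matrix.cons_val_one, Matrix.of_apply, Matrix.cons_val_fin_one]
      linear_combination (4 * d + 1) * hp'
  have hz := heckeRep_im_pos (p := p) (σ i) hτ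
  obtain ⟨e1, -⟩ := fixesTheta_of_thetaLevel hdd hth _ hz
  obtain ⟨e2, -⟩ := fixesTheta_of_thetaLevel h1 hγ _ hτ
  have e3 : mob (heckeRep p i) (mob γ τ) = mob (γ * γ') (mob (heckeRep p (σ i)) τ) := by
    rw [← mob_mul (hd i) (by omega) hτ, h3, mob_mul (by omega) (hd _) hτ]
  have e4 : jden (heckeRep p i) (mob γ τ) * jden γ τ =
      jden (γ * γ') (mob (heckeRep p (σ i)) τ) * jden (heckeRep p (σ i)) τ := by
    rw [← jden_mul _ (by omega) hτ, h3, jden_mul _ (hd _).ne' hτ]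
  have n1 := jden_ne_zero (M := γ * γ') (by omega) hz
  have n2 := thA_ne_zero hz
  rw [heckeV, heckeV, e3, e1, e2, div_eq_div_iff (mul_ne_zero n1 n2) n2]
  linear_combination (thA τ * thA (mob (heckeRep p (σ i)) τ)) * e4

lemma norm_heckeV_mob (hp2 : p ≠ 2) {N : Matrix (Fin 2) (Fin 2) ℤ} (hN : N.det = 1) {r : ℂ → ℂ}
    (hA : ∀ z : ℂ, 0 < z.im → ‖thA (mob N z)‖ = ‖jden N z‖ * ‖thA z‖ * ‖r z‖)
    (hr : ∀ γ : Matrix (Fin 2) (Fin 2) ℤ, γ.det = 1 → LevelTwo γ → ∀ z : ℂ, 0 < z.im →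
      ‖r (mob γ z)‖ = ‖r z‖) (hr0 : ∀ z : ℂ, 0 < z.im → r z ≠ 0) :
    ∃ σ : Equiv.Perm (Option (Fin p)), ∀ i, ∀ τ : ℂ, 0 < τ.im →
      ‖heckeV p i (mob N τ)‖ =
        ‖heckeV p (σ i) τ * (r τ / r (mob (heckeRep p (σ i)) τ))‖ := by
  obtain ⟨σ, hσ⟩ := exists_heckePerm hp2 hN
  refine ⟨σ, fun i τ hτ => ?_⟩
  obtain ⟨γ, hd', hl', h3⟩ := hσ i
  have hd : ∀ k, 0 < (heckeRep p k).det := fun k => by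
    rw [det_heckeRep]; exact_mod_cast hp.out.pos
  have hdd : (N * γ).det = 1 := by rw [Matrix.det_mul, hN, hd', one_mul]
  have hz := heckeRep_im_pos (p := p) (σ i) hτ
  have hγz : 0 < (mob γ (mob (heckeRep p (σ i)) τ)).im := mob_im_pos (by omega) hz
  have e3 : mob (heckeRep p i) (mob N τ) = mob N (mob γ (mob (heckeRep p (σ i)) τ)) := by
    rw [← mob_mul (hd i) (by omega) hτ, h3, mob_mul (by omega) (hd _) hτ,
      mob_mul (by omega) (by omega) hz]
  have e4 : jden (heckeRep p i) (mob N τ) * jden N τ =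
      jden N (mob γ (mob (heckeRep p (σ i)) τ)) * jden γ (mob (heckeRep p (σ i)) τ) *
        jden (heckeRep p (σ i)) τ := by
    rw [← jden_mul _ (by omega) hτ, h3, jden_mul _ (hd _).ne' hτ, jden_mul _ (by omega) hz]
  have e5 := congrArg norm e4
  simp only [norm_mul] at e5
  have n1 := norm_ne_zero_iff.mpr (jden_ne_zero (M := γ) (by omega) hz)
  have n2 := norm_ne_zero_iff.mpr (thA_ne_zero hz)
  have n3 := norm_ne_zero_iff.mpr (jden_ne_zero (M := N) (by omega) hγz)
  have n4 := norm_ne_zero_iff.mpr (hr0 _ hz)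
  rw [heckeV, heckeV, e3, norm_div, norm_mul, norm_mul, norm_div, norm_div, norm_mul, hA _ hτ,
    hA _ hγz, norm_thA_mob hd' hl' hz, hr γ hd' hl' _ hz]
  field_simp
  linear_combination (‖thA τ‖ * ‖r τ‖) * e5

lemma hasQ_heckeV (i : Option (Fin p)) : HasQ p (heckeV p i)
    ((i.elim 1 fun _ => C (p : ℂ)) *
      PowerSeries.expand p hp.out.ne_zero ((thetaZ ^ 2).map (Int.castRingHom ℂ)) *
      heckeSeries p (zetaP p) i ((thetaInvZ ^ 2).map (Int.castRingHom ℂ))) := by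
  have h1 := hasQ_thA.self_level hp.out.ne_zero
  have h2 := (hasQ_th3_inv.pow 2).hecke (p := p) i
  rw [← map_pow] at h2
  cases i with
  | none =>
    have h := (((HasQ.const p 1).mul h1).mul h2)
    rw [map_one] at h
    exact h.congr fun τ hτ => by simp [heckeV, jden, heckeRep, thA, div_eq_mul_inv]
  | some j =>
    exact (((HasQ.const p (p : ℂ)).mul h1).mul h2).congr fun τ hτ => by
      simp [heckeV, jden, heckeRep, thA, div_eq_mul_inv]

/-- The monic polynomial with roots the values `heckeV p i τ`, evaluated at `y`. -/
noncomputable def heckeF (p : ℕ) (y : ℂ) (τ : ℂ) : ℂ := ∏ i : Option (Fin p), (y - heckeV p i τ)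

lemma differentiableAt_heckeV (i : Option (Fin p)) {τ : ℂ} (hτ : 0 < τ.im) :
    DifferentiableAt ℂ (heckeV p i) τ :=
  (hasQ_heckeV i).differentiableAt hp.out.pos hτ

lemma heckeF_invariant (hp4 : p % 4 = 1) (y : ℂ) : GammaTwoInvariant (heckeF p y) := by
  have key : ∀ γ : Matrix (Fin 2) (Fin 2) ℤ, γ.det = 1 → ThetaLevel γ → ∀ τ : ℂ, 0 < τ.im →
      heckeF p y (mob γ τ) = heckeF p y τ := by
    intro γ h1 h2 τ hτ
    obtain ⟨σ, hσ⟩ := heckeV_comp_theta hp4 h1 h2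
    rw [heckeF, heckeF, ← Equiv.prod_comp σ fun i => y - heckeV p i τ]
    exact Finset.prod_congr rfl fun i _ => by rw [hσ i τ hτ]
  intro γ h1 h2 τ hτ
  rcases thetaLevel_or_neg (by omega) h2 with h | h
  · exact key γ h1 h τ hτ
  · rw [← mob_neg]
    exact key _ (by rw [Matrix.det_neg]; simpa using h1) h τ hτ

lemma bddInfty_heckeV_S (hp2 : p ≠ 2) (i : Option (Fin p)) :
    BddInfty fun τ => heckeV p i (-1 / τ) := by
  obtain ⟨σ, hσ⟩ := norm_heckeV_mob (p := p) hp2 (N := !![0, -1; 1, 0])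
    (by simp [Matrix.det_fin_two]) (r := fun _ => 1) (fun z hz => by
      rw [mob_S, thA_S hz]
      simp [jden]) (fun _ _ _ _ _ => rfl) (fun _ _ => one_ne_zero)
  refine (hasQ_heckeV (p := p) (σ i)).bddInfty.of_norm_eq fun τ hτ => ?_
  have := hσ i τ hτ
  rw [mob_S] at this
  rw [this]
  simp

lemma bddInfty_heckeV_TS (hp2 : p ≠ 2) (i : Option (Fin p)) :
    BddInfty fun τ => heckeV p i (-1 / τ + 1) * lam τ ^ p := by
  have hk : ∀ z : ℂ, (th2 z ^ 2 / th3 z ^ 2) ^ 2 = lam z := by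
    intro z
    rw [lam, div_pow, ← pow_mul, ← pow_mul]
  obtain ⟨σ, hσ⟩ := norm_heckeV_mob (p := p) hp2 (N := !![1, -1; 1, 0])
    (by simp [Matrix.det_fin_two]) (r := fun z => th2 z ^ 2 / th3 z ^ 2) (fun z hz => by
      have := th3_ne_zero hz
      rw [mob_TS hz, thA_TS hz, ← norm_mul, ← norm_mul, thA]
      simp only [jden, Matrix.cons_val', Matrix.cons_val_zero, Matrix.cons_val_one,
        Matrix.of_apply, Matrix.cons_val_fin_one, Int.cast_one, Int.cast_zero]
      rw [← norm_neg]
      have e : (1 * z + 0) * th3 z ^ 2 * (th2 z ^ 2 / th3 z ^ 2) = z * th2 z ^ 2 := by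
        field_simp
        ring
      rw [e]
      simp) (fun γ h1 h2 z hz => by
      rw [← sq_eq_sq₀ (norm_nonneg _) (norm_nonneg _), ← norm_pow, ← norm_pow, hk, hk,
        lam_mob h1 h2 hz]) (fun z hz => div_ne_zero (pow_ne_zero _ (th2_ne_zero hz))
          (pow_ne_zero _ (th3_ne_zero hz)))
  have hbd : BddInfty fun τ => lam τ ^ p / lam (mob (heckeRep p (σ i)) τ) := by
    cases σ i with
    | none => exact bddInfty_lam_div_lam_none
    | some j =>
      refine ((bddInfty_lam_div_lam_some j).mul (bddInfty_lam.pow (p - 1))).congr fun τ _ => ?_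
      have h2 : lam τ ^ p = lam τ * lam τ ^ (p - 1) := by
        rw [← pow_succ', Nat.sub_add_cancel hp.out.one_le]
      rw [h2]
      ring
  have hrb : BddInfty fun τ => th2 τ ^ 2 / th3 τ ^ 2 / (th2 (mob (heckeRep p (σ i)) τ) ^ 2 /
      th3 (mob (heckeRep p (σ i)) τ) ^ 2) * lam τ ^ p := by
    refine BddInfty.of_sq ((hbd.mul (bddInfty_lam.pow (p + 1))).congr fun τ _ => ?_)
    rw [mul_pow, div_pow, hk, hk]
    ring
  refine (((hasQ_heckeV (p := p) (σ i)).bddInfty).mul hrb).of_norm_eq fun τ hτ => ?_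
  have := hσ i τ hτ
  rw [mob_TS hτ] at this
  rw [norm_mul, this, ← norm_mul, mul_assoc]

theorem exists_heckeF_polynomial (hp4 : p % 4 = 1) (y : ℂ) : ∃ P : Polynomial ℂ,
    ∀ τ : ℂ, 0 < τ.im → heckeF p y τ = P.eval (lam τ) := by
  have hp2 : p ≠ 2 := by rintro rfl; omega
  obtain ⟨P, -, hP⟩ := (heckeF_invariant hp4 y).exists_polynomial (p * (p + 1))
    (fun τ hτ => DifferentiableAt.fun_finsetProd fun i _ =>
      (differentiableAt_const y).sub (differentiableAt_heckeV i hτ))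
    (BddInfty.prod univ (F := fun i τ => y - heckeV p i τ) fun i _ =>
      (BddInfty.const y).sub (hasQ_heckeV i).bddInfty)
    (BddInfty.prod univ (F := fun i τ => y - heckeV p i (-1 / τ)) fun i _ =>
      (BddInfty.const y).sub (bddInfty_heckeV_S hp2 i))
    ((BddInfty.prod univ (F := fun i τ => y * lam τ ^ p - heckeV p i (-1 / τ + 1) * lam τ ^ p)
      fun i _ => ((BddInfty.const y).mul (bddInfty_lam.pow p)).sub
        (bddInfty_heckeV_TS hp2 i)).congr fun τ _ => by
      have e : lam τ ^ (p * (p + 1)) = ∏ _i : Option (Fin p), lam τ ^ p := by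
        simp [← pow_mul]
      rw [heckeF, e, ← Finset.prod_mul_distrib]
      exact Finset.prod_congr rfl fun i _ => sub_mul _ _ _)
  exact ⟨P, hP⟩

end HeckeEigen

section HeckeEigenReduction

open PowerSeries IsLocalRing

variable {p : ℕ} [hp : Fact p.Prime]

include hp

lemma heckeF_series_reduction {K : Type*} [Field K] [CharP K p] {N : ℕ} (hN : p = 2 * N + 1)
    (y : K) :
    ∏ i : Option (Fin p), (C y - (i.elim 1 fun _ => C (p : K)) *
      PowerSeries.expand p hp.out.ne_zero ((thetaZ ^ 2).map (Int.castRingHom K)) *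
      heckeSeries p (1 : K) i ((thetaInvZ ^ 2).map (Int.castRingHom K))) =
    Polynomial.aeval (PowerSeries.expand p hp.out.ne_zero (lamZ.map (Int.castRingHom K)))
      (Polynomial.C (y ^ p) * (Polynomial.C y - hassePoly K N)) := by
  set Θ := (thetaZ ^ 2).map (Int.castRingHom K) with hΘ
  set Φ := (thetaInvZ ^ 2).map (Int.castRingHom K) with hΦ
  have hΘΦ : Θ * Φ = 1 := by
    rw [hΘ, hΦ, ← map_mul, ← mul_pow, thetaZ_mul_inv, one_pow, map_one]
  have h : PowerSeries.expand (p ^ 2) (pow_ne_zero 2 hp.out.ne_zero) Φ = (Φ ^ p) ^ p := by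
    have e := PowerSeries.expand_mul (R := K) p hp.out.ne_zero p hp.out.ne_zero Φ
    simp only [pow_two]
    rw [e, hΦ, expand_map_intCast, map_pow, expand_map_intCast]
  have h1 : Θ ^ p * (Φ ^ p) ^ p = (Φ ^ (p - 1)) ^ p := by
    rw [← mul_pow]
    congr 1
    obtain ⟨k, hk⟩ : ∃ k, p = k + 1 := ⟨p - 1, (Nat.sub_add_cancel hp.out.one_le).symm⟩
    rw [hk, pow_succ, Nat.add_sub_cancel, mul_left_comm, hΘΦ, mul_one]
  have h2 : Φ ^ (p - 1) =
      Polynomial.aeval (lamZ.map (Int.castRingHom K)) (hassePoly K N) := by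
    have e := hassePoly_lamZ_mul hN (K := K)
    rw [← hΘ] at e
    calc Φ ^ (p - 1) = Polynomial.aeval (lamZ.map (Int.castRingHom K)) (hassePoly K N) *
          Θ ^ (p - 1) * Φ ^ (p - 1) := by rw [e, one_mul]
      _ = _ := by rw [mul_assoc, ← mul_pow, hΘΦ, one_pow, mul_one]
  have h3 : (Φ ^ (p - 1)) ^ p = PowerSeries.expand p hp.out.ne_zero (Φ ^ (p - 1)) := by
    rw [map_pow, hΦ, expand_map_intCast, ← pow_mul, ← pow_mul, mul_comm]
  rw [Fintype.prod_option]
  simp only [Option.elim, heckeSeries, CharP.cast_eq_zero, map_zero, zero_mul, sub_zero,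
    Finset.prod_const, Finset.card_univ, Fintype.card_fin, one_mul]
  rw [h, hΘ, expand_map_intCast, ← hΘ, h1, h3, h2,
    ← Polynomial.aeval_algHom_apply (PowerSeries.expand p hp.out.ne_zero)]
  simp only [map_mul, map_sub, Polynomial.aeval_C, map_pow]
  rw [show (algebraMap K K⟦X⟧) y = C y from rfl]
  ring

theorem heckeF_reduction (O : ValuationSubring ℂ) [CharP (ResidueField O) p] {N : ℕ}
    (hN : p = 2 * N + 1) (y : O) {P : Polynomial ℂ}
    (hP : ∀ τ : ℂ, 0 < τ.im → heckeF p y τ = P.eval (lam τ)) :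
    ∃ Q : Polynomial O, Q.map O.subtype = P ∧
      Q.map (residue O) = Polynomial.C (residue O y ^ p) *
        (Polynomial.C (residue O y) - hassePoly (ResidueField O) N) := by
  have hp2 : p ≠ 2 := by omega
  obtain ⟨ζ, hζ, hζ1⟩ := exists_zeta (p := p) O
  obtain ⟨Q, hQ, hQ2⟩ := exists_integral_polynomial (p := p) O hp2 (P := P)
    (t := ∏ i : Option (Fin p), (C y - (i.elim 1 fun _ => C (p : O)) *
      PowerSeries.expand p hp.out.ne_zero ((thetaZ ^ 2).map (Int.castRingHom O)) *
      heckeSeries p ζ i ((thetaInvZ ^ 2).map (Int.castRingHom O)))) (by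
      have h := HasQ.prod (F := fun i τ => (y : ℂ) - heckeV p i τ) univ fun i _ =>
        (HasQ.const p (y : ℂ)).sub (hasQ_heckeV i)
      refine HasQ.congr ?_ fun τ hτ => (hP τ hτ).symm
      convert h using 1
      · rfl
      rw [map_prod]
      refine Finset.prod_congr rfl fun i _ => ?_
      rw [map_sub, map_mul, map_mul, heckeSeries_map, PowerSeries.map_expand,
        map_subtype_intCast, map_subtype_intCast, PowerSeries.map_C,
        show O.subtype ζ = zetaP p from hζ]
      congr 3
      cases i <;> simp)
  refine ⟨Q, hQ, ?_⟩
  rw [map_prod] at hQ2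
  have h3 := hQ2.trans (Finset.prod_congr rfl fun i _ => by
    rw [map_sub, map_mul, map_mul, heckeSeries_map, PowerSeries.map_expand, map_residue_intCast,
      map_residue_intCast, hζ1, PowerSeries.map_C,
      show (PowerSeries.map (residue O)) (i.elim 1 fun _ => C (p : O)) =
        i.elim 1 fun _ => C (p : ResidueField O) by
          cases i
          · simp
          · simp only [Option.elim, map_natCast]])
  rw [heckeF_series_reduction hN, ← sub_eq_zero, ← map_sub] at h3
  refine sub_eq_zero.mp (eq_zero_of_aeval_powerSeries ?_ ?_ h3)
  · rw [expand_map_intCast]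
    exact pow_ne_zero _ (map_lamZ_ne_zero hp2)
  · rw [PowerSeries.constantCoeff_expand, ← coeff_zero_eq_constantCoeff_apply, coeff_map,
      coeff_zero_lamZ, map_zero]

theorem residue_heckeV (O : ValuationSubring ℂ) [CharP (ResidueField O) p] (hp4 : p % 4 = 1)
    {y r : O} {τ : ℂ} (hτ : 0 < τ.im) {i : Option (Fin p)} (hy : (y : ℂ) = heckeV p i τ)
    (hr : (r : ℂ) = lam τ) {x : ZMod p}
    (hx : residue O r = ZMod.castHom (dvd_refl p) (ResidueField O) x) :
    residue O y = 0 ∨ residue O y = (legA p x : ResidueField O) := by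
  obtain ⟨P, hP⟩ := exists_heckeF_polynomial hp4 (y : ℂ)
  obtain ⟨Q, hQ, hQ2⟩ := heckeF_reduction (p := p) (N := (p - 1) / 2) O (by omega) y hP
  have h1 : P.eval (lam τ) = 0 := by
    rw [← hP τ hτ, heckeF]
    exact Finset.prod_eq_zero (Finset.mem_univ i) (by rw [hy, sub_self])
  have h2 : Q.eval r = 0 := by
    apply Subtype.val_injective
    have e := Polynomial.eval_map_apply O.subtype r (p := Q)
    rw [hQ] at e
    have e2 : P.eval (r : ℂ) = ((Q.eval r : O) : ℂ) := e
    rw [← e2, hr, h1]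
    rfl
  have h3 : (Q.map (residue O)).eval (residue O r) = 0 := by
    rw [Polynomial.eval_map_apply, h2, map_zero]
  have h4 : (hassePoly (ResidueField O) ((p - 1) / 2)).eval (residue O r) =
      (legA p x : ResidueField O) := by
    rw [hx, ← hassePoly_map (ZMod.castHom (dvd_refl p) (ResidueField O)),
      Polynomial.eval_map_apply, ← legA_cast hp4]
    simp
  rw [hQ2, Polynomial.eval_mul, Polynomial.eval_C, Polynomial.eval_sub, Polynomial.eval_C, h4,
    mul_eq_zero, sub_eq_zero] at h3
  exact h3.imp_left fun h => (pow_eq_zero_iff hp.out.ne_zero).mp h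

end HeckeEigenReduction

section TraceMatching

open IsLocalRing

/-- The integral matrices of determinant `p` that are congruent to `1` modulo `2` and have
lower right entry congruent to `1` modulo `4`. -/
def HeckeMat (p : ℕ) (M : Matrix (Fin 2) (Fin 2) ℤ) : Prop :=
  M.det = p ∧ LevelTwo M ∧ 4 ∣ M 1 1 - 1

variable {p : ℕ} [hp : Fact p.Prime] {M : Matrix (Fin 2) (Fin 2) ℤ} {τ : ℂ}

lemma fixed_eq (hτ : 0 < τ.im) (hdet : M.det ≠ 0) (hfix : mob M τ = τ) :
    (M 1 0 : ℂ) * τ ^ 2 + ((M 1 1 : ℂ) - M 0 0) * τ - M 0 1 = 0 := by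
  have h := jden_ne_zero hdet hτ
  rw [mob, div_eq_iff h, jden] at hfix
  linear_combination -hfix

lemma fixed_re_im (hτ : 0 < τ.im) (hdet : M.det ≠ 0) (hfix : mob M τ = τ) :
    2 * (M 1 0 : ℝ) * τ.re = M 0 0 - M 1 1 ∧ (M 1 0 : ℝ) * (τ.re ^ 2 + τ.im ^ 2) = - M 0 1 := by
  have h := fixed_eq hτ hdet hfix
  have h1 := congrArg Complex.re h
  have h2 := congrArg Complex.im h
  simp [pow_two] at h1 h2
  have h3 : 2 * (M 1 0 : ℝ) * τ.re = M 0 0 - M 1 1 := by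
    refine mul_right_cancel₀ hτ.ne' ?_
    linear_combination h2
  refine ⟨h3, ?_⟩
  linear_combination -h1 + τ.re * h3

lemma fixed_disc (hτ : 0 < τ.im) (hdet : M.det ≠ 0) (hfix : mob M τ = τ) :
    ((M 0 0 : ℝ) + M 1 1) ^ 2 - 4 * M.det = -4 * (M 1 0 : ℝ) ^ 2 * τ.im ^ 2 := by
  obtain ⟨h1, h2⟩ := fixed_re_im hτ hdet hfix
  have h3 : (M.det : ℝ) = M 0 0 * M 1 1 - M 0 1 * M 1 0 := by
    rw [Matrix.det_fin_two]; push_cast; ring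
  have h4 : ((M 0 0 : ℝ) - M 1 1) ^ 2 = (2 * (M 1 0 : ℝ) * τ.re) ^ 2 := by rw [h1]
  rw [h3]
  linear_combination h4 + 4 * (M 1 0 : ℝ) * h2

include hp

lemma lower_left_ne_zero_of_fixed (hM : M.det = p) (hτ : 0 < τ.im) (hfix : mob M τ = τ) :
    M 1 0 ≠ 0 := by
  intro h0
  have hdet : M.det ≠ 0 := by rw [hM]; exact_mod_cast hp.out.ne_zero
  obtain ⟨h1, h2⟩ := fixed_re_im hτ hdet hfix
  rw [h0] at h1
  have h3 : M 0 0 = M 1 1 := by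
    have : (M 0 0 : ℝ) = M 1 1 := by simp at h1; linarith
    exact_mod_cast this
  rw [Matrix.det_fin_two, h0, mul_zero, sub_zero, h3] at hM
  have hp' : Prime (p : ℤ) := Nat.prime_iff_prime_int.mp hp.out
  rw [← hM] at hp'
  exact hp'.irreducible.not_isSquare ⟨_, rfl⟩

lemma HeckeMat.lower_left_ne_zero (hM : HeckeMat p M) (hτ : 0 < τ.im) (hfix : mob M τ = τ) :
    M 1 0 ≠ 0 :=
  lower_left_ne_zero_of_fixed hM.1 hτ hfix

lemma HeckeMat.trace_sq_lt (hM : HeckeMat p M) (hτ : 0 < τ.im) (hfix : mob M τ = τ) :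
    (M 0 0 + M 1 1) ^ 2 < 4 * (p : ℤ) := by
  have hdet : M.det ≠ 0 := by rw [hM.1]; exact_mod_cast hp.out.ne_zero
  have h1 := fixed_disc hτ hdet hfix
  have h0 : (M 1 0 : ℝ) ≠ 0 := by exact_mod_cast hM.lower_left_ne_zero hτ hfix
  have h2 : 0 < (M 1 0 : ℝ) ^ 2 * τ.im ^ 2 := by positivity
  rw [hM.1] at h1
  have h3 : ((M 0 0 : ℝ) + M 1 1) ^ 2 < 4 * (p : ℝ) := by
    push_cast at h1
    linarith
  exact_mod_cast h3

omit hp in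
lemma HeckeMat.upper_left (hp4 : p % 4 = 1) (hM : HeckeMat p M) : 4 ∣ M 0 0 - 1 := by
  obtain ⟨h1, ⟨⟨b, hb⟩, ⟨c, hc⟩⟩, ⟨d, hd⟩⟩ := hM
  rw [Matrix.det_fin_two, hb, hc, show M 1 1 = 4 * d + 1 by linarith] at h1
  have hp' : (p : ℤ) = 4 * ((p / 4 : ℕ) : ℤ) + 1 := by omega
  exact ⟨((p / 4 : ℕ) : ℤ) + b * c - M 0 0 * d, by linear_combination h1 + hp'⟩

omit hp in
lemma HeckeMat.adjugate (hp4 : p % 4 = 1) (hM : HeckeMat p M) : HeckeMat p M.adjugate := by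
  have h := hM.upper_left hp4
  obtain ⟨h1, ⟨h2, h3⟩, h4⟩ := hM
  refine ⟨?_, ⟨?_, ?_⟩, ?_⟩
  · rw [Matrix.det_adjugate, h1]; simp
  · simpa [Matrix.adjugate_fin_two] using h2
  · simpa [Matrix.adjugate_fin_two] using h3
  · simpa [Matrix.adjugate_fin_two] using h

lemma mob_adjugate_fixed (hM : HeckeMat p M) (hp4 : p % 4 = 1) (hτ : 0 < τ.im)
    (hfix : mob M τ = τ) : mob M.adjugate τ = τ := by
  have hdet : M.det ≠ 0 := by rw [hM.1]; exact_mod_cast hp.out.ne_zero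
  have hdet' : M.adjugate.det ≠ 0 := by
    rw [(hM.adjugate hp4).1]; exact_mod_cast hp.out.ne_zero
  have h := fixed_eq hτ hdet hfix
  rw [mob, div_eq_iff (jden_ne_zero hdet' hτ), jden]
  simp [Matrix.adjugate_fin_two]
  linear_combination h

lemma HeckeMat.exists_heckeV (hp4 : p % 4 = 1) (hM : HeckeMat p M) (hτ : 0 < τ.im)
    (hfix : mob M τ = τ) : ∃ i, jden M τ = heckeV p i τ := by
  have hp2 : p ≠ 2 := by rintro rfl; omega
  obtain ⟨i, γ, h1, h2, h3⟩ := exists_heckeRep hp2 hM.1 hM.2.1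
  have hθ := thetaLevel_of_mul_heckeRep hp4 h2 hM.2.2 h3
  have hd : 0 < (heckeRep p i).det := by
    rw [det_heckeRep]; exact_mod_cast hp.out.pos
  have hz := heckeRep_im_pos i hτ
  refine ⟨i, ?_⟩
  have e1 : τ = mob γ (mob (heckeRep p i) τ) := by
    rw [← mob_mul (by omega) hd hτ, ← h3, hfix]
  have e2 := (fixesTheta_of_thetaLevel h1 hθ _ hz).1
  rw [← e1] at e2
  have e3 : jden M τ = jden γ (mob (heckeRep p i) τ) * jden (heckeRep p i) τ := by
    rw [h3, jden_mul _ hd.ne' hτ]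
  have n1 := thA_ne_zero hz
  rw [heckeV, e2, e3]
  field_simp

omit hp in
lemma jden_isIntegral (hτ : 0 < τ.im) (hdet : M.det ≠ 0) (hfix : mob M τ = τ) :
    IsIntegral ℤ (jden M τ) := by
  have h := fixed_eq hτ hdet hfix
  refine ⟨Polynomial.X ^ 2 - (Polynomial.C (M 0 0 + M 1 1) * Polynomial.X - Polynomial.C M.det),
    ?_, ?_⟩
  · refine Polynomial.monic_X_pow_sub ?_
    refine lt_of_le_of_lt (b := (1 : WithBot ℕ)) ?_ (by norm_num)
    compute_degree
  · rw [jden, Matrix.det_fin_two]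
    simp only [Polynomial.eval₂_sub, Polynomial.eval₂_mul, Polynomial.eval₂_pow,
      Polynomial.eval₂_X, Polynomial.eval₂_C]
    simp only [eq_intCast]
    push_cast
    linear_combination (M 1 0 : ℂ) * h

theorem HeckeMat.trace_eq (hp4 : p % 4 = 1) (h64 : 64 ≤ p) (O : ValuationSubring ℂ)
    [CharP (ResidueField O) p] (hM : HeckeMat p M) (hτ : 0 < τ.im) (hfix : mob M τ = τ) {r : O}
    (hr : (r : ℂ) = lam τ) {x : ZMod p}
    (hx : residue O r = ZMod.castHom (dvd_refl p) (ResidueField O) x) :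
    M 0 0 + M 1 1 = legA p x := by
  have hdet : M.det ≠ 0 := by rw [hM.1]; exact_mod_cast hp.out.ne_zero
  have hM' := hM.adjugate hp4
  have hdet' : M.adjugate.det ≠ 0 := by
    rw [hM'.1]; exact_mod_cast hp.out.ne_zero
  have hfix' := mob_adjugate_fixed hM hp4 hτ hfix
  obtain ⟨i, hi⟩ := hM.exists_heckeV hp4 hτ hfix
  obtain ⟨j, hj⟩ := hM'.exists_heckeV hp4 hτ hfix'
  set y : O := ⟨_, mem_valuationSubring_of_isIntegral O (jden_isIntegral hτ hdet hfix)⟩ with hy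
  set z : O := ⟨_, mem_valuationSubring_of_isIntegral O (jden_isIntegral hτ hdet' hfix')⟩ with hz
  have h1 := residue_heckeV O hp4 hτ (y := y) hi hr hx
  have h2 := residue_heckeV O hp4 hτ (y := z) hj hr hx
  have hsum : y + z = ((M 0 0 + M 1 1 : ℤ) : O) := by
    apply Subtype.val_injective
    have : jden M τ + jden M.adjugate τ = ((M 0 0 + M 1 1 : ℤ) : ℂ) := by
      simp [jden, Matrix.adjugate_fin_two]
      ring
    simpa [hy, hz] using this
  have hprod : y * z = (p : O) := by
    apply Subtype.val_injective
    have : jden M τ * jden M.adjugate τ = (p : ℂ) := by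
      have h := fixed_eq hτ hdet hfix
      have hd := congrArg (Int.cast : ℤ → ℂ) hM.1
      rw [Matrix.det_fin_two] at hd
      push_cast at hd
      simp [jden, Matrix.adjugate_fin_two]
      linear_combination -(M 1 0 : ℂ) * h + hd
    simpa [hy, hz] using this
  have hs := congrArg (residue O) hsum
  have hpr := congrArg (residue O) hprod
  rw [map_add, map_intCast] at hs
  rw [map_mul, map_natCast, CharP.cast_eq_zero] at hpr
  have htr : (((M 0 0 + M 1 1 : ℤ)) : ResidueField O) = 0 ∨
      (((M 0 0 + M 1 1 : ℤ)) : ResidueField O) = (legA p x : ResidueField O) := by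
    rw [← hs]
    rcases mul_eq_zero.mp hpr with h | h
    · rw [h, zero_add]; exact h2
    · rw [h, add_zero]; exact h1
  have hlt := hM.trace_sq_lt hτ hfix
  have hp64 : (64 : ℤ) ≤ p := by exact_mod_cast h64
  have ht4 : |M 0 0 + M 1 1| * 4 < p := by
    have : (|M 0 0 + M 1 1| * 4) ^ 2 < (p : ℤ) ^ 2 := by
      rw [mul_pow, sq_abs]; nlinarith
    exact lt_of_pow_lt_pow_left₀ 2 (by positivity) this
  have hap := two_mul_legA_sq_le hp4 x
  have ha4 : |legA p x| * 4 ≤ 3 * p := by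
    have : (|legA p x| * 4) ^ 2 ≤ (3 * (p : ℤ)) ^ 2 := by
      rw [mul_pow, sq_abs]; nlinarith
    exact le_of_sq_le_sq this (by positivity)
  rcases htr with h | h
  · exfalso
    rw [CharP.intCast_eq_zero_iff (ResidueField O) p] at h
    have h0 := Int.eq_zero_of_abs_lt_dvd h (by linarith [abs_nonneg (M 0 0 + M 1 1)])
    have := hM.upper_left hp4
    have := hM.2.2
    omega
  · rw [← sub_eq_zero, ← Int.cast_sub, CharP.intCast_eq_zero_iff (ResidueField O) p] at h
    have h0 := Int.eq_zero_of_abs_lt_dvd h (by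
      have := abs_sub (M 0 0 + M 1 1) (legA p x)
      linarith)
    linarith

end TraceMatching

section Multiplicity

variable {p : ℕ} [hp : Fact p.Prime] {M : Matrix (Fin 2) (Fin 2) ℤ} {τ : ℂ}

lemma eq_one_of_thetaLevel_of_fixed {γ : Matrix (Fin 2) (Fin 2) ℤ} (h1 : γ.det = 1)
    (hγ : ThetaLevel γ) (hτ : 0 < τ.im) (hfix : mob γ τ = τ) : γ = 1 := by
  have hdet : γ.det ≠ 0 := by simp [h1]
  have hd := fixed_disc hτ hdet hfix
  have hri := fixed_re_im hτ hdet hfix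
  obtain ⟨⟨b, hb⟩, ⟨c, hc⟩, ⟨d, hd4⟩⟩ := hγ
  have h00 : γ 0 0 = 1 + 4 * (b * c - γ 0 0 * d) := by
    have := h1
    rw [Matrix.det_fin_two, hb, hc, show γ 1 1 = 4 * d + 1 by linarith] at this
    linarith
  have hc0 : γ 1 0 = 0 := by
    by_contra h0
    have h0' : (γ 1 0 : ℝ) ≠ 0 := by exact_mod_cast h0
    have h2 : 0 < (γ 1 0 : ℝ) ^ 2 * τ.im ^ 2 := by positivity
    have h3 : (γ 0 0 + γ 1 1) ^ 2 < 4 := by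
      have : ((γ 0 0 : ℝ) + γ 1 1) ^ 2 < 4 := by
        rw [h1] at hd; push_cast at hd; linarith
      exact_mod_cast this
    have h4 : γ 0 0 + γ 1 1 < 2 := by nlinarith
    have h5 : -2 < γ 0 0 + γ 1 1 := by nlinarith
    omega
  rw [hc0] at hri
  have h6 : γ 0 0 = γ 1 1 := by
    have := hri.1; simp at this
    have : (γ 0 0 : ℝ) = γ 1 1 := by linarith
    exact_mod_cast this
  have h7 : γ 0 1 = 0 := by
    have := hri.2; simp at this; exact_mod_cast this
  have h8 : γ 1 1 = 1 := by
    rw [Matrix.det_fin_two, hc0, mul_zero, sub_zero, h6] at h1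
    rcases mul_self_eq_one_iff.mp h1 with h | h <;> omega
  ext i j
  fin_cases i <;> fin_cases j <;> simp [hc0, h7, h8, h6]

lemma thetaLevel_mul {γ κ : Matrix (Fin 2) (Fin 2) ℤ} (hγ : ThetaLevel γ) (hκ : ThetaLevel κ) :
    ThetaLevel (γ * κ) := by
  obtain ⟨⟨b, hb⟩, ⟨c, hc⟩, ⟨d, hd⟩⟩ := hγ
  obtain ⟨⟨b', hb'⟩, ⟨c', hc'⟩, ⟨d', hd'⟩⟩ := hκ
  have e1 : γ 1 1 = 4 * d + 1 := by linarith
  have e2 : κ 1 1 = 4 * d' + 1 := by linarith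
  refine ⟨⟨γ 0 0 * b' + b * κ 1 1, ?_⟩, ⟨c * κ 0 0 + γ 1 1 * c', ?_⟩,
    ⟨c * b' + 4 * d * d' + d + d', ?_⟩⟩ <;>
  simp only [Matrix.mul_apply, Fin.sum_univ_two, hb, hc, hb', hc', e1, e2] <;> ring

lemma thetaLevel_adjugate {γ : Matrix (Fin 2) (Fin 2) ℤ} (h1 : γ.det = 1) (hγ : ThetaLevel γ) :
    ThetaLevel γ.adjugate := by
  obtain ⟨⟨b, hb⟩, ⟨c, hc⟩, ⟨d, hd⟩⟩ := hγ
  have e1 : γ 1 1 = 4 * d + 1 := by linarith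
  refine ⟨?_, ?_, ?_⟩
  · simp [Matrix.adjugate_fin_two, hb]
  · simp [Matrix.adjugate_fin_two, hc]
  · rw [Matrix.det_fin_two, hb, hc, e1] at h1
    exact ⟨b * c - γ 0 0 * d, by simp [Matrix.adjugate_fin_two]; linear_combination h1⟩

omit hp in
lemma levelTwo_heckeRep (hp4 : p % 4 = 1) (i : Option (Fin p)) :
    LevelTwo (heckeRep p i) ∧ 4 ∣ heckeRep p i 1 1 - 1 := by
  cases i with
  | none => simp [LevelTwo, heckeRep]
  | some j =>
    simp [LevelTwo, heckeRep]
    omega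

omit hp in
lemma heckeMat_mul_heckeRep (hp4 : p % 4 = 1) {γ : Matrix (Fin 2) (Fin 2) ℤ} (h1 : γ.det = 1)
    (hγ : ThetaLevel γ) (i : Option (Fin p)) : HeckeMat p (γ * heckeRep p i) := by
  obtain ⟨hl, h4⟩ := levelTwo_heckeRep hp4 i
  refine ⟨by rw [Matrix.det_mul, h1, det_heckeRep, one_mul], levelTwo_mul ⟨hγ.1, hγ.2.1⟩ hl, ?_⟩
  obtain ⟨c, hc⟩ := hγ.2.1
  obtain ⟨d, hd⟩ := hγ.2.2
  obtain ⟨b, hb⟩ := hl.1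
  obtain ⟨d', hd'⟩ := h4
  refine ⟨c * b + 4 * d * d' + d + d', ?_⟩
  simp only [Matrix.mul_apply, Fin.sum_univ_two, hc, hb, show γ 1 1 = 4 * d + 1 by linarith,
    show heckeRep p i 1 1 = 4 * d' + 1 by linarith]
  ring

lemma exists_fixed_of_lam_hecke_eq (hτ : 0 < τ.im) {i : Option (Fin p)}
    (h : lam (mob (heckeRep p i) τ) = lam τ) :
    ∃ γ : Matrix (Fin 2) (Fin 2) ℤ, γ.det = 1 ∧ ThetaLevel γ ∧ mob (γ * heckeRep p i) τ = τ := by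
  obtain ⟨γ, h1, hγ, hτγ⟩ := exists_thetaLevel_of_lam_eq hτ (heckeRep_im_pos i hτ) h.symm
  refine ⟨γ, h1, hγ, ?_⟩
  rw [mob_mul (by simp [h1]) (by rw [det_heckeRep]; exact_mod_cast hp.out.pos) hτ, ← hτγ]

/-- The matrices fixing a point correspond to the Hecke representatives preserving its `λ`-value. -/
theorem exists_finset_heckeMat_fixed (hp2 : p ≠ 2) (hp4 : p % 4 = 1) (hτ : 0 < τ.im) :
    ∃ F : Finset (Matrix (Fin 2) (Fin 2) ℤ), (∀ M, M ∈ F ↔ HeckeMat p M ∧ mob M τ = τ) ∧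
      F.card = (univ.filter fun i : Option (Fin p) => lam (mob (heckeRep p i) τ) = lam τ).card := by
  classical
  have hex : ∀ i : Option (Fin p), ∃ γ : Matrix (Fin 2) (Fin 2) ℤ,
      lam (mob (heckeRep p i) τ) = lam τ →
        γ.det = 1 ∧ ThetaLevel γ ∧ mob (γ * heckeRep p i) τ = τ := by
    intro i
    by_cases h : lam (mob (heckeRep p i) τ) = lam τ
    · obtain ⟨γ, hγ⟩ := exists_fixed_of_lam_hecke_eq hτ h
      exact ⟨γ, fun _ => hγ⟩
    · exact ⟨1, fun h' => absurd h' h⟩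
  choose γ hγ using hex
  have hp0 : (0 : ℤ) < p := by exact_mod_cast hp.out.pos
  refine ⟨(univ.filter fun i => lam (mob (heckeRep p i) τ) = lam τ).image
    fun i => γ i * heckeRep p i, fun M => ?_, card_image_of_injOn ?_⟩
  · simp only [mem_image, mem_filter, mem_univ, true_and]
    constructor
    · rintro ⟨i, hi, rfl⟩
      obtain ⟨h1, h2, h3⟩ := hγ i hi
      exact ⟨heckeMat_mul_heckeRep hp4 h1 h2 i, h3⟩
    · rintro ⟨hM, hfix⟩
      obtain ⟨i, κ, hκ1, hκl, hMκ⟩ := exists_heckeRep hp2 hM.1 hM.2.1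
      have hκ := thetaLevel_of_mul_heckeRep hp4 hκl hM.2.2 hMκ
      have hσ := heckeRep_im_pos i hτ
      have hκσ : mob κ (mob (heckeRep p i) τ) = τ := by
        rw [← mob_mul (by simp [hκ1]) (by rw [det_heckeRep]; exact hp0) hτ, ← hMκ, hfix]
      have hi : lam (mob (heckeRep p i) τ) = lam τ := by
        conv_rhs => rw [← hκσ]
        exact ((fixesTheta_of_thetaLevel hκ1 hκ _ hσ).2).symm
      obtain ⟨h1, h2, h3⟩ := hγ i hi
      refine ⟨i, hi, ?_⟩
      rw [mob_mul (by simp [h1]) (by rw [det_heckeRep]; exact hp0) hτ] at h3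
      have hadj : κ.adjugate * κ = 1 := by rw [Matrix.adjugate_mul, hκ1, one_smul]
      have hadj' : κ * κ.adjugate = 1 := by rw [Matrix.mul_adjugate, hκ1, one_smul]
      have hda : κ.adjugate.det = 1 := by rw [Matrix.det_adjugate, hκ1]; simp
      have hfix' : mob (γ i * κ.adjugate) τ = τ := by
        rw [mob_mul (by simp [h1]) (by simp [hda]) hτ]
        conv_lhs => rw [← hκσ]
        rw [← mob_mul (by simp [hda]) (by simp [hκ1]) hσ, hadj, mob_one, h3]
      have := eq_one_of_thetaLevel_of_fixed (by rw [Matrix.det_mul, h1, hda, one_mul])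
        (thetaLevel_mul h2 (thetaLevel_adjugate hκ1 hκ)) hτ hfix'
      have hγκ : γ i = κ := by
        calc γ i = γ i * (κ.adjugate * κ) := by rw [hadj, mul_one]
          _ = κ := by rw [← mul_assoc, this, one_mul]
      rw [hMκ, hγκ]
  · intro i hi j hj hij
    simp only [coe_filter, mem_univ, true_and, Set.mem_ofPred_eq] at hi hj
    obtain ⟨h1, -, -⟩ := hγ i hi
    refine eq_of_heckeRep_eq_mul hp2 (g := (γ i).adjugate * γ j) ?_
    dsimp only at hij
    rw [mul_assoc, ← hij, ← mul_assoc, Matrix.adjugate_mul, h1, one_smul, one_mul]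

lemma lam_analyticAt (hτ : 0 < τ.im) : AnalyticAt ℂ lam τ :=
  DifferentiableOn.analyticAt (s := {z : ℂ | 0 < z.im})
    (fun _ hz => (lam_differentiableAt hz).differentiableWithinAt)
    ((isOpen_lt continuous_const Complex.continuous_im).mem_nhds hτ)

lemma lam_hecke_analyticAt (i : Option (Fin p)) (hτ : 0 < τ.im) :
    AnalyticAt ℂ (fun z => lam (mob (heckeRep p i) z)) τ :=
  DifferentiableOn.analyticAt (s := {z : ℂ | 0 < z.im})
    (fun _ hz => (differentiableAt_comp_hecke
      (fun _ => lam_differentiableAt) i hz).differentiableWithinAt)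
    ((isOpen_lt continuous_const Complex.continuous_im).mem_nhds hτ)

lemma analyticOrderAt_lam_sub_hecke (hp4 : p % 4 = 1) (hτ : 0 < τ.im) (i : Option (Fin p)) :
    analyticOrderAt (fun z => lam z - lam (mob (heckeRep p i) z)) τ =
      if lam (mob (heckeRep p i) τ) = lam τ then 1 else 0 := by
  have han := (lam_analyticAt hτ).sub (lam_hecke_analyticAt i hτ)
  split_ifs with h
  · obtain ⟨γ, h1, hγ, hfix⟩ := exists_fixed_of_lam_hecke_eq hτ h
    have hM := heckeMat_mul_heckeRep hp4 h1 hγ i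
    set M := γ * heckeRep p i with hMdef
    have hp0 : (0 : ℤ) < p := by exact_mod_cast hp.out.pos
    have hdet : M.det ≠ 0 := by rw [hM.1]; exact hp0.ne'
    have hder : HasDerivAt (fun z => lam z - lam (mob (heckeRep p i) z))
        (deriv lam τ - deriv lam τ * (M.det / jden M τ ^ 2)) τ := by
      have h2 : HasDerivAt (fun z => lam z - lam (mob M z))
          (deriv lam τ - deriv lam τ * (M.det / jden M τ ^ 2)) τ := by
        refine (lam_differentiableAt hτ).hasDerivAt.sub ?_
        have h3 : HasDerivAt lam (deriv lam τ) (mob M τ) := by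
          rw [hfix]; exact (lam_differentiableAt hτ).hasDerivAt
        exact h3.comp τ (hasDerivAt_mob hdet hτ)
      refine h2.congr_of_eventuallyEq ?_
      filter_upwards [(isOpen_lt continuous_const Complex.continuous_im).mem_nhds hτ] with z hz
      have hz' : 0 < z.im := hz
      rw [hMdef, mob_mul (by simp [h1]) (by rw [det_heckeRep]; exact hp0) hz',
        (fixesTheta_of_thetaLevel h1 hγ _ (heckeRep_im_pos i hz')).2]
    have hj := jden_ne_zero hdet hτ
    have hne : deriv lam τ - deriv lam τ * (M.det / jden M τ ^ 2) ≠ 0 := by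
      rw [← mul_one_sub]
      refine mul_ne_zero (deriv_lam_ne_zero hτ) fun h0 => ?_
      have h4 : jden M τ ^ 2 = p := by
        rw [hM.1] at h0
        field_simp at h0
        push_cast at h0
        linear_combination h0
      have hre := congrArg Complex.re h4
      have him := congrArg Complex.im h4
      have hjim : (jden M τ).im ≠ 0 := by
        simp [jden]
        exact ⟨hM.lower_left_ne_zero hτ hfix, hτ.ne'⟩
      simp [pow_two] at hre him
      have hjre : (jden M τ).re = 0 := by
        refine (mul_eq_zero.mp (?_ : (jden M τ).re * (jden M τ).im = 0)).resolve_right hjim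
        linarith
      rw [hjre] at hre
      have : (0 : ℝ) < p := by exact_mod_cast hp0
      nlinarith [sq_nonneg (jden M τ).im]
    rw [← hder.deriv] at hne
    have := han.analyticOrderAt_sub_eq_one_of_deriv_ne_zero hne
    simpa [h] using this
  · rw [analyticOrderAt_eq_zero]
    right
    rw [sub_ne_zero]
    exact fun h' => h h'.symm

lemma analyticOrderAt_prod {ι : Type*} (s : Finset ι) {f : ι → ℂ → ℂ} {z : ℂ}
    (hf : ∀ i ∈ s, AnalyticAt ℂ (f i) z) :
    analyticOrderAt (fun w => ∏ i ∈ s, f i w) z = ∑ i ∈ s, analyticOrderAt (f i) z := by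
  classical
  induction s using Finset.induction_on with
  | empty => simp [analyticOrderAt_eq_zero]
  | insert a s ha ih =>
    rw [sum_insert ha, ← ih fun i hi => hf i (mem_insert_of_mem hi)]
    have h2 : AnalyticAt ℂ (fun w => ∏ i ∈ s, f i w) z :=
      Finset.analyticAt_fun_prod s fun i hi => hf i (mem_insert_of_mem hi)
    rw [← analyticOrderAt_mul (hf a (mem_insert_self a s)) h2]
    congr 1
    ext w
    simp [prod_insert ha]

/-- The multiplicity of a root of the Hecke polynomial counts matrices with a given fixed point. -/
theorem rootMultiplicity_heckePoly (hp4 : p % 4 = 1) {P : Polynomial ℂ} (hP0 : P ≠ 0)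
    (hP : ∀ τ : ℂ, 0 < τ.im → heckePsi p τ = P.eval (lam τ)) (hτ : 0 < τ.im) :
    P.rootMultiplicity (lam τ) =
      (univ.filter fun i : Option (Fin p) => lam (mob (heckeRep p i) τ) = lam τ).card := by
  obtain ⟨Q, hQ, hQ0⟩ := Polynomial.exists_eq_pow_rootMultiplicity_mul_and_not_dvd P hP0 (lam τ)
  have hQ0' : Q.eval (lam τ) ≠ 0 := fun h => hQ0 (Polynomial.dvd_iff_isRoot.mpr h)
  have hlam := lam_analyticAt hτ
  have hQan : AnalyticAt ℂ (fun z => Q.eval (lam z)) τ := by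
    have := AnalyticAt.aeval_polynomial hlam Q
    simpa [Polynomial.aeval_def, Polynomial.eval₂_eq_eval_map] using this
  have h1 : analyticOrderAt (heckePsi p) τ =
      ((univ.filter fun i : Option (Fin p) => lam (mob (heckeRep p i) τ) = lam τ).card : ℕ∞) := by
    have : heckePsi p = fun τ => ∏ i : Option (Fin p), (lam τ - lam (mob (heckeRep p i) τ)) := rfl
    rw [this, analyticOrderAt_prod univ
      fun i _ => (lam_analyticAt hτ).fun_sub (lam_hecke_analyticAt i hτ),
      sum_congr rfl fun i _ => analyticOrderAt_lam_sub_hecke hp4 hτ i]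
    simp
  have h2 : analyticOrderAt (heckePsi p) τ = (P.rootMultiplicity (lam τ) : ℕ∞) := by
    have he : heckePsi p =ᶠ[nhds τ]
        (fun z => lam z - lam τ) ^ P.rootMultiplicity (lam τ) * fun z => Q.eval (lam z) := by
      filter_upwards [(isOpen_lt continuous_const Complex.continuous_im).mem_nhds hτ] with z hz
      rw [hP z hz]
      conv_lhs => rw [hQ]
      simp
    have hsub : AnalyticAt ℂ (fun z => lam z - lam τ) τ := hlam.fun_sub analyticAt_const
    rw [analyticOrderAt_congr he, analyticOrderAt_mul (hsub.pow _) hQan, analyticOrderAt_pow hsub,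
      hlam.analyticOrderAt_sub_eq_one_of_deriv_ne_zero (deriv_lam_ne_zero hτ),
      (analyticOrderAt_eq_zero (f := fun z => Q.eval (lam z))).mpr (Or.inr hQ0')]
    simp
  exact_mod_cast h2.symm.trans h1

end Multiplicity

section FundamentalDomain

open IsLocalRing

/-- Representatives of `SL(2, ℤ)` modulo the level two group. -/
def cosetRep : Fin 6 → Matrix (Fin 2) (Fin 2) ℤ :=
  ![1, !![1, 1; 0, 1], !![0, -1; 1, 0], !![0, -1; 1, 1], !![1, -1; 1, 0], !![1, 0; 1, 1]]

lemma det_cosetRep (i : Fin 6) : (cosetRep i).det = 1 := by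
  fin_cases i <;> simp [cosetRep, Matrix.det_fin_two]

lemma exists_cosetRep {g : Matrix (Fin 2) (Fin 2) ℤ} (hg : g.det = 1) :
    ∃ γ : Matrix (Fin 2) (Fin 2) ℤ, ∃ i, γ.det = 1 ∧ LevelTwo γ ∧ g = γ * cosetRep i := by
  obtain ⟨γ, h, k, h1, h2, hh, hk, hg'⟩ := exists_levelTwo_mul hg
  refine ⟨γ, ?_⟩
  have key : ∃ i, h * !![1, k; 0, 1] = cosetRep i := by
    rcases hh with rfl | rfl | rfl <;> rcases hk with rfl | rfl
    · exact ⟨0, by simp [cosetRep, ← Matrix.one_fin_two]⟩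
    · exact ⟨1, by simp [cosetRep]⟩
    · exact ⟨2, by simp [cosetRep]⟩
    · exact ⟨3, by simp [cosetRep]⟩
    · exact ⟨4, by simp [cosetRep]⟩
    · exact ⟨5, by simp [cosetRep]⟩
  obtain ⟨i, hi⟩ := key
  exact ⟨i, h1, h2, by rw [hg', hi]⟩

lemma two_dvd_levelTwo_mul_sub {γ : Matrix (Fin 2) (Fin 2) ℤ} (h1 : γ.det = 1) (hγ : LevelTwo γ)
    (r : Matrix (Fin 2) (Fin 2) ℤ) (u v : Fin 2) : 2 ∣ (γ * r) u v - r u v := by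
  obtain ⟨⟨b, hb⟩, ⟨c, hc⟩⟩ := hγ
  rw [Matrix.det_fin_two, hb] at h1
  have hodd : Odd (γ 0 0 * γ 1 1) := ⟨b * γ 1 0, by linear_combination h1⟩
  obtain ⟨⟨a, ha⟩, ⟨d, hd⟩⟩ := Int.odd_mul.mp hodd
  fin_cases u
  · exact ⟨a * r 0 v + b * r 1 v, by
      simp [Matrix.mul_apply, Fin.sum_univ_two, ha, hb]; ring⟩
  · exact ⟨c * r 0 v + d * r 1 v, by
      simp [Matrix.mul_apply, Fin.sum_univ_two, hc, hd]; ring⟩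

lemma cosetRep_injective_mod {i j : Fin 6}
    (h : ∀ u v, (cosetRep i u v - cosetRep j u v) % 2 = 0) : i = j := by
  have key : ∀ i j : Fin 6, (∀ u v, (cosetRep i u v - cosetRep j u v) % 2 = 0) → i = j := by
    decide +kernel
  exact key i j h

lemma cosetRep_eq_of_mul {γ κ : Matrix (Fin 2) (Fin 2) ℤ} (h1 : γ.det = 1) (hγ : LevelTwo γ)
    (h2 : κ.det = 1) (hκ : LevelTwo κ) {i j : Fin 6}
    (h : γ * cosetRep i = κ * cosetRep j ∨ γ * cosetRep i = -(κ * cosetRep j)) : i = j := by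
  refine cosetRep_injective_mod fun u v => ?_
  have e1 := two_dvd_levelTwo_mul_sub h1 hγ (cosetRep i) u v
  have e2 := two_dvd_levelTwo_mul_sub h2 hκ (cosetRep j) u v
  rcases h with h | h
  · rw [h] at e1; omega
  · rw [h, Matrix.neg_apply] at e1; omega

/-- Conjugation by a coset representative. -/
def twist (i : Fin 6) (N : Matrix (Fin 2) (Fin 2) ℤ) : Matrix (Fin 2) (Fin 2) ℤ :=
  cosetRep i * N * (cosetRep i).adjugate

lemma trace_conj {g : Matrix (Fin 2) (Fin 2) ℤ} (hg : g.det = 1) (N : Matrix (Fin 2) (Fin 2) ℤ) :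
    (g * N * g.adjugate) 0 0 + (g * N * g.adjugate) 1 1 = N 0 0 + N 1 1 := by
  rw [Matrix.det_fin_two] at hg
  simp [Matrix.mul_apply, Fin.sum_univ_two, Matrix.adjugate_fin_two]
  linear_combination (N 0 0 + N 1 1) * hg

lemma HeckeMat.conj {p : ℕ} {M γ : Matrix (Fin 2) (Fin 2) ℤ} (hM : HeckeMat p M) (h1 : γ.det = 1)
    (hγ : LevelTwo γ) : HeckeMat p (γ * M * γ.adjugate) := by
  have hadj : LevelTwo γ.adjugate := by
    obtain ⟨⟨b, hb⟩, ⟨c, hc⟩⟩ := hγ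
    constructor <;> simp [Matrix.adjugate_fin_two, hb, hc]
  refine ⟨?_, levelTwo_mul (levelTwo_mul hγ hM.2.1) hadj, ?_⟩
  · rw [Matrix.det_mul, Matrix.det_mul, Matrix.det_adjugate, h1, hM.1]; simp
  · obtain ⟨-, ⟨⟨b', hb'⟩, ⟨c', hc'⟩⟩, ⟨d', hd'⟩⟩ := hM
    obtain ⟨⟨b, hb⟩, ⟨c, hc⟩⟩ := hγ
    rw [Matrix.det_fin_two, hb, hc] at h1
    refine ⟨d' + c * b * (M 1 1 - M 0 0) - b * γ 1 1 * c' + γ 0 0 * c * b', ?_⟩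
    simp [Matrix.mul_apply, Fin.sum_univ_two, Matrix.adjugate_fin_two, hb, hc, hb', hc']
    linear_combination hd' + M 1 1 * h1

/-- Matrices of determinant `p` congruent to `1` modulo `2` whose fixed point lies in the closed
fundamental domain or its mirror image. -/
def FdMat (p : ℕ) (N : Matrix (Fin 2) (Fin 2) ℤ) : Prop :=
  N.det = p ∧ LevelTwo N ∧ N 0 1 * N 1 0 < 0 ∧ |N 0 0 - N 1 1| ≤ |N 1 0| ∧ |N 1 0| ≤ |N 0 1|

/-- Matrices of determinant `p` congruent to `1` modulo `2` whose fixed point lies in the open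
fundamental domain or its mirror image. -/
def FdoMat (p : ℕ) (N : Matrix (Fin 2) (Fin 2) ℤ) : Prop :=
  N.det = p ∧ LevelTwo N ∧ N 0 1 * N 1 0 < 0 ∧ |N 0 0 - N 1 1| < |N 1 0| ∧ |N 1 0| < |N 0 1|

lemma FdoMat.fdMat {p : ℕ} {N : Matrix (Fin 2) (Fin 2) ℤ} (h : FdoMat p N) : FdMat p N :=
  ⟨h.1, h.2.1, h.2.2.1, h.2.2.2.1.le, h.2.2.2.2.le⟩

lemma FdMat.trace_sq_lt {p : ℕ} {N : Matrix (Fin 2) (Fin 2) ℤ} (h : FdMat p N) :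
    (N 0 0 + N 1 1) ^ 2 + 3 * |N 0 1 * N 1 0| ≤ 4 * p := by
  obtain ⟨h1, -, h3, h4, h5⟩ := h
  have h6 := sq_le_sq.mpr h4
  have h7 : (N 1 0) ^ 2 ≤ |N 0 1 * N 1 0| := by
    rw [abs_mul, ← sq_abs (N 1 0)]
    nlinarith [abs_nonneg (N 1 0)]
  rw [Matrix.det_fin_two] at h1
  rw [abs_of_neg h3] at h7 ⊢
  nlinarith

lemma FdMat.abs_le {p : ℕ} {N : Matrix (Fin 2) (Fin 2) ℤ} (h : FdMat p N) (u v : Fin 2) :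
    |N u v| ≤ 8 * p := by
  have h0 := h.trace_sq_lt
  obtain ⟨h1, -, h3, h4, h5⟩ := h
  have hb0 : N 0 1 ≠ 0 := fun h => by simp [h] at h3
  have hc0 : N 1 0 ≠ 0 := fun h => by simp [h] at h3
  have hb1 : 1 ≤ |N 0 1| := Int.one_le_abs hb0
  have hc1 : 1 ≤ |N 1 0| := Int.one_le_abs hc0
  rw [abs_mul] at h0
  have hb : |N 0 1| ≤ 4 * p := by nlinarith [sq_nonneg (N 0 0 + N 1 1)]
  have hc : |N 1 0| ≤ 4 * p := by linarith
  have ht : |N 0 0 + N 1 1| ≤ 4 * p := by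
    rw [← sq_abs] at h0
    nlinarith [abs_nonneg (N 0 0 + N 1 1), mul_nonneg (abs_nonneg (N 0 1)) (abs_nonneg (N 1 0))]
  have hs : |N 0 0 - N 1 1| ≤ 4 * p := h4.trans hc
  rw [_root_.abs_le] at *
  fin_cases u <;> fin_cases v <;> simp <;> constructor <;> linarith

lemma finite_fdMat (p : ℕ) : {N | FdMat p N}.Finite := by
  have hf : (Set.univ.pi fun _ : Fin 2 => Set.univ.pi fun _ : Fin 2 =>
      Set.Icc (-(8 * p : ℤ)) (8 * p)).Finite :=
    Set.Finite.pi fun _ => Set.Finite.pi fun _ => Set.finite_Icc _ _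
  refine Set.Finite.subset (s := (show Set (Matrix (Fin 2) (Fin 2) ℤ) from _)) hf fun N hN => ?_
  intro u _ v _
  exact _root_.abs_le.mp (FdMat.abs_le hN u v)

/-- The matrices with fixed point in the closed fundamental domain or its mirror image. -/
noncomputable def fdFinset (p : ℕ) : Finset (Matrix (Fin 2) (Fin 2) ℤ) := (finite_fdMat p).toFinset

lemma mem_fdFinset {p : ℕ} {N : Matrix (Fin 2) (Fin 2) ℤ} : N ∈ fdFinset p ↔ FdMat p N := by
  simp [fdFinset]

variable {p : ℕ} [hp : Fact p.Prime] {N : Matrix (Fin 2) (Fin 2) ℤ}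

include hp in
lemma FdMat.exists_fixed (h : FdMat p N) : ∃ z : ℂ, 0 < z.im ∧ mob N z = z := by
  have h0 := h.trace_sq_lt
  have hb0 : N 0 1 * N 1 0 ≠ 0 := h.2.2.1.ne
  have hc0 : N 1 0 ≠ 0 := fun h => by simp [h] at hb0
  have hcR : (N 1 0 : ℝ) ≠ 0 := by exact_mod_cast hc0
  have hdisc : (N 0 0 + N 1 1) ^ 2 < 4 * (p : ℤ) := by
    have := abs_pos.mpr hb0; linarith
  have hdR : 0 < 4 * (p : ℝ) - ((N 0 0 : ℝ) + N 1 1) ^ 2 := by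
    have : ((N 0 0 : ℝ) + N 1 1) ^ 2 < 4 * (p : ℝ) := by exact_mod_cast hdisc
    linarith
  set s : ℝ := √(4 * (p : ℝ) - ((N 0 0 : ℝ) + N 1 1) ^ 2) with hs
  have hs2 : s ^ 2 = 4 * (p : ℝ) - ((N 0 0 : ℝ) + N 1 1) ^ 2 := Real.sq_sqrt hdR.le
  have hs0 : 0 < s := Real.sqrt_pos.mpr hdR
  have hdet : (N 0 0 : ℝ) * N 1 1 - N 0 1 * N 1 0 = p := by
    have := h.1
    rw [Matrix.det_fin_two] at this
    exact_mod_cast this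
  set z : ℂ := ⟨((N 0 0 : ℝ) - N 1 1) / (2 * N 1 0), s / (2 * |(N 1 0 : ℝ)|)⟩ with hz
  have hzim : 0 < z.im := by
    simp only [hz]; positivity
  refine ⟨z, hzim, ?_⟩
  have hdet0 : N.det ≠ 0 := by rw [h.1]; exact_mod_cast hp.out.ne_zero
  have him : z.im ^ 2 * (4 * (N 1 0 : ℝ) ^ 2) = s ^ 2 := by
    simp only [hz]; rw [div_pow, mul_pow, sq_abs]; field_simp; norm_num
  have hre : z.re * (2 * N 1 0) = (N 0 0 : ℝ) - N 1 1 := by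
    simp only [hz]; field_simp
  rw [mob, div_eq_iff (jden_ne_zero hdet0 hzim), jden]
  apply Complex.ext
  · simp
    refine mul_left_cancel₀ (mul_ne_zero (four_ne_zero' ℝ) hcR) ?_
    rw [hs2] at him
    linear_combination him - (2 * N 1 0 * z.re + 2 * N 1 1 - (N 0 0 + N 1 1)) * hre - 4 * hdet
  · simp
    linear_combination -z.im * hre

lemma fixed_unique {z w : ℂ} (hdet : N.det ≠ 0) (hc : N 1 0 ≠ 0) (hz : 0 < z.im) (hw : 0 < w.im)
    (h1 : mob N z = z) (h2 : mob N w = w) : z = w := by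
  obtain ⟨e1, e2⟩ := fixed_re_im hz hdet h1
  obtain ⟨e3, e4⟩ := fixed_re_im hw hdet h2
  have hcR : (N 1 0 : ℝ) ≠ 0 := by exact_mod_cast hc
  have hre : z.re = w.re := mul_left_cancel₀ (mul_ne_zero two_ne_zero hcR) (e1.trans e3.symm)
  have him : z.im ^ 2 = w.im ^ 2 := by
    have := mul_left_cancel₀ hcR (e2.trans e4.symm)
    rw [hre] at this; linarith
  exact Complex.ext hre ((sq_eq_sq₀ hz.le hw.le).mp him)

lemma fd_iff_of_fixed {z : ℂ} (hdet : N.det ≠ 0) (hc : N 1 0 ≠ 0) (hz : 0 < z.im)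
    (h1 : mob N z = z) :
    (N 0 1 * N 1 0 < 0 ∧ (|N 0 0 - N 1 1| ≤ |N 1 0| ↔ |z.re| ≤ 1 / 2) ∧
      (|N 1 0| ≤ |N 0 1| ↔ 1 ≤ Complex.normSq z)) ∧
    ((|N 0 0 - N 1 1| < |N 1 0| ↔ |z.re| < 1 / 2) ∧ (|N 1 0| < |N 0 1| ↔ 1 < Complex.normSq z)) := by
  obtain ⟨e1, e2⟩ := fixed_re_im hz hdet h1
  have hcR : (N 1 0 : ℝ) ≠ 0 := by exact_mod_cast hc
  have hcA : 0 < |(N 1 0 : ℝ)| := abs_pos.mpr hcR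
  have hn : Complex.normSq z = z.re ^ 2 + z.im ^ 2 := by rw [Complex.normSq_apply]; ring
  have hn0 : 0 < Complex.normSq z := by rw [hn]; positivity
  rw [← hn] at e2
  have hb : |(N 0 1 : ℝ)| = |(N 1 0 : ℝ)| * Complex.normSq z := by
    rw [← abs_neg, ← e2, abs_mul, abs_of_pos hn0]
  have ha : |(N 0 0 : ℝ) - N 1 1| = 2 * |(N 1 0 : ℝ)| * |z.re| := by
    rw [← e1, abs_mul, abs_mul, abs_two]
  have hbc : (N 0 1 : ℝ) * N 1 0 < 0 := by
    have : (N 0 1 : ℝ) * N 1 0 = -((N 1 0 : ℝ) ^ 2 * Complex.normSq z) := by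
      linear_combination (N 1 0 : ℝ) * e2
    rw [this]
    have : 0 < (N 1 0 : ℝ) ^ 2 := by positivity
    nlinarith
  have k1 : |N 0 0 - N 1 1| ≤ |N 1 0| ↔ |z.re| ≤ 1 / 2 := by
    rw [← @Int.cast_le ℝ]; push_cast; rw [ha]
    constructor <;> intro h <;> nlinarith
  have k2 : |N 1 0| ≤ |N 0 1| ↔ 1 ≤ Complex.normSq z := by
    rw [← @Int.cast_le ℝ]; push_cast; rw [hb]
    constructor <;> intro h <;> nlinarith
  have k3 : |N 0 0 - N 1 1| < |N 1 0| ↔ |z.re| < 1 / 2 := by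
    rw [← @Int.cast_lt ℝ]; push_cast; rw [ha]
    constructor <;> intro h <;> nlinarith
  have k4 : |N 1 0| < |N 0 1| ↔ 1 < Complex.normSq z := by
    rw [← @Int.cast_lt ℝ]; push_cast; rw [hb]
    constructor <;> intro h <;> nlinarith
  exact ⟨⟨by exact_mod_cast hbc, k1, k2⟩, k3, k4⟩

lemma exists_mob_mem_fd {τ : ℂ} (hτ : 0 < τ.im) : ∃ g : Matrix (Fin 2) (Fin 2) ℤ, g.det = 1 ∧
    |(mob g τ).re| ≤ 1 / 2 ∧ 1 ≤ Complex.normSq (mob g τ) := by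
  obtain ⟨g, hg⟩ := ModularGroup.exists_smul_mem_fd ⟨τ, hτ⟩
  have h := coe_smul_eq_mob g ⟨τ, hτ⟩
  refine ⟨g.1, g.2, ?_, ?_⟩
  · rw [← h]; exact hg.2
  · rw [← h]; exact hg.1

lemma eq_one_or_neg_one_of_mob_mem_fdo {τ : ℂ} (hτ : 0 < τ.im) (h1 : |τ.re| < 1 / 2)
    (h2 : 1 < Complex.normSq τ) {g : Matrix (Fin 2) (Fin 2) ℤ} (hg : g.det = 1)
    (h3 : |(mob g τ).re| < 1 / 2) (h4 : 1 < Complex.normSq (mob g τ)) : g = 1 ∨ g = -1 := by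
  obtain ⟨G, rfl⟩ : ∃ G : Matrix.SpecialLinearGroup (Fin 2) ℤ, G.1 = g := ⟨⟨g, hg⟩, rfl⟩
  have h := coe_smul_eq_mob G ⟨τ, hτ⟩
  have hmem : (⟨τ, hτ⟩ : UpperHalfPlane) ∈ ModularGroup.fdo := ⟨h2, h1⟩
  have hmem' : G • (⟨τ, hτ⟩ : UpperHalfPlane) ∈
      ModularGroup.fdo := by
    refine ⟨?_, ?_⟩
    · rw [h]; exact h4
    · rw [← UpperHalfPlane.coe_re, h]; exact h3
  rcases ModularGroup.eq_one_or_neg_one_of_mem_fdo_mem_fdo hmem hmem' with h | h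
  · left; exact congrArg Subtype.val h
  · right; exact congrArg Subtype.val h

end FundamentalDomain

section TraceSum

open IsLocalRing

variable {p : ℕ} [hp : Fact p.Prime] {τ : ℂ}

/-- The fixed point in the upper half plane of an elliptic matrix. -/
noncomputable def fixedPoint (N : Matrix (Fin 2) (Fin 2) ℤ) : ℂ :=
  open Classical in if h : ∃ z : ℂ, 0 < z.im ∧ mob N z = z then h.choose else 0

lemma fixedPoint_spec {N : Matrix (Fin 2) (Fin 2) ℤ} (h : FdMat p N) :
    0 < (fixedPoint N).im ∧ mob N (fixedPoint N) = fixedPoint N := by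
  have h' := h.exists_fixed
  rw [fixedPoint, dif_pos h']
  exact h'.choose_spec

lemma mob_conj_fixed {g N : Matrix (Fin 2) (Fin 2) ℤ} (hg : g.det = 1) (hN : 0 < N.det) {z : ℂ}
    (hz : 0 < z.im) (hfix : mob N z = z) : mob (g * N * g.adjugate) (mob g z) = mob g z := by
  have hadj : g.adjugate.det = 1 := by rw [Matrix.det_adjugate, hg]; simp
  have hgz : 0 < (mob g z).im := mob_im_pos (by simp [hg]) hz
  rw [mob_mul (by rw [Matrix.det_mul, hg, one_mul]; exact hN) (by simp [hadj]) hgz,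
    ← mob_mul (by simp [hadj]) (by simp [hg]) hz, Matrix.adjugate_mul, hg, one_smul, mob_one,
    mob_mul (by simp [hg]) hN hz, hfix]

lemma adjugate_mul_conj_mul {g : Matrix (Fin 2) (Fin 2) ℤ} (hg : g.det = 1)
    (M : Matrix (Fin 2) (Fin 2) ℤ) : g.adjugate * (g * M * g.adjugate) * g = M := by
  have h : g.adjugate * g = 1 := by rw [Matrix.adjugate_mul, hg, one_smul]
  calc g.adjugate * (g * M * g.adjugate) * g = (g.adjugate * g) * M * (g.adjugate * g) := by
        simp only [mul_assoc]
    _ = M := by rw [h, one_mul, mul_one]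

lemma levelTwo_conj {g M : Matrix (Fin 2) (Fin 2) ℤ} (hM : LevelTwo M) (h : 2 ∣ M 0 0 - M 1 1) :
    LevelTwo (g * M * g.adjugate) := by
  obtain ⟨⟨b, hb⟩, ⟨c, hc⟩⟩ := hM
  obtain ⟨k, hk⟩ := h
  have hk' : M 0 0 = M 1 1 + 2 * k := by linarith
  constructor
  · exact ⟨g 0 0 ^ 2 * b - g 0 0 * g 0 1 * k - g 0 1 ^ 2 * c, by
      simp [Matrix.mul_apply, Fin.sum_univ_two, Matrix.adjugate_fin_two, hb, hc, hk']; ring⟩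
  · exact ⟨g 1 1 ^ 2 * c + g 1 0 * g 1 1 * k - g 1 0 ^ 2 * b, by
      simp [Matrix.mul_apply, Fin.sum_univ_two, Matrix.adjugate_fin_two, hb, hc, hk']; ring⟩

/-- The pairs of a matrix in the fundamental domain and a coset representative conjugating it to
a Hecke matrix. -/
noncomputable def fdPairs (p : ℕ) : Finset (Matrix (Fin 2) (Fin 2) ℤ × Fin 6) :=
  open Classical in (fdFinset p ×ˢ univ).filter fun x => HeckeMat p (twist x.2 x.1)

omit hp in
lemma mem_fdPairs {x : Matrix (Fin 2) (Fin 2) ℤ × Fin 6} :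
    x ∈ fdPairs p ↔ FdMat p x.1 ∧ HeckeMat p (twist x.2 x.1) := by
  simp [fdPairs, mem_fdFinset]

/-- The `λ`-value attached to a pair. -/
noncomputable def pairLam (x : Matrix (Fin 2) (Fin 2) ℤ × Fin 6) : ℂ :=
  lam (mob (cosetRep x.2) (fixedPoint x.1))

lemma twist_fixed {x : Matrix (Fin 2) (Fin 2) ℤ × Fin 6} (hx : x ∈ fdPairs p) :
    0 < (mob (cosetRep x.2) (fixedPoint x.1)).im ∧
      mob (twist x.2 x.1) (mob (cosetRep x.2) (fixedPoint x.1)) =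
        mob (cosetRep x.2) (fixedPoint x.1) := by
  rw [mem_fdPairs] at hx
  obtain ⟨h1, h2⟩ := fixedPoint_spec hx.1
  have hd := det_cosetRep x.2
  refine ⟨mob_im_pos (by simp [hd]) h1, mob_conj_fixed hd ?_ h1 h2⟩
  rw [hx.1.1]; exact_mod_cast hp.out.pos

omit hp in
lemma fdMat_lower_left_ne_zero {N : Matrix (Fin 2) (Fin 2) ℤ} (h : FdMat p N) : N 1 0 ≠ 0 :=
  fun h0 => by have := h.2.2.1; simp [h0] at this

/-- The pairs over a point of the open fundamental domain are at most as many as the matrices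
fixing a point. -/
lemma card_fdo_fiber_le {F : Finset (Matrix (Fin 2) (Fin 2) ℤ)} (hτ : 0 < τ.im)
    (hF : ∀ M, M ∈ F ↔ HeckeMat p M ∧ mob M τ = τ) :
    (open Classical in
      (fdPairs p).filter fun x => FdoMat p x.1 ∧ pairLam x = lam τ).card ≤ F.card := by
  classical
  have hp0 : (0 : ℤ) < p := by exact_mod_cast hp.out.pos
  have hex : ∀ x : Matrix (Fin 2) (Fin 2) ℤ × Fin 6, ∃ γ : Matrix (Fin 2) (Fin 2) ℤ,
      x ∈ fdPairs p → pairLam x = lam τ → γ.det = 1 ∧ LevelTwo γ ∧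
        τ = mob γ (mob (cosetRep x.2) (fixedPoint x.1)) := by
    intro x
    by_cases h : x ∈ fdPairs p ∧ pairLam x = lam τ
    · obtain ⟨γ, h1, h2, h3⟩ := exists_thetaLevel_of_lam_eq hτ (twist_fixed h.1).1 h.2.symm
      exact ⟨γ, fun _ _ => ⟨h1, ⟨h2.1, h2.2.1⟩, h3⟩⟩
    · exact ⟨1, fun h1 h2 => absurd ⟨h1, h2⟩ h⟩
  choose γ hγ using hex
  refine card_le_card_of_injOn (fun x => γ x * twist x.2 x.1 * (γ x).adjugate) ?_ ?_
  · intro x hx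
    simp only [coe_filter, Set.mem_ofPred_eq] at hx
    obtain ⟨h1, h2, h3⟩ := hγ x hx.1 hx.2.2
    have hH := (mem_fdPairs.mp hx.1).2
    have hfix := mob_conj_fixed h1 (by rw [hH.1]; exact hp0) (twist_fixed hx.1).1
      (twist_fixed hx.1).2
    rw [← h3] at hfix
    exact (hF _).mpr ⟨hH.conj h1 h2, hfix⟩
  · intro x hx y hy hxy
    simp only [coe_filter, Set.mem_ofPred_eq] at hx hy
    obtain ⟨h1, h2, h3⟩ := hγ x hx.1 hx.2.2
    obtain ⟨k1, k2, k3⟩ := hγ y hy.1 hy.2.2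
    have hfx := fixedPoint_spec hx.2.1.fdMat
    have hfy := fixedPoint_spec hy.2.1.fdMat
    have hdx : x.1.det ≠ 0 := by rw [hx.2.1.1]; exact hp0.ne'
    have hdy : y.1.det ≠ 0 := by rw [hy.2.1.1]; exact hp0.ne'
    obtain ⟨hx1, hx2⟩ :=
      (fd_iff_of_fixed hdx (fdMat_lower_left_ne_zero hx.2.1.fdMat) hfx.1 hfx.2).2
    obtain ⟨hy1, hy2⟩ :=
      (fd_iff_of_fixed hdy (fdMat_lower_left_ne_zero hy.2.1.fdMat) hfy.1 hfy.2).2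
    set G := γ x * cosetRep x.2 with hG
    set K := γ y * cosetRep y.2 with hK
    have hGd : G.det = 1 := by rw [hG, Matrix.det_mul, h1, det_cosetRep, one_mul]
    have hKd : K.det = 1 := by rw [hK, Matrix.det_mul, k1, det_cosetRep, one_mul]
    have hKad : K.adjugate.det = 1 := by rw [Matrix.det_adjugate, hKd]; simp
    have hxG : τ = mob G (fixedPoint x.1) := by
      rw [hG, mob_mul (by simp [h1]) (by simp [det_cosetRep]) hfx.1]; exact h3
    have hyK : τ = mob K (fixedPoint y.1) := by
      rw [hK, mob_mul (by simp [k1]) (by simp [det_cosetRep]) hfy.1]; exact k3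
    have hmob : mob (K.adjugate * G) (fixedPoint x.1) = fixedPoint y.1 := by
      rw [mob_mul (by simp [hKad]) (by simp [hGd]) hfx.1, ← hxG, hyK,
        ← mob_mul (by simp [hKad]) (by simp [hKd]) hfy.1, Matrix.adjugate_mul, hKd, one_smul,
        mob_one]
    have hcase := eq_one_or_neg_one_of_mob_mem_fdo hfx.1 (hx1.mp hx.2.1.2.2.2.1)
      (hx2.mp hx.2.1.2.2.2.2) (g := K.adjugate * G)
      (by rw [Matrix.det_mul, hKad, hGd, one_mul])
      (by rw [hmob]; exact hy1.mp hy.2.1.2.2.2.1) (by rw [hmob]; exact hy2.mp hy.2.1.2.2.2.2)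
    have hGK : G = K ∨ G = -K := by
      have e : G = K * (K.adjugate * G) := by
        rw [← mul_assoc, Matrix.mul_adjugate, hKd, one_smul, one_mul]
      rcases hcase with h | h
      · left; rw [e, h, mul_one]
      · right; rw [e, h, mul_neg, mul_one]
    have hi : x.2 = y.2 := cosetRep_eq_of_mul h1 h2 k1 k2 hGK
    have hconj : G * x.1 * G.adjugate = K * y.1 * K.adjugate := by
      rw [hG, hK, Matrix.adjugate_mul_distrib, Matrix.adjugate_mul_distrib]
      simpa only [twist, mul_assoc] using hxy
    have hconj' : G * x.1 * G.adjugate = G * y.1 * G.adjugate := by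
      rw [hconj]
      rcases hGK with h | h
      · rw [h]
      · rw [h]
        have e : (-K).adjugate = -K.adjugate := by
          simp [Matrix.adjugate_fin_two, ← Matrix.ext_iff]
        rw [e]
        simp
    refine Prod.ext ?_ hi
    rw [← adjugate_mul_conj_mul hGd x.1, hconj', adjugate_mul_conj_mul hGd]

/-- The pairs over a point of the closed fundamental domain are at least as many as the matrices
fixing a point. -/
lemma card_le_fd_fiber (hp4 : p % 4 = 1) {F : Finset (Matrix (Fin 2) (Fin 2) ℤ)} (hτ : 0 < τ.im)
    (hF : ∀ M, M ∈ F ↔ HeckeMat p M ∧ mob M τ = τ) :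
    F.card ≤ (open Classical in (fdPairs p).filter fun x => pairLam x = lam τ).card := by
  classical
  have hp0 : (0 : ℤ) < p := by exact_mod_cast hp.out.pos
  obtain ⟨g, hg, hre, hnorm⟩ := exists_mob_mem_fd hτ
  have hga : g.adjugate.det = 1 := by rw [Matrix.det_adjugate, hg]; simp
  obtain ⟨γ, i, h1, h2, hgi⟩ := exists_cosetRep hga
  have hgl : g.adjugate * g = 1 := by rw [Matrix.adjugate_mul, hg, one_smul]
  have hγa : γ.adjugate.det = 1 := by rw [Matrix.det_adjugate, h1]; simp
  have hγl : LevelTwo γ.adjugate := by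
    obtain ⟨⟨b, hb⟩, ⟨c, hc⟩⟩ := h2
    constructor <;> simp [Matrix.adjugate_fin_two, hb, hc]
  have hri : cosetRep i = γ.adjugate * g.adjugate := by
    rw [hgi, ← mul_assoc, Matrix.adjugate_mul, h1, one_smul, one_mul]
  have hgaa : g.adjugate.adjugate = g := by simp [Matrix.adjugate_fin_two, ← Matrix.ext_iff]
  have hgτ : 0 < (mob g τ).im := mob_im_pos (by simp [hg]) hτ
  refine card_le_card_of_injOn (fun M => (g * M * g.adjugate, i)) ?_ ?_
  · intro M hM
    obtain ⟨hH, hfix⟩ := (hF M).mp hM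
    have hMd : 0 < M.det := by rw [hH.1]; exact hp0
    have hNfix := mob_conj_fixed hg hMd hτ hfix
    set N := g * M * g.adjugate with hN
    have hNd : N.det = p := by
      rw [hN, Matrix.det_mul, Matrix.det_mul, hg, hga, hH.1]; simp
    have htw : twist i N = γ.adjugate * M * γ.adjugate.adjugate := by
      rw [twist, hri, Matrix.adjugate_mul_distrib, hgaa, hN]
      calc γ.adjugate * g.adjugate * (g * M * g.adjugate) * (g * γ.adjugate.adjugate)
          = γ.adjugate * (g.adjugate * g) * M * (g.adjugate * g) * γ.adjugate.adjugate := by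
            simp only [mul_assoc]
        _ = _ := by rw [hgl, mul_one, mul_one]
    have hHt : HeckeMat p (twist i N) := by rw [htw]; exact hH.conj hγa hγl
    have hl : LevelTwo N := by
      refine levelTwo_conj hH.2.1 ?_
      have h3 := hH.upper_left hp4
      have h4 := hH.2.2
      omega
    have hc0 : N 1 0 ≠ 0 := lower_left_ne_zero_of_fixed hNd hgτ hNfix
    have hfd := fd_iff_of_fixed (by rw [hNd]; exact hp0.ne') hc0 hgτ hNfix
    have hFd : FdMat p N := ⟨hNd, hl, hfd.1.1, hfd.1.2.1.mpr hre, hfd.1.2.2.mpr hnorm⟩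
    have hfp := fixedPoint_spec hFd
    have hfpe : fixedPoint N = mob g τ :=
      fixed_unique (by rw [hNd]; exact hp0.ne') hc0 hfp.1 hgτ hfp.2 hNfix
    simp only [coe_filter, Set.mem_ofPred_eq]
    refine ⟨mem_fdPairs.mpr ⟨hFd, hHt⟩, ?_⟩
    rw [pairLam]
    dsimp only
    rw [hfpe, hri, mob_mul (by simp [hγa]) (by simp [hga]) hgτ,
      ← mob_mul (by simp [hga]) (by simp [hg]) hτ, hgl, mob_one]
    exact lam_mob (by simp [hγa]) hγl hτ
  · intro M _ M' _ hMM
    have h := congrArg Prod.fst hMM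
    dsimp only at h
    rw [← adjugate_mul_conj_mul hg M, h, adjugate_mul_conj_mul hg]

end TraceSum

section TraceSumBound

open IsLocalRing

variable {p : ℕ} [hp : Fact p.Prime]

/-- The moment of the Legendre family is the sum of powers of traces over the open fundamental
domain, up to a boundary contribution. -/
theorem abs_two_mul_sum_legA_sub_le (hp4 : p % 4 = 1) (h64 : 64 ≤ p) (m : ℕ) :
    |2 * ∑ x ∈ univ.filter (fun x : ZMod p => x ≠ 0 ∧ x ≠ 1), legA p x ^ m -
      ∑ x ∈ (open Classical in (fdPairs p).filter fun x => FdoMat p x.1),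
        (x.1 0 0 + x.1 1 1) ^ m| ≤
      ∑ x ∈ (open Classical in (fdPairs p).filter fun x => ¬ FdoMat p x.1),
        |(x.1 0 0 + x.1 1 1) ^ m| := by
  classical
  have hp2 : p ≠ 2 := by omega
  obtain ⟨O, hO⟩ := exists_valuationSubring_charP p
  obtain ⟨P, hdeg, hP⟩ := exists_heckePoly (p := p) hp2
  obtain ⟨R, hR, hR2⟩ := heckePoly_roots hdeg hP O hp2
  have hP0 : P ≠ 0 := by
    rintro rfl
    rw [Polynomial.roots_zero] at hR
    have h0 : R = 0 := Multiset.map_eq_zero.mp hR.symm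
    have h := congrArg Multiset.card hR2
    simp [h0, ZMod.card] at h
    exact hp.out.ne_zero h
  set ι := ZMod.castHom (dvd_refl p) (ResidueField O) with hι
  have hlift : ∀ X, P.IsRoot X → ∃ x : ZMod p, ∃ r : O, (r : ℂ) = X ∧ residue O r = ι x := by
    intro X hX
    have hX' : X ∈ R.map O.subtype := by
      rw [← hR]; exact (Polynomial.mem_roots hP0).mpr hX
    obtain ⟨r, hr, hrX⟩ := Multiset.mem_map.mp hX'
    have h2 : residue O r ∈ R.map (residue O) := Multiset.mem_map_of_mem _ hr
    rw [hR2, Multiset.mem_nsmul] at h2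
    obtain ⟨x, -, hx⟩ := Multiset.mem_map.mp h2.2
    exact ⟨x, r, hrX, hx.symm⟩
  set g : ℂ → ℤ := fun X =>
    if h : ∃ x : ZMod p, ∃ r : O, (r : ℂ) = X ∧ residue O r = ι x then legA p h.choose ^ m else 0
    with hg
  have hgval : ∀ (r : O) (x : ZMod p), residue O r = ι x → g r = legA p x ^ m := by
    intro r x hx
    have h : ∃ y : ZMod p, ∃ s : O, (s : ℂ) = r ∧ residue O s = ι y := ⟨x, r, rfl, hx⟩
    rw [hg]
    dsimp only
    rw [dif_pos h]
    obtain ⟨s, hs, hs2⟩ := h.choose_spec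
    have hsr : s = r := Subtype.ext hs
    rw [hsr, hx] at hs2
    rw [← ι.injective hs2]
  have hmain := sum_heckePoly_roots hdeg hP O hp2 g (fun x => legA p x ^ m)
    (fun r _ _ _ x hx => hgval r x hx)
  set V := P.roots.toFinset.filter (fun X => X ≠ 0 ∧ X ≠ 1) with hV
  have hsum : ((P.roots.filter fun X => X ≠ 0 ∧ X ≠ 1).map g).sum =
      ∑ X ∈ V, (P.rootMultiplicity X : ℤ) * g X := by
    rw [Finset.sum_multiset_map_count, Multiset.toFinset_filter]
    refine sum_congr rfl fun X hX => ?_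
    rw [Multiset.count_filter_of_pos (p := fun X : ℂ => X ≠ 0 ∧ X ≠ 1) (mem_filter.mp hX).2,
      Polynomial.count_roots, nsmul_eq_mul]
  have hpair : ∀ x ∈ fdPairs p, pairLam x ∈ V ∧ g (pairLam x) = (x.1 0 0 + x.1 1 1) ^ m := by
    intro x hx
    obtain ⟨h1, h2⟩ := twist_fixed hx
    have hH := (mem_fdPairs.mp hx).2
    obtain ⟨F, hF, hFc⟩ := exists_finset_heckeMat_fixed hp2 hp4 h1
    have hroot : P.IsRoot (pairLam x) := by
      rw [← Polynomial.rootMultiplicity_pos hP0, pairLam, rootMultiplicity_heckePoly hp4 hP0 hP h1,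
        ← hFc, card_pos]
      exact ⟨_, (hF _).mpr ⟨hH, h2⟩⟩
    refine ⟨?_, ?_⟩
    · simp only [hV, mem_filter, Multiset.mem_toFinset, Polynomial.mem_roots hP0]
      exact ⟨hroot, lam_ne_zero h1, lam_ne_one h1⟩
    · obtain ⟨y, r, hr, hy⟩ := hlift _ hroot
      rw [← hr, hgval r y hy, ← hH.trace_eq hp4 h64 O h1 h2 hr hy, twist,
        trace_conj (det_cosetRep _)]
  have hmult : ∀ X ∈ V, (((fdPairs p).filter fun x => FdoMat p x.1).filter
      fun x => pairLam x = X).card ≤ P.rootMultiplicity X ∧ P.rootMultiplicity X ≤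
      (((fdPairs p).filter fun x => FdoMat p x.1).filter fun x => pairLam x = X).card +
      (((fdPairs p).filter fun x => ¬ FdoMat p x.1).filter fun x => pairLam x = X).card := by
    intro X hX
    obtain ⟨-, hX0, hX1⟩ := mem_filter.mp hX
    obtain ⟨τ, hτ, rfl⟩ := exists_lam_eq hX0 hX1
    obtain ⟨F, hF, hFc⟩ := exists_finset_heckeMat_fixed hp2 hp4 hτ
    rw [rootMultiplicity_heckePoly hp4 hP0 hP hτ, ← hFc]
    constructor
    · rw [filter_filter]
      convert card_fdo_fiber_le hτ hF
    · refine (card_le_fd_fiber hp4 hτ hF).trans ?_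
      rw [← card_union_of_disjoint]
      · refine card_le_card fun x hx => ?_
        simp only [mem_filter, mem_union] at hx ⊢
        tauto
      · refine disjoint_left.mpr fun x hx hx' => ?_
        simp only [mem_filter] at hx hx'
        tauto
  have hfib : ∀ (A : Finset (Matrix (Fin 2) (Fin 2) ℤ × Fin 6)) (h : ℂ → ℤ), A ⊆ fdPairs p →
      ∑ x ∈ A, h (pairLam x) = ∑ X ∈ V, ((A.filter fun x => pairLam x = X).card : ℤ) * h X := by
    intro A h hA
    rw [← sum_fiberwise_of_maps_to (t := V) (g := pairLam) (fun x hx => (hpair x (hA hx)).1)]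
    refine sum_congr rfl fun X _ => ?_
    rw [sum_congr rfl (g := fun _ => h X) (fun x hx => by rw [(mem_filter.mp hx).2]), sum_const,
      nsmul_eq_mul]
  rw [← hmain, hsum]
  rw [sum_congr rfl fun x hx => (hpair x (mem_filter.mp hx).1).2.symm,
    sum_congr rfl (s₁ := (fdPairs p).filter fun x => ¬ FdoMat p x.1)
      fun x hx => congrArg abs (hpair x (mem_filter.mp hx).1).2.symm,
    hfib _ g (filter_subset _ _), hfib _ (fun X => |g X|) (filter_subset _ _),
    ← sum_sub_distrib]
  refine (abs_sum_le_sum_abs _ _).trans (sum_le_sum fun X hX => ?_)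
  rw [← sub_mul, abs_mul]
  obtain ⟨h1, h2⟩ := hmult X hX
  refine mul_le_mul_of_nonneg_right ?_ (abs_nonneg _)
  rw [abs_le]
  constructor <;> omega

end TraceSumBound

section DivisorBound

lemma succ_pow_le_mul_two_pow {k : ℕ} (hk : 0 < k) (f : ℕ) : (f + 1) ^ k ≤ k ^ k * 2 ^ f := by
  have h1 : f + 1 ≤ k * 2 ^ (f / k) := by
    have h2 : f / k + 1 ≤ 2 ^ (f / k) := Nat.lt_two_pow_self
    have h3 : f < k * (f / k + 1) := Nat.lt_mul_div_succ f hk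
    exact h3.trans_le (Nat.mul_le_mul_left k h2)
  calc (f + 1) ^ k ≤ (k * 2 ^ (f / k)) ^ k := Nat.pow_le_pow_left h1 k
    _ = k ^ k * 2 ^ (f / k * k) := by rw [mul_pow, pow_mul]
    _ ≤ k ^ k * 2 ^ f :=
      Nat.mul_le_mul_left _ (Nat.pow_le_pow_right two_pos (Nat.div_mul_le_self f k))

/-- The divisor function grows more slowly than any power. -/
theorem exists_card_divisors_pow_le (k : ℕ) (hk : 0 < k) :
    ∃ C : ℕ, 0 < C ∧ ∀ n : ℕ, n ≠ 0 → n.divisors.card ^ k ≤ C * n := by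
  have hkk : 0 < k ^ k := pow_pos hk k
  refine ⟨(k ^ k) ^ (2 ^ k), pow_pos hkk _, fun n hn => ?_⟩
  rw [Nat.card_divisors hn, ← prod_pow]
  have h1 : ∀ q ∈ n.primeFactors, (n.factorization q + 1) ^ k ≤
      (if q < 2 ^ k then k ^ k else 1) * q ^ n.factorization q := by
    intro q hq
    have hq2 : 2 ≤ q := (Nat.prime_of_mem_primeFactors hq).two_le
    split_ifs with h
    · exact (succ_pow_le_mul_two_pow hk _).trans
        (Nat.mul_le_mul_left _ (Nat.pow_le_pow_left hq2 _))
    · rw [one_mul]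
      calc (n.factorization q + 1) ^ k ≤ (2 ^ n.factorization q) ^ k :=
            Nat.pow_le_pow_left Nat.lt_two_pow_self k
        _ = (2 ^ k) ^ n.factorization q := by rw [← pow_mul, ← pow_mul, mul_comm]
        _ ≤ q ^ n.factorization q := Nat.pow_le_pow_left (not_lt.mp h) _
  refine (prod_le_prod' h1).trans ?_
  rw [prod_mul_distrib]
  have h2 : ∏ q ∈ n.primeFactors, q ^ n.factorization q = n :=
    Nat.prod_factorization_pow_eq_self hn
  rw [h2]
  refine Nat.mul_le_mul_right _ ?_
  rw [prod_ite, prod_const, prod_const_one, mul_one]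
  refine Nat.pow_le_pow_right hkk ?_
  calc _ ≤ (range (2 ^ k)).card := card_le_card fun q hq => by
        rw [mem_range]; exact (mem_filter.mp hq).2
    _ = 2 ^ k := card_range _

lemma le_card_divisors_mul_totient {n : ℕ} (hn : n ≠ 0) : n ≤ n.divisors.card * n.totient := by
  conv_lhs => rw [← Nat.sum_totient n]
  rw [← smul_eq_mul]
  refine sum_le_card_nsmul _ _ _ fun d hd => ?_
  exact Nat.le_of_dvd (Nat.totient_pos.mpr (Nat.pos_of_ne_zero hn))
    (Nat.totient_dvd_of_dvd (Nat.dvd_of_mem_divisors hd))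

/-- A weighted sum against `gcd` is controlled by sums over multiples of divisors. -/
lemma sum_mul_gcd_le {N : ℕ} (hN : N ≠ 0) {B : ℝ} (s : Finset ℕ) (f : ℕ → ℝ) (hf : ∀ h ∈ s, 0 ≤ f h)
    (hB : ∀ g ∈ N.divisors, (g : ℝ) * ∑ h ∈ s.filter (fun h => g ∣ h), f h ≤ B) :
    ∑ h ∈ s, f h * (Nat.gcd h N : ℝ) ≤ N.divisors.card * B := by
  calc ∑ h ∈ s, f h * (Nat.gcd h N : ℝ)
      ≤ ∑ h ∈ s, ∑ g ∈ N.divisors, if g ∣ h then f h * (g : ℝ) else 0 := by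
        refine sum_le_sum fun h hh => ?_
        have hmem : Nat.gcd h N ∈ N.divisors :=
          Nat.mem_divisors.mpr ⟨Nat.gcd_dvd_right h N, hN⟩
        refine le_trans ?_ (single_le_sum (f := fun g : ℕ => if g ∣ h then f h * (g : ℝ) else 0)
          (fun g _ => ?_) hmem)
        · rw [if_pos (Nat.gcd_dvd_left h N)]
        · split_ifs
          · exact mul_nonneg (hf h hh) (Nat.cast_nonneg g)
          · exact le_rfl
    _ = ∑ g ∈ N.divisors, (g : ℝ) * ∑ h ∈ s.filter (fun h => g ∣ h), f h := by
        rw [sum_comm]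
        refine sum_congr rfl fun g _ => ?_
        rw [← sum_filter, mul_sum]
        exact sum_congr rfl fun h _ => mul_comm _ _
    _ ≤ ∑ g ∈ N.divisors, B := sum_le_sum hB
    _ = N.divisors.card * B := by rw [sum_const, nsmul_eq_mul]

lemma sum_gcd_le {N : ℕ} (hN : N ≠ 0) :
    ∑ h ∈ range N, (Nat.gcd h N : ℝ) ≤ N.divisors.card * N := by
  have h := sum_mul_gcd_le hN (range N) (fun _ => 1) (fun _ _ => zero_le_one) (B := N) ?_
  · simpa using h
  intro g hg
  have hgN := Nat.dvd_of_mem_divisors hg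
  have hg0 : 0 < g := Nat.pos_of_mem_divisors hg
  obtain ⟨k, rfl⟩ := hgN
  have hcard : ((range (g * k)).filter fun h => g ∣ h).card ≤ k := by
    calc _ ≤ ((range k).image fun j => g * j).card := card_le_card fun h hh => by
          obtain ⟨h1, j, rfl⟩ := mem_filter.mp hh
          exact mem_image.mpr ⟨j, mem_range.mpr (lt_of_mul_lt_mul_left (mem_range.mp h1) hg0.le), rfl⟩
      _ ≤ (range k).card := card_image_le
      _ = k := card_range k
  rw [sum_const, nsmul_eq_mul, mul_one]
  push_cast
  exact mul_le_mul_of_nonneg_left (by exact_mod_cast hcard) (Nat.cast_nonneg g)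

/-- The logarithmic sum weighted by `gcd`. -/
lemma sum_gcd_div_le {N : ℕ} (hN : N ≠ 0) :
    ∑ h ∈ Ioo 0 N, (1 / (h : ℝ)) * (Nat.gcd h N : ℝ) ≤
      N.divisors.card * ∑ j ∈ Ioo 0 N, 1 / (j : ℝ) := by
  refine sum_mul_gcd_le hN _ _ (fun h _ => by positivity) fun g hg => ?_
  have hg0 : 0 < g := Nat.pos_of_mem_divisors hg
  rw [mul_sum]
  have hsub : (Ioo 0 N).filter (fun h => g ∣ h) ⊆ (Ioo 0 N).image fun j => g * j := by
    intro h hh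
    obtain ⟨h1, j, rfl⟩ := mem_filter.mp hh
    rw [mem_Ioo] at h1
    refine mem_image.mpr ⟨j, mem_Ioo.mpr ⟨Nat.pos_of_mul_pos_left h1.1, ?_⟩, rfl⟩
    exact lt_of_le_of_lt (Nat.le_mul_of_pos_left j hg0) h1.2
  refine (sum_le_sum_of_subset_of_nonneg hsub fun _ _ _ => by positivity).trans ?_
  rw [sum_image fun x _ y _ h => Nat.eq_of_mul_eq_mul_left hg0 h]
  refine le_of_eq (sum_congr rfl fun j hj => ?_)
  have hg0' : (g : ℝ) ≠ 0 := by exact_mod_cast hg0.ne'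
  have hj0 : (j : ℝ) ≠ 0 := by exact_mod_cast (mem_Ioo.mp hj).1.ne'
  push_cast
  field_simp

end DivisorBound

section Kloosterman

variable {N : ℕ} [hN : NeZero N]

/-- The twisted Kloosterman sum to the modulus `N`. -/
noncomputable def kloosterman (ψ : MulChar (ZMod N) ℂ) (x y : ZMod N) : ℂ :=
  ∑ v : (ZMod N)ˣ, ψ v * ZMod.stdAddChar (x * (v : ZMod N) + y * ((v⁻¹ : (ZMod N)ˣ) : ZMod N))

omit hN in
lemma norm_mulChar_unit (ψ : MulChar (ZMod N) ℂ) (v : (ZMod N)ˣ) : ‖ψ v‖ = 1 :=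
  DirichletCharacter.unit_norm_eq_one ψ v

lemma sum_stdAddChar_mul (b : ZMod N) :
    ∑ x : ZMod N, ZMod.stdAddChar (x * b) = if b = 0 then (N : ℂ) else 0 := by
  have h := AddChar.sum_mulShift b (ZMod.isPrimitive_stdAddChar N)
  rw [h, ZMod.card]
  split_ifs <;> simp

lemma conj_stdAddChar (x : ZMod N) :
    (starRingEnd ℂ) (ZMod.stdAddChar x) = ZMod.stdAddChar (-x) := by
  rw [AddChar.map_neg_eq_conj]

/-- A mean square bound for exponential polynomials in two variables. -/
lemma sum_norm_sq_le {ι : Type*} [Fintype ι] (α β : ι → ZMod N) (c : ι → ℂ)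
    (hc : ∀ i, ‖c i‖ ≤ 1) :
    ∑ x : ZMod N, ∑ y : ZMod N, ‖∑ i, c i * ZMod.stdAddChar (x * α i + y * β i)‖ ^ 2 ≤
      (N : ℝ) ^ 2 * (univ.filter fun q : ι × ι => α q.1 = α q.2 ∧ β q.1 = β q.2).card := by
  have key : ((∑ x : ZMod N, ∑ y : ZMod N,
      ‖∑ i, c i * ZMod.stdAddChar (x * α i + y * β i)‖ ^ 2 : ℝ) : ℂ) =
      ∑ q : ι × ι, c q.1 * (starRingEnd ℂ) (c q.2) *
        ((if α q.1 - α q.2 = 0 then (N : ℂ) else 0) *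
          (if β q.1 - β q.2 = 0 then (N : ℂ) else 0)) := by
    push_cast
    have h1 : ∀ x y : ZMod N, ((‖∑ i, c i * ZMod.stdAddChar (x * α i + y * β i)‖ : ℝ) : ℂ) ^ 2 =
        ∑ q : ι × ι, c q.1 * (starRingEnd ℂ) (c q.2) *
          (ZMod.stdAddChar (x * (α q.1 - α q.2)) * ZMod.stdAddChar (y * (β q.1 - β q.2))) := by
      intro x y
      rw [← Complex.mul_conj', map_sum, sum_mul_sum, Fintype.sum_prod_type]
      refine sum_congr rfl fun i _ => sum_congr rfl fun j _ => ?_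
      have e : (ZMod.stdAddChar (x * (α i - α j)) * ZMod.stdAddChar (y * (β i - β j)) : ℂ) =
          ZMod.stdAddChar (x * α i + y * β i) * ZMod.stdAddChar (-(x * α j + y * β j)) := by
        rw [← AddChar.map_add_eq_mul, ← AddChar.map_add_eq_mul]
        congr 1
        ring
      rw [map_mul, conj_stdAddChar, e, mul_mul_mul_comm]
    simp_rw [h1]
    rw [sum_congr rfl fun x _ => sum_comm, sum_comm]
    refine sum_congr rfl fun q _ => ?_
    simp_rw [← mul_sum, ← sum_mul]
    rw [sum_stdAddChar_mul, sum_stdAddChar_mul]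
  have hnn : 0 ≤ ∑ x : ZMod N, ∑ y : ZMod N,
      ‖∑ i, c i * ZMod.stdAddChar (x * α i + y * β i)‖ ^ 2 :=
    sum_nonneg fun _ _ => sum_nonneg fun _ _ => by positivity
  have h2 := congrArg norm key
  rw [Complex.norm_real, Real.norm_of_nonneg hnn] at h2
  rw [h2, card_filter]
  push_cast
  rw [mul_sum]
  refine (norm_sum_le _ _).trans (sum_le_sum fun q _ => ?_)
  rw [norm_mul, norm_mul, RCLike.norm_conj]
  have h3 : ‖c q.1‖ * ‖c q.2‖ ≤ 1 := mul_le_one₀ (hc _) (norm_nonneg _) (hc _)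
  by_cases ha : α q.1 = α q.2 <;> by_cases hb : β q.1 = β q.2 <;>
    simp [ha, hb, sub_eq_zero]
  nlinarith [sq_nonneg (N : ℝ)]

omit hN in
lemma sum_comp_le_mul_sum {A B : Type*} [Fintype A] [Fintype B] [DecidableEq B] (f : A → B)
    (F : B → ℝ) (hF : ∀ b, 0 ≤ F b) (n : ℕ)
    (hf : ∀ a, (univ.filter fun a' => f a' = f a).card ≤ n) :
    ∑ a, F (f a) ≤ n * ∑ b, F b := by
  rw [← sum_fiberwise univ f, mul_sum]
  refine sum_le_sum fun b _ => ?_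
  rw [sum_congr rfl (g := fun _ => F b) fun a ha => by rw [(mem_filter.mp ha).2], sum_const,
    nsmul_eq_mul]
  refine mul_le_mul_of_nonneg_right ?_ (hF b)
  rcases (univ.filter fun a => f a = b).eq_empty_or_nonempty with h | ⟨a, ha⟩
  · rw [h]; simp
  · have := hf a
    rw [(mem_filter.mp ha).2] at this
    exact_mod_cast this

lemma card_mul_eq_zero_le (k : ℕ) :
    (univ.filter fun z : ZMod N => (k : ZMod N) * z = 0).card ≤ Nat.gcd k N := by
  have hN0 : 0 < N := Nat.pos_of_ne_zero hN.out
  have hg0 : 0 < Nat.gcd k N := Nat.gcd_pos_of_pos_right _ hN0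
  obtain ⟨k', hk'⟩ := Nat.gcd_dvd_left k N
  obtain ⟨M, hM⟩ := Nat.gcd_dvd_right k N
  set g := Nat.gcd k N with hg
  have hM0 : 0 < M := Nat.pos_of_ne_zero fun h => by rw [h, mul_zero] at hM; exact hN.out hM
  have hcop : Nat.Coprime M k' := by
    have h1 : g * Nat.gcd k' M = g * 1 := by
      rw [← Nat.gcd_mul_left, ← hk', ← hM, mul_one]
    exact (Nat.coprime_comm).mp (Nat.eq_of_mul_eq_mul_left hg0 h1)
  have hdvd : ∀ z : ZMod N, (k : ZMod N) * z = 0 → M ∣ z.val := by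
    intro z hz
    have h1 : ((k * z.val : ℕ) : ZMod N) = 0 := by
      rw [Nat.cast_mul, ZMod.natCast_zmod_val]; exact hz
    rw [ZMod.natCast_eq_zero_iff] at h1
    have h2 : g * M ∣ g * (k' * z.val) := by
      rw [← mul_assoc, ← hk', ← hM]; exact h1
    exact hcop.dvd_of_dvd_mul_left (Nat.dvd_of_mul_dvd_mul_left hg0 h2)
  calc _ ≤ (range g).card := by
        refine card_le_card_of_injOn (fun z => z.val / M) ?_ ?_
        · intro z _
          rw [coe_range, Set.mem_Iio]
          refine Nat.div_lt_of_lt_mul ?_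
          rw [mul_comm, ← hM]
          exact ZMod.val_lt z
        · intro z hz w hw hzw
          rw [coe_filter] at hz hw
          have h1 := hdvd z hz.2
          have h2 := hdvd w hw.2
          refine ZMod.val_injective N ?_
          dsimp only at hzw
          rw [← Nat.div_mul_cancel h1, ← Nat.div_mul_cancel h2, hzw]
    _ = g := card_range g

lemma card_two_mul_eq_le (w : ZMod N) : (univ.filter fun z : ZMod N => 2 * z = w).card ≤ 2 := by
  rcases (univ.filter fun z : ZMod N => 2 * z = w).eq_empty_or_nonempty with h | ⟨z₀, hz₀⟩
  · rw [h]; simp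
  · have hz₀' := (mem_filter.mp hz₀).2
    calc _ ≤ (univ.filter fun z : ZMod N => ((2 : ℕ) : ZMod N) * z = 0).card := by
          refine card_le_card_of_injOn (fun z => z - z₀) ?_ fun z _ w _ h => sub_left_injective h
          intro z hz
          rw [coe_filter] at hz ⊢
          refine ⟨mem_univ _, ?_⟩
          dsimp only
          push_cast
          rw [mul_sub, hz.2, hz₀', sub_self]
      _ ≤ Nat.gcd 2 N := card_mul_eq_zero_le 2
      _ ≤ 2 := Nat.gcd_le_left _ two_pos

lemma card_triple_mul_eq_zero_le :
    ((univ.filter fun q : ZMod N × ZMod N × ZMod N => q.1 * q.2.1 * q.2.2 = 0).card : ℝ) ≤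
      (N.divisors.card * N) ^ 2 := by
  have hval : ∀ f : ℕ → ℝ, ∑ x : ZMod N, f x.val = ∑ h ∈ range N, f h := by
    intro f
    refine sum_nbij (fun x => x.val) (fun x _ => mem_range.mpr (ZMod.val_lt x))
      (fun x _ y _ h => ZMod.val_injective N h) ?_ fun _ _ => rfl
    intro h hh
    rw [coe_range, Set.mem_Iio] at hh
    exact ⟨(h : ZMod N), by simp, ZMod.val_cast_of_lt hh⟩
  rw [card_filter]
  push_cast
  rw [Fintype.sum_prod_type]
  simp_rw [Fintype.sum_prod_type]
  calc ∑ x : ZMod N, ∑ y : ZMod N, ∑ z : ZMod N, (if x * y * z = 0 then (1 : ℝ) else 0)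
      ≤ ∑ x : ZMod N, ∑ y : ZMod N, (Nat.gcd x.val N : ℝ) * (Nat.gcd y.val N : ℝ) := by
        refine sum_le_sum fun x _ => sum_le_sum fun y _ => ?_
        rw [← sum_filter, sum_const, nsmul_eq_mul, mul_one]
        have h1 := card_mul_eq_zero_le (N := N) (x.val * y.val)
        have h2 : Nat.gcd (x.val * y.val) N ≤ Nat.gcd x.val N * Nat.gcd y.val N := by
          refine Nat.le_of_dvd ?_ ?_
          · exact Nat.mul_pos (Nat.gcd_pos_of_pos_right _ (Nat.pos_of_ne_zero hN.out))
              (Nat.gcd_pos_of_pos_right _ (Nat.pos_of_ne_zero hN.out))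
          · rw [Nat.gcd_comm, Nat.gcd_comm x.val, Nat.gcd_comm y.val]
            exact Nat.gcd_mul_right_dvd_mul_gcd N x.val y.val
        push_cast at h1
        simp only [ZMod.natCast_zmod_val] at h1
        exact_mod_cast h1.trans h2
    _ = (∑ x : ZMod N, (Nat.gcd x.val N : ℝ)) ^ 2 := by rw [sq, sum_mul_sum]
    _ ≤ _ := by
        rw [hval fun h => (Nat.gcd h N : ℝ)]
        exact pow_le_pow_left₀ (sum_nonneg fun _ _ => Nat.cast_nonneg _) (sum_gcd_le hN.out) 2

/-- The number of solutions governing the fourth moment of Kloosterman sums. -/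
lemma card_fourth_moment_le :
    ((univ.filter fun q : ((ZMod N)ˣ × (ZMod N)ˣ) × ((ZMod N)ˣ × (ZMod N)ˣ) =>
      (q.1.1 : ZMod N) + q.1.2 = q.2.1 + q.2.2 ∧
      ((q.1.1⁻¹ : (ZMod N)ˣ) : ZMod N) + (q.1.2⁻¹ : (ZMod N)ˣ) =
        (q.2.1⁻¹ : (ZMod N)ˣ) + (q.2.2⁻¹ : (ZMod N)ˣ)).card : ℝ) ≤
      2 * (N.divisors.card * N) ^ 2 := by
  set S := univ.filter fun q : ((ZMod N)ˣ × (ZMod N)ˣ) × ((ZMod N)ˣ × (ZMod N)ˣ) =>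
      (q.1.1 : ZMod N) + q.1.2 = q.2.1 + q.2.2 ∧
      ((q.1.1⁻¹ : (ZMod N)ˣ) : ZMod N) + (q.1.2⁻¹ : (ZMod N)ˣ) =
        (q.2.1⁻¹ : (ZMod N)ˣ) + (q.2.2⁻¹ : (ZMod N)ˣ) with hS
  let f : ((ZMod N)ˣ × (ZMod N)ˣ) × ((ZMod N)ˣ × (ZMod N)ˣ) → ZMod N × ZMod N × ZMod N :=
    fun q => ((q.1.1 : ZMod N) + q.1.2, (q.1.1 : ZMod N) - q.2.1, (q.1.1 : ZMod N) - q.2.2)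
  have h1 : S.card ≤ 2 * (S.image f).card := by
    refine card_le_mul_card_image S 2 fun w _ => ?_
    refine le_trans ?_ (card_two_mul_eq_le (w.1 + w.2.1 + w.2.2))
    refine card_le_card_of_injOn (fun q => (q.1.1 : ZMod N)) ?_ ?_
    · intro q hq
      rw [coe_filter] at hq ⊢
      obtain ⟨hq1, hq2⟩ := hq
      obtain ⟨-, h3, -⟩ := mem_filter.mp hq1
      refine ⟨mem_univ _, ?_⟩
      rw [← hq2]
      dsimp only [f]
      linear_combination -h3
    · intro q hq r hr hqr
      rw [coe_filter] at hq hr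
      have h2 : f q = f r := hq.2.trans hr.2.symm
      simp only [f, Prod.mk.injEq] at h2
      dsimp only at hqr
      obtain ⟨e1, e2, e3⟩ := h2
      refine Prod.ext (Prod.ext (Units.ext hqr) (Units.ext ?_))
        (Prod.ext (Units.ext ?_) (Units.ext ?_))
      · linear_combination e1 - hqr
      · linear_combination hqr - e2
      · linear_combination hqr - e3
  have h2 : S.image f ⊆
      univ.filter fun q : ZMod N × ZMod N × ZMod N => q.1 * q.2.1 * q.2.2 = 0 := by
    intro w hw
    obtain ⟨q, hq, rfl⟩ := mem_image.mp hw
    obtain ⟨-, h3, h4⟩ := mem_filter.mp hq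
    refine mem_filter.mpr ⟨mem_univ _, ?_⟩
    dsimp only [f]
    obtain ⟨⟨a, b⟩, ⟨c, d⟩⟩ := q
    dsimp only at h3 h4 ⊢
    have ha := Units.mul_inv a
    have hb := Units.mul_inv b
    have hc := Units.mul_inv c
    have hd := Units.mul_inv d
    have h5 : ((a : ZMod N) + b) * (c * d) = (c + d) * (a * b) := by
      have e1 : ((a : ZMod N) + b) =
          a * b * (((a⁻¹ : (ZMod N)ˣ) : ZMod N) + (b⁻¹ : (ZMod N)ˣ)) := by
        linear_combination -(b : ZMod N) * ha - a * hb
      have e2 : ((c : ZMod N) + d) =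
          c * d * (((c⁻¹ : (ZMod N)ˣ) : ZMod N) + (d⁻¹ : (ZMod N)ˣ)) := by
        linear_combination -(d : ZMod N) * hc - c * hd
      rw [e1, e2, h4]
      ring
    have hbb : (b : ZMod N) = c + d - a := by linear_combination h3
    rw [hbb] at h5 ⊢
    linear_combination h5
  have h3 := card_triple_mul_eq_zero_le (N := N)
  have h4 : (S.card : ℝ) ≤ 2 * ((S.image f).card : ℝ) := by exact_mod_cast h1
  have h5 : ((S.image f).card : ℝ) ≤ _ := (by exact_mod_cast card_le_card h2 :
    ((S.image f).card : ℝ) ≤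
      ((univ.filter fun q : ZMod N × ZMod N × ZMod N => q.1 * q.2.1 * q.2.2 = 0).card : ℝ))
  linarith

lemma norm_kloosterman_mul (ψ : MulChar (ZMod N) ℂ) (x y : ZMod N) (w : (ZMod N)ˣ) :
    ‖kloosterman ψ (x * w) (y * (w⁻¹ : (ZMod N)ˣ))‖ = ‖kloosterman ψ x y‖ := by
  have h : kloosterman ψ x y = ψ w * kloosterman ψ (x * w) (y * (w⁻¹ : (ZMod N)ˣ)) := by
    rw [kloosterman, kloosterman, mul_sum, ← Equiv.sum_comp (Equiv.mulLeft w)]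
    refine sum_congr rfl fun v _ => ?_
    rw [Equiv.coe_mulLeft, Units.val_mul, map_mul, mul_inv, Units.val_mul]
    rw [mul_assoc, mul_assoc x, mul_assoc y]
  rw [h, norm_mul, norm_mulChar_unit, one_mul]

/-- Kloosterman's bound, by the fourth moment method. -/
theorem norm_kloosterman_pow_four_le (ψ : MulChar (ZMod N) ℂ) (x y : ZMod N) :
    ‖kloosterman ψ x y‖ ^ 4 ≤
      2 * (N : ℝ) ^ 3 * (N.divisors.card : ℝ) ^ 3 * (Nat.gcd (Nat.gcd x.val y.val) N : ℝ) := by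
  have hN0 : (0 : ℝ) < N := by exact_mod_cast Nat.pos_of_ne_zero hN.out
  set g := Nat.gcd (Nat.gcd x.val y.val) N with hg
  set t : ℝ := (N.divisors.card : ℝ) with ht
  have ht0 : 0 ≤ t := Nat.cast_nonneg _
  have hmom : ∑ a : ZMod N, ∑ b : ZMod N, ‖kloosterman ψ a b‖ ^ 4 ≤
      (N : ℝ) ^ 2 * (2 * (t * N) ^ 2) := by
    have h1 := sum_norm_sq_le (ι := (ZMod N)ˣ × (ZMod N)ˣ)
      (fun q => (q.1 : ZMod N) + (q.2 : ZMod N))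
      (fun q => ((q.1⁻¹ : (ZMod N)ˣ) : ZMod N) + ((q.2⁻¹ : (ZMod N)ˣ) : ZMod N))
      (fun q => ψ q.1 * ψ q.2)
      (fun q => by rw [norm_mul, norm_mulChar_unit, norm_mulChar_unit, one_mul])
    refine le_trans (le_of_eq ?_) (h1.trans (mul_le_mul_of_nonneg_left card_fourth_moment_le
      (by positivity)))
    refine sum_congr rfl fun a _ => sum_congr rfl fun b _ => ?_
    have h2 : kloosterman ψ a b ^ 2 = ∑ q : (ZMod N)ˣ × (ZMod N)ˣ, ψ q.1 * ψ q.2 *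
        ZMod.stdAddChar (a * ((q.1 : ZMod N) + (q.2 : ZMod N)) +
          b * (((q.1⁻¹ : (ZMod N)ˣ) : ZMod N) + ((q.2⁻¹ : (ZMod N)ˣ) : ZMod N))) := by
      rw [sq, kloosterman, sum_mul_sum, Fintype.sum_prod_type]
      refine sum_congr rfl fun v _ => sum_congr rfl fun w _ => ?_
      rw [mul_mul_mul_comm, ← AddChar.map_add_eq_mul]
      congr 2
      ring
    rw [← h2, norm_pow]
    ring
  have horb : (N.totient : ℝ) * ‖kloosterman ψ x y‖ ^ 4 ≤
      g * ((N : ℝ) ^ 2 * (2 * (t * N) ^ 2)) := by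
    have h1 := sum_comp_le_mul_sum
      (fun w : (ZMod N)ˣ => (x * (w : ZMod N), y * ((w⁻¹ : (ZMod N)ˣ) : ZMod N)))
      (fun q => ‖kloosterman ψ q.1 q.2‖ ^ 4) (fun q => by positivity) g ?_
    · simp only [norm_kloosterman_mul, sum_const, card_univ, ZMod.card_units_eq_totient,
        nsmul_eq_mul, Fintype.sum_prod_type] at h1
      exact h1.trans (mul_le_mul_of_nonneg_left hmom (Nat.cast_nonneg _))
    · intro w
      refine le_trans ?_ (card_mul_eq_zero_le (N := N) (Nat.gcd x.val y.val))
      refine card_le_card_of_injOn (fun v : (ZMod N)ˣ => (v : ZMod N) - w) ?_ ?_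
      · intro v hv
        rw [coe_filter] at hv ⊢
        obtain ⟨-, hv⟩ := hv
        rw [Prod.mk.injEq] at hv
        obtain ⟨hx, hy⟩ := hv
        refine ⟨mem_univ _, ?_⟩
        dsimp only
        have hy' : y * ((v : ZMod N) - w) = 0 := by
          have e1 := Units.mul_inv v
          have e2 := Units.mul_inv w
          linear_combination (-(v : ZMod N) * w) * hy + y * w * e1 - y * v * e2
        have hx' : x * ((v : ZMod N) - w) = 0 := by linear_combination hx
        have hb : ((Nat.gcd x.val y.val : ℕ) : ZMod N) =
            x * (Nat.gcdA x.val y.val : ZMod N) + y * (Nat.gcdB x.val y.val : ZMod N) := by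
          have h := congrArg (Int.cast : ℤ → ZMod N) (Nat.gcd_eq_gcd_ab x.val y.val)
          push_cast at h
          simpa using h
        rw [hb]
        linear_combination (Nat.gcdA x.val y.val : ZMod N) * hx' +
          (Nat.gcdB x.val y.val : ZMod N) * hy'
      · intro v _ v' _ h
        exact Units.ext (sub_left_injective h)
  have htot : (N : ℝ) ≤ t * N.totient := by
    rw [ht]
    exact_mod_cast le_card_divisors_mul_totient hN.out
  have h4 : (N : ℝ) * ‖kloosterman ψ x y‖ ^ 4 ≤
      N * (2 * (N : ℝ) ^ 3 * t ^ 3 * g) := by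
    calc (N : ℝ) * ‖kloosterman ψ x y‖ ^ 4 ≤ t * N.totient * ‖kloosterman ψ x y‖ ^ 4 :=
          mul_le_mul_of_nonneg_right htot (by positivity)
      _ = t * (N.totient * ‖kloosterman ψ x y‖ ^ 4) := by ring
      _ ≤ t * (g * ((N : ℝ) ^ 2 * (2 * (t * N) ^ 2))) := mul_le_mul_of_nonneg_left horb ht0
      _ = _ := by ring
  exact le_of_mul_le_mul_left h4 hN0

end Kloosterman

section IntervalSums

variable {N : ℕ} [hN : NeZero N]

lemma sub_one_mul_sum_Ico_zpow {z : ℂ} (hz : z ≠ 0) {a b : ℤ} (hab : a ≤ b) :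
    (z - 1) * ∑ s ∈ Ico a b, z ^ s = z ^ b - z ^ a := by
  induction b, hab using Int.leInduction with
  | base => simp
  | succ b hab ih =>
    have h : Ico a (b + 1) = insert b (Ico a b) := by
      ext x; simp only [mem_insert, mem_Ico]; omega
    rw [h, sum_insert (by simp), mul_add, ih, zpow_add₀ hz, zpow_one]
    ring

lemma norm_sum_Ico_zpow_le {z : ℂ} (hz : ‖z‖ = 1) (a b : ℤ) :
    ‖z - 1‖ * ‖∑ s ∈ Ico a b, z ^ s‖ ≤ 2 := by
  have hz0 : z ≠ 0 := by rintro rfl; simp at hz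
  rcases le_total a b with hab | hab
  · rw [← norm_mul, sub_one_mul_sum_Ico_zpow hz0 hab]
    refine (norm_sub_le _ _).trans ?_
    rw [norm_zpow, norm_zpow, hz, one_zpow, one_zpow]
    norm_num
  · rw [Ico_eq_empty (not_lt.mpr hab)]
    simp

lemma le_norm_stdAddChar_sub_one (h : ZMod N) :
    4 * (min h.val (N - h.val) : ℕ) / (N : ℝ) ≤ ‖ZMod.stdAddChar h - 1‖ := by
  have hN0 : (0 : ℝ) < N := by exact_mod_cast Nat.pos_of_ne_zero hN.out
  have hlt := ZMod.val_lt h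
  have h1 : ZMod.stdAddChar h = Complex.exp (Complex.I * ((2 * Real.pi * h.val / N : ℝ) : ℂ)) := by
    have h2 := ZMod.stdAddChar_coe (N := N) (h.val : ℤ)
    simp only [Int.cast_natCast, ZMod.natCast_zmod_val] at h2
    rw [h2]
    congr 1
    push_cast
    ring
  rw [h1, Complex.norm_exp_I_mul_ofReal_sub_one, norm_mul, Real.norm_eq_abs, Real.norm_eq_abs,
    abs_of_pos (two_pos : (0 : ℝ) < 2)]
  set x : ℝ := 2 * Real.pi * h.val / N / 2 with hx
  have hx' : x = Real.pi * (h.val / N) := by rw [hx]; ring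
  have hpi := Real.pi_pos
  have hv0 : (0 : ℝ) ≤ h.val / N := by positivity
  have key : 2 * ((min h.val (N - h.val) : ℕ) / (N : ℝ)) ≤ Real.sin x := by
    have hle : ∀ y : ℝ, 0 ≤ y → y ≤ 1 / 2 → 2 * y ≤ Real.sin (Real.pi * y) := by
      intro y hy0 hy
      have h3 := Real.mul_le_sin (x := Real.pi * y) (by positivity) (by nlinarith)
      calc 2 * y = 2 / Real.pi * (Real.pi * y) := by field_simp
        _ ≤ _ := h3
    rcases le_total (2 * h.val) N with hc | hc
    · have hmin : min h.val (N - h.val) = h.val := by omega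
      rw [hmin, hx']
      refine hle _ hv0 ?_
      rw [div_le_iff₀ hN0]
      have : (2 : ℝ) * h.val ≤ N := by exact_mod_cast hc
      linarith
    · have hmin : min h.val (N - h.val) = N - h.val := by omega
      have hc' : (N : ℝ) ≤ 2 * h.val := by exact_mod_cast hc
      have hlt' : (h.val : ℝ) < N := by exact_mod_cast hlt
      rw [hmin, ← Real.sin_pi_sub, hx', Nat.cast_sub hlt.le,
        show Real.pi - Real.pi * (h.val / N : ℝ) = Real.pi * ((N - h.val) / N) by field_simp]
      refine hle _ (div_nonneg (by linarith) hN0.le) ?_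
      rw [div_le_iff₀ hN0]
      linarith
  have h4 := le_abs_self (Real.sin x)
  calc 4 * (min h.val (N - h.val) : ℕ) / (N : ℝ)
      = 2 * (2 * ((min h.val (N - h.val) : ℕ) / (N : ℝ))) := by ring
    _ ≤ _ := by linarith

/-- The exponential sum over an interval. -/
noncomputable def intervalSum (N : ℕ) [NeZero N] (a b : ℤ) (h : ZMod N) : ℂ :=
  ∑ s ∈ Ico a b, ZMod.stdAddChar (-h * (s : ZMod N))

lemma norm_intervalSum_le_card (a b : ℤ) (h : ZMod N) :
    ‖intervalSum N a b h‖ ≤ ((b - a).toNat : ℝ) := by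
  refine (norm_sum_le _ _).trans ?_
  simp [AddChar.norm_apply]

lemma norm_intervalSum_le (a b : ℤ) {h : ZMod N} (hh : h ≠ 0) :
    ‖intervalSum N a b h‖ ≤ N / 2 * (1 / (h.val : ℝ) + 1 / ((N - h.val : ℕ) : ℝ)) := by
  have hN0 : (0 : ℝ) < N := by exact_mod_cast Nat.pos_of_ne_zero hN.out
  have hlt := ZMod.val_lt h
  have hpos : 0 < h.val := Nat.pos_of_ne_zero fun h0 => hh ((ZMod.val_eq_zero h).mp h0)
  set z : ℂ := ZMod.stdAddChar (-h) with hz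
  have hz1 : ‖z‖ = 1 := AddChar.norm_apply _ _
  have hsum : intervalSum N a b h = ∑ s ∈ Ico a b, z ^ s := by
    refine sum_congr rfl fun s _ => ?_
    rw [hz, ← AddChar.map_zsmul_eq_zpow, zsmul_eq_mul, mul_comm]
  have h1 := norm_sum_Ico_zpow_le hz1 a b
  rw [← hsum] at h1
  have h2 : ‖z - 1‖ = ‖ZMod.stdAddChar h - 1‖ := by
    rw [hz, ← conj_stdAddChar, ← RCLike.norm_conj]
    simp
  rw [h2] at h1
  have h3 := le_norm_stdAddChar_sub_one h
  set μ := min h.val (N - h.val) with hμ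
  have hμ0 : 0 < μ := by omega
  have hμ0' : (0 : ℝ) < μ := by exact_mod_cast hμ0
  have h4 : 4 * (μ : ℝ) / N * ‖intervalSum N a b h‖ ≤ 2 :=
    (mul_le_mul_of_nonneg_right h3 (norm_nonneg _)).trans h1
  have h5 : ‖intervalSum N a b h‖ ≤ N / 2 * (1 / (μ : ℝ)) := by
    rw [div_mul_eq_mul_div, div_le_iff₀ hN0] at h4
    rw [div_mul_div_comm, mul_one, le_div_iff₀ (by positivity)]
    linarith
  refine h5.trans (mul_le_mul_of_nonneg_left ?_ (by positivity))
  rcases min_choice h.val (N - h.val) with hc | hc <;> rw [hμ, hc]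
  · have : (0 : ℝ) ≤ 1 / ((N - h.val : ℕ) : ℝ) := by positivity
    linarith
  · have : (0 : ℝ) ≤ 1 / (h.val : ℝ) := by positivity
    linarith

/-- The truncated harmonic sum. -/
noncomputable def harm (N : ℕ) : ℝ := ∑ j ∈ Ioo 0 N, 1 / (j : ℝ)

/-- The `gcd`-weighted `L¹` norm of the Fourier transform of an interval. -/
lemma sum_norm_intervalSum_mul_gcd_le (a b : ℤ) :
    ∑ h ∈ univ.filter (fun h : ZMod N => h ≠ 0), ‖intervalSum N a b h‖ * (Nat.gcd h.val N : ℝ) ≤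
      N * (N.divisors.card * harm N) := by
  have hN0 : 0 < N := Nat.pos_of_ne_zero hN.out
  set F : ℕ → ℝ := fun h => N / 2 * (1 / (h : ℝ) + 1 / ((N - h : ℕ) : ℝ)) * (Nat.gcd h N : ℝ)
    with hF
  have h1 : ∑ h ∈ univ.filter (fun h : ZMod N => h ≠ 0),
      ‖intervalSum N a b h‖ * (Nat.gcd h.val N : ℝ) ≤ ∑ h ∈ Ioo 0 N, F h := by
    refine (sum_le_sum fun h hh => mul_le_mul_of_nonneg_right
      (norm_intervalSum_le a b (mem_filter.mp hh).2) (Nat.cast_nonneg _)).trans (le_of_eq ?_)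
    refine sum_nbij (fun x => x.val) ?_ (fun x _ y _ h => ZMod.val_injective N h) ?_
      fun _ _ => rfl
    · intro h hh
      exact mem_Ioo.mpr ⟨Nat.pos_of_ne_zero fun h0 =>
        (mem_filter.mp hh).2 ((ZMod.val_eq_zero h).mp h0), ZMod.val_lt h⟩
    · intro j hj
      rw [coe_Ioo] at hj
      have hv := ZMod.val_cast_of_lt hj.2
      refine ⟨(j : ZMod N), ?_, hv⟩
      rw [coe_filter]
      refine ⟨mem_univ _, fun h0 => ?_⟩
      rw [h0, ZMod.val_zero] at hv
      exact hj.1.ne hv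
  refine h1.trans ?_
  have h2 : ∑ h ∈ Ioo 0 N, 1 / ((N - h : ℕ) : ℝ) * (Nat.gcd h N : ℝ) =
      ∑ h ∈ Ioo 0 N, 1 / (h : ℝ) * (Nat.gcd h N : ℝ) := by
    refine sum_nbij' (fun h => N - h) (fun h => N - h) ?_ ?_ ?_ ?_ ?_
    · intro h hh; rw [mem_Ioo] at hh ⊢; omega
    · intro h hh; rw [mem_Ioo] at hh ⊢; omega
    · intro h hh; rw [mem_Ioo] at hh; omega
    · intro h hh; rw [mem_Ioo] at hh; omega
    · intro h hh
      rw [mem_Ioo] at hh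
      have : Nat.gcd (N - h) N = Nat.gcd h N := by
        conv_lhs => rw [show N = h + (N - h) by omega, Nat.add_sub_cancel_left]
        conv_rhs => rw [show N = (N - h) + h by omega]
        rw [Nat.gcd_add_self_right, Nat.gcd_add_self_right, Nat.gcd_comm]
      rw [this]
  have h3 := sum_gcd_div_le hN.out
  calc ∑ h ∈ Ioo 0 N, F h = N / 2 * (∑ h ∈ Ioo 0 N, 1 / (h : ℝ) * (Nat.gcd h N : ℝ) +
        ∑ h ∈ Ioo 0 N, 1 / ((N - h : ℕ) : ℝ) * (Nat.gcd h N : ℝ)) := by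
        rw [← sum_add_distrib, mul_sum]
        exact sum_congr rfl fun h _ => by rw [hF]; ring
    _ = N * ∑ h ∈ Ioo 0 N, 1 / (h : ℝ) * (Nat.gcd h N : ℝ) := by rw [h2]; ring
    _ ≤ N * (N.divisors.card * harm N) := mul_le_mul_of_nonneg_left h3 (Nat.cast_nonneg _)

end IntervalSums

section HyperbolaBox

variable {N : ℕ} [hN : NeZero N]

/-- The weighted indicator of the hyperbola `(s + e)(s - e) = u`. -/
noncomputable def hyperbola (ψ : MulChar (ZMod N) ℂ) (u : (ZMod N)ˣ) (s e : ZMod N) : ℂ :=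
  if (s + e) * (s - e) = u then ψ (s - e) else 0

/-- The Fourier transform of the weighted hyperbola. -/
noncomputable def hyperbolaHat (ψ : MulChar (ZMod N) ℂ) (u : (ZMod N)ˣ) (h k : ZMod N) : ℂ :=
  ∑ s : ZMod N, ∑ e : ZMod N, hyperbola ψ u s e * ZMod.stdAddChar (h * s + k * e)

lemma sum_hyperbola_mul_eq (ψ : MulChar (ZMod N) ℂ) (u : (ZMod N)ˣ) (f : ZMod N → ZMod N → ℂ) :
    ∑ s : ZMod N, ∑ e : ZMod N, hyperbola ψ u s e * f s e =
      ∑ v : (ZMod N)ˣ, ψ v * ∑ e ∈ univ.filter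
        (fun e : ZMod N => 2 * e = u * (v⁻¹ : (ZMod N)ˣ) - v), f (v + e) e := by
  rw [sum_comm]
  have h1 : ∀ e : ZMod N, ∑ s : ZMod N, hyperbola ψ u s e * f s e =
      ∑ d : ZMod N, hyperbola ψ u (d + e) e * f (d + e) e := fun e =>
    (Equiv.sum_comp (Equiv.addRight e) fun s => hyperbola ψ u s e * f s e).symm
  rw [sum_congr rfl fun e _ => h1 e, sum_comm]
  have h2 : ∑ d : ZMod N, ∑ e : ZMod N, hyperbola ψ u (d + e) e * f (d + e) e =
      ∑ d ∈ univ.filter (fun d : ZMod N => IsUnit d),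
        ∑ e : ZMod N, hyperbola ψ u (d + e) e * f (d + e) e := by
    rw [sum_filter]
    refine sum_congr rfl fun d _ => ?_
    split_ifs with hd
    · rfl
    · refine sum_eq_zero fun e _ => ?_
      rw [hyperbola, if_neg, zero_mul]
      intro h
      refine hd ?_
      rw [add_sub_cancel_right] at h
      exact isUnit_of_mul_isUnit_right (by rw [h]; exact u.isUnit)
  rw [h2]
  symm
  refine sum_bij (fun v _ => (v : ZMod N)) (fun v _ => mem_filter.mpr ⟨mem_univ _, v.isUnit⟩)
    (fun v _ w _ h => Units.ext h) (fun d hd => ?_) (fun v _ => ?_)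
  · obtain ⟨v, rfl⟩ := (mem_filter.mp hd).2
    exact ⟨v, mem_univ _, rfl⟩
  · rw [sum_filter, mul_sum]
    refine sum_congr rfl fun e _ => ?_
    have hv := Units.mul_inv v
    have hiff : ((v : ZMod N) + e + e) * ((v : ZMod N) + e - e) = u ↔
        2 * e = u * ((v⁻¹ : (ZMod N)ˣ) : ZMod N) - v := by
      constructor
      · intro h
        linear_combination ((v⁻¹ : (ZMod N)ˣ) : ZMod N) * h - (v + 2 * e) * hv
      · intro h
        linear_combination (v : ZMod N) * h + (u : ZMod N) * hv
    rw [hyperbola]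
    by_cases h : 2 * e = u * ((v⁻¹ : (ZMod N)ˣ) : ZMod N) - v
    · rw [if_pos h, if_pos (hiff.mpr h), add_sub_cancel_right]
    · rw [if_neg h, if_neg (fun h' => h (hiff.mp h')), zero_mul, mul_zero]

lemma sum_two_torsion_shift {e₀ w : ZMod N} (h : 2 * e₀ = w) (f : ZMod N → ℂ) :
    ∑ e ∈ univ.filter (fun e : ZMod N => 2 * e = w), f e =
      ∑ e ∈ univ.filter (fun e : ZMod N => 2 * e = 0), f (e₀ + e) := by
  refine sum_nbij' (fun e => e - e₀) (fun e => e₀ + e) ?_ ?_ ?_ ?_ ?_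
  · intro e he
    refine mem_filter.mpr ⟨mem_univ _, ?_⟩
    linear_combination (mem_filter.mp he).2 - h
  · intro e he
    refine mem_filter.mpr ⟨mem_univ _, ?_⟩
    linear_combination (mem_filter.mp he).2 + h
  · intro e _; ring
  · intro e _; ring
  · intro e _; rw [add_sub_cancel]

lemma exists_two_mul_eq (hN2 : 2 ∣ N) (x y : (ZMod N)ˣ) : ∃ e : ZMod N, 2 * e = x - y := by
  have hodd : ∀ z : (ZMod N)ˣ, (z : ZMod N).val % 2 = 1 := by
    intro z
    have h1 := ZMod.val_coe_unit_coprime z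
    have h2 : Nat.Coprime (z : ZMod N).val 2 := h1.coprime_dvd_right hN2
    exact Nat.odd_iff.mp (Nat.coprime_two_right.mp h2)
  have hx := hodd x
  have hy := hodd y
  obtain ⟨k, hk⟩ : ∃ k : ℤ, ((x : ZMod N).val : ℤ) - (y : ZMod N).val = 2 * k :=
    ⟨(((x : ZMod N).val : ℤ) - (y : ZMod N).val) / 2, by omega⟩
  refine ⟨(k : ZMod N), ?_⟩
  have h := congrArg (Int.cast : ℤ → ZMod N) hk
  push_cast at h
  simpa using h.symm

/-- The Fourier transform of the hyperbola is a Kloosterman sum. -/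
lemma hyperbolaHat_eq (hN2 : 2 ∣ N) (ψ : MulChar (ZMod N) ℂ) (u : (ZMod N)ˣ) (h k l : ZMod N)
    (hl : 2 * l = h + k) :
    hyperbolaHat ψ u h k = (univ.filter fun e : ZMod N => 2 * e = 0).card *
      kloosterman ψ (h - l) (l * u) := by
  rw [hyperbolaHat, sum_hyperbola_mul_eq ψ u fun s e => ZMod.stdAddChar (h * s + k * e),
    kloosterman, mul_sum]
  refine sum_congr rfl fun v _ => ?_
  obtain ⟨e₀, he₀⟩ := exists_two_mul_eq hN2 (u * v⁻¹) v
  rw [Units.val_mul] at he₀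
  rw [sum_two_torsion_shift he₀]
  have h1 : ∀ e ∈ univ.filter (fun e : ZMod N => 2 * e = 0),
      (ZMod.stdAddChar (h * ((v : ZMod N) + (e₀ + e)) + k * (e₀ + e)) : ℂ) =
        ZMod.stdAddChar ((h - l) * (v : ZMod N) + l * (u : ZMod N) * ((v⁻¹ : (ZMod N)ˣ) : ZMod N)) := by
    intro e he
    have he' := (mem_filter.mp he).2
    congr 1
    linear_combination (-(e₀ + e)) * hl + l * he₀ + l * he'
  rw [sum_congr rfl h1, sum_const, nsmul_eq_mul]
  ring

lemma hyperbolaHat_eq_zero (hN2 : 2 ∣ N) (ψ : MulChar (ZMod N) ℂ) (u : (ZMod N)ˣ) (h k : ZMod N)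
    (hl : ∀ l : ZMod N, 2 * l ≠ h + k) : hyperbolaHat ψ u h k = 0 := by
  rw [hyperbolaHat, sum_hyperbola_mul_eq ψ u fun s e => ZMod.stdAddChar (h * s + k * e)]
  refine sum_eq_zero fun v _ => ?_
  have hN0 : 0 < N := Nat.pos_of_ne_zero hN.out
  obtain ⟨M, hM⟩ := hN2
  have hz : ZMod.stdAddChar ((h + k) * (M : ZMod N)) ≠ (1 : ℂ) := by
    intro h1
    have h2 : (h + k) * (M : ZMod N) = 0 :=
      ZMod.injective_stdAddChar (by rw [h1, AddChar.map_zero_eq_one])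
    have h3 : (((h + k).val * M : ℕ) : ZMod N) = 0 := by
      push_cast
      rw [ZMod.natCast_zmod_val]
      exact h2
    rw [ZMod.natCast_eq_zero_iff] at h3
    obtain ⟨j, hj⟩ := Nat.dvd_of_mul_dvd_mul_right (by omega) ((dvd_of_eq hM.symm).trans h3)
    refine hl (j : ZMod N) ?_
    rw [← ZMod.natCast_zmod_val (h + k), hj]
    push_cast
    ring
  have hM2 : (2 : ZMod N) * (M : ZMod N) = 0 := by
    have : ((2 * M : ℕ) : ZMod N) = 0 := by rw [← hM]; exact ZMod.natCast_self N
    exact_mod_cast this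
  set T := ∑ e ∈ univ.filter (fun e : ZMod N => 2 * e = u * ((v⁻¹ : (ZMod N)ˣ) : ZMod N) - v),
    (ZMod.stdAddChar (h * ((v : ZMod N) + e) + k * e) : ℂ) with hT
  have hshift : T = ZMod.stdAddChar ((h + k) * (M : ZMod N)) * T := by
    conv_rhs => rw [hT, mul_sum]
    rw [hT]
    refine sum_nbij' (fun e => e - (M : ZMod N)) (fun e => e + (M : ZMod N)) ?_ ?_ ?_ ?_ ?_
    · intro e he
      have he' := (mem_filter.mp he).2
      refine mem_filter.mpr ⟨mem_univ _, ?_⟩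
      linear_combination he' - hM2
    · intro e he
      have he' := (mem_filter.mp he).2
      refine mem_filter.mpr ⟨mem_univ _, ?_⟩
      linear_combination he' + hM2
    · intro e _; ring
    · intro e _; ring
    · intro e _
      rw [← AddChar.map_add_eq_mul]
      congr 1
      ring
  have hT0 : T = 0 := by
    by_contra hne
    exact hz (mul_right_cancel₀ hne (by rw [one_mul]; exact hshift.symm))
  rw [hT0, mul_zero]

lemma card_two_torsion_le : (univ.filter fun e : ZMod N => 2 * e = 0).card ≤ 2 :=
  card_two_mul_eq_le 0

/-- Bound for the Fourier transform of the hyperbola. -/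
lemma norm_hyperbolaHat_le (hN2 : 2 ∣ N) (ψ : MulChar (ZMod N) ℂ) (u : (ZMod N)ˣ) {B : ℝ}
    (hB0 : 0 ≤ B) (hB : 2 * (N : ℝ) ^ 3 * (N.divisors.card : ℝ) ^ 3 ≤ B ^ 4) (h k : ZMod N) :
    ‖hyperbolaHat ψ u h k‖ ≤ 2 * B * (Nat.gcd h.val N : ℝ) ∧
      ‖hyperbolaHat ψ u h k‖ ≤ 2 * B * (Nat.gcd k.val N : ℝ) := by
  have hN0 : 0 < N := Nat.pos_of_ne_zero hN.out
  by_cases hl : ∃ l : ZMod N, 2 * l = h + k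
  swap
  · rw [not_exists] at hl
    rw [hyperbolaHat_eq_zero hN2 ψ u h k hl, norm_zero]
    constructor <;> positivity
  obtain ⟨l, hl⟩ := hl
  set g := Nat.gcd (Nat.gcd (h - l).val (l * (u : ZMod N)).val) N with hg
  have hgN : g ∣ N := Nat.gcd_dvd_right _ _
  have hg1 : g ∣ (h - l).val := (Nat.gcd_dvd_left _ _).trans (Nat.gcd_dvd_left _ _)
  have hg2 : g ∣ (l * (u : ZMod N)).val := (Nat.gcd_dvd_left _ _).trans (Nat.gcd_dvd_right _ _)
  have hg0 : 0 < g := Nat.gcd_pos_of_pos_right _ hN0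
  have hcast : ∀ x : ZMod N, g ∣ x.val ↔ ZMod.castHom hgN (ZMod g) x = 0 := by
    intro x
    rw [← ZMod.natCast_eq_zero_iff, ZMod.castHom_apply, ZMod.natCast_val]
  rw [hcast] at hg1 hg2
  rw [map_sub] at hg1
  rw [map_mul] at hg2
  have hl0 : ZMod.castHom hgN (ZMod g) l = 0 := by
    have hu : IsUnit (ZMod.castHom hgN (ZMod g) (u : ZMod N)) := u.isUnit.map _
    exact (hu.mul_left_eq_zero).mp hg2
  have hh0 : ZMod.castHom hgN (ZMod g) h = 0 := by rw [hl0, sub_zero] at hg1; exact hg1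
  have hk0 : ZMod.castHom hgN (ZMod g) k = 0 := by
    have h1 := congrArg (ZMod.castHom hgN (ZMod g)) hl
    rw [map_mul, map_add, hl0, hh0, mul_zero, zero_add] at h1
    exact h1.symm
  rw [← hcast] at hh0 hk0
  have hgh : g ≤ Nat.gcd h.val N :=
    Nat.le_of_dvd (Nat.gcd_pos_of_pos_right _ hN0) (Nat.dvd_gcd hh0 hgN)
  have hgk : g ≤ Nat.gcd k.val N :=
    Nat.le_of_dvd (Nat.gcd_pos_of_pos_right _ hN0) (Nat.dvd_gcd hk0 hgN)
  have hK : ‖kloosterman ψ (h - l) (l * u)‖ ≤ B * g := by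
    have h1 := norm_kloosterman_pow_four_le ψ (h - l) (l * u)
    have hg1' : (1 : ℝ) ≤ g := by exact_mod_cast hg0
    have h2 : ‖kloosterman ψ (h - l) (l * u)‖ ^ 4 ≤ (B * g) ^ 4 := by
      calc _ ≤ _ := h1
        _ ≤ B ^ 4 * g := mul_le_mul_of_nonneg_right hB (Nat.cast_nonneg _)
        _ ≤ B ^ 4 * (g : ℝ) ^ 4 := mul_le_mul_of_nonneg_left
            (le_self_pow₀ hg1' (by norm_num)) (by positivity)
        _ = (B * g) ^ 4 := by rw [mul_pow]
    exact le_of_pow_le_pow_left₀ (by norm_num) (by positivity) h2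
  have hmain : ‖hyperbolaHat ψ u h k‖ ≤ 2 * (B * g) := by
    rw [hyperbolaHat_eq hN2 ψ u h k l hl, norm_mul, Complex.norm_natCast]
    have h2 : ((univ.filter fun e : ZMod N => 2 * e = 0).card : ℝ) ≤ 2 := by
      exact_mod_cast card_two_torsion_le
    exact mul_le_mul h2 hK (norm_nonneg _) (by norm_num)
  constructor
  · refine hmain.trans ?_
    rw [mul_assoc]
    have : (g : ℝ) ≤ (Nat.gcd h.val N : ℝ) := by exact_mod_cast hgh
    gcongr
  · refine hmain.trans ?_
    rw [mul_assoc]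
    have : (g : ℝ) ≤ (Nat.gcd k.val N : ℝ) := by exact_mod_cast hgk
    gcongr

/-- Fourier inversion on a box. -/
lemma sum_box_hyperbola (ψ : MulChar (ZMod N) ℂ) (u : (ZMod N)ˣ) (a b a' b' : ℤ) :
    (N : ℂ) ^ 2 * ∑ s ∈ Ico a b, ∑ e ∈ Ico a' b', hyperbola ψ u s e =
      ∑ h : ZMod N, ∑ k : ZMod N,
        hyperbolaHat ψ u h k * (intervalSum N a b h * intervalSum N a' b' k) := by
  have hinv : ∀ x y : ZMod N, ∑ h : ZMod N, ∑ k : ZMod N, hyperbolaHat ψ u h k *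
      (ZMod.stdAddChar (-h * x) * ZMod.stdAddChar (-k * y)) = (N : ℂ) ^ 2 * hyperbola ψ u x y := by
    intro x y
    have h1 : ∀ h k : ZMod N, hyperbolaHat ψ u h k *
        (ZMod.stdAddChar (-h * x) * ZMod.stdAddChar (-k * y)) =
        ∑ q : ZMod N × ZMod N, hyperbola ψ u q.1 q.2 *
          (ZMod.stdAddChar (h * (q.1 - x)) * ZMod.stdAddChar (k * (q.2 - y))) := by
      intro h k
      rw [hyperbolaHat, Fintype.sum_prod_type, sum_mul]
      refine sum_congr rfl fun s _ => ?_
      rw [sum_mul]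
      refine sum_congr rfl fun e _ => ?_
      rw [mul_assoc, ← AddChar.map_add_eq_mul, ← AddChar.map_add_eq_mul,
        ← AddChar.map_add_eq_mul]
      congr 2
      ring
    simp_rw [h1]
    rw [sum_congr rfl fun h _ => sum_comm, sum_comm]
    have h2 : ∀ q : ZMod N × ZMod N, ∑ h : ZMod N, ∑ k : ZMod N, hyperbola ψ u q.1 q.2 *
        (ZMod.stdAddChar (h * (q.1 - x)) * ZMod.stdAddChar (k * (q.2 - y))) =
        if q = (x, y) then (N : ℂ) ^ 2 * hyperbola ψ u x y else 0 := by
      intro q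
      simp_rw [← mul_sum, ← sum_mul]
      rw [sum_stdAddChar_mul, sum_stdAddChar_mul]
      by_cases hq : q = (x, y)
      · rw [hq]; simp; ring
      · rw [if_neg hq]
        by_cases hx : q.1 = x
        · have hy : q.2 ≠ y := fun hy => hq (Prod.ext hx hy)
          simp [sub_eq_zero, hy]
        · simp [sub_eq_zero, hx]
    rw [sum_congr rfl fun q _ => h2 q, sum_ite_eq' univ (x, y), if_pos (mem_univ _)]
  have h3 : ∀ h k : ZMod N, hyperbolaHat ψ u h k *
      (intervalSum N a b h * intervalSum N a' b' k) =
      ∑ q ∈ Ico a b ×ˢ Ico a' b', hyperbolaHat ψ u h k *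
        (ZMod.stdAddChar (-h * ((q.1 : ℤ) : ZMod N)) *
          ZMod.stdAddChar (-k * ((q.2 : ℤ) : ZMod N))) := by
    intro h k
    rw [intervalSum, intervalSum, sum_mul_sum, mul_sum, sum_product]
    exact sum_congr rfl fun s _ => by rw [mul_sum]
  have h4 : ∑ s ∈ Ico a b, ∑ e ∈ Ico a' b', hyperbola ψ u s e =
      ∑ q ∈ Ico a b ×ˢ Ico a' b', hyperbola ψ u q.1 q.2 := by rw [sum_product]
  rw [h4]
  simp_rw [h3]
  rw [sum_congr rfl fun h _ => sum_comm, sum_comm,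
    sum_congr rfl fun (q : ℤ × ℤ) _ => hinv q.1 q.2, ← mul_sum]

/-- Equidistribution of the hyperbola in boxes. -/
theorem norm_sum_box_hyperbola_sub_le (hN2 : 2 ∣ N) (ψ : MulChar (ZMod N) ℂ) (u : (ZMod N)ˣ)
    {B : ℝ} (hB0 : 0 ≤ B) (hB : 2 * (N : ℝ) ^ 3 * (N.divisors.card : ℝ) ^ 3 ≤ B ^ 4)
    (a b a' b' : ℤ) :
    (N : ℝ) ^ 2 * ‖∑ s ∈ Ico a b, ∑ e ∈ Ico a' b', hyperbola ψ u s e‖ ≤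
      ‖hyperbolaHat ψ u 0 0‖ * ((b - a).toNat * (b' - a').toNat) +
      2 * B * (N * (N.divisors.card * harm N) *
        ((b - a).toNat + (b' - a').toNat + N * (N.divisors.card * harm N))) := by
  set Δ : ℝ := N * (N.divisors.card * harm N) with hΔ
  set I := intervalSum N a b
  set J := intervalSum N a' b'
  have hI : ∑ h ∈ univ.filter (fun h : ZMod N => h ≠ 0), ‖I h‖ * (Nat.gcd h.val N : ℝ) ≤ Δ :=
    sum_norm_intervalSum_mul_gcd_le a b
  have hJ : ∑ h ∈ univ.filter (fun h : ZMod N => h ≠ 0), ‖J h‖ * (Nat.gcd h.val N : ℝ) ≤ Δ :=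
    sum_norm_intervalSum_mul_gcd_le a' b'
  have hN0 : 0 < N := Nat.pos_of_ne_zero hN.out
  have hJ1 : ∑ h ∈ univ.filter (fun h : ZMod N => h ≠ 0), ‖J h‖ ≤ Δ := by
    refine le_trans (sum_le_sum fun h _ => ?_) hJ
    have : 1 ≤ Nat.gcd h.val N := Nat.gcd_pos_of_pos_right _ hN0
    exact le_mul_of_one_le_right (norm_nonneg _) (by exact_mod_cast this)
  have split : ∀ f : ZMod N → ℝ, ∑ h, f h = f 0 + ∑ h ∈ univ.filter (fun h => h ≠ 0), f h := by
    intro f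
    rw [filter_ne', add_sum_erase _ _ (mem_univ _)]
  have hI0 : ‖I 0‖ ≤ ((b - a).toNat : ℝ) := norm_intervalSum_le_card a b 0
  have hJ0 : ‖J 0‖ ≤ ((b' - a').toNat : ℝ) := norm_intervalSum_le_card a' b' 0
  have hΔ0 : 0 ≤ Δ := le_trans (sum_nonneg fun _ _ => norm_nonneg _) hJ1
  calc (N : ℝ) ^ 2 * ‖∑ s ∈ Ico a b, ∑ e ∈ Ico a' b', hyperbola ψ u s e‖
      = ‖(N : ℂ) ^ 2 * ∑ s ∈ Ico a b, ∑ e ∈ Ico a' b', hyperbola ψ u s e‖ := by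
        rw [norm_mul, norm_pow, Complex.norm_natCast]
    _ ≤ ∑ h : ZMod N, ∑ k : ZMod N, ‖hyperbolaHat ψ u h k‖ * (‖I h‖ * ‖J k‖) := by
        rw [sum_box_hyperbola]
        refine (norm_sum_le _ _).trans (sum_le_sum fun h _ => (norm_sum_le _ _).trans
          (sum_le_sum fun k _ => ?_))
        rw [norm_mul, norm_mul]
    _ = ‖hyperbolaHat ψ u 0 0‖ * (‖I 0‖ * ‖J 0‖) +
          ∑ k ∈ univ.filter (fun k => k ≠ 0), ‖hyperbolaHat ψ u 0 k‖ * (‖I 0‖ * ‖J k‖) +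
          ∑ h ∈ univ.filter (fun h => h ≠ 0), ∑ k : ZMod N,
            ‖hyperbolaHat ψ u h k‖ * (‖I h‖ * ‖J k‖) := by
        rw [split, split fun k => ‖hyperbolaHat ψ u 0 k‖ * (‖I 0‖ * ‖J k‖)]
    _ ≤ ‖hyperbolaHat ψ u 0 0‖ * ((b - a).toNat * (b' - a').toNat) +
          2 * B * ((b - a).toNat * Δ) + 2 * B * (Δ * ((b' - a').toNat + Δ)) := by
        refine add_le_add (add_le_add ?_ ?_) ?_
        · gcongr
        · calc _ ≤ ∑ k ∈ univ.filter (fun k => k ≠ 0),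
                2 * B * ((b - a).toNat * (‖J k‖ * (Nat.gcd k.val N : ℝ))) := by
                refine sum_le_sum fun k _ => ?_
                calc _ ≤ 2 * B * (Nat.gcd k.val N : ℝ) * (((b - a).toNat : ℝ) * ‖J k‖) := by
                      gcongr
                      exact (norm_hyperbolaHat_le hN2 ψ u hB0 hB 0 k).2
                  _ = _ := by ring
            _ ≤ _ := by
                rw [← mul_sum, ← mul_sum]
                gcongr
        · calc _ ≤ ∑ h ∈ univ.filter (fun h => h ≠ 0), ∑ k : ZMod N,
                2 * B * ((‖I h‖ * (Nat.gcd h.val N : ℝ)) * ‖J k‖) := by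
                refine sum_le_sum fun h _ => sum_le_sum fun k _ => ?_
                calc _ ≤ 2 * B * (Nat.gcd h.val N : ℝ) * (‖I h‖ * ‖J k‖) := by
                      gcongr
                      exact (norm_hyperbolaHat_le hN2 ψ u hB0 hB h k).1
                  _ = _ := by ring
            _ ≤ _ := by
                simp_rw [← mul_sum]
                rw [← sum_mul, split fun k => ‖J k‖]
                gcongr
    _ = _ := by ring

lemma hyperbolaHat_zero_zero (hN2 : 2 ∣ N) (ψ : MulChar (ZMod N) ℂ) (u : (ZMod N)ˣ) :
    hyperbolaHat ψ u 0 0 = (univ.filter fun e : ZMod N => 2 * e = 0).card *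
      ∑ v : (ZMod N)ˣ, ψ v := by
  rw [hyperbolaHat_eq hN2 ψ u 0 0 0 (by ring), kloosterman]
  simp

lemma hyperbolaHat_zero_zero_of_ne_one (hN2 : 2 ∣ N) {ψ : MulChar (ZMod N) ℂ} (hψ : ψ ≠ 1)
    (u : (ZMod N)ˣ) : hyperbolaHat ψ u 0 0 = 0 := by
  rw [hyperbolaHat_zero_zero hN2]
  have h1 : ∑ v : (ZMod N)ˣ, ψ v = ∑ x : ZMod N, ψ x := by
    have h2 : ∑ x : ZMod N, ψ x = ∑ x ∈ univ.filter (fun x : ZMod N => IsUnit x), ψ x := by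
      rw [sum_filter]
      refine sum_congr rfl fun x _ => ?_
      split_ifs with hx
      · rfl
      · exact ψ.map_nonunit hx
    rw [h2]
    refine sum_bij (fun v _ => (v : ZMod N)) (fun v _ => mem_filter.mpr ⟨mem_univ _, v.isUnit⟩)
      (fun v _ w _ h => Units.ext h) (fun d hd => ?_) (fun v _ => rfl)
    obtain ⟨v, rfl⟩ := (mem_filter.mp hd).2
    exact ⟨v, mem_univ _, rfl⟩
  rw [h1, MulChar.sum_eq_zero_of_ne_one hψ, mul_zero]

lemma norm_hyperbolaHat_zero_zero_le (hN2 : 2 ∣ N) (ψ : MulChar (ZMod N) ℂ) (u : (ZMod N)ˣ) :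
    ‖hyperbolaHat ψ u 0 0‖ ≤ 2 * N := by
  rw [hyperbolaHat_zero_zero hN2, norm_mul, Complex.norm_natCast]
  have h2 : ((univ.filter fun e : ZMod N => 2 * e = 0).card : ℝ) ≤ 2 := by
    exact_mod_cast card_two_torsion_le
  have h3 : ‖∑ v : (ZMod N)ˣ, ψ v‖ ≤ N := by
    refine (norm_sum_le _ _).trans ?_
    rw [sum_congr rfl fun v _ => norm_mulChar_unit ψ v, sum_const, nsmul_one, card_univ,
      ZMod.card_units_eq_totient]
    exact_mod_cast Nat.totient_le N
  exact mul_le_mul h2 h3 (norm_nonneg _) (by norm_num)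

end HyperbolaBox

section RegionSum

/-- Summation by parts against the weight `s`. -/
lemma norm_sum_Ico_mul_le {F : ℕ → ℂ} {r : ℕ} {E : ℝ}
    (hF : ∀ k ≤ r, ‖∑ s ∈ Ico k r, F s‖ ≤ E) {k : ℕ} (hk : k ≤ r) :
    ‖∑ s ∈ Ico k r, (s : ℂ) * F s‖ ≤ r * E := by
  have key : ∀ j, j ≤ r → ‖∑ s ∈ Ico (r - j) r, (s : ℂ) * F s -
      ((r - j : ℕ) : ℂ) * ∑ s ∈ Ico (r - j) r, F s‖ ≤ j * E := by
    intro j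
    induction j with
    | zero => simp
    | succ j ih =>
      intro hj
      obtain ⟨i, hi⟩ : ∃ i, i + (j + 1) = r := ⟨r - (j + 1), by omega⟩
      have h1 : r - (j + 1) = i := by omega
      have h2 : r - j = i + 1 := by omega
      have ih' := ih (by omega)
      rw [h2] at ih'
      have hir : i < r := by omega
      rw [h1, sum_eq_sum_Ico_succ_bot hir, sum_eq_sum_Ico_succ_bot hir F]
      have e : (i : ℂ) * F i + ∑ s ∈ Ico (i + 1) r, (s : ℂ) * F s -
          (i : ℂ) * (F i + ∑ s ∈ Ico (i + 1) r, F s) =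
          (∑ s ∈ Ico (i + 1) r, (s : ℂ) * F s -
            ((i + 1 : ℕ) : ℂ) * ∑ s ∈ Ico (i + 1) r, F s) + ∑ s ∈ Ico (i + 1) r, F s := by
        push_cast
        ring
      rw [e]
      refine (norm_add_le _ _).trans ?_
      have h3 := hF (i + 1) (by omega)
      push_cast at ih' ⊢
      linarith
  have h := key (r - k) (by omega)
  rw [show r - (r - k) = k by omega] at h
  have hE := hF k hk
  calc ‖∑ s ∈ Ico k r, (s : ℂ) * F s‖
      = ‖(∑ s ∈ Ico k r, (s : ℂ) * F s - (k : ℂ) * ∑ s ∈ Ico k r, F s) +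
          (k : ℂ) * ∑ s ∈ Ico k r, F s‖ := by rw [sub_add_cancel]
    _ ≤ ((r - k : ℕ) : ℝ) * E + k * E := by
        refine (norm_add_le _ _).trans (add_le_add h ?_)
        rw [norm_mul, Complex.norm_natCast]
        gcongr
    _ = r * E := by
        rw [← add_mul, ← Nat.cast_add, Nat.sub_add_cancel hk]

lemma norm_sum_Ico_pow_mul_le {F : ℕ → ℂ} {r : ℕ} {E : ℝ}
    (hF : ∀ k ≤ r, ‖∑ s ∈ Ico k r, F s‖ ≤ E) (m : ℕ) :
    ∀ k ≤ r, ‖∑ s ∈ Ico k r, (s : ℂ) ^ m * F s‖ ≤ (r : ℝ) ^ m * E := by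
  induction m with
  | zero => simpa using hF
  | succ m ih =>
    intro k hk
    have h := norm_sum_Ico_mul_le ih hk
    calc _ = ‖∑ s ∈ Ico k r, (s : ℂ) * ((s : ℂ) ^ m * F s)‖ := by
          congr 1
          exact sum_congr rfl fun s _ => by ring
      _ ≤ _ := h
      _ = _ := by ring

/-- Sums over the region under a monotone graph, from estimates over boxes. -/
lemma norm_sum_region_le {F : ℕ → ℕ → ℂ} {n : ℕ → ℕ → ℝ} (hFn : ∀ s e, ‖F s e‖ ≤ n s e)
    {ρ : ℕ → ℕ} (hρ : Monotone ρ) {G R H K : ℕ} (hR : ρ G ≤ R) {E κ : ℝ} (hE0 : 0 ≤ E)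
    (hκ : 0 ≤ κ)
    (hF : ∀ k r j l, k ≤ r → r ≤ R → j ≤ l → l ≤ G →
      ‖∑ s ∈ Ico k r, ∑ e ∈ Ico j l, F s e‖ ≤ E)
    (hn : ∀ k r j l, k ≤ r → r ≤ R → j ≤ l → l ≤ G →
      ∑ s ∈ Ico k r, ∑ e ∈ Ico j l, n s e ≤ κ * ((r - k : ℕ) * (l - j : ℕ)) + E)
    (hG : G ≤ K * H) (m : ℕ) :
    ‖∑ e ∈ range G, ∑ s ∈ range (ρ e), (s : ℂ) ^ m * F s e‖ ≤
      (R : ℝ) ^ m * (2 * K * E + κ * H * R) := by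
  have hn0 : ∀ s e, 0 ≤ n s e := fun s e => (norm_nonneg _).trans (hFn s e)
  have key : ∀ j : ℕ, ‖∑ e ∈ range (min (j * H) G), ∑ s ∈ range (ρ e), (s : ℂ) ^ m * F s e‖ ≤
      (R : ℝ) ^ m * (2 * j * E + κ * H * ρ (min (j * H) G)) := by
    intro j
    induction j with
    | zero =>
      simp only [zero_mul, Nat.zero_min, range_zero, sum_empty, norm_zero]
      positivity
    | succ j ih =>
      set a := min (j * H) G with ha
      set b := min ((j + 1) * H) G with hb
      have hab : a ≤ b := min_le_min (Nat.mul_le_mul_right _ (by omega)) le_rfl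
      have hbG : b ≤ G := min_le_right _ _
      have hba : b - a ≤ H := by
        have : (j + 1) * H = j * H + H := by ring
        omega
      have hρab := hρ hab
      have hρbR : ρ b ≤ R := (hρ hbG).trans hR
      rw [← sum_range_add_sum_Ico _ hab]
      have h1 : ∑ e ∈ Ico a b, ∑ s ∈ range (ρ e), (s : ℂ) ^ m * F s e =
          ∑ s ∈ Ico 0 (ρ a), (s : ℂ) ^ m * ∑ e ∈ Ico a b, F s e +
          ∑ e ∈ Ico a b, ∑ s ∈ Ico (ρ a) (ρ e), (s : ℂ) ^ m * F s e := by
        simp_rw [mul_sum]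
        rw [sum_comm, ← sum_add_distrib, ← range_eq_Ico]
        refine sum_congr rfl fun e he => ?_
        rw [sum_range_add_sum_Ico _ (hρ (mem_Ico.mp he).1)]
      have h2 : ‖∑ s ∈ Ico 0 (ρ a), (s : ℂ) ^ m * ∑ e ∈ Ico a b, F s e‖ ≤ (R : ℝ) ^ m * E := by
        refine (norm_sum_Ico_pow_mul_le (fun k hk =>
          hF k (ρ a) a b hk (hρab.trans hρbR) hab hbG) m 0 (Nat.zero_le _)).trans ?_
        have : (ρ a : ℝ) ≤ R := by exact_mod_cast hρab.trans hρbR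
        gcongr
      have h3 : ‖∑ e ∈ Ico a b, ∑ s ∈ Ico (ρ a) (ρ e), (s : ℂ) ^ m * F s e‖ ≤
          (R : ℝ) ^ m * (κ * ((ρ b - ρ a : ℕ) * (b - a : ℕ)) + E) := by
        calc _ ≤ ∑ e ∈ Ico a b, ∑ s ∈ Ico (ρ a) (ρ b), (R : ℝ) ^ m * n s e := by
              refine (norm_sum_le _ _).trans (sum_le_sum fun e he => ?_)
              have hρe : ρ e ≤ ρ b := hρ (mem_Ico.mp he).2.le
              refine (norm_sum_le _ _).trans ?_
              calc _ ≤ ∑ s ∈ Ico (ρ a) (ρ e), (R : ℝ) ^ m * n s e := by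
                    refine sum_le_sum fun s hs => ?_
                    have hs' : (s : ℝ) ≤ R := by
                      have := (mem_Ico.mp hs).2
                      exact_mod_cast (by omega : s ≤ R)
                    rw [norm_mul, norm_pow, Complex.norm_natCast]
                    gcongr
                    exact hFn s e
                _ ≤ _ := sum_le_sum_of_subset_of_nonneg (Ico_subset_Ico_right hρe)
                    fun s _ _ => mul_nonneg (by positivity) (hn0 s e)
          _ = (R : ℝ) ^ m * ∑ s ∈ Ico (ρ a) (ρ b), ∑ e ∈ Ico a b, n s e := by
              rw [sum_comm]
              simp_rw [mul_sum]
          _ ≤ _ := by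
              gcongr
              exact hn _ _ _ _ hρab hρbR hab hbG
      rw [h1]
      refine (norm_add_le _ _).trans ((add_le_add ih ((norm_add_le _ _).trans
        (add_le_add h2 h3))).trans ?_)
      have h4 : κ * (((ρ b - ρ a : ℕ) : ℝ) * ((b - a : ℕ) : ℝ)) ≤ κ * H * ((ρ b : ℝ) - ρ a) := by
        rw [← Nat.cast_sub hρab, mul_assoc, mul_comm (H : ℝ)]
        gcongr
      rw [← mul_add, ← mul_add]
      refine mul_le_mul_of_nonneg_left ?_ (by positivity)
      push_cast
      linarith
  have h := key K
  rw [min_eq_right hG] at h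
  refine h.trans ?_
  have : (ρ G : ℝ) ≤ R := by exact_mod_cast hR
  gcongr

end RegionSum

section BoxError

/-- The error term in the equidistribution of the hyperbola in boxes. -/
noncomputable def boxErr (K : ℝ) (N : ℕ) : ℝ :=
  4 * ((N : ℝ) ^ ((1 : ℝ) / 48)) ^ 36 * N.divisors.card ^ 2 * harm N *
    (2 * K + N.divisors.card * harm N)

lemma harm_nonneg (N : ℕ) : 0 ≤ harm N := sum_nonneg fun _ _ => by positivity

lemma boxErr_nonneg {K : ℝ} (hK : 0 ≤ K) (N : ℕ) : 0 ≤ boxErr K N := by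
  have := harm_nonneg N
  unfold boxErr
  positivity

lemma rpow_one_div_pow_fortyeight (N : ℕ) : ((N : ℝ) ^ ((1 : ℝ) / 48)) ^ 48 = N := by
  rw [← Real.rpow_natCast, ← Real.rpow_mul (Nat.cast_nonneg _)]
  norm_num

lemma harm_le (N : ℕ) (hN : 0 < N) : harm N ≤ 1 + Real.log N := by
  have h1 : harm N ≤ (harmonic N : ℝ) := by
    rw [harmonic, harm]
    push_cast
    rw [show Ioo 0 N = Ico 1 N from rfl, sum_Ico_eq_sum_range]
    calc _ = ∑ k ∈ range (N - 1), ((k : ℝ) + 1)⁻¹ := by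
          refine sum_congr rfl fun k _ => ?_
          push_cast
          rw [one_div, add_comm]
      _ ≤ _ := sum_le_sum_of_subset_of_nonneg (range_mono (by omega)) fun k _ _ => by positivity
  exact h1.trans (harmonic_le_one_add_log N)

/-- The box error is of lower order than the modulus. -/
lemma exists_boxErr_le {K ε : ℝ} (hK : 0 ≤ K) (hε : 0 < ε) :
    ∃ C : ℝ, 0 ≤ C ∧ ∀ N : ℕ, 0 < N → boxErr K N ≤ ε * N + C := by
  obtain ⟨C₁, hC₁, hτ⟩ := exists_card_divisors_pow_le 48 (by norm_num)
  set A : ℝ := 4 * C₁ ^ 2 * 49 * (2 * K + C₁ * 49) with hA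
  have hC₁' : (1 : ℝ) ≤ C₁ := by exact_mod_cast hC₁
  have hA0 : 0 < A := by positivity
  set ε' := ε / A with hε'
  have hε'0 : 0 < ε' := by positivity
  refine ⟨A * (1 / ε') ^ 41, by positivity, fun N hN => ?_⟩
  set y := (N : ℝ) ^ ((1 : ℝ) / 48) with hy
  have hN1 : (1 : ℝ) ≤ N := by exact_mod_cast hN
  have hy1 : 1 ≤ y := Real.one_le_rpow hN1 (by norm_num)
  have hy48 : y ^ 48 = N := rpow_one_div_pow_fortyeight N
  have hτy : (N.divisors.card : ℝ) ≤ C₁ * y := by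
    have h1 : (N.divisors.card : ℝ) ^ 48 ≤ C₁ * N := by exact_mod_cast hτ N hN.ne'
    refine le_of_pow_le_pow_left₀ (n := 48) (by norm_num) (by positivity) (h1.trans ?_)
    rw [mul_pow, hy48]
    gcongr
    exact le_self_pow₀ hC₁' (by norm_num)
  have hhy : harm N ≤ 49 * y := by
    have h1 := harm_le N hN
    have h2 := Real.log_le_rpow_div (Nat.cast_nonneg N) (by norm_num : (0 : ℝ) < 1 / 48)
    rw [← hy] at h2
    linarith
  have h0 := harm_nonneg N
  have h1 : boxErr K N ≤ A * y ^ 41 := by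
    have h3 : 2 * K + N.divisors.card * harm N ≤ (2 * K + C₁ * 49) * y ^ 2 := by
      have h4 : (N.divisors.card : ℝ) * harm N ≤ (C₁ * y) * (49 * y) := by gcongr
      have h5 : 2 * K ≤ 2 * K * y ^ 2 := le_mul_of_one_le_right (by positivity) (one_le_pow₀ hy1)
      nlinarith
    calc boxErr K N ≤ 4 * y ^ 36 * (C₁ * y) ^ 2 * (49 * y) * ((2 * K + C₁ * 49) * y ^ 2) := by
          unfold boxErr
          gcongr
      _ = A * y ^ 41 := by rw [hA]; ring
  refine h1.trans ?_
  rcases le_total (1 / ε') y with h | h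
  · have h2 : 1 ≤ ε' * y := by
      rw [div_le_iff₀ hε'0] at h
      linarith
    have h3 : y ^ 41 ≤ ε' * y ^ 48 := by
      calc y ^ 41 ≤ (ε' * y) * y ^ 47 := by
            calc y ^ 41 ≤ y ^ 47 := pow_le_pow_right₀ hy1 (by norm_num)
              _ ≤ _ := le_mul_of_one_le_left (by positivity) h2
        _ = _ := by ring
    calc A * y ^ 41 ≤ A * (ε' * y ^ 48) := by gcongr
      _ = ε * N := by rw [hy48, hε']; field_simp
      _ ≤ _ := le_add_of_nonneg_right (by positivity)
  · have h2 : 1 ≤ 1 / ε' := hy1.trans h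
    calc A * y ^ 41 ≤ A * (1 / ε') ^ 41 := by gcongr
      _ ≤ _ := le_add_of_nonneg_left (by positivity)

variable {N : ℕ} [hN : NeZero N]

lemma norm_sum_box_hyperbola_le (hN2 : 2 ∣ N) (ψ : MulChar (ZMod N) ℂ) (u : (ZMod N)ˣ) {K R : ℝ}
    (hR : R ≤ K * N) {a b a' b' : ℤ} (h1 : ((b - a).toNat : ℝ) ≤ R)
    (h2 : ((b' - a').toNat : ℝ) ≤ R) :
    ‖∑ s ∈ Ico a b, ∑ e ∈ Ico a' b', hyperbola ψ u s e‖ ≤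
      ‖hyperbolaHat ψ u 0 0‖ / (N : ℝ) ^ 2 * ((b - a).toNat * (b' - a').toNat) + boxErr K N := by
  have hN0 : 0 < N := Nat.pos_of_ne_zero hN.out
  have hN0' : (0 : ℝ) < N := by exact_mod_cast hN0
  have hτ : (1 : ℝ) ≤ N.divisors.card := by
    exact_mod_cast card_pos.mpr ⟨1, Nat.one_mem_divisors.mpr hN0.ne'⟩
  have hh := harm_nonneg N
  set y := (N : ℝ) ^ ((1 : ℝ) / 48) with hy
  have hy0 : 0 ≤ y := by positivity
  have hy48 : y ^ 48 = N := rpow_one_div_pow_fortyeight N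
  have hB : 2 * (N : ℝ) ^ 3 * (N.divisors.card : ℝ) ^ 3 ≤ (2 * N.divisors.card * y ^ 36) ^ 4 := by
    have e : (2 * (N.divisors.card : ℝ) * y ^ 36) ^ 4 =
        16 * (N : ℝ) ^ 3 * (N.divisors.card : ℝ) ^ 4 := by
      rw [← hy48]; ring
    rw [e]
    have h4 : (N.divisors.card : ℝ) ^ 3 ≤ (N.divisors.card : ℝ) ^ 4 :=
      pow_le_pow_right₀ hτ (by norm_num)
    gcongr
    norm_num
  have h := norm_sum_box_hyperbola_sub_le hN2 ψ u (by positivity) hB a b a' b'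
  have hN2' : (0 : ℝ) < (N : ℝ) ^ 2 := by positivity
  rw [← mul_le_mul_iff_right₀ hN2']
  refine h.trans ?_
  rw [mul_add ((N : ℝ) ^ 2)]
  have e1 : (N : ℝ) ^ 2 * (‖hyperbolaHat ψ u 0 0‖ / (N : ℝ) ^ 2 *
      ((b - a).toNat * (b' - a').toNat)) =
      ‖hyperbolaHat ψ u 0 0‖ * ((b - a).toNat * (b' - a').toNat) := by
    field_simp
  rw [e1]
  refine add_le_add le_rfl ?_
  calc _ ≤ 2 * (2 * N.divisors.card * y ^ 36) * (N * (N.divisors.card * harm N) *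
        (K * N + K * N + N * (N.divisors.card * harm N))) := by
        exact mul_le_mul_of_nonneg_left (mul_le_mul_of_nonneg_left
          (add_le_add (add_le_add (h1.trans hR) (h2.trans hR)) le_rfl) (by positivity))
          (by positivity)
    _ = _ := by
        rw [boxErr]
        ring

end BoxError

section SignedRegion

/-- An affine parametrisation of integers by natural numbers carrying intervals to intervals. -/
def PreservesIntervals (σ : ℕ → ℤ) : Prop :=
  ∀ k r : ℕ, k ≤ r → ∃ a b : ℤ, (b - a).toNat = r - k ∧
    ∀ g : ℤ → ℂ, ∑ s ∈ Ico k r, g (σ s) = ∑ s ∈ Ico a b, g s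

lemma preservesIntervals_natCast : PreservesIntervals (fun s : ℕ => (s : ℤ)) := by
  intro k r h
  refine ⟨k, r, by omega, fun g => ?_⟩
  refine sum_nbij' (fun s => (s : ℤ)) (fun s => s.toNat) ?_ ?_ ?_ ?_ ?_
  all_goals simp only [mem_Ico]
  all_goals intros
  all_goals first | omega | trivial

lemma preservesIntervals_sub (δ : ℤ) : PreservesIntervals (fun s : ℕ => δ - (s : ℤ)) := by
  intro k r h
  refine ⟨δ - r + 1, δ - k + 1, by omega, fun g => ?_⟩
  refine sum_nbij' (fun s => δ - (s : ℤ)) (fun s => (δ - s).toNat) ?_ ?_ ?_ ?_ ?_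
  all_goals simp only [mem_Ico]
  all_goals intros
  all_goals first | omega | trivial

lemma sum_Ioo_neg_eq (r : ℕ) (hr : 0 < r) (f : ℤ → ℂ) :
    ∑ e ∈ Ioo (-(r : ℤ)) r, f e = ∑ e ∈ range r, f e + ∑ e ∈ range (r - 1), f (-1 - (e : ℤ)) := by
  have h1 : ∑ e ∈ range r, f e = ∑ e ∈ Ico (0 : ℤ) r, f e := by
    refine sum_nbij' (fun s => (s : ℤ)) (fun s => s.toNat) ?_ ?_ ?_ ?_ ?_
    all_goals simp only [mem_Ico, mem_range]
    all_goals intros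
    all_goals first | omega | trivial
  have h2 : ∑ e ∈ range (r - 1), f (-1 - (e : ℤ)) = ∑ e ∈ Ioo (-(r : ℤ)) 0, f e := by
    refine sum_nbij' (fun s => -1 - (s : ℤ)) (fun s => (-1 - s).toNat) ?_ ?_ ?_ ?_ ?_
    all_goals simp only [mem_Ioo, mem_range]
    all_goals intros
    all_goals first | omega | trivial
  rw [h1, h2, add_comm, ← sum_union]
  · refine sum_congr ?_ fun _ _ => rfl
    ext x
    simp only [mem_Ioo, mem_union, mem_Ico]
    omega
  · rw [disjoint_left]
    intro x hx hx'
    rw [mem_Ioo] at hx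
    rw [mem_Ico] at hx'
    omega

lemma sum_Ioo_neg_eq_of_zero (r : ℕ) {f : ℤ → ℂ} (hf : f 0 = 0) :
    ∑ s ∈ Ioo (-(r : ℤ)) r, f s = ∑ s ∈ range r, f s + ∑ s ∈ range r, f (0 - (s : ℤ)) := by
  rcases Nat.eq_zero_or_pos r with rfl | hr
  · simp
  · rw [sum_Ioo_neg_eq r hr]
    obtain ⟨t, rfl⟩ : ∃ t, r = t + 1 := ⟨r - 1, by omega⟩
    congr 1
    rw [sum_range_succ' fun s : ℕ => f (0 - (s : ℤ))]
    simp only [Nat.cast_zero, sub_zero, hf, add_zero, Nat.add_sub_cancel]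
    refine sum_congr rfl fun s _ => ?_
    congr 1
    push_cast
    ring

variable {N : ℕ} [hN : NeZero N]

lemma norm_hyperbola_le (ψ : MulChar (ZMod N) ℂ) (u : (ZMod N)ˣ) (s e : ZMod N) :
    ‖hyperbola ψ u s e‖ ≤ (hyperbola 1 u s e).re := by
  unfold hyperbola
  split_ifs with h
  · obtain ⟨v, hv⟩ : IsUnit (s - e) := isUnit_of_mul_isUnit_right (by rw [h]; exact u.isUnit)
    rw [← hv, norm_mulChar_unit, MulChar.one_apply_coe]
    simp
  · simp

lemma norm_sum_param_region_le (hN2 : 2 ∣ N) {ψ : MulChar (ZMod N) ℂ} (hψ : ψ ≠ 1)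
    (u : (ZMod N)ˣ) {σ τ : ℕ → ℤ} (hσ : PreservesIntervals σ) (hτ : PreservesIntervals τ)
    {ρ : ℕ → ℕ} (hρ : Monotone ρ) {G R H K : ℕ} (hR : ρ G ≤ R) (hGR : G ≤ R) (hRK : R ≤ K * N)
    (hG : G ≤ K * H) (m : ℕ) :
    ‖∑ e ∈ range G, ∑ s ∈ range (ρ e), (s : ℂ) ^ m * hyperbola ψ u (σ s : ℤ) (τ e : ℤ)‖ ≤
      (R : ℝ) ^ m * (2 * K * boxErr K N + 2 / N * H * R) := by
  have hN0 : (0 : ℝ) < N := by exact_mod_cast Nat.pos_of_ne_zero hN.out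
  have hRK' : (R : ℝ) ≤ K * N := by exact_mod_cast hRK
  have hbox : ∀ (ψ : MulChar (ZMod N) ℂ) (k r j l : ℕ), k ≤ r → r ≤ R → j ≤ l → l ≤ G →
      ‖∑ s ∈ Ico k r, ∑ e ∈ Ico j l, hyperbola ψ u (σ s : ℤ) (τ e : ℤ)‖ ≤
        ‖hyperbolaHat ψ u 0 0‖ / (N : ℝ) ^ 2 * ((r - k : ℕ) * (l - j : ℕ)) + boxErr K N := by
    intro ψ k r j l hkr hrR hjl hlG
    obtain ⟨a, b, hab, hs⟩ := hσ k r hkr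
    obtain ⟨a', b', hab', he⟩ := hτ j l hjl
    have e : ∑ s ∈ Ico k r, ∑ e ∈ Ico j l, hyperbola ψ u (σ s : ℤ) (τ e : ℤ) =
        ∑ s ∈ Ico a b, ∑ e ∈ Ico a' b', hyperbola ψ u s e := by
      rw [hs fun s => ∑ e ∈ Ico j l, hyperbola ψ u s (τ e : ℤ)]
      exact sum_congr rfl fun s _ => he fun e => hyperbola ψ u s e
    rw [e, ← hab, ← hab']
    refine norm_sum_box_hyperbola_le hN2 ψ u hRK' ?_ ?_
    · rw [hab]; exact_mod_cast (by omega : r - k ≤ R)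
    · rw [hab']; exact_mod_cast (by omega : l - j ≤ R)
  refine norm_sum_region_le (n := fun s e => (hyperbola 1 u (σ s : ℤ) (τ e : ℤ)).re)
    (fun s e => norm_hyperbola_le ψ u _ _) hρ hR (boxErr_nonneg (Nat.cast_nonneg K) N)
    (by positivity) ?_ ?_ hG m
  · intro k r j l h1 h2 h3 h4
    have h := hbox ψ k r j l h1 h2 h3 h4
    rwa [hyperbolaHat_zero_zero_of_ne_one hN2 hψ, norm_zero, zero_div, zero_mul, zero_add] at h
  · intro k r j l h1 h2 h3 h4
    have h := hbox 1 k r j l h1 h2 h3 h4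
    have e : ∑ s ∈ Ico k r, ∑ e ∈ Ico j l, (hyperbola 1 u (σ s : ℤ) (τ e : ℤ)).re =
        (∑ s ∈ Ico k r, ∑ e ∈ Ico j l, hyperbola 1 u (σ s : ℤ) (τ e : ℤ)).re := by
      simp_rw [Complex.re_sum]
    rw [e]
    refine (Complex.re_le_norm _).trans (h.trans (add_le_add ?_ le_rfl))
    refine mul_le_mul_of_nonneg_right ?_ (by positivity)
    rw [div_le_div_iff₀ (by positivity) hN0]
    calc ‖hyperbolaHat 1 u 0 0‖ * N ≤ 2 * N * N :=
          mul_le_mul_of_nonneg_right (norm_hyperbolaHat_zero_zero_le hN2 1 u) hN0.le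
      _ = _ := by ring

theorem norm_sum_hyperbola_region_le (hN2 : 2 ∣ N) {ψ : MulChar (ZMod N) ℂ} (hψ : ψ ≠ 1)
    (u : (ZMod N)ˣ) {ρ : ℤ → ℕ} (hρ : ∀ e e' : ℤ, |e| ≤ |e'| → ρ e ≤ ρ e') {G R H K : ℕ}
    (hG0 : 0 < G) (hR : ρ G ≤ R) (hGR : G ≤ R) (hRK : R ≤ K * N) (hG : G ≤ K * H) {m : ℕ}
    (hm : 0 < m) :
    ‖∑ e ∈ Ioo (-(G : ℤ)) G, ∑ s ∈ Ioo (-(ρ e : ℤ)) (ρ e), (s : ℂ) ^ m * hyperbola ψ u s e‖ ≤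
      4 * ((R : ℝ) ^ m * (2 * K * boxErr K N + 2 / N * H * R)) := by
  have hs : ∀ e : ℤ, ∑ s ∈ Ioo (-(ρ e : ℤ)) (ρ e), (s : ℂ) ^ m * hyperbola ψ u s e =
      ∑ s ∈ range (ρ e), (s : ℂ) ^ m * hyperbola ψ u ((s : ℤ) : ℤ) e +
      (-1) ^ m * ∑ s ∈ range (ρ e), (s : ℂ) ^ m * hyperbola ψ u ((0 - (s : ℤ) : ℤ)) e := by
    intro e
    rw [sum_Ioo_neg_eq_of_zero (f := fun s : ℤ => (s : ℂ) ^ m * hyperbola ψ u s e) (ρ e)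
      (by simp [hm.ne']), mul_sum]
    congr 1
    refine sum_congr rfl fun s _ => ?_
    rw [← mul_assoc, ← mul_pow]
    congr 2
    push_cast
    ring
  rw [sum_Ioo_neg_eq G hG0]
  simp_rw [hs]
  simp_rw [sum_add_distrib, ← mul_sum]
  have hmono1 : Monotone fun e : ℕ => ρ (e : ℤ) := fun a b hab => hρ _ _ (by
    rw [abs_of_nonneg (by positivity), abs_of_nonneg (by positivity)]; exact_mod_cast hab)
  have hmono2 : Monotone fun e : ℕ => ρ (-1 - (e : ℤ)) := fun a b hab => hρ _ _ (by
    rw [abs_of_neg (by omega), abs_of_neg (by omega)]; omega)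
  have hR2 : ρ (-1 - ((G - 1 : ℕ) : ℤ)) ≤ R := (hρ _ (G : ℤ) (by
    rw [abs_of_neg (by omega), abs_of_nonneg (by omega)]; omega)).trans hR
  have h1 := norm_sum_param_region_le hN2 hψ u preservesIntervals_natCast
    preservesIntervals_natCast hmono1 hR hGR hRK hG m
  have h2 := norm_sum_param_region_le hN2 hψ u (preservesIntervals_sub 0)
    preservesIntervals_natCast hmono1 hR hGR hRK hG m
  have h3 := norm_sum_param_region_le hN2 hψ u preservesIntervals_natCast
    (preservesIntervals_sub (-1)) hmono2 hR2 ((Nat.sub_le _ _).trans hGR) hRK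
    ((Nat.sub_le _ _).trans hG) m
  have h4 := norm_sum_param_region_le hN2 hψ u (preservesIntervals_sub 0)
    (preservesIntervals_sub (-1)) hmono2 hR2 ((Nat.sub_le _ _).trans hGR) hRK
    ((Nat.sub_le _ _).trans hG) m
  have hsign : ∀ z : ℂ, ‖(-1 : ℂ) ^ m * z‖ = ‖z‖ := by
    intro z; simp
  refine (norm_add_le _ _).trans ((add_le_add (norm_add_le _ _) (norm_add_le _ _)).trans ?_)
  rw [hsign, hsign]
  linarith

end SignedRegion

section RegionBound

lemma card_hyperbola_region_le {G R : ℕ} (hGR : G ≤ R) (u : (ZMod (8 * G))ˣ)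
    {T : Finset (ℤ × ℤ)} (hT : ∀ x ∈ T, |x.2| < G ∧ |x.1| < R ∧
      ((x.1 : ZMod (8 * G)) + (x.2 : ZMod (8 * G))) * (x.1 - x.2) = u) :
    T.card ≤ 4 * R := by
  have h1 : T.card ≤ (Ioo (-(2 * R : ℤ)) (2 * R)).card := by
    refine card_le_card_of_injOn (fun x => x.1 + x.2) ?_ ?_
    · intro x hx
      obtain ⟨he, hs, -⟩ := hT x hx
      rw [abs_lt] at he hs
      simp only [coe_Ioo, Set.mem_Ioo]
      omega
    · intro x hx y hy hxy
      obtain ⟨he, hs, hx⟩ := hT x hx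
      obtain ⟨he', hs', hy⟩ := hT y hy
      simp only at hxy
      have hu : IsUnit ((x.1 : ZMod (8 * G)) + (x.2 : ZMod (8 * G))) :=
        isUnit_of_mul_isUnit_left (by rw [hx]; exact u.isUnit)
      have hc := congrArg (Int.cast : ℤ → ZMod (8 * G)) hxy
      push_cast at hc
      rw [← hc] at hy
      have h2 := hu.mul_left_cancel (hx.trans hy.symm)
      have h3 : (((x.1 - x.2) - (y.1 - y.2) : ℤ) : ZMod (8 * G)) = 0 := by
        push_cast
        rw [h2, sub_self]
      rw [ZMod.intCast_zmod_eq_zero_iff_dvd] at h3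
      push_cast at h3
      rw [abs_lt] at he he'
      have h4 : (x.1 - x.2) - (y.1 - y.2) = 2 * (y.2 - x.2) := by linear_combination hxy
      rw [h4] at h3
      have h5 : 2 * (y.2 - x.2) = 0 := by
        refine Int.eq_zero_of_abs_lt_dvd h3 ?_
        rw [abs_lt]
        omega
      exact Prod.ext (by omega) (by omega)
  refine h1.trans ?_
  rw [Int.card_Ioo]
  omega

lemma norm_sum_hyperbola_region_le_trivial {G R : ℕ} (hG0 : 0 < G) (hGR : G ≤ R)
    (ψ : MulChar (ZMod (8 * G)) ℂ) (u : (ZMod (8 * G))ˣ) {ρ : ℤ → ℕ}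
    (hR : ∀ e : ℤ, |e| ≤ G → ρ e ≤ R) (m : ℕ) :
    ‖∑ e ∈ Ioo (-(G : ℤ)) G, ∑ s ∈ Ioo (-(ρ e : ℤ)) (ρ e), (s : ℂ) ^ m * hyperbola ψ u s e‖ ≤
      (R : ℝ) ^ m * (4 * R) := by
  have : NeZero (8 * G) := ⟨by omega⟩
  set T := (Ioo (-(R : ℤ)) R ×ˢ Ioo (-(G : ℤ)) G).filter fun x : ℤ × ℤ =>
    ((x.1 : ZMod (8 * G)) + (x.2 : ZMod (8 * G))) * (x.1 - x.2) = u with hT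
  have hcard : T.card ≤ 4 * R := by
    refine card_hyperbola_region_le hGR u fun x hx => ?_
    simp only [hT, mem_filter, mem_product, mem_Ioo] at hx
    rw [abs_lt, abs_lt]
    exact ⟨hx.1.2, hx.1.1, hx.2⟩
  calc _ ≤ ∑ e ∈ Ioo (-(G : ℤ)) G, ∑ s ∈ Ioo (-(R : ℤ)) R, (R : ℝ) ^ m *
        (if ((s : ZMod (8 * G)) + (e : ZMod (8 * G))) * (s - e) = u then 1 else 0) := by
        refine (norm_sum_le _ _).trans (sum_le_sum fun e he => (norm_sum_le _ _).trans ?_)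
        have hρe : ρ e ≤ R := by
          refine hR e ?_
          rw [mem_Ioo] at he
          rw [abs_le]
          omega
        calc _ ≤ ∑ s ∈ Ioo (-(ρ e : ℤ)) (ρ e), (R : ℝ) ^ m *
              (if ((s : ZMod (8 * G)) + (e : ZMod (8 * G))) * (s - e) = u then 1 else 0) := by
              refine sum_le_sum fun s hs => ?_
              rw [norm_mul, norm_pow, Complex.norm_intCast]
              have hs' : |(s : ℝ)| ≤ R := by
                rw [mem_Ioo] at hs
                have : |s| ≤ (R : ℤ) := by rw [abs_le]; omega
                exact_mod_cast this
              gcongr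
              refine (norm_hyperbola_le ψ u _ _).trans ?_
              unfold hyperbola
              split_ifs with h
              · obtain ⟨v, hv⟩ : IsUnit ((s : ZMod (8 * G)) - e) :=
                  isUnit_of_mul_isUnit_right (by rw [h]; exact u.isUnit)
                rw [← hv, MulChar.one_apply_coe]
                simp
              · simp
          _ ≤ _ := by
              refine sum_le_sum_of_subset_of_nonneg (Ioo_subset_Ioo (by omega) (by omega))
                fun s _ _ => ?_
              positivity
    _ = (R : ℝ) ^ m * T.card := by
        rw [hT, card_filter, sum_product_right]
        push_cast
        simp_rw [mul_sum]
    _ ≤ _ := by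
        gcongr
        exact_mod_cast hcard

/-- The contribution of a modulus to the region sum. -/
lemma norm_sum_hyperbola_region_le_ite {G R K : ℕ} (hG0 : 0 < G) (hGR : G ≤ R) (hK : 0 < K)
    {ε C : ℝ} (hε : 0 ≤ ε) (hC : ∀ N : ℕ, 0 < N → boxErr K N ≤ ε * N + C)
    {ψ : MulChar (ZMod (8 * G)) ℂ} (hψ : ψ ≠ 1) (u : (ZMod (8 * G))ˣ) {ρ : ℤ → ℕ}
    (hρ : ∀ e e' : ℤ, |e| ≤ |e'| → ρ e ≤ ρ e') (hR : ρ G ≤ R) {m : ℕ} (hm : 0 < m) :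
    ‖∑ e ∈ Ioo (-(G : ℤ)) G, ∑ s ∈ Ioo (-(ρ e : ℤ)) (ρ e), (s : ℂ) ^ m * hyperbola ψ u s e‖ ≤
      4 * (R : ℝ) ^ m * (if G * K < R then (R : ℝ) else
        16 * K * ε * R + 2 * K * C + R / (4 * K) + K / 4) := by
  have : NeZero (8 * G) := ⟨by omega⟩
  split_ifs with h
  · refine (norm_sum_hyperbola_region_le_trivial hG0 hGR ψ u (fun e he => ?_) m).trans_eq (by ring)
    exact (hρ e G (by rwa [abs_of_nonneg (by omega : (0 : ℤ) ≤ (G : ℤ))])).trans hR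
  · rw [not_lt] at h
    have h1 := norm_sum_hyperbola_region_le (N := 8 * G) ⟨4 * G, by ring⟩ hψ u hρ hG0 hR hGR
      (K := K) (H := G / K + 1) (by nlinarith) (Nat.lt_mul_div_succ G hK).le hm
    refine h1.trans ?_
    rw [mul_assoc 4]
    have hE := hC (8 * G) (by omega)
    have hG' : (0 : ℝ) < G := by exact_mod_cast hG0
    have hK' : (0 : ℝ) < K := by exact_mod_cast hK
    have hGR' : (G : ℝ) ≤ R := by exact_mod_cast hGR
    have hRK : (R : ℝ) ≤ G * K := by exact_mod_cast h
    have hH : ((G / K + 1 : ℕ) : ℝ) ≤ G / K + 1 := by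
      push_cast
      exact add_le_add Nat.cast_div_le le_rfl
    have h2 : 2 / ((8 * G : ℕ) : ℝ) * ((G / K + 1 : ℕ) : ℝ) * R ≤ R / (4 * K) + K / 4 := by
      calc _ ≤ 2 / ((8 * G : ℕ) : ℝ) * (G / K + 1) * R := by gcongr
        _ = R / (4 * K) + R / (4 * G) := by
            push_cast
            field_simp
            ring
        _ ≤ _ := by
            refine add_le_add le_rfl ?_
            rw [div_le_div_iff₀ (by positivity) (by norm_num)]
            linarith
    have h3 : 2 * K * boxErr K (8 * G) ≤ 16 * K * ε * R + 2 * K * C := by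
      calc 2 * K * boxErr K (8 * G) ≤ 2 * K * (ε * ((8 * G : ℕ) : ℝ) + C) := by gcongr
        _ = 16 * K * ε * G + 2 * K * C := by push_cast; ring
        _ ≤ _ := by gcongr
    refine mul_le_mul_of_nonneg_left (mul_le_mul_of_nonneg_left ?_ (by positivity)) (by norm_num)
    linarith

/-- Summation of the contributions of the moduli. -/
lemma exists_sum_contribution_le {η : ℝ} (hη : 0 < η) :
    ∃ (K : ℕ) (ε C D : ℝ), 0 < K ∧ 0 ≤ ε ∧ (∀ N : ℕ, 0 < N → boxErr K N ≤ ε * N + C) ∧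
      ∀ R : ℕ, ∑ G ∈ Icc 1 R, (if G * K < R then (R : ℝ) else
        16 * K * ε * R + 2 * K * C + R / (4 * K) + K / 4) ≤ η * R ^ 2 + D * R := by
  obtain ⟨K, hK⟩ := exists_nat_gt (4 / η)
  have hK0' : (0 : ℝ) < K := (by positivity : (0 : ℝ) < 4 / η).trans hK
  have hK0 : 0 < K := by exact_mod_cast hK0'
  set ε := η / (64 * K) with hε
  have hε0 : 0 < ε := by positivity
  obtain ⟨C, hC0, hC⟩ := exists_boxErr_le (Nat.cast_nonneg K) hε0
  refine ⟨K, ε, C, 2 * K * C + K / 4 + 1, hK0, hε0.le, hC, fun R => ?_⟩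
  have hK4 : 1 / (K : ℝ) ≤ η / 4 := by
    rw [div_lt_iff₀ hη] at hK
    rw [div_le_div_iff₀ hK0' (by norm_num)]
    linarith
  have hcard : (((Icc 1 R).filter fun G => G * K < R).card : ℝ) ≤ R / K := by
    have h1 : (Icc 1 R).filter (fun G => G * K < R) ⊆ Icc 1 (R / K) := by
      intro G hG
      rw [mem_filter, mem_Icc] at hG
      rw [mem_Icc]
      exact ⟨hG.1.1, (Nat.le_div_iff_mul_le hK0).mpr hG.2.le⟩
    have h2 := card_le_card h1
    rw [Nat.card_Icc, Nat.add_sub_cancel] at h2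
    exact (Nat.cast_le.mpr h2).trans Nat.cast_div_le
  calc _ ≤ ∑ G ∈ Icc 1 R, ((if G * K < R then (R : ℝ) else 0) +
        (16 * K * ε * R + 2 * K * C + R / (4 * K) + K / 4)) := by
        refine sum_le_sum fun G _ => ?_
        have : 0 ≤ 16 * K * ε * R + 2 * K * C + R / (4 * K) + (K : ℝ) / 4 := by positivity
        split_ifs <;> linarith
    _ = ((Icc 1 R).filter fun G => G * K < R).card * (R : ℝ) +
        R * (16 * K * ε * R + 2 * K * C + R / (4 * K) + K / 4) := by
        rw [sum_add_distrib, ← sum_filter, sum_const, sum_const, Nat.card_Icc, nsmul_eq_mul,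
          nsmul_eq_mul, Nat.add_sub_cancel]
    _ ≤ R / K * R + R * (16 * K * ε * R + 2 * K * C + R / (4 * K) + K / 4) := by gcongr
    _ = (5 / 4 * (1 / K) + 16 * K * ε) * R ^ 2 + (2 * K * C + K / 4) * R := by
        field_simp
        ring
    _ ≤ _ := by
        have e : 16 * K * ε = η / 4 := by rw [hε]; field_simp; norm_num
        rw [e]
        have hR0 : (0 : ℝ) ≤ R := Nat.cast_nonneg R
        refine add_le_add (mul_le_mul_of_nonneg_right ?_ (by positivity))
          (mul_le_mul_of_nonneg_right ?_ hR0)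
        · linarith
        · linarith

end RegionBound

section QuarticSign

/-- The sum over the six cosets of the signs relative to the lower right entry. -/
def cosetWeight (b c : ℤ) : ℤ :=
  2 * (1 + (if 4 ∣ b then 1 else -1) + (if 4 ∣ c then 1 else -1))

lemma abs_cosetWeight_le (b c : ℤ) : |cosetWeight b c| ≤ 6 := by
  unfold cosetWeight
  split_ifs <;> simp

lemma chi_four_table : ∀ b c d : ZMod 4, (b = 0 ∨ b = 2) → (c = 0 ∨ c = 2) →
    ZMod.χ₄ d + ZMod.χ₄ (d - c) + ZMod.χ₄ d + ZMod.χ₄ (d + c) + ZMod.χ₄ (d + b) + ZMod.χ₄ (d + b) =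
      ZMod.χ₄ d * (2 * (1 + (if b = 0 then 1 else -1) + (if c = 0 then 1 else -1))) := by
  decide

lemma eq_zero_or_eq_two_of_even {b : ℤ} (hb : 2 ∣ b) : (b : ZMod 4) = 0 ∨ (b : ZMod 4) = 2 := by
  obtain ⟨k, rfl⟩ := hb
  push_cast
  generalize (k : ZMod 4) = z
  revert z
  decide

lemma sum_chi_four_twist {N : Matrix (Fin 2) (Fin 2) ℤ} (hN : LevelTwo N)
    (hd : (N 0 0 : ZMod 4) = N 1 1) :
    ∑ i, ZMod.χ₄ (twist i N 1 1 : ℤ) = ZMod.χ₄ (N 1 1 : ℤ) * cosetWeight (N 0 1) (N 1 0) := by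
  have h := chi_four_table (N 0 1 : ℤ) (N 1 0 : ℤ) (N 1 1 : ℤ) (eq_zero_or_eq_two_of_even hN.1)
    (eq_zero_or_eq_two_of_even hN.2)
  have hb : ((N 0 1 : ℤ) : ZMod 4) = 0 ↔ (4 : ℤ) ∣ N 0 1 := ZMod.intCast_zmod_eq_zero_iff_dvd _ 4
  have hc : ((N 1 0 : ℤ) : ZMod 4) = 0 ↔ (4 : ℤ) ∣ N 1 0 := ZMod.intCast_zmod_eq_zero_iff_dvd _ 4
  simp only [hb, hc] at h
  rw [cosetWeight, ← h, Fin.sum_univ_six]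
  have e0 : twist 0 N 1 1 = N 1 1 := by simp [twist, cosetRep]
  have e1 : twist 1 N 1 1 = N 1 1 - N 1 0 := by
    simp [twist, cosetRep, Matrix.mul_apply, Fin.sum_univ_two, Matrix.adjugate_fin_two,
      Matrix.vecMul, dotProduct]; ring
  have e2 : twist 2 N 1 1 = N 0 0 := by
    simp [twist, cosetRep, Matrix.mul_apply, Fin.sum_univ_two, Matrix.adjugate_fin_two,
      Matrix.vecMul, dotProduct]
  have e3 : twist 3 N 1 1 = N 0 0 + N 1 0 := by
    simp [twist, cosetRep, Matrix.mul_apply, Fin.sum_univ_two, Matrix.adjugate_fin_two,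
      Matrix.vecMul, dotProduct]
  have e4 : twist 4 N 1 1 = N 0 0 + N 0 1 := by
    simp [twist, cosetRep, Matrix.mul_apply, Fin.sum_univ_two, Matrix.adjugate_fin_two,
      Matrix.vecMul, dotProduct]
  have e5 : twist 5 N 1 1 = N 0 1 + N 1 1 := by
    simp [twist, cosetRep, Matrix.mul_apply, Fin.sum_univ_two, Matrix.adjugate_fin_two,
      Matrix.vecMul, dotProduct]
  rw [e0, e1, e2, e3, e4, e5]
  push_cast
  rw [hd, add_comm ((N 0 1 : ℤ) : ZMod 4)]

variable {p : ℕ}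

lemma diag_eq_of_levelTwo (hp4 : p % 4 = 1) {N : Matrix (Fin 2) (Fin 2) ℤ} (hdet : N.det = p)
    (hN : LevelTwo N) : (N 0 0 : ZMod 4) = N 1 1 ∧ ¬ 2 ∣ N 1 1 := by
  obtain ⟨⟨b, hb⟩, ⟨c, hc⟩⟩ := hN
  rw [Matrix.det_fin_two, hb, hc] at hdet
  have hp' : (p : ℤ) = 4 * ((p / 4 : ℕ) : ℤ) + 1 := by omega
  have h1 : N 0 0 * N 1 1 = 4 * (((p / 4 : ℕ) : ℤ) + b * c) + 1 := by linear_combination hdet + hp'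
  have h2 := congrArg (Int.cast : ℤ → ZMod 4) h1
  push_cast at h2
  have h4 : (4 : ZMod 4) = 0 := rfl
  rw [h4, zero_mul, zero_add] at h2
  refine ⟨?_, ?_⟩
  · revert h2
    generalize ((N 0 0 : ℤ) : ZMod 4) = x
    generalize ((N 1 1 : ℤ) : ZMod 4) = y
    revert x y
    decide
  · rintro ⟨d, hd⟩
    rw [hd] at h1
    have h3 : 2 * (N 0 0 * d) = 4 * (((p / 4 : ℕ) : ℤ) + b * c) + 1 := by linear_combination h1
    omega

lemma levelTwo_twist (hp4 : p % 4 = 1) {N : Matrix (Fin 2) (Fin 2) ℤ} (hdet : N.det = p)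
    (hN : LevelTwo N) (i : Fin 6) : LevelTwo (twist i N) := by
  refine levelTwo_conj hN ?_
  have h := (diag_eq_of_levelTwo hp4 hdet hN).1
  rw [← sub_eq_zero, ← Int.cast_sub, ZMod.intCast_zmod_eq_zero_iff_dvd] at h
  exact (by norm_num : (2 : ℤ) ∣ 4).trans h

lemma twist_neg (i : Fin 6) (N : Matrix (Fin 2) (Fin 2) ℤ) : twist i (-N) = -twist i N := by
  simp [twist]

open Classical in
lemma card_heckeMat_twist_sub (hp4 : p % 4 = 1) {N : Matrix (Fin 2) (Fin 2) ℤ}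
    (hdet : N.det = p) (hN : LevelTwo N) :
    ((univ.filter fun i => HeckeMat p (twist i N)).card : ℤ) -
      (univ.filter fun i => HeckeMat p (twist i (-N))).card =
      ZMod.χ₄ (N 1 1 : ℤ) * cosetWeight (N 0 1) (N 1 0) := by
  rw [← sum_chi_four_twist hN (diag_eq_of_levelTwo hp4 hdet hN).1, card_filter, card_filter]
  push_cast
  rw [← sum_sub_distrib]
  refine sum_congr rfl fun i _ => ?_
  have hdet' : (twist i N).det = p := by
    rw [twist, Matrix.det_mul, Matrix.det_mul, Matrix.det_adjugate, det_cosetRep, hdet]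
    simp
  have hl := levelTwo_twist hp4 hdet hN i
  have hodd := (diag_eq_of_levelTwo hp4 hdet' hl).2
  have h1 : HeckeMat p (twist i N) ↔ 4 ∣ twist i N 1 1 - 1 := by
    simp [HeckeMat, hdet', hl]
  have h2 : HeckeMat p (twist i (-N)) ↔ 4 ∣ -(twist i N 1 1) - 1 := by
    rw [twist_neg, HeckeMat]
    have : LevelTwo (-twist i N) := ⟨by simpa using hl.1, by simpa using hl.2⟩
    simp [this, Matrix.det_neg, hdet']
  rw [if_congr h1 rfl rfl, if_congr h2 rfl rfl, ZMod.χ₄_int_eq_if_mod_four]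
  generalize twist i N 1 1 = D at hodd
  split_ifs <;> omega

lemma FdoMat.neg {N : Matrix (Fin 2) (Fin 2) ℤ} (h : FdoMat p N) : FdoMat p (-N) := by
  obtain ⟨h1, h2, h3, h4, h5⟩ := h
  refine ⟨by simp [Matrix.det_neg, h1], ⟨by simpa using h2.1, by simpa using h2.2⟩, by simpa using h3,
    ?_, by simpa using h5⟩
  have : (-N) 0 0 - (-N) 1 1 = -(N 0 0 - N 1 1) := by simp; ring
  rw [this, abs_neg]
  simpa using h4

open Classical in
/-- The trace sum over the open fundamental domain with positive lower left entry. -/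
lemma sum_fdPairs_eq (hp4 : p % 4 = 1) {m : ℕ} (hm : Odd m) :
    ∑ x ∈ (fdPairs p).filter (fun x => FdoMat p x.1), (x.1 0 0 + x.1 1 1) ^ m =
      ∑ N ∈ (fdFinset p).filter (fun N => FdoMat p N ∧ 0 < N 1 0),
        (N 0 0 + N 1 1) ^ m * (ZMod.χ₄ (N 1 1 : ℤ) * cosetWeight (N 0 1) (N 1 0)) := by
  set n : Matrix (Fin 2) (Fin 2) ℤ → ℤ := fun N =>
    ((univ.filter fun i => HeckeMat p (twist i N)).card : ℤ) with hn
  have h1 : ∑ x ∈ (fdPairs p).filter (fun x => FdoMat p x.1), (x.1 0 0 + x.1 1 1) ^ m =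
      ∑ N ∈ (fdFinset p).filter (fun N => FdoMat p N), (N 0 0 + N 1 1) ^ m * n N := by
    have e : (fdPairs p).filter (fun x => FdoMat p x.1) =
        (((fdFinset p).filter fun N => FdoMat p N) ×ˢ univ).filter
          fun x => HeckeMat p (twist x.2 x.1) := by
      ext x
      simp only [mem_filter, mem_product, mem_univ, mem_fdPairs, mem_fdFinset]
      tauto
    rw [e, sum_filter, sum_product]
    refine sum_congr rfl fun N _ => ?_
    simp only [hn]
    rw [← sum_filter, sum_const, nsmul_eq_mul, mul_comm]
  have hsplit : (fdFinset p).filter (fun N => FdoMat p N) =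
      (fdFinset p).filter (fun N => FdoMat p N ∧ 0 < N 1 0) ∪
      (fdFinset p).filter (fun N => FdoMat p N ∧ N 1 0 < 0) := by
    ext N
    simp only [mem_filter, mem_union, mem_fdFinset]
    constructor
    · rintro ⟨h, h'⟩
      have h0 : N 1 0 ≠ 0 := fun h0 => by
        have := h'.2.2.1
        rw [h0, mul_zero] at this
        exact lt_irrefl _ this
      rcases lt_or_gt_of_ne h0 with h0 | h0
      · exact Or.inr ⟨h, h', h0⟩
      · exact Or.inl ⟨h, h', h0⟩
    · rintro (⟨h, h', -⟩ | ⟨h, h', -⟩) <;> exact ⟨h, h'⟩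
  rw [h1, hsplit, sum_union]
  swap
  · rw [disjoint_left]
    intro N hN hN'
    have h2 := (mem_filter.mp hN).2.2
    have h3 := (mem_filter.mp hN').2.2
    omega
  have h2 : ∑ N ∈ (fdFinset p).filter (fun N => FdoMat p N ∧ N 1 0 < 0),
      (N 0 0 + N 1 1) ^ m * n N =
      ∑ N ∈ (fdFinset p).filter (fun N => FdoMat p N ∧ 0 < N 1 0),
      -((N 0 0 + N 1 1) ^ m * n (-N)) := by
    refine sum_nbij' (fun N => -N) (fun N => -N) ?_ ?_ ?_ ?_ ?_
    · intro N hN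
      simp only [mem_filter, mem_fdFinset] at hN ⊢
      exact ⟨hN.2.1.neg.fdMat, hN.2.1.neg, by simpa using hN.2.2⟩
    · intro N hN
      simp only [mem_filter, mem_fdFinset] at hN ⊢
      exact ⟨hN.2.1.neg.fdMat, hN.2.1.neg, by simpa using hN.2.2⟩
    · intro N _; exact neg_neg N
    · intro N _; exact neg_neg N
    · intro N _
      have : (-N) 0 0 + (-N) 1 1 = -(N 0 0 + N 1 1) := by simp; ring
      rw [this, hm.neg_pow, neg_neg]
      ring
  rw [h2, ← sum_add_distrib]
  refine sum_congr rfl fun N hN => ?_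
  have hN' := (mem_filter.mp hN).2.1
  rw [← card_heckeMat_twist_sub hp4 hN'.1 hN'.2.1]
  ring

end QuarticSign

section MatrixParametrisation

lemma mem_Ioo_ceil_sqrt (s v : ℤ) :
    s ∈ Ioo (-((⌈√(v : ℝ)⌉₊ : ℕ) : ℤ)) (⌈√(v : ℝ)⌉₊ : ℕ) ↔ s ^ 2 < v := by
  have h : s ∈ Ioo (-((⌈√(v : ℝ)⌉₊ : ℕ) : ℤ)) (⌈√(v : ℝ)⌉₊ : ℕ) ↔ s.natAbs < ⌈√(v : ℝ)⌉₊ := by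
    rw [mem_Ioo]; omega
  rw [h, Nat.lt_ceil, Real.lt_sqrt (Nat.cast_nonneg _), ← Int.natAbs_sq s]
  rw [← Int.cast_lt (R := ℝ), Int.cast_pow, Int.cast_natCast]

variable {p : ℕ}

/-- The odd quadratic character modulo `4`, lifted to level `8 * G`. -/
noncomputable def liftedChi (G : ℕ) : MulChar (ZMod (8 * G)) ℂ :=
  DirichletCharacter.changeLevel (⟨2 * G, by ring⟩ : 4 ∣ 8 * G)
    (ZMod.χ₄.ringHomComp (Int.castRingHom ℂ) : DirichletCharacter ℂ 4)

lemma liftedChi_intCast {G : ℕ} {d : ℤ} (hd : IsUnit (d : ZMod (8 * G))) :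
    liftedChi G (d : ZMod (8 * G)) = (ZMod.χ₄ (d : ZMod 4) : ℤ) := by
  rw [liftedChi, DirichletCharacter.changeLevel_eq_cast_of_dvd' _ _
    (isCoprime_comm.mp ((ZMod.coe_int_isUnit_iff_isCoprime _ _).mp hd))]
  simp

lemma liftedChi_ne_one (G : ℕ) : liftedChi G ≠ 1 := by
  intro h
  have hu : IsUnit ((-1 : ℤ) : ZMod (8 * G)) := by simp
  have h1 := liftedChi_intCast hu
  rw [h, MulChar.one_apply hu] at h1
  have h2 : ZMod.χ₄ ((-1 : ℤ) : ZMod 4) = -1 := by decide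
  rw [h2] at h1
  norm_num at h1

lemma isUnit_intCast_add_two_mul (hp : p.Prime) (hp4 : p % 4 = 1) {G : ℕ} (hG0 : 0 < G)
    (hG : G < p) {b : ℤ} (hb : 2 ∣ b) : IsUnit (((p : ℤ) + 2 * G * b : ℤ) : ZMod (8 * G)) := by
  obtain ⟨β, rfl⟩ := hb
  rw [ZMod.coe_int_isUnit_iff_isCoprime, isCoprime_comm]
  push_cast
  refine IsCoprime.mul_right ?_ ?_
  · have h2 : IsCoprime ((p : ℤ) + 2 * G * (2 * β)) 2 := by
      refine ⟨1, -(2 * ((p / 4 : ℕ) : ℤ) + 2 * G * β), ?_⟩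
      have hp' : (p : ℤ) = 4 * ((p / 4 : ℕ) : ℤ) + 1 := by omega
      linear_combination hp'
    exact (by norm_num : (2 : ℤ) ^ 3 = 8) ▸ h2.pow_right (n := 3)
  · have h3 : IsCoprime (p : ℤ) G := by
      rw [Nat.isCoprime_iff_coprime]
      exact (Nat.Prime.coprime_iff_not_dvd hp).mpr (Nat.not_dvd_of_pos_of_lt hG0 hG)
    have h4 := h3.add_mul_left_left (2 * (2 * β))
    rwa [show (p : ℤ) + 2 * G * (2 * β) = p + G * (2 * (2 * β)) by ring]

/-- The length of the trace interval attached to the lower left entry `2 * G`. -/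
noncomputable def traceRange (p G : ℕ) (e : ℤ) : ℕ :=
  ⌈√(((p : ℤ) - 4 * (G : ℤ) ^ 2 + e ^ 2 : ℤ) : ℝ)⌉₊

lemma traceRange_mono (p G : ℕ) (e e' : ℤ) (h : |e| ≤ |e'|) :
    traceRange p G e ≤ traceRange p G e' := by
  refine Nat.ceil_le_ceil (Real.sqrt_le_sqrt ?_)
  have := sq_le_sq.mpr h
  exact_mod_cast by linarith

lemma traceRange_le (p G : ℕ) : traceRange p G G ≤ ⌈√(p : ℝ)⌉₊ := by
  refine Nat.ceil_le_ceil (Real.sqrt_le_sqrt ?_)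
  push_cast
  nlinarith [sq_nonneg (G : ℝ)]

/-- The matrices with positive lower left entry `2 * G` and fixed upper right entry modulo `4`. -/
lemma sum_fdoMat_fibre_eq (hp4 : p % 4 = 1) {G : ℕ} (hG0 : 0 < G) {b₀ : ℤ} (hb₀ : 2 ∣ b₀)
    {u : (ZMod (8 * G))ˣ} (hu : (u : ZMod (8 * G)) = ((p : ℤ) + 2 * G * b₀ : ℤ)) (m : ℕ)
    {T : Finset (Matrix (Fin 2) (Fin 2) ℤ)}
    (hT : ∀ N, N ∈ T ↔ FdoMat p N ∧ N 1 0 = 2 * G ∧ 4 ∣ N 0 1 - b₀) :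
    ((∑ N ∈ T, (N 0 0 + N 1 1) ^ m * ZMod.χ₄ (N 1 1 : ℤ) : ℤ) : ℂ) =
      2 ^ m * ∑ e ∈ Ioo (-(G : ℤ)) G, ∑ s ∈ Ioo (-(traceRange p G e : ℤ)) (traceRange p G e),
        (s : ℂ) ^ m * hyperbola (liftedChi G) u s e := by
  have hG0' : (0 : ℤ) < G := by exact_mod_cast hG0
  have hcond : ∀ s e : ℤ, ((s : ZMod (8 * G)) + e) * (s - e) = u ↔
      ∃ b : ℤ, 4 ∣ b - b₀ ∧ (s + e) * (s - e) - b * (2 * G) = p := by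
    intro s e
    have h : ((s : ZMod (8 * G)) + e) * (s - e) = u ↔
        (((s + e) * (s - e) - (p + 2 * G * b₀) : ℤ) : ZMod (8 * G)) = 0 := by
      rw [hu, ← sub_eq_zero]
      push_cast
      exact Iff.rfl
    rw [h, ZMod.intCast_zmod_eq_zero_iff_dvd]
    push_cast
    constructor
    · rintro ⟨k, hk⟩
      exact ⟨b₀ + 4 * k, ⟨k, by ring⟩, by linear_combination hk⟩
    · rintro ⟨b, ⟨k, hk⟩, hb⟩
      exact ⟨k, by linear_combination hb + 2 * G * hk⟩
  rw [mul_sum]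
  simp_rw [mul_sum]
  rw [sum_sigma']
  have hsub : ((Ioo (-(G : ℤ)) G).sigma fun e =>
      Ioo (-(traceRange p G e : ℤ)) (traceRange p G e)).filter
        (fun x => ((x.2 : ZMod (8 * G)) + x.1) * (x.2 - x.1) = u) ⊆
      (Ioo (-(G : ℤ)) G).sigma fun e => Ioo (-(traceRange p G e : ℤ)) (traceRange p G e) :=
    filter_subset _ _
  rw [← sum_subset hsub]
  swap
  · intro x hx hx'
    have : ¬ ((x.2 : ZMod (8 * G)) + x.1) * (x.2 - x.1) = u := fun h =>
      hx' (mem_filter.mpr ⟨hx, h⟩)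
    rw [hyperbola, if_neg this, mul_zero, mul_zero]
  push_cast
  have hmem : ∀ e s : ℤ, (⟨e, s⟩ : (_ : ℤ) × ℤ) ∈ ((Ioo (-(G : ℤ)) G).sigma fun e =>
      Ioo (-(traceRange p G e : ℤ)) (traceRange p G e)).filter
        (fun x => ((x.2 : ZMod (8 * G)) + x.1) * (x.2 - x.1) = u) ↔
      (|e| < G ∧ s ^ 2 < (p : ℤ) - 4 * (G : ℤ) ^ 2 + e ^ 2) ∧
        ∃ b : ℤ, 4 ∣ b - b₀ ∧ (s + e) * (s - e) - b * (2 * G) = p := by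
    intro e s
    rw [mem_filter, mem_sigma, hcond, traceRange, mem_Ioo_ceil_sqrt, mem_Ioo, abs_lt]
  have hdiag : ∀ N, N ∈ T → ∃ s e : ℤ, N 0 0 = s + e ∧ N 1 1 = s - e ∧
      (N 0 0 - N 1 1) / 2 = e ∧ (N 0 0 + N 1 1) / 2 = s := by
    intro N hN
    have h := ((hT N).mp hN).1
    have h1 := (diag_eq_of_levelTwo hp4 h.1 h.2.1).1
    rw [← sub_eq_zero, ← Int.cast_sub, ZMod.intCast_zmod_eq_zero_iff_dvd] at h1
    obtain ⟨k, hk⟩ := h1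
    push_cast at hk
    exact ⟨N 1 1 + 2 * k, 2 * k, by omega, by omega, by omega, by omega⟩
  refine sum_bij' (fun N _ => ⟨(N 0 0 - N 1 1) / 2, (N 0 0 + N 1 1) / 2⟩)
    (fun x _ => !![x.2 + x.1, ((x.2 + x.1) * (x.2 - x.1) - p) / (2 * G); 2 * (G : ℤ), x.2 - x.1])
    ?_ ?_ ?_ ?_ ?_
  · intro N hN
    obtain ⟨s, e, h1, h2, h3, h4⟩ := hdiag N hN
    obtain ⟨⟨hdet, -, hneg, ha, hb⟩, hc, hb'⟩ := (hT N).mp hN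
    rw [h3, h4, hmem]
    rw [Matrix.det_fin_two, hc, h1, h2] at hdet
    rw [hc] at hneg ha hb
    have hb1 : N 0 1 < 0 := neg_of_mul_neg_left hneg (by omega)
    rw [abs_of_neg hb1, abs_of_pos (by omega)] at hb
    rw [h1, h2, show s + e - (s - e) = 2 * e by ring, abs_mul, abs_of_pos (a := 2 * (G : ℤ))
      (by omega)] at ha
    refine ⟨⟨by simpa using ha, ?_⟩, N 0 1, hb', hdet⟩
    nlinarith
  · rintro ⟨e, s⟩ hx
    obtain ⟨⟨h1, h2⟩, b, hb4, hb⟩ := (hmem e s).mp hx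
    have h3 : ((s + e) * (s - e) - p) / (2 * G) = b := by
      rw [show (s + e) * (s - e) - p = b * (2 * G) by linear_combination hb]
      exact Int.mul_ediv_cancel _ (by omega)
    rw [hT]
    simp only [h3]
    have h4 : b < -(2 * G) := by
      by_contra! h
      nlinarith
    refine ⟨⟨?_, ⟨?_, ?_⟩, ?_, ?_, ?_⟩, ?_, ?_⟩
    · rw [Matrix.det_fin_two_of, hb]
    · simp only [Matrix.of_apply, Matrix.cons_val', Matrix.cons_val_zero, Matrix.cons_val_one]
      omega
    · simp
    · simp only [Matrix.of_apply, Matrix.cons_val', Matrix.cons_val_zero, Matrix.cons_val_one]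
      exact mul_neg_of_neg_of_pos (by omega) (by omega)
    · simp only [Matrix.of_apply, Matrix.cons_val', Matrix.cons_val_zero, Matrix.cons_val_one]
      rw [show s + e - (s - e) = 2 * e by ring, abs_mul, abs_mul, abs_of_pos hG0']
      simpa using h1
    · simp only [Matrix.of_apply, Matrix.cons_val', Matrix.cons_val_zero, Matrix.cons_val_one]
      rw [abs_of_pos (by omega), abs_of_neg (by omega)]
      omega
    · simp
    · simpa using hb4
  · intro N hN
    obtain ⟨s, e, h1, h2, h3, h4⟩ := hdiag N hN
    obtain ⟨⟨hdet, -⟩, hc, -⟩ := (hT N).mp hN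
    rw [Matrix.det_fin_two, hc, h1, h2] at hdet
    simp only [h3, h4]
    have h5 : ((s + e) * (s - e) - p) / (2 * G) = N 0 1 := by
      rw [show (s + e) * (s - e) - p = N 0 1 * (2 * G) by linear_combination hdet]
      exact Int.mul_ediv_cancel _ (by omega)
    rw [h5, ← h1, ← h2, ← hc]
    exact (Matrix.eta_fin_two N).symm
  · rintro ⟨e, s⟩ -
    simp only [Matrix.of_apply, Matrix.cons_val', Matrix.cons_val_zero, Matrix.cons_val_one]
    have h1 : (s + e - (s - e)) / 2 = e := by omega
    have h2 : (s + e + (s - e)) / 2 = s := by omega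
    simp [-add_sub_sub_cancel, -add_add_sub_cancel, h1, h2]
  · intro N hN
    obtain ⟨s, e, h1, h2, h3, h4⟩ := hdiag N hN
    obtain ⟨⟨hdet, -⟩, hc, hb⟩ := (hT N).mp hN
    rw [Matrix.det_fin_two, hc, h1, h2] at hdet
    simp only [h3, h4]
    have h5 := (hcond s e).mpr ⟨N 0 1, hb, hdet⟩
    have hunit : IsUnit ((s - e : ℤ) : ZMod (8 * G)) :=
      isUnit_of_mul_isUnit_right (x := (s : ZMod (8 * G)) + e) (by
        push_cast; rw [h5]; exact u.isUnit)
    rw [hyperbola, if_pos h5, ← Int.cast_sub, liftedChi_intCast hunit, h1, h2]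
    push_cast
    ring

open Classical in
lemma exists_abs_sum_fdoMat_le {η : ℝ} (hη : 0 < η) {m : ℕ} (hm : 0 < m) :
    ∃ D : ℝ, ∀ p : ℕ, p.Prime → p % 4 = 1 →
      |((∑ N ∈ (fdFinset p).filter (fun N => FdoMat p N ∧ 0 < N 1 0),
        (N 0 0 + N 1 1) ^ m * (ZMod.χ₄ (N 1 1 : ℤ) * cosetWeight (N 0 1) (N 1 0)) : ℤ) : ℝ)| ≤
        (⌈√(p : ℝ)⌉₊ : ℝ) ^ m * (η * (⌈√(p : ℝ)⌉₊ : ℝ) ^ 2 + D * ⌈√(p : ℝ)⌉₊) := by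
  obtain ⟨K, ε, C, D, hK, hε, hC, hD⟩ := exists_sum_contribution_le
    (show 0 < η / (48 * 2 ^ m) by positivity)
  refine ⟨48 * 2 ^ m * D, fun p hp hp4 => ?_⟩
  set R := ⌈√(p : ℝ)⌉₊ with hR
  have hRp : R < p := by
    have h5 : 5 ≤ p := by
      have := hp.two_le
      omega
    have : R ≤ p - 1 := by
      rw [hR, Nat.ceil_le, Nat.cast_sub (by omega), Nat.cast_one]
      have h5' : (5 : ℝ) ≤ p := by exact_mod_cast h5
      rw [Real.sqrt_le_left (by linarith)]
      nlinarith
    omega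
  set T := (fdFinset p).filter (fun N => FdoMat p N ∧ 0 < N 1 0) with hT
  set f : Matrix (Fin 2) (Fin 2) ℤ → ℤ := fun N =>
    (N 0 0 + N 1 1) ^ m * (ZMod.χ₄ (N 1 1 : ℤ) * cosetWeight (N 0 1) (N 1 0)) with hf
  set g : Matrix (Fin 2) (Fin 2) ℤ → ℕ × ℤ := fun N => ((N 1 0 / 2).toNat, N 0 1 % 4) with hg
  have hmemT : ∀ N, N ∈ T ↔ FdoMat p N ∧ 0 < N 1 0 := fun N => by
    rw [hT, mem_filter, mem_fdFinset]
    exact ⟨fun h => h.2, fun h => ⟨h.1.fdMat, h⟩⟩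
  have hmaps : ∀ N ∈ T, g N ∈ Icc 1 R ×ˢ ({0, 2} : Finset ℤ) := by
    intro N hN
    obtain ⟨h, h0⟩ := (hmemT N).mp hN
    have h1 := h.fdMat.trace_sq_lt
    obtain ⟨-, ⟨hb, γ, hγ⟩, -, -, h5⟩ := h
    have h6 : (N 1 0) ^ 2 ≤ |N 0 1 * N 1 0| := by
      rw [abs_mul, ← sq_abs, sq]
      exact mul_le_mul_of_nonneg_right h5.le (abs_nonneg _)
    have h7 : 3 * γ ^ 2 ≤ p := by
      rw [hγ] at h1 h6
      nlinarith [sq_nonneg (N 0 0 + N 1 1)]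
    have h8 : (γ.toNat : ℤ) = γ := Int.toNat_of_nonneg (by omega)
    have h9 : γ.toNat ≤ R := by
      refine Nat.cast_le.mp ((Real.le_sqrt_of_sq_le ?_).trans (Nat.le_ceil (√(p : ℝ))))
      have : ((γ.toNat : ℤ)) ^ 2 ≤ p := by rw [h8]; nlinarith [sq_nonneg γ]
      exact_mod_cast this
    simp only [hg, mem_product, mem_Icc, mem_insert, mem_singleton]
    rw [hγ, Int.mul_ediv_cancel_left _ two_ne_zero]
    exact ⟨⟨by omega, h9⟩, by omega⟩
  rw [← sum_fiberwise_of_maps_to hmaps f, sum_product]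
  have hfibre : ∀ G ∈ Icc 1 R, ∀ b₀ ∈ ({0, 2} : Finset ℤ),
      |((∑ N ∈ T with g N = (G, b₀), f N : ℤ) : ℝ)| ≤
        24 * 2 ^ m * (R : ℝ) ^ m * (if G * K < R then (R : ℝ) else
        16 * K * ε * R + 2 * K * C + R / (4 * K) + K / 4) := by
    intro G hG b₀ hb₀
    rw [mem_Icc] at hG
    have hb₀2 : 2 ∣ b₀ := by
      simp only [mem_insert, mem_singleton] at hb₀
      omega
    have hunit := isUnit_intCast_add_two_mul hp hp4 hG.1 (hG.2.trans_lt hRp) hb₀2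
    have hmemF : ∀ N, N ∈ T.filter (fun N => g N = (G, b₀)) ↔
        FdoMat p N ∧ N 1 0 = 2 * G ∧ 4 ∣ N 0 1 - b₀ := by
      intro N
      rw [mem_filter, hmemT, hg, Prod.mk.injEq, and_assoc]
      refine and_congr_right fun h => ?_
      obtain ⟨c, hc⟩ := h.2.1.2
      simp only [mem_insert, mem_singleton] at hb₀
      omega
    have h1 := sum_fdoMat_fibre_eq hp4 hG.1 hb₀2 (u := hunit.unit) rfl m hmemF
    have h2 := norm_sum_hyperbola_region_le_ite hG.1 hG.2 hK hε hC (liftedChi_ne_one G) hunit.unit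
      (traceRange_mono p G) (traceRange_le p G) hm
    have h3 : ∑ N ∈ T with g N = (G, b₀), f N = cosetWeight b₀ (2 * G) *
        ∑ N ∈ T with g N = (G, b₀), (N 0 0 + N 1 1) ^ m * ZMod.χ₄ (N 1 1 : ℤ) := by
      rw [mul_sum]
      refine sum_congr rfl fun N hN => ?_
      obtain ⟨-, hc, hb⟩ := (hmemF N).mp hN
      have : cosetWeight (N 0 1) (N 1 0) = cosetWeight b₀ (2 * G) := by
        rw [hc, cosetWeight, cosetWeight, if_congr (by omega : 4 ∣ N 0 1 ↔ 4 ∣ b₀) rfl rfl]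
      rw [hf]
      simp only [this]
      ring
    rw [h3, Int.cast_mul, abs_mul]
    have h4 : |(cosetWeight b₀ (2 * G) : ℝ)| ≤ 6 := by
      exact_mod_cast abs_cosetWeight_le b₀ (2 * G)
    rw [← Complex.norm_intCast (∑ N ∈ T with g N = (G, b₀), _), h1, norm_mul, norm_pow,
      Complex.norm_ofNat]
    refine (mul_le_mul h4 (mul_le_mul_of_nonneg_left h2 (by positivity)) (by positivity)
      (by norm_num)).trans_eq ?_
    ring
  push_cast at hfibre ⊢
  refine (abs_sum_le_sum_abs _ _).trans ((sum_le_sum fun G hG => (abs_sum_le_sum_abs _ _).trans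
    (sum_le_sum fun b₀ hb₀ => hfibre G hG b₀ hb₀)).trans ?_)
  simp only [sum_const, ← mul_sum, nsmul_eq_mul]
  have h48 : ((({0, 2} : Finset ℤ).card : ℕ) : ℝ) = 2 := by norm_num
  rw [h48]
  calc _ ≤ 2 * (24 * 2 ^ m * (R : ℝ) ^ m * (η / (48 * 2 ^ m) * R ^ 2 + D * R)) := by
        gcongr
        exact hD R
    _ = _ := by
        field_simp
        ring

end MatrixParametrisation

section Boundary

lemma exists_card_divisors_le {δ : ℝ} (hδ : 0 < δ) :
    ∃ D : ℝ, ∀ n R : ℕ, n ≠ 0 → n ≤ 4 * R ^ 2 → (n.divisors.card : ℝ) ≤ δ * R + D := by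
  obtain ⟨C, hC0, hC⟩ := exists_card_divisors_pow_le 4 (by norm_num)
  refine ⟨2 * C / δ, fun n R hn hnR => ?_⟩
  by_contra! h
  have hC1 : (1 : ℝ) ≤ C := by exact_mod_cast hC0
  have hR : (0 : ℝ) ≤ R := Nat.cast_nonneg R
  have h1 : (n.divisors.card : ℝ) ^ 4 ≤ C * (4 * R ^ 2) := by
    have h2 : (n.divisors.card : ℝ) ^ 4 ≤ C * n := by exact_mod_cast hC n hn
    exact h2.trans (mul_le_mul_of_nonneg_left (by exact_mod_cast hnR) (by positivity))
  have hD : 0 < 2 * C / δ := by positivity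
  have h3 : (δ * R) ^ 2 ≤ (n.divisors.card : ℝ) ^ 2 :=
    pow_le_pow_left₀ (by positivity) (by linarith) 2
  have h4 : (2 * C / δ) ^ 2 < (n.divisors.card : ℝ) ^ 2 :=
    pow_lt_pow_left₀ (by nlinarith [mul_nonneg hδ.le hR]) hD.le two_ne_zero
  have h5 : (0 : ℝ) < (n.divisors.card : ℝ) ^ 2 := (by positivity : 0 < (2 * C / δ) ^ 2).trans h4
  have h6 : (δ * R) ^ 2 * (2 * C / δ) ^ 2 < (n.divisors.card : ℝ) ^ 2 * (n.divisors.card : ℝ) ^ 2 :=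
    mul_lt_mul' h3 h4 (by positivity) h5
  have h7 : (δ * R) ^ 2 * (2 * C / δ) ^ 2 = 4 * C ^ 2 * R ^ 2 := by
    field_simp
    ring
  nlinarith [mul_nonneg (mul_nonneg (by linarith : (0 : ℝ) ≤ C) (by linarith : (0 : ℝ) ≤ C - 1))
    (sq_nonneg (R : ℝ))]

/-- The integer divisors of `n`, of both signs. -/
def intDivisors (n : ℤ) : Finset ℤ :=
  n.natAbs.divisors.image (fun k : ℕ => (k : ℤ)) ∪ n.natAbs.divisors.image (fun k : ℕ => -(k : ℤ))

lemma mem_intDivisors {n a : ℤ} (hn : n ≠ 0) (h : a ∣ n) : a ∈ intDivisors n := by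
  have h1 : a.natAbs ∈ n.natAbs.divisors :=
    Nat.mem_divisors.mpr ⟨Int.natAbs_dvd_natAbs.mpr h, by simpa using hn⟩
  rw [intDivisors, mem_union, mem_image, mem_image]
  rcases Int.natAbs_eq a with h2 | h2
  · exact Or.inl ⟨_, h1, h2.symm⟩
  · exact Or.inr ⟨_, h1, h2.symm⟩

lemma card_intDivisors_le (n : ℤ) : (intDivisors n).card ≤ 2 * n.natAbs.divisors.card := by
  refine (card_union_le _ _).trans ?_
  rw [two_mul]
  exact Nat.add_le_add card_image_le card_image_le

variable {p : ℕ}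

lemma FdMat.abs_trace_le {N : Matrix (Fin 2) (Fin 2) ℤ} (h : FdMat p N) {R : ℕ}
    (hR : p ≤ R ^ 2) : |N 0 0 + N 1 1| ≤ 2 * R ∧ |N 1 0| ≤ 2 * R ∧ |N 1 1| ≤ 2 * R := by
  have h1 := h.trace_sq_lt
  obtain ⟨-, -, -, h4, h5⟩ := h
  have hR' : (p : ℤ) ≤ (R : ℤ) ^ 2 := by exact_mod_cast hR
  have h6 : (N 1 0) ^ 2 ≤ |N 0 1 * N 1 0| := by
    rw [abs_mul, ← sq_abs, sq]
    exact mul_le_mul_of_nonneg_right h5 (abs_nonneg _)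
  have h7 : |N 0 0 + N 1 1| ≤ 2 * R :=
    abs_le_of_sq_le_sq (by nlinarith [sq_nonneg (N 1 0)]) (by positivity)
  have h8 : |N 1 0| ≤ 2 * R :=
    abs_le_of_sq_le_sq (by nlinarith [sq_nonneg (N 0 0 + N 1 1), sq_nonneg (N 1 0)])
      (by positivity)
  refine ⟨h7, h8, ?_⟩
  have h9 := h4.trans h8
  rw [_root_.abs_le] at h7 h9 ⊢
  omega

open Classical in
lemma card_fdMat_not_fdoMat_le (hp : p.Prime) {R : ℕ} (hR : p ≤ R ^ 2) {δ D : ℝ}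
    (hD : ∀ n R : ℕ, n ≠ 0 → n ≤ 4 * R ^ 2 → (n.divisors.card : ℝ) ≤ δ * R + D) :
    (((fdFinset p).filter fun N => ¬ FdoMat p N).card : ℝ) ≤ 6 * (4 * R + 1) * (δ * R + D) := by
  set S : Finset ((_ : ℤ) × ℤ) :=
    (Icc (-(2 * R : ℤ)) (2 * R)).sigma fun c => intDivisors (p - c ^ 2) with hS
  have hne : ∀ c : ℤ, (p : ℤ) - c ^ 2 ≠ 0 := by
    intro c hc
    have h : p = c.natAbs * c.natAbs := by
      zify
      rw [← sq, sq_abs]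
      linarith
    exact Irreducible.not_isSquare hp ⟨_, h⟩
  have hmemS : ∀ c a : ℤ, |c| ≤ 2 * R → a ∣ p - c ^ 2 → (⟨c, a⟩ : (_ : ℤ) × ℤ) ∈ S := fun c a h h' =>
    mem_sigma.mpr ⟨mem_Icc.mpr (abs_le.mp h), mem_intDivisors (hne c) h'⟩
  have hsub : ((fdFinset p).filter fun N => ¬ FdoMat p N) ⊆
      (S.image fun x => !![x.2, -x.1; x.1, (p - x.1 ^ 2) / x.2]) ∪
      ((S.image fun x => !![x.1 + x.2, x.1 - (p - x.1 ^ 2) / x.2; x.2, x.1]) ∪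
      (S.image fun x => !![x.1 - x.2, -x.1 - (p - x.1 ^ 2) / x.2; x.2, x.1])) := by
    intro N hN
    rw [mem_filter, mem_fdFinset] at hN
    obtain ⟨h, hno⟩ := hN
    obtain ⟨-, hc, hd⟩ := h.abs_trace_le hR
    obtain ⟨hdet, hlev, hneg, h4, h5⟩ := h
    rw [Matrix.det_fin_two] at hdet
    have hc0 : N 1 0 ≠ 0 := fun h0 => by simp [h0] at hneg
    rw [mem_union, mem_union, mem_image, mem_image, mem_image]
    rcases eq_or_lt_of_le h5 with h5 | h5
    · left
      have hb : N 0 1 = -N 1 0 := by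
        rcases abs_eq_abs.mp h5.symm with h | h
        · rw [h] at hneg
          nlinarith [mul_self_nonneg (N 1 0)]
        · exact h
      have had : (p : ℤ) - N 1 0 ^ 2 = N 0 0 * N 1 1 := by rw [hb] at hdet; linear_combination -hdet
      have ha0 : N 0 0 ≠ 0 := fun h0 => hne (N 1 0) (by rw [had, h0, zero_mul])
      refine ⟨⟨N 1 0, N 0 0⟩, hmemS _ _ hc ⟨_, had⟩, ?_⟩
      simp only
      rw [had, Int.mul_ediv_cancel_left _ ha0, ← hb]
      exact (Matrix.eta_fin_two N).symm
    · right
      have h4 : |N 0 0 - N 1 1| = |N 1 0| := by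
        by_contra hlt
        exact hno ⟨by rw [Matrix.det_fin_two]; exact hdet, hlev, hneg, lt_of_le_of_ne h4 hlt, h5⟩
      rcases abs_eq_abs.mp h4 with h | h
      · left
        have had : (p : ℤ) - N 1 1 ^ 2 = N 1 0 * (N 1 1 - N 0 1) := by
          linear_combination N 1 1 * h - hdet
        refine ⟨⟨N 1 1, N 1 0⟩, hmemS _ _ hd ⟨_, had⟩, ?_⟩
        simp only
        rw [had, Int.mul_ediv_cancel_left _ hc0, sub_sub_cancel,
          show N 1 1 + N 1 0 = N 0 0 by linear_combination -h]
        exact (Matrix.eta_fin_two N).symm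
      · right
        have had : (p : ℤ) - N 1 1 ^ 2 = N 1 0 * (-N 1 1 - N 0 1) := by
          linear_combination N 1 1 * h - hdet
        refine ⟨⟨N 1 1, N 1 0⟩, hmemS _ _ hd ⟨_, had⟩, ?_⟩
        simp only
        rw [had, Int.mul_ediv_cancel_left _ hc0, sub_sub_cancel,
          show N 1 1 - N 1 0 = N 0 0 by linear_combination -h]
        exact (Matrix.eta_fin_two N).symm
  have h1 : ((fdFinset p).filter fun N => ¬ FdoMat p N).card ≤ 3 * S.card := by
    refine (card_le_card hsub).trans ((card_union_le _ _).trans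
      ((Nat.add_le_add card_image_le ((card_union_le _ _).trans
        (Nat.add_le_add card_image_le card_image_le))).trans ?_))
    omega
  have h2 : (S.card : ℝ) ≤ (4 * R + 1) * (2 * (δ * R + D)) := by
    rw [hS, card_sigma]
    push_cast
    refine (sum_le_card_nsmul _ _ (2 * (δ * R + D)) fun c hc => ?_).trans_eq ?_
    · rw [mem_Icc, ← abs_le] at hc
      have h3 : (((p : ℤ) - c ^ 2).natAbs) ≤ 4 * R ^ 2 := by
        zify
        have h4 := sq_le_sq' (abs_le.mp hc).1 (abs_le.mp hc).2
        have hR' : (p : ℤ) ≤ (R : ℤ) ^ 2 := by exact_mod_cast hR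
        rw [abs_le]
        constructor <;> nlinarith [sq_nonneg c]
      have h4 := hD _ R (by simpa using hne c) h3
      have h5 : ((intDivisors (p - c ^ 2)).card : ℝ) ≤
          2 * ((p : ℤ) - c ^ 2).natAbs.divisors.card := by
        exact_mod_cast card_intDivisors_le _
      linarith
    · rw [Int.card_Icc, nsmul_eq_mul]
      congr 1
      rw [show ((2 * R + 1 - -(2 * R) : ℤ)).toNat = 4 * R + 1 by omega]
      push_cast
      ring
  have h1' : (((fdFinset p).filter fun N => ¬ FdoMat p N).card : ℝ) ≤ 3 * S.card := by
    exact_mod_cast h1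
  linarith

open Classical in
lemma exists_sum_not_fdoMat_le {η : ℝ} (hη : 0 < η) (m : ℕ) :
    ∃ D : ℝ, ∀ p R : ℕ, p.Prime → p ≤ R ^ 2 →
      ((∑ x ∈ (fdPairs p).filter (fun x => ¬ FdoMat p x.1), |(x.1 0 0 + x.1 1 1) ^ m| : ℤ) : ℝ) ≤
        (R : ℝ) ^ m * (η * (R : ℝ) ^ 2 + D * R) := by
  obtain ⟨D, hD⟩ := exists_card_divisors_le (show 0 < η / (180 * 2 ^ m) by positivity)
  refine ⟨180 * 2 ^ m * D, fun p R hp hR => ?_⟩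
  have hR1 : (1 : ℝ) ≤ R := by
    have : R ≠ 0 := fun h => by simp [h, hp.ne_zero] at hR
    exact_mod_cast Nat.one_le_iff_ne_zero.mpr this
  have hc := card_fdMat_not_fdoMat_le hp hR hD
  have hpos : 0 ≤ η / (180 * 2 ^ m) * R + D := by
    have := hD 1 R one_ne_zero (by
      have : 1 ≤ R := by exact_mod_cast hR1
      nlinarith)
    exact (Nat.cast_nonneg _).trans this
  have h1 : ((fdPairs p).filter (fun x => ¬ FdoMat p x.1)).card ≤
      ((fdFinset p).filter fun N => ¬ FdoMat p N).card * 6 := by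
    have : (fdPairs p).filter (fun x => ¬ FdoMat p x.1) ⊆
        ((fdFinset p).filter fun N => ¬ FdoMat p N) ×ˢ univ := by
      intro x
      simp only [mem_filter, mem_product, mem_univ, mem_fdPairs, mem_fdFinset]
      tauto
    simpa using card_le_card this
  push_cast
  refine (sum_le_card_nsmul _ _ ((2 * R : ℝ) ^ m) fun x hx => ?_).trans ?_
  · rw [abs_pow]
    refine pow_le_pow_left₀ (abs_nonneg _) ?_ m
    exact_mod_cast ((mem_fdPairs.mp (mem_filter.mp hx).1).1.abs_trace_le hR).1
  · rw [nsmul_eq_mul]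
    have h2 : (((fdPairs p).filter (fun x => ¬ FdoMat p x.1)).card : ℝ) ≤
        6 * (5 * R) * (η / (180 * 2 ^ m) * R + D) * 6 := by
      refine (by exact_mod_cast h1 : (_ : ℝ) ≤
        (((fdFinset p).filter fun N => ¬ FdoMat p N).card : ℝ) * 6).trans ?_
      refine mul_le_mul_of_nonneg_right (hc.trans ?_) (by norm_num)
      refine mul_le_mul_of_nonneg_right ?_ hpos
      linarith
    refine (mul_le_mul_of_nonneg_right h2 (by positivity)).trans_eq ?_
    rw [mul_pow]
    field_simp
    ring

end Boundary

section Assembly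

lemma sum_legA_pow_eq_zero {p : ℕ} [Fact p.Prime] (hp4 : p % 4 = 3) {m : ℕ} (hodd : Odd m) :
    ∑ l ∈ univ.filter (fun l : ZMod p => l ≠ 0 ∧ l ≠ 1), legA p l ^ m = 0 := by
  have hχ : quadraticChar (ZMod p) (-1) = -1 := by
    rw [quadraticChar_neg_one (by rw [ZMod.ringChar_zmod_n]; omega), ZMod.card,
      ZMod.χ₄_nat_three_mod_four hp4]
  have h : ∑ l ∈ univ.filter (fun l : ZMod p => l ≠ 0 ∧ l ≠ 1), legA p l ^ m =
      ∑ l ∈ univ.filter (fun l : ZMod p => l ≠ 0 ∧ l ≠ 1), -legA p l ^ m := by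
    refine sum_nbij' (fun l => 1 - l) (fun l => 1 - l) ?_ ?_ ?_ ?_ ?_
    · intro l hl
      rw [mem_filter] at hl ⊢
      exact ⟨mem_univ _, sub_ne_zero.mpr hl.2.2.symm, fun h => hl.2.1 (by simpa using h)⟩
    · intro l hl
      rw [mem_filter] at hl ⊢
      exact ⟨mem_univ _, sub_ne_zero.mpr hl.2.2.symm, fun h => hl.2.1 (by simpa using h)⟩
    · intro l _; exact sub_sub_cancel 1 l
    · intro l _; exact sub_sub_cancel 1 l
    · intro l _
      rw [legA_one_sub, hχ, neg_one_mul, hodd.neg_pow, neg_neg]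
  rw [sum_neg_distrib] at h
  omega

lemma exists_abs_sum_legA_pow_lt {m : ℕ} (hm : 0 < m) (hodd : Odd m) {ε : ℝ} (hε : 0 < ε) :
    ∃ P : ℕ, ∀ p : ℕ, [Fact p.Prime] → P ≤ p →
      |((∑ l ∈ univ.filter (fun l : ZMod p => l ≠ 0 ∧ l ≠ 1), legA p l ^ m : ℤ) : ℝ)| <
        ε * √(p : ℝ) ^ (m + 2) := by
  have hη : 0 < ε / (16 * 2 ^ m) := by positivity
  obtain ⟨D₁, hD₁⟩ := exists_abs_sum_fdoMat_le hη hm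
  obtain ⟨D₂, hD₂⟩ := exists_sum_not_fdoMat_le hη m
  set D : ℝ := |D₁| + |D₂| with hD
  obtain ⟨Q, hQ⟩ := exists_nat_gt (2 ^ (m + 2) * D / ε)
  refine ⟨max 64 (Q ^ 2), fun p hp hPp => ?_⟩
  have h64 : 64 ≤ p := (le_max_left _ _).trans hPp
  have hp0 : (1 : ℝ) ≤ p := by exact_mod_cast (by omega : 1 ≤ p)
  set x := √(p : ℝ) with hx
  have hx1 : 1 ≤ x := Real.one_le_sqrt.mpr hp0
  have hxQ : (Q : ℝ) ≤ x :=
    Real.le_sqrt_of_sq_le (by exact_mod_cast (le_max_right _ _).trans hPp)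
  rcases (by have := hp.out.eq_two_or_odd; omega : p % 4 = 1 ∨ p % 4 = 3) with hp4 | hp4
  swap
  · rw [sum_legA_pow_eq_zero hp4 hodd, Int.cast_zero, abs_zero]
    positivity
  set S := ∑ l ∈ univ.filter (fun l : ZMod p => l ≠ 0 ∧ l ≠ 1), legA p l ^ m with hS
  set R := ⌈x⌉₊ with hR
  have hRx : (R : ℝ) ≤ 2 * x := (Nat.ceil_lt_add_one (by linarith)).le.trans (by linarith)
  have hpR : p ≤ R ^ 2 := by
    have : (p : ℝ) ≤ (R : ℝ) ^ 2 := by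
      rw [← Real.sq_sqrt (Nat.cast_nonneg p)]
      exact pow_le_pow_left₀ (Real.sqrt_nonneg _) (Nat.le_ceil _) 2
    exact_mod_cast this
  have h1 := abs_two_mul_sum_legA_sub_le hp4 h64 m
  have h2 := hD₁ p hp.out hp4
  have h3 := hD₂ p R hp.out hpR
  rw [← sum_fdPairs_eq hp4 hodd] at h2
  have h1' := (Int.cast_le (R := ℝ)).mpr h1
  rw [Int.cast_abs, Int.cast_sub, Int.cast_mul] at h1'
  have hR0 : (0 : ℝ) ≤ R := Nat.cast_nonneg R
  have hbound : |(S : ℝ)| ≤ (R : ℝ) ^ m * (2 * (ε / (16 * 2 ^ m)) * R ^ 2 + D * R) := by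
    have h4 : |(S : ℝ)| ≤ |((2 : ℤ) : ℝ) * S| := by
      rw [abs_mul]
      refine le_mul_of_one_le_left (abs_nonneg _) (by norm_num)
    have h5 := abs_sub_abs_le_abs_sub (((2 : ℤ) : ℝ) * S) _ |>.trans h1'
    have h6 : D₁ * R + D₂ * R ≤ D * R := by
      rw [← add_mul]
      exact mul_le_mul_of_nonneg_right (add_le_add (le_abs_self _) (le_abs_self _)) hR0
    have h7 := mul_le_mul_of_nonneg_left h6 (pow_nonneg hR0 m)
    linarith
  have hD0 : 0 ≤ D := by positivity
  have hlt : 2 ^ (m + 2) * D < ε * x := by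
    rw [div_lt_iff₀ hε] at hQ
    nlinarith
  calc |(S : ℝ)| ≤ (R : ℝ) ^ m * (2 * (ε / (16 * 2 ^ m)) * R ^ 2 + D * R) := hbound
    _ ≤ (2 * x) ^ m * (2 * (ε / (16 * 2 ^ m)) * (2 * x) ^ 2 + D * (2 * x)) := by gcongr
    _ = x ^ (m + 1) * (ε / 2 * x + 2 ^ (m + 2) * D / 2) := by
      rw [mul_pow]
      field_simp
      ring
    _ < x ^ (m + 1) * (ε / 2 * x + ε * x / 2) := by gcongr
    _ = ε * x ^ (m + 2) := by ring

end Assembly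

/-- **Odd power moments of the Legendre family traces of Frobenius.**
For a fixed odd positive integer `m`, as the prime `p` tends to infinity,
`p^{-(m/2+1)} · ∑_{λ ∈ F_p, λ ≠ 0, 1} a_p(λ)^m` converges to `0`, where
`a_p(λ) = -∑_{x ∈ F_p} φ(x(x-1)(x-λ))` and `φ` is the quadratic character of `F_p`
(with `φ(0) = 0`), and `p^{-(m/2+1)}` denotes the real power `p^{-(m+2)/2}`. -/
theorem odd_moments_ap_tendsto_zero (m : ℕ) (hm : 0 < m) (hodd : Odd m) :
    Tendsto
      (fun p : Nat.Primes =>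
        haveI : Fact (p : ℕ).Prime := ⟨p.property⟩
        ((p : ℕ) : ℝ) ^ (-((m : ℝ) / 2 + 1)) *
          ∑ l ∈ univ.filter (fun l : ZMod p => l ≠ 0 ∧ l ≠ 1),
            (((-∑ x : ZMod p, quadraticChar (ZMod p) (x * (x - 1) * (x - l))) ^ m :
              ℤ) : ℝ))
      (Filter.comap ((↑) : Nat.Primes → ℕ) atTop)
      (nhds 0) := by
  rw [Metric.tendsto_nhds]
  intro ε hε
  obtain ⟨P, hP⟩ := exists_abs_sum_legA_pow_lt hm hodd hε
  filter_upwards [preimage_mem_comap (Ici_mem_atTop P)] with p hp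
  have : Fact (p : ℕ).Prime := ⟨p.property⟩
  have h := hP p hp
  have hp0 : (0 : ℝ) < (p : ℕ) := by exact_mod_cast p.property.pos
  have hpow : ((p : ℕ) : ℝ) ^ (-((m : ℝ) / 2 + 1)) = (√((p : ℕ) : ℝ) ^ (m + 2))⁻¹ := by
    rw [Real.rpow_neg hp0.le, Real.sqrt_eq_rpow, ← Real.rpow_natCast, ← Real.rpow_mul hp0.le]
    congr 2
    push_cast
    ring
  have hx : 0 < √((p : ℕ) : ℝ) ^ (m + 2) := by positivity
  rw [← Int.cast_sum, Real.dist_eq, sub_zero, abs_mul, hpow, abs_of_pos (inv_pos.mpr hx),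
    inv_mul_lt_iff₀ hx, mul_comm]
  exact h
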